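/- For every natural number K ≥ 1 there are infinitely many natural numbers n such that σ(p_n − 1) > σ(p_{n+1} − 1) > ⋯ > σ(p_{n+K−1} − 1), i.e., the sum-of-divisors function evaluated at the shifted primes p − 1 is strictly decreasing along some run of K consecutive primes, for infinitely many starting indices n. -/

import Mathlib

namespace SDR
open Finset
open Real (exp le_log_iff_exp_le exp_add exp_pos exp_le_exp exp_nat_mul exp_neg add_one_le_exp exp_le_one_iff exp_sum log log_pos log_pow log_two_gt_d9 one_le_exp exp_log log_le_log rpow_neg zero_rpow rpow_add rpow_neg_one rpow_def_of_pos log_mul norm_eq_abs log_two_lt_d9 log_nonneg exp_one_lt_d9 log_natCast_nonneg rpow_le_rpow_of_exponent_le log_le_iff_le_exp rpow_le_one_of_one_le_of_nonpos log_lt_iff_lt_exp)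
open Nat (one_le_iff_ne_zero le_log_of_pow_le log_lt_of_lt_pow one_le_two_pow pow_log_le_self lt_pow_succ_log_self card_Ico pow_le_pow_right Coprime chineseRemainder mod_modEq mod_eq_of_lt coprime_primes dvd_one mod_lt prime_of_mem_primesBelow mem_primeFactors prime_of_mem_primeFactors div_le_div_right cast_sub div_add_mod ModEq mod_add_div cast_nonneg lt_two_pow_self totient_le cast_zero mem_divisorsAntidiagonal le_of_dvd cast_one totient_pos le_floor pow_le_pow_left le_ceil ceil_le primeFactors_mono floor_le lt_ceil prime_two mem_primesBelow factoredNumbers modEq_iff_dvd')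
open ArithmeticFunction (vonMangoldt_le_log vonMangoldt_nonneg cardFactors_mul)

/-- truncated alternating sum of elementary symmetric functions -/
def T (g : ℕ → ℝ) : ℕ → List ℕ → ℝ
  | _, [] => 1
  | 0, _ :: _ => 1
  | m + 1, p :: l => T g (m + 1) l - g p * T g m l

/-- elementary symmetric functions -/
def el (g : ℕ → ℝ) : ℕ → List ℕ → ℝ
  | 0, _ => 1
  | _ + 1, [] => 0
  | m + 1, p :: l => el g (m + 1) l + g p * el g m l

def V (g : ℕ → ℝ) (l : List ℕ) : ℝ := (l.map (fun p => 1 - g p)).prod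

lemma T_zero (g : ℕ → ℝ) (l : List ℕ) : T g 0 l = 1 := by cases l <;> simp [T]
lemma el_zero (g : ℕ → ℝ) (l : List ℕ) : el g 0 l = 1 := by cases l <;> simp [el]

lemma V_cons (g : ℕ → ℝ) (p : ℕ) (l : List ℕ) : V g (p :: l) = (1 - g p) * V g l := by simp [V]

lemma V_bounds (g : ℕ → ℝ) (l : List ℕ) (h : ∀ p ∈ l, 0 ≤ g p ∧ g p ≤ 1) :
    0 ≤ V g l ∧ V g l ≤ 1 := by
  induction l with
  | nil => simp [V]
  | cons p l ih =>
    rw [V_cons]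
    have h1 := h p (by simp)
    have h2 := ih (fun q hq => h q (by simp [hq]))
    constructor
    · exact mul_nonneg (by linarith) h2.1
    · nlinarith

lemma el_nonneg (g : ℕ → ℝ) (l : List ℕ) (h : ∀ p ∈ l, 0 ≤ g p) (m : ℕ) : 0 ≤ el g m l := by
  induction l generalizing m with
  | nil => cases m <;> simp [el]
  | cons p l ih =>
    have ih' := ih (fun q hq => h q (by simp [hq]))
    cases m with
    | zero => simp [el]
    | succ m =>
      simp only [el]
      have := ih' (m+1); have := mul_nonneg (h p (by simp)) (ih' m); linarith

lemma bonf (g : ℕ → ℝ) (l : List ℕ) (h : ∀ p ∈ l, 0 ≤ g p ∧ g p ≤ 1) (m : ℕ) :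
    0 ≤ (-1) ^ m * (T g m l - V g l) ∧ (-1) ^ m * (T g m l - V g l) ≤ el g (m + 1) l := by
  induction l generalizing m with
  | nil => simp [T, V, el]
  | cons p l ih =>
    have h1 := h p (by simp)
    have hl : ∀ q ∈ l, 0 ≤ g q ∧ g q ≤ 1 := fun q hq => h q (by simp [hq])
    have ih' := ih hl
    have hV := V_bounds g l hl
    cases m with
    | zero =>
      have := ih' 0
      simp only [T_zero, pow_zero, one_mul, V_cons, el, el_zero] at this ⊢
      constructor
      · nlinarith
      · nlinarith
    | succ m =>
      have a := ih' m
      have b := ih' (m+1)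
      have key : (-1 : ℝ) ^ (m+1) * (T g (m+1) (p :: l) - V g (p :: l)) =
          (-1) ^ (m+1) * (T g (m+1) l - V g l) + g p * ((-1) ^ m * (T g m l - V g l)) := by
        rw [V_cons]; simp only [T]; ring
      rw [key]
      simp only [el] at *
      constructor
      · have := mul_nonneg h1.1 a.1; linarith
      · have := mul_le_mul_of_nonneg_left a.2 h1.1
        linarith [b.2]

lemma el_le (g : ℕ → ℝ) (l : List ℕ) (h : ∀ p ∈ l, 0 ≤ g p) (m : ℕ) :
    el g m l ≤ (l.map g).sum ^ m / m.factorial := by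
  induction l generalizing m with
  | nil => cases m <;> simp [el]
  | cons p l ih =>
    have ih' := ih (fun q hq => h q (by simp [hq]))
    have hp := h p (by simp)
    have hs : 0 ≤ (l.map g).sum := List.sum_nonneg (by
      intro x hx; simp only [List.mem_map] at hx; obtain ⟨q, hq, rfl⟩ := hx; exact h q (by simp [hq]))
    cases m with
    | zero => simp [el]
    | succ m =>
      simp only [el, List.map_cons, List.sum_cons]
      set s := (l.map g).sum
      have hpow : s ^ (m+1) + (m+1) * g p * s ^ m ≤ (g p + s) ^ (m+1) := by
        clear ih ih'
        induction m with
        | zero => simp; linarith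
        | succ n ihn =>
          have := mul_le_mul_of_nonneg_left ihn (by linarith : 0 ≤ g p + s)
          rw [pow_succ' (g p + s)]
          refine le_trans ?_ this
          have h3 : 0 ≤ (n+1) * g p * g p * s ^ n := by positivity
          push_cast
          rw [pow_succ s (n+1), pow_succ s n]
          nlinarith
      calc el g (m+1) l + g p * el g m l ≤ s ^ (m+1) / (m+1).factorial + g p * (s ^ m / m.factorial) := by
            gcongr
            · exact ih' _
            · exact ih' _
        _ = (s ^ (m+1) + (m+1) * g p * s ^ m) / (m+1).factorial := by
            rw [Nat.factorial_succ]; push_cast; field_simp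
        _ ≤ _ := by gcongr

lemma Tneg_bounds (w : ℕ → ℝ) (l : List ℕ) (h : ∀ p ∈ l, 0 ≤ w p) (m : ℕ) :
    0 ≤ T (fun p => - w p) m l ∧ T (fun p => - w p) m l ≤ (1 + (l.map w).sum) ^ m := by
  induction l generalizing m with
  | nil => simp [T]
  | cons p l ih =>
    have ih' := ih (fun q hq => h q (by simp [hq]))
    have hp := h p (by simp)
    have hs : 0 ≤ (l.map w).sum := List.sum_nonneg (by
      intro x hx; simp only [List.mem_map] at hx; obtain ⟨q, hq, rfl⟩ := hx; exact h q (by simp [hq]))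
    cases m with
    | zero => simp [T]
    | succ m =>
      simp only [T, List.map_cons, List.sum_cons]
      set s := (l.map w).sum
      have a := ih' m
      have b := ih' (m+1)
      constructor
      · nlinarith [mul_nonneg hp a.1]
      · have h1 : (1+s)^m ≤ (1 + (w p + s))^m := by gcongr; linarith
        have h2 := mul_le_mul_of_nonneg_left a.2 hp
        have h3 : (1+s)^(m+1) + w p * (1+s)^m = (1 + (w p + s)) * (1+s)^m := by ring
        have h4 := mul_le_mul_of_nonneg_left h1 (by linarith : 0 ≤ 1 + (w p + s))
        rw [pow_succ' (1 + (w p + s))]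
        linarith [b.2]

lemma el_le_pow (w : ℕ → ℝ) (l : List ℕ) (h : ∀ p ∈ l, 0 ≤ w p) (m : ℕ) :
    el w m l ≤ (1 + (l.map w).sum) ^ m := by
  refine (el_le w l h m).trans ?_
  have hs : 0 ≤ (l.map w).sum := List.sum_nonneg (by
      intro x hx; simp only [List.mem_map] at hx; obtain ⟨q, hq, rfl⟩ := hx; exact h q hq)
  refine (div_le_self (by positivity) (mod_cast one_le_iff_ne_zero.2 (Nat.factorial_ne_zero m))).trans ?_
  gcongr; linarith

section sieve
variable {ι : Type*} (S : Finset ι) (hit : ℕ → ι → ℝ) (H : ℝ) (g w : ℕ → ℝ) (PP : Finset ℕ)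

def Good (f : ι → ℝ) (A : Finset ℕ) (X E : ℝ) : Prop :=
  ∀ D : Finset ℕ, D ⊆ PP → Disjoint D A →
    |∑ t ∈ S, f t * ∏ p ∈ D, hit p t - H * X * ∏ p ∈ D, g p| ≤ E * ∏ p ∈ D, w p

variable {S hit H g w PP}

lemma Good.mono {f : ι → ℝ} {A A' : Finset ℕ} {X E E' : ℝ} (hw : ∀ p ∈ PP, 0 ≤ w p)
    (h : Good S hit H g w PP f A X E) (hA : A ⊆ A') (hE : E ≤ E') :
    Good S hit H g w PP f A' X E' := by
  intro D hD hDA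
  refine (h D hD (hDA.mono_right hA)).trans ?_
  exact mul_le_mul_of_nonneg_right hE (prod_nonneg fun p hp => hw p (hD hp))

lemma Good.add {f f' : ι → ℝ} {A : Finset ℕ} {X E X' E' : ℝ}
    (h : Good S hit H g w PP f A X E) (h' : Good S hit H g w PP f' A X' E') :
    Good S hit H g w PP (fun t => f t + f' t) A (X + X') (E + E') := by
  intro D hD hDA
  have a := h D hD hDA
  have b := h' D hD hDA
  have : ∑ t ∈ S, (f t + f' t) * ∏ p ∈ D, hit p t - H * (X + X') * ∏ p ∈ D, g p =
    (∑ t ∈ S, f t * ∏ p ∈ D, hit p t - H * X * ∏ p ∈ D, g p) +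
    (∑ t ∈ S, f' t * ∏ p ∈ D, hit p t - H * X' * ∏ p ∈ D, g p) := by
    simp only [add_mul, sum_add_distrib]; ring
  rw [this, add_mul]
  exact (abs_add_le _ _).trans (add_le_add a b)

lemma Good.neg {f : ι → ℝ} {A : Finset ℕ} {X E : ℝ}
    (h : Good S hit H g w PP f A X E) :
    Good S hit H g w PP (fun t => - f t) A (-X) E := by
  intro D hD hDA
  have a := h D hD hDA
  have : ∑ t ∈ S, (-f t) * ∏ p ∈ D, hit p t - H * (-X) * ∏ p ∈ D, g p =
    -(∑ t ∈ S, f t * ∏ p ∈ D, hit p t - H * X * ∏ p ∈ D, g p) := by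
    simp only [neg_mul, sum_neg_distrib]; ring
  rw [this, abs_neg]
  exact a

lemma Good.mulhit {f : ι → ℝ} {A : Finset ℕ} {X E : ℝ}
    (h : Good S hit H g w PP f A X E) {p : ℕ} (hp : p ∈ PP) (hpA : p ∉ A) :
    Good S hit H g w PP (fun t => hit p t * f t) (insert p A) (g p * X) (w p * E) := by
  intro D hD hDA
  have hpD : p ∉ D := fun hh => (Finset.disjoint_left.1 hDA hh) (by simp)
  have a := h (insert p D) (by
    intro x hx; rcases mem_insert.1 hx with rfl | hx; exacts [hp, hD hx]) (by
    rw [Finset.disjoint_left]; intro x hx hxA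
    rcases mem_insert.1 hx with rfl | hx
    · exact hpA hxA
    · exact (Finset.disjoint_left.1 hDA hx) (by simp [hxA]))
  simp only [prod_insert hpD] at a
  convert a using 1
  · congr 2
    · apply sum_congr rfl; intros; ring
    · ring
  · ring

lemma Good.T {f : ι → ℝ} {A : Finset ℕ} {X E : ℝ} (hw : ∀ p ∈ PP, 0 ≤ w p) (hE : 0 ≤ E)
    (h : Good S hit H g w PP f A X E) (l : List ℕ) (hl : ∀ p ∈ l, p ∈ PP) (hA : ∀ p ∈ l, p ∉ A)
    (hn : l.Nodup) (m : ℕ) :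
    Good S hit H g w PP (fun t => T (fun p => hit p t) m l * f t) (A ∪ l.toFinset)
      (SDR.T g m l * X) (SDR.T (fun p => - w p) m l * E) := by
  induction l generalizing m with
  | nil => simpa [SDR.T] using h
  | cons p l ih =>
    have ih' := ih (fun q hq => hl q (by simp [hq])) (fun q hq => hA q (by simp [hq])) (List.nodup_cons.1 hn).2
    have hwl : ∀ q ∈ l, 0 ≤ w q := fun q hq => hw q (hl q (by simp [hq]))
    cases m with
    | zero =>
      simp only [SDR.T_zero, one_mul]
      exact h.mono hw subset_union_left le_rfl
    | succ m =>
      have hsub : A ∪ l.toFinset ⊆ A ∪ (p :: l).toFinset := by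
        intro x; simp only [mem_union, List.mem_toFinset, List.mem_cons]; tauto
      have a := (ih' (m+1)).mono hw hsub le_rfl
      have hpn : p ∉ A ∪ l.toFinset := by
        simp only [mem_union, List.mem_toFinset, not_or]
        exact ⟨hA p (by simp), (List.nodup_cons.1 hn).1⟩
      have b := (((ih' m).mulhit (hl p (by simp)) hpn).neg)
      have hsub2 : insert p (A ∪ l.toFinset) ⊆ A ∪ (p :: l).toFinset := by
        intro x; simp only [mem_union, List.mem_toFinset, List.mem_cons, mem_insert]; tauto
      have c := a.add (b.mono hw hsub2 le_rfl)
      simp only [SDR.T]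
      convert c using 1
      · ext t; ring
      · ring
      · ring

lemma Good.el {f : ι → ℝ} {A : Finset ℕ} {X E : ℝ} (hw : ∀ p ∈ PP, 0 ≤ w p) (hE : 0 ≤ E)
    (h : Good S hit H g w PP f A X E) (l : List ℕ) (hl : ∀ p ∈ l, p ∈ PP) (hA : ∀ p ∈ l, p ∉ A)
    (hn : l.Nodup) (m : ℕ) :
    Good S hit H g w PP (fun t => el (fun p => hit p t) m l * f t) (A ∪ l.toFinset)
      (SDR.el g m l * X) (SDR.el w m l * E) := by
  induction l generalizing m with
  | nil =>
    cases m with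
    | zero => simpa [SDR.el] using h
    | succ m =>
      simp only [SDR.el, zero_mul]
      intro D hD hDA; simp
  | cons p l ih =>
    have ih' := ih (fun q hq => hl q (by simp [hq])) (fun q hq => hA q (by simp [hq])) (List.nodup_cons.1 hn).2
    cases m with
    | zero =>
      simp only [SDR.el_zero, one_mul]
      exact h.mono hw subset_union_left le_rfl
    | succ m =>
      have hsub : A ∪ l.toFinset ⊆ A ∪ (p :: l).toFinset := by
        intro x; simp only [mem_union, List.mem_toFinset, List.mem_cons]; tauto
      have a := (ih' (m+1)).mono hw hsub le_rfl
      have hpn : p ∉ A ∪ l.toFinset := by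
        simp only [mem_union, List.mem_toFinset, not_or]
        exact ⟨hA p (by simp), (List.nodup_cons.1 hn).1⟩
      have b := (((ih' m).mulhit (hl p (by simp)) hpn))
      have hsub2 : insert p (A ∪ l.toFinset) ⊆ A ∪ (p :: l).toFinset := by
        intro x; simp only [mem_union, List.mem_toFinset, List.mem_cons, mem_insert]; tauto
      have c := a.add (b.mono hw hsub2 le_rfl)
      simp only [SDR.el]
      convert c using 1
      · ext t; ring
      · ring
      · ring

lemma blocks (hw : ∀ p ∈ PP, 0 ≤ w p) (hg : ∀ p ∈ PP, 0 ≤ g p ∧ g p ≤ 1)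
    (hhit : ∀ p t, 0 ≤ hit p t ∧ hit p t ≤ 1)
    (h0 : Good S hit H g w PP (fun _ => 1) ∅ 1 1) (bl : ℕ → List ℕ)
    (hbl : ∀ j, ∀ p ∈ bl j, p ∈ PP) (hnd : ∀ j, (bl j).Nodup)
    (hdis : ∀ i j, i < j → ∀ p ∈ bl j, p ∉ bl i) (k : ℕ → ℕ) (N η : ℕ → ℝ)
    (hN1 : ∀ j, SDR.T (fun p => - w p) (2 * k j) (bl j) ≤ N j)
    (hN2 : ∀ j, SDR.el w (2 * k j + 1) (bl j) ≤ N j)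
    (hη0 : ∀ j, 0 ≤ η j)
    (hη : ∀ j, SDR.el g (2 * k j + 1) (bl j) ≤ η j * V g (bl j)) (I : ℕ) :
    ∃ (F L : ι → ℝ) (XF XL : ℝ),
      (∀ t, L t ≤ ∏ j ∈ range I, V (fun p => hit p t) (bl j)) ∧
      (∀ t, ∏ j ∈ range I, V (fun p => hit p t) (bl j) ≤ F t) ∧
      Good S hit H g w PP F ((range I).biUnion fun j => (bl j).toFinset) XF (∏ j ∈ range I, (2 * N j)) ∧
      Good S hit H g w PP L ((range I).biUnion fun j => (bl j).toFinset) XL (∏ j ∈ range I, (2 * N j)) ∧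
      ∏ j ∈ range I, V g (bl j) ≤ XF ∧
      XF ≤ ∏ j ∈ range I, ((1 + η j) * V g (bl j)) ∧
      XF * (1 - ∑ j ∈ range I, η j) ≤ XL := by
  have hN0 : ∀ j, 0 ≤ N j := fun j =>
    (Tneg_bounds w (bl j) (fun p hp => hw p (hbl j p hp)) _).1.trans (hN1 j)
  induction I with
  | zero => exact ⟨fun _ => 1, fun _ => 1, 1, 1, by simp, by simp, by simpa using h0, by simpa using h0,
      by simp, by simp, by simp⟩
  | succ I ih =>
    obtain ⟨F, L, XF, XL, hL, hF, gF, gL, x1, x2, x3⟩ := ih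
    set l := bl I
    set A := (range I).biUnion fun j => (bl j).toFinset
    have hlA : ∀ p ∈ l, p ∉ A := by
      intro p hp hpA
      simp only [A, mem_biUnion, mem_range, List.mem_toFinset] at hpA
      obtain ⟨i, hi, hpi⟩ := hpA
      exact hdis i I hi p hp hpi
    have hA' : (range (I+1)).biUnion (fun j => (bl j).toFinset) = A ∪ l.toFinset := by
      rw [range_add_one, biUnion_insert, union_comm]
    set EN := ∏ j ∈ range I, (2 * N j)
    have hEN : 0 ≤ EN := prod_nonneg fun j _ => by have := hN0 j; linarith
    have gFU := gF.T hw hEN l (hbl I) hlA (hnd I) (2 * k I)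
    have gLU := gL.T hw hEN l (hbl I) hlA (hnd I) (2 * k I)
    have gFW := gF.el hw hEN l (hbl I) hlA (hnd I) (2 * k I + 1)
    have bt := fun t => bonf (fun p => hit p t) l (fun p _ => hhit p t) (2 * k I)
    have bg := bonf g l (fun p hp => hg p (hbl I p hp)) (2 * k I)
    have hVt := fun t => V_bounds (fun p => hit p t) l (fun p _ => hhit p t)
    have hVg := V_bounds g l (fun p hp => hg p (hbl I p hp))
    have hP0 : ∀ t, 0 ≤ ∏ j ∈ range I, V (fun p => hit p t) (bl j) := fun t =>
      prod_nonneg fun j _ => (V_bounds (fun p => hit p t) (bl j) (fun p _ => hhit p t)).1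
    have hPg : 0 ≤ ∏ j ∈ range I, V g (bl j) :=
      prod_nonneg fun j _ => (V_bounds g (bl j) (fun p hp => hg p (hbl j p hp))).1
    have hXF : 0 ≤ XF := hPg.trans x1
    simp only [pow_mul, neg_one_sq, one_pow, one_mul] at bt bg
    have hel : ∀ t, 0 ≤ SDR.el (fun p => hit p t) (2 * k I + 1) l := fun t =>
      el_nonneg _ _ (fun p _ => (hhit p t).1) _
    refine ⟨fun t => SDR.T (fun p => hit p t) (2 * k I) l * F t,
      fun t => SDR.T (fun p => hit p t) (2 * k I) l * L t +
        -(SDR.el (fun p => hit p t) (2 * k I + 1) l * F t),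
      SDR.T g (2 * k I) l * XF, SDR.T g (2 * k I) l * XL + -(SDR.el g (2 * k I + 1) l * XF),
      ?_, ?_, ?_, ?_, ?_, ?_, ?_⟩
    · intro t
      rw [prod_range_succ]
      have h1 := hL t; have h2 := hF t; have h3 := bt t; have h4 := hVt t
      have h5 := hP0 t; have h6 := hel t
      set a := ∏ j ∈ range I, V (fun p => hit p t) (bl j)
      have : SDR.T (fun p => hit p t) (2 * k I) l * L t ≤ SDR.T (fun p => hit p t) (2 * k I) l * a :=
        mul_le_mul_of_nonneg_left h1 (by linarith [h3.1])
      have h7 : SDR.T (fun p => hit p t) (2 * k I) l * a ≤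
        (V (fun p => hit p t) l + SDR.el (fun p => hit p t) (2 * k I + 1) l) * a :=
        mul_le_mul_of_nonneg_right (by linarith [h3.2]) h5
      have h8 := mul_le_mul_of_nonneg_left h2 h6
      linarith
    · intro t
      rw [prod_range_succ]
      have h2 := hF t; have h3 := bt t; have h4 := hVt t; have h5 := hP0 t
      rw [mul_comm]
      exact mul_le_mul (by linarith [h3.1]) h2 h5 (by linarith [h3.1])
    · rw [hA', prod_range_succ]
      refine gFU.mono hw subset_rfl ?_
      have := mul_le_mul_of_nonneg_right (hN1 I) hEN
      have := mul_nonneg (hN0 I) hEN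
      linarith
    · rw [hA', prod_range_succ]
      refine (gLU.add gFW.neg).mono hw subset_rfl ?_
      have := mul_le_mul_of_nonneg_right (hN1 I) hEN
      have := mul_le_mul_of_nonneg_right (hN2 I) hEN
      linarith
    · rw [prod_range_succ, mul_comm]
      exact mul_le_mul (by linarith [bg.1]) x1 hPg (by linarith [bg.1])
    · rw [prod_range_succ, mul_comm]
      have h9 := hη I
      refine mul_le_mul x2 ?_ (by linarith [bg.1]) (hXF.trans x2)
      linarith [bg.2]
    · rw [sum_range_succ]
      have h9 := hη I
      have hT : V g l ≤ SDR.T g (2 * k I) l := by linarith [bg.1]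
      have h10 : SDR.el g (2 * k I + 1) l ≤ η I * SDR.T g (2 * k I) l :=
        h9.trans (mul_le_mul_of_nonneg_left hT (hη0 I))
      have h11 := mul_le_mul_of_nonneg_right h10 hXF
      have h12 := mul_le_mul_of_nonneg_left x3 (hVg.1.trans hT)
      linarith

end sieve

/-- primes in a dyadic range -/
lemma card_dyadic (a : ℕ) (ha : 1 ≤ a) (s : Finset ℕ) (hs : ∀ p ∈ s, p.Prime ∧ 2 ^ a ≤ p ∧ p < 2 ^ (a+1)) :
    a * #s ≤ 2 ^ (a+2) := by
  have h1 : (2 ^ a) ^ #s ≤ ∏ p ∈ s, p := Finset.pow_card_le_prod _ _ _ (fun p hp => (hs p hp).2.1)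
  have h2 : ∏ p ∈ s, p ≤ primorial (2 ^ (a+1)) := by
    unfold primorial
    apply Finset.prod_le_prod_of_subset_of_one_le'
    · intro p hp
      simp only [mem_filter, mem_range]
      exact ⟨by have := (hs p hp).2.2; omega, (hs p hp).1⟩
    · intro p hp _
      exact (mem_filter.1 hp).2.one_lt.le
  have h3 := primorial_le_four_pow (2 ^ (a+1))
  have h4 : 2 ^ (a * #s) ≤ 2 ^ (2 ^ (a+2)) := by
    rw [pow_mul]
    refine h1.trans (h2.trans (h3.trans ?_))
    rw [show (4:ℕ) = 2 ^ 2 by norm_num, ← pow_mul]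
    apply le_of_eq; congr 1; ring
  exact (Nat.pow_le_pow_iff_right (by norm_num)).1 h4

lemma sum_dyadic (a : ℕ) (ha : 1 ≤ a) (s : Finset ℕ) (hs : ∀ p ∈ s, p.Prime ∧ 2 ^ a ≤ p ∧ p < 2 ^ (a+1)) :
    ∑ p ∈ s, (1:ℝ) / p ≤ 4 / a := by
  have h := card_dyadic a ha s hs
  have ha' : (0:ℝ) < a := mod_cast ha
  calc ∑ p ∈ s, (1:ℝ) / p ≤ ∑ p ∈ s, (1:ℝ) / 2 ^ a := by
        apply sum_le_sum; intro p hp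
        have := (hs p hp).2.1
        have : (2:ℝ) ^ a ≤ p := mod_cast this
        gcongr
    _ = #s / 2 ^ a := by simp [div_eq_mul_inv]
    _ ≤ 4 / a := by
        rw [div_le_div_iff₀ (by positivity) ha']
        have : (a:ℝ) * #s ≤ 2 ^ (a+2) := mod_cast h
        rw [pow_add] at this; linarith

lemma sum_block (j : ℕ) (s : Finset ℕ) (hs : ∀ p ∈ s, p.Prime ∧ 2 ^ (2 ^ j) ≤ p ∧ p < 2 ^ (2 ^ (j+1))) :
    ∑ p ∈ s, (1:ℝ) / p ≤ 4 := by
  have hmaps : ∀ p ∈ s, Nat.log 2 p ∈ Ico (2 ^ j) (2 ^ (j+1)) := by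
    intro p hp
    have := hs p hp
    rw [mem_Ico]
    refine ⟨le_log_of_pow_le (by norm_num) this.2.1, log_lt_of_lt_pow this.1.ne_zero this.2.2⟩
  rw [← sum_fiberwise_of_maps_to hmaps]
  calc _ ≤ ∑ a ∈ Ico (2 ^ j) (2 ^ (j+1)), (4:ℝ) / 2 ^ j := by
        apply sum_le_sum; intro a ha
        have h1 : 1 ≤ 2 ^ j := one_le_two_pow
        have ha' := (mem_Ico.1 ha).1
        refine (sum_dyadic a (h1.trans ha') _ ?_).trans ?_
        · intro p hp
          have hp' := mem_filter.1 hp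
          refine ⟨(hs p hp'.1).1, ?_, ?_⟩
          · rw [← hp'.2]; exact pow_log_le_self 2 (hs p hp'.1).1.ne_zero
          · rw [← hp'.2]; exact lt_pow_succ_log_self (by norm_num) p
        · have : (2:ℝ) ^ j ≤ a := mod_cast ha'
          gcongr
    _ = 4 := by
        simp only [sum_const, card_Ico, nsmul_eq_mul]
        have : 2 ^ (j+1) - 2 ^ j = 2 ^ j := by rw [pow_succ]; omega
        rw [this]; push_cast; field_simp

lemma one_sub_ge_exp (x : ℝ) (h0 : 0 ≤ x) (h1 : x ≤ 2/3) : exp (-(3*x)) ≤ 1 - x := by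
  have hp : 0 < 1 - x := by linarith
  rw [← le_log_iff_exp_le hp]
  refine le_trans ?_ (Real.one_sub_inv_le_log_of_pos hp)
  have : (1-x)⁻¹ = 1 + x / (1-x) := by field_simp; ring
  rw [this]
  have : x / (1-x) ≤ 3 * x := by rw [div_le_iff₀ hp]; nlinarith
  linarith

lemma V_ge_exp (g : ℕ → ℝ) (l : List ℕ) (h : ∀ p ∈ l, 0 ≤ g p ∧ g p ≤ 2/3) :
    exp (-(3 * (l.map g).sum)) ≤ V g l := by
  induction l with
  | nil => simp [V]
  | cons p l ih =>
    rw [V_cons, List.map_cons, List.sum_cons, mul_add, neg_add, exp_add]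
    have hp := h p (by simp)
    exact mul_le_mul (one_sub_ge_exp _ hp.1 hp.2) (ih (fun q hq => h q (by simp [hq]))) (exp_pos _).le
      (by linarith)

lemma sum_pow_sub (J : ℕ) : ∑ j ∈ range J, 2 ^ j * (J - j) ≤ 2 ^ (J+1) := by
  have : ∀ J, ∑ j ∈ range J, 2 ^ j * (J - j) + (J + 2) = 2 ^ (J+1) := by
    intro J
    induction J with
    | zero => simp
    | succ J ih =>
      have h1 : ∑ j ∈ range (J+1), 2 ^ j * (J + 1 - j) = ∑ j ∈ range (J+1), (2 ^ j * (J - j) + 2 ^ j) := by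
        apply sum_congr rfl; intro j hj
        have : j ≤ J := by have := mem_range.1 hj; omega
        rw [Nat.succ_sub this, Nat.succ_eq_add_one]; ring
      rw [h1, sum_add_distrib, sum_range_succ]
      have h2 := Nat.geomSum_eq (m := 2) le_rfl (J+1)
      have h3 : 1 ≤ 2 ^ (J+1) := one_le_two_pow
      simp only [Nat.sub_self, mul_zero, add_zero]
      rw [h2]
      rw [pow_succ 2 (J+1)]
      omega
  have := this J; omega

theorem FL : ∃ B0 : ℕ, ∀ (S : Finset ℕ) (hit : ℕ → ℕ → ℝ) (H : ℝ) (w : ℕ → ℝ) (PP : Finset ℕ) (J B : ℕ),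
    B0 ≤ B → 0 ≤ H → (∀ p ∈ PP, p.Prime ∧ p < 2 ^ (2 ^ J)) →
    (∀ p ∈ PP, 0 ≤ w p ∧ w p ≤ 2 ∧ w p / p ≤ 2/3) →
    (∀ p t, 0 ≤ hit p t ∧ hit p t ≤ 1) →
    (∀ D, D ⊆ PP → |∑ t ∈ S, ∏ p ∈ D, hit p t - H * ∏ p ∈ D, (w p / p)| ≤ ∏ p ∈ D, w p) →
    |∑ t ∈ S, ∏ p ∈ PP, (1 - hit p t) - H * ∏ p ∈ PP, (1 - w p / p)| ≤
      H * (∏ p ∈ PP, (1 - w p / p)) * exp (-B) + 2 ^ (2 ^ J * (40 * B)) := by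
  set C : ℝ := exp (24 + 8 * exp 4) with hC
  have hC0 : 0 < C := exp_pos _
  obtain ⟨B0, hB0⟩ : ∃ B0 : ℕ, 2 * C * 2 ≤ B0 := exists_nat_ge _
  refine ⟨B0 + 1, ?_⟩
  intro S hit H w PP J B hB hH hPP hw hhit hD
  set g : ℕ → ℝ := fun p => w p / p with hgdef
  set blk : ℕ → Finset ℕ := fun j => PP.filter (fun p => 2 ^ (2 ^ j) ≤ p ∧ p < 2 ^ (2 ^ (j+1))) with hblk
  set bl : ℕ → List ℕ := fun j => (blk j).toList with hbl
  set k : ℕ → ℕ := fun j => B + (J - j) with hk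
  set N : ℕ → ℝ := fun j => (2 ^ (2 ^ (j+1) + 2)) ^ (2 * k j + 1) with hN
  set η : ℕ → ℝ := fun j => C * exp (-(4 * (2 * k j + 1))) with hη
  have hgP : ∀ p ∈ PP, 0 ≤ g p ∧ g p ≤ 2/3 := by
    intro p hp
    have := hw p hp
    exact ⟨div_nonneg this.1 (by positivity), this.2.2⟩
  have hmem : ∀ j p, p ∈ bl j ↔ p ∈ PP ∧ 2 ^ (2 ^ j) ≤ p ∧ p < 2 ^ (2 ^ (j+1)) := by
    intro j p; simp [hbl, hblk]
  have hsumL : ∀ (f : ℕ → ℝ) j, ((bl j).map f).sum = ∑ p ∈ blk j, f p := by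
    grind
  have hVL : ∀ (f : ℕ → ℝ) j, V f (bl j) = ∏ p ∈ blk j, (1 - f p) := by
    intro f j; simp only [hbl, V]; exact Finset.prod_map_toList _ _
  have hgsum : ∀ j, ((bl j).map g).sum ≤ 8 := by
    intro j
    rw [hsumL]
    have h1 : ∑ p ∈ blk j, g p ≤ ∑ p ∈ blk j, 2 * (1 / (p:ℝ)) := by
      apply sum_le_sum; intro p hp
      have hp' : p ∈ PP := (mem_filter.1 hp).1
      rw [← mul_div_assoc, mul_one]
      have := (hw p hp').2.1
      simp only [hgdef]; gcongr
    rw [← mul_sum] at h1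
    have h2 := sum_block j (blk j) (by
      intro p hp; have := mem_filter.1 hp; exact ⟨(hPP p this.1).1, this.2.1, this.2.2⟩)
    linarith
  have hwsum : ∀ j, 0 ≤ ((bl j).map w).sum ∧ 1 + ((bl j).map w).sum ≤ 2 ^ (2 ^ (j+1) + 2) := by
    intro j
    rw [hsumL]
    refine ⟨sum_nonneg fun p hp => (hw p (mem_filter.1 hp).1).1, ?_⟩
    have h1 : ∑ p ∈ blk j, w p ≤ ∑ p ∈ blk j, 2 := by
      apply sum_le_sum; grind
    have h2 : #(blk j) ≤ 2 ^ (2 ^ (j+1)) := by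
      have : blk j ⊆ range (2 ^ (2 ^ (j+1))) := by
        grind
      simpa using card_le_card this
    have h3 : (#(blk j) : ℝ) ≤ 2 ^ (2 ^ (j+1)) := mod_cast h2
    simp only [sum_const, nsmul_eq_mul] at h1
    have h4 : (1:ℝ) ≤ 2 ^ (2 ^ (j+1)) := one_le_pow₀ (by norm_num)
    rw [pow_add]; linarith
  have h2ge : ∀ j, (1:ℝ) ≤ 2 ^ (2 ^ (j+1) + 2) := fun j => one_le_pow₀ (by norm_num)
  have hw0 : ∀ p ∈ PP, 0 ≤ w p := fun p hp => (hw p hp).1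
  have hw0' : ∀ j, ∀ p ∈ bl j, 0 ≤ w p := fun j p hp => hw0 p ((hmem j p).1 hp).1
  have hVge : ∀ j, exp (-24) ≤ V g (bl j) := by
    intro j
    refine le_trans ?_ (V_ge_exp g (bl j) (fun p hp => hgP p ((hmem j p).1 hp).1))
    apply exp_le_exp.2
    have := hgsum j; linarith
  have h0 : Good S hit H g w PP (fun _ => 1) ∅ 1 1 := by
    intro D hDP _
    simpa using hD D hDP
  obtain ⟨F, L, XF, XL, hL, hF, gF, gL, x1, x2, x3⟩ := blocks hw0
    (fun p hp => ⟨(hgP p hp).1, by linarith [(hgP p hp).2]⟩) hhit h0 bl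
    (fun j p hp => ((hmem j p).1 hp).1) (fun j => Finset.nodup_toList _)
    (by
      intro i j hij p hp hpi
      have a := (hmem j p).1 hp
      have b := (hmem i p).1 hpi
      have : 2 ^ (2 ^ (i+1)) ≤ 2 ^ (2 ^ j) := pow_le_pow_right (by norm_num) (pow_le_pow_right (by norm_num) hij)
      omega) k N η
    (by
      intro j
      refine (Tneg_bounds w (bl j) (hw0' j) _).2.trans ?_
      calc _ ≤ (2 ^ (2 ^ (j+1) + 2) : ℝ) ^ (2 * k j) := by
            have := hwsum j
            gcongr
            · linarith
            · linarith
        _ ≤ _ := by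
            simp only [hN]
            exact pow_le_pow_right₀ (h2ge j) (by omega))
    (by
      intro j
      refine (el_le_pow w (bl j) (hw0' j) _).trans ?_
      have := hwsum j
      simp only [hN]
      gcongr
      · linarith
      · linarith)
    (by intro j; positivity)
    (by
      intro j
      have hpos : 0 ≤ ((bl j).map g).sum := by
        rw [hsumL]; exact sum_nonneg fun p hp => (hgP p (mem_filter.1 hp).1).1
      refine (el_le g (bl j) (fun p hp => (hgP p ((hmem j p).1 hp).1).1) _).trans ?_
      set n := 2 * k j + 1 with hn
      have h1 : ((bl j).map g).sum ^ n / n.factorial ≤ 8 ^ n / n.factorial := by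
        gcongr; exact hgsum j
      have h2 := Real.pow_div_factorial_le_exp (8 * exp 4) (by positivity) n
      have h3 : (8:ℝ) ^ n / n.factorial ≤ exp (8 * exp 4) * exp (-(4 * n)) := by
        have : (8 * exp 4) ^ n / n.factorial = (8:ℝ) ^ n / n.factorial * exp (4 * n) := by
          rw [mul_pow, ← exp_nat_mul, mul_comm (n:ℝ) 4]; ring
        rw [this] at h2
        rw [exp_neg, ← div_eq_mul_inv, le_div_iff₀ (exp_pos _)]
        exact h2
      have h4 : η j = exp (8 * exp 4) * exp (-(4 * n)) * exp 24 := by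
        simp only [hη, hC, hn]; rw [exp_add]; push_cast; ring
      rw [h4]
      calc _ ≤ exp (8 * exp 4) * exp (-(4 * n)) := h1.trans h3
        _ = exp (8 * exp 4) * exp (-(4 * n)) * exp 24 * exp (-24) := by
            rw [mul_assoc _ (exp 24), ← exp_add (24:ℝ), add_neg_cancel, Real.exp_zero, mul_one]
        _ ≤ _ := by gcongr; exact hVge j) J
  -- total of η
  have hηsum : ∑ j ∈ range J, η j ≤ exp (-B) / 2 := by
    have h1 : ∀ j ∈ range J, η j ≤ C * exp (-(2 * B)) * (1/2) ^ (J - 1 - j) := by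
      intro j hj
      have hj' := mem_range.1 hj
      have e1 : (exp (-1)) ≤ 1/2 := by
        rw [exp_neg, ← one_div]
        have := add_one_le_exp (1:ℝ)
        apply one_div_le_one_div_of_le <;> linarith
      have : exp (-(4 * (2 * (k j:ℝ) + 1))) ≤ exp (-(2 * B)) * exp (-1) ^ (J - 1 - j) := by
        rw [← exp_nat_mul, ← exp_add]
        apply exp_le_exp.2
        have : ((J - 1 - j : ℕ):ℝ) ≤ (J - j : ℕ) := mod_cast (by omega)
        simp only [hk]; push_cast
        linarith
      simp only [hη]
      rw [mul_assoc]
      refine mul_le_mul_of_nonneg_left (this.trans ?_) hC0.le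
      gcongr
    refine (sum_le_sum h1).trans ?_
    rw [← mul_sum, Finset.sum_range_reflect (fun i => ((1:ℝ)/2) ^ i)]
    have h2 : ∑ i ∈ range J, ((1:ℝ)/2) ^ i ≤ 2 := by
      have := geom_sum_eq (x := (1:ℝ)/2) (by norm_num) J
      rw [this]
      have : (0:ℝ) < (1/2) ^ J := by positivity
      grind
    have h3 : C * exp (-(2*B)) * 2 ≤ exp (-B) / 2 := by
      have h4 : exp (-(2*(B:ℝ))) = exp (-B) * exp (-B) := by
        rw [← exp_add]; congr 1; ring
      have h5 : 2 * C * 2 * exp (-B) ≤ 1 := by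
        rw [exp_neg, ← div_eq_mul_inv, div_le_one (exp_pos _)]
        have h6 := add_one_le_exp (B:ℝ)
        have : (B0:ℝ) ≤ B := mod_cast (by omega)
        linarith
      rw [h4]
      have := mul_le_mul_of_nonneg_left h5 (exp_pos (-(B:ℝ))).le
      linarith
    refine le_trans ?_ h3
    gcongr
  have hexpB : exp (-(B:ℝ)) ≤ 1 := exp_le_one_iff.2 (by simp)
  have hη0 : 0 ≤ ∑ j ∈ range J, η j := sum_nonneg fun j _ => by positivity
  -- decomposition of PP
  have hdecomp : PP = (range J).biUnion blk := by
    ext p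
    simp only [mem_biUnion, mem_range, hblk, mem_filter]
    constructor
    · intro hp
      have hpp := hPP p hp
      have hp2 := hpp.1.two_le
      have hl1 : 1 ≤ Nat.log 2 p := le_log_of_pow_le (by norm_num) (by simpa using hp2)
      refine ⟨Nat.log 2 (Nat.log 2 p), ?_, hp, ?_, ?_⟩
      · apply log_lt_of_lt_pow (by omega)
        exact log_lt_of_lt_pow hpp.1.ne_zero hpp.2
      · calc 2 ^ 2 ^ Nat.log 2 (Nat.log 2 p) ≤ 2 ^ (Nat.log 2 p) :=
              pow_le_pow_right (by norm_num) (pow_log_le_self 2 (by omega))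
          _ ≤ p := pow_log_le_self 2 hpp.1.ne_zero
      · rw [← Nat.log_lt_iff_lt_pow (by norm_num) hpp.1.ne_zero]
        exact lt_pow_succ_log_self (by norm_num) _
    · rintro ⟨j, _, hp, _⟩; exact hp
  have hpd : ∀ (f : ℕ → ℝ), ∏ p ∈ PP, (1 - f p) = ∏ j ∈ range J, V f (bl j) := by
    intro f
    conv_lhs => rw [hdecomp]
    rw [prod_biUnion]
    · apply prod_congr rfl; intro j _; rw [hVL]
    · intro i _ j _ hij
      rw [Function.onFun, Finset.disjoint_left]
      intro p hp hpj
      simp only [hblk, mem_filter] at hp hpj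
      rcases lt_or_gt_of_ne hij with h | h
      · have : 2 ^ (2 ^ (i+1)) ≤ 2 ^ (2 ^ j) := pow_le_pow_right (by norm_num) (pow_le_pow_right (by norm_num) h)
        omega
      · have : 2 ^ (2 ^ (j+1)) ≤ 2 ^ (2 ^ i) := pow_le_pow_right (by norm_num) (pow_le_pow_right (by norm_num) h)
        omega
  have hlev : ∏ j ∈ range J, (2 * N j) ≤ 2 ^ (2 ^ J * (40 * B)) := by
    have h1 : ∀ j ∈ range J, 2 * N j = 2 ^ (1 + (2 ^ (j+1) + 2) * (2 * k j + 1)) := by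
      intro j _; simp only [hN]; rw [← pow_mul, pow_add 2 1, pow_one]
    rw [prod_congr rfl h1, prod_pow_eq_pow_sum]
    apply pow_le_pow_right₀ (by norm_num)
    have hB1 : 1 ≤ B := by omega
    have h2 : ∀ j ∈ range J, 1 + (2 ^ (j+1) + 2) * (2 * k j + 1) ≤ 2 ^ j * (8 * B + 5) + 8 * (2 ^ j * (J - j)) := by
      intro j _
      have : 1 ≤ 2 ^ j := one_le_two_pow
      simp only [hk]
      have h3 : 2 ^ (j+1) + 2 ≤ 4 * 2 ^ j := by rw [pow_succ]; omega
      calc _ ≤ 2 ^ j + 4 * 2 ^ j * (2 * (B + (J - j)) + 1) := by gcongr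
        _ = _ := by ring
    refine (sum_le_sum h2).trans ?_
    rw [sum_add_distrib, ← sum_mul, ← mul_sum]
    have h4 := sum_pow_sub J
    have h5 := Nat.geomSum_eq (m := 2) le_rfl J
    have h6 : ∑ i ∈ range J, 2 ^ i ≤ 2 ^ J := by rw [h5]; simp
    calc _ ≤ 2 ^ J * (8 * B + 5) + 8 * 2 ^ (J+1) := by gcongr
      _ = 2 ^ J * (8 * B + 21) := by ring
      _ ≤ _ := by gcongr; omega
  have uF := gF ∅ (by simp) (by simp)
  have uL := gL ∅ (by simp) (by simp)
  simp only [prod_empty, mul_one] at uF uL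
  have sF : ∑ t ∈ S, ∏ p ∈ PP, (1 - hit p t) ≤ ∑ t ∈ S, F t := by
    apply sum_le_sum; intro t _
    rw [hpd (fun p => hit p t)]; exact hF t
  have sL : ∑ t ∈ S, L t ≤ ∑ t ∈ S, ∏ p ∈ PP, (1 - hit p t) := by
    apply sum_le_sum; intro t _
    rw [hpd (fun p => hit p t)]; exact hL t
  have hVg := hpd g
  simp only [hgdef] at hVg
  rw [hVg]
  set VV := ∏ j ∈ range J, V g (bl j)
  have hVV0 : 0 ≤ VV := prod_nonneg fun j _ => (exp_pos _).le.trans (hVge j)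
  have hXFu : XF ≤ VV * (1 + exp (-B)) := by
    refine x2.trans ?_
    rw [prod_mul_distrib, mul_comm]
    refine mul_le_mul_of_nonneg_left ?_ hVV0
    calc ∏ j ∈ range J, (1 + η j) ≤ ∏ j ∈ range J, exp (η j) := by
          apply prod_le_prod
          · intro j _; positivity
          · intro j _; have := add_one_le_exp (η j); linarith
      _ = exp (∑ j ∈ range J, η j) := (exp_sum _ _).symm
      _ ≤ 1 + 2 * (∑ j ∈ range J, η j) := by
          have := Real.exp_bound_div_one_sub_of_interval hη0 (by linarith : ∑ j ∈ range J, η j < 1)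
          refine this.trans ?_
          rw [div_le_iff₀ (by linarith)]
          nlinarith
      _ ≤ _ := by linarith
  have hXLl : VV * (1 - exp (-B)) ≤ XL := by
    refine le_trans ?_ x3
    have : VV * (1 - exp (-B)) ≤ VV * (1 - ∑ j ∈ range J, η j) :=
      mul_le_mul_of_nonneg_left (by linarith [exp_pos (-(B:ℝ))]) hVV0
    refine this.trans (mul_le_mul_of_nonneg_right x1 ?_)
    linarith
  have q1 := mul_le_mul_of_nonneg_left hXFu hH
  have q2 := mul_le_mul_of_nonneg_left hXLl hH
  rw [abs_le] at uF uL ⊢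
  grind

lemma modeq_count (t0 H m c : ℕ) (hm : 1 ≤ m) :
    |(#{t ∈ Ico t0 (t0+H) | t ≡ c [MOD m]} : ℝ) - H / m| ≤ 1 := by
  have h := Nat.Ico_filter_modEq_card t0 (t0+H) (r := m) (by omega) c
  have hle : ((t0:ℚ) - c) / m ≤ (((t0+H:ℕ):ℚ) - c) / m := by
    gcongr; omega
  rw [max_eq_left (by have := Int.ceil_le_ceil hle; omega)] at h
  have e1 : (((t0+H:ℕ):ℚ) - c) / m = ((t0:ℚ) - c) / m + H / m := by push_cast; ring
  rw [e1] at h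
  set x := ((t0:ℚ) - c) / m
  set y := (H:ℚ) / m with hy
  have a1 := Int.le_ceil x
  have a2 := Int.ceil_lt_add_one x
  have b1 := Int.le_ceil (x+y)
  have b2 := Int.ceil_lt_add_one (x+y)
  have hq : |(#{t ∈ Ico t0 (t0+H) | t ≡ c [MOD m]} : ℚ) - y| ≤ 1 := by
    have h' : (#{t ∈ Ico t0 (t0+H) | t ≡ c [MOD m]} : ℚ) = (⌈x+y⌉:ℚ) - ⌈x⌉ := mod_cast h
    rw [h', abs_le]; constructor <;> linarith
  have : |(((#{t ∈ Ico t0 (t0+H) | t ≡ c [MOD m]} : ℚ) - y : ℚ) : ℝ)| ≤ ((1:ℚ):ℝ) := by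
    exact_mod_cast hq
  simpa [hy] using this

lemma crt_count (t0 H : ℕ) (R : ℕ → Finset ℕ) (D : Finset ℕ) (hD : ∀ p ∈ D, p.Prime)
    (hR : ∀ p ∈ D, ∀ b ∈ R p, b < p) (m c : ℕ) (hm : 1 ≤ m) (hcop : ∀ p ∈ D, Coprime m p) :
    |(#{t ∈ Ico t0 (t0+H) | t ≡ c [MOD m] ∧ ∀ p ∈ D, t % p ∈ R p} : ℝ) - H / m * ∏ p ∈ D, ((#(R p) : ℝ) / p)|
      ≤ ∏ p ∈ D, (#(R p) : ℝ) := by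
  induction D using Finset.induction_on generalizing m c with
  | empty => simpa using modeq_count t0 H m c hm
  | insert p D hp ih =>
    have hpp := hD p (by simp)
    have ih' := ih (fun q hq => hD q (by simp [hq])) (fun q hq => hR q (by simp [hq]))
    have hset : {t ∈ Ico t0 (t0+H) | t ≡ c [MOD m] ∧ ∀ q ∈ insert p D, t % q ∈ R q} =
        (R p).biUnion fun b => {t ∈ Ico t0 (t0+H) | t ≡ (chineseRemainder (hcop p (by simp)) c b : ℕ) [MOD (m*p)] ∧
          ∀ q ∈ D, t % q ∈ R q} := by
      ext t
      simp only [mem_filter, mem_biUnion, forall_mem_insert]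
      constructor
      · rintro ⟨h1, h2, h3, h4⟩
        refine ⟨t % p, h3, h1, ?_, h4⟩
        exact Nat.chineseRemainder_modEq_unique _ h2 (mod_modEq t p).symm
      · rintro ⟨b, hb, h1, h2, h3⟩
        have hc := (chineseRemainder (hcop p (by simp)) c b).2
        refine ⟨h1, (h2.of_mul_right p).trans hc.1, ?_, h3⟩
        have : t ≡ b [MOD p] := (h2.of_mul_left m).trans hc.2
        have hb' := hR p (by simp) b hb
        rw [this, mod_eq_of_lt hb']; exact hb
    rw [hset, card_biUnion]
    · rw [prod_insert hp, prod_insert hp]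
      push_cast
      have : (H:ℝ) / m * ((#(R p):ℝ) / p * ∏ q ∈ D, ((#(R q) : ℝ) / q)) =
          ∑ b ∈ R p, (H:ℝ) / (m * p : ℕ) * ∏ q ∈ D, ((#(R q) : ℝ) / q) := by
        rw [sum_const, nsmul_eq_mul]; push_cast; rw [div_mul_eq_div_div]; ring
      rw [this, ← sum_sub_distrib]
      refine (abs_sum_le_sum_abs _ _).trans ?_
      refine (sum_le_sum (g := fun _ => ∏ q ∈ D, (#(R q):ℝ)) ?_).trans ?_
      · intro b _
        refine ih' (m*p) _ (Nat.mul_pos hm hpp.pos) ?_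
        intro q hq
        refine Coprime.mul_left (hcop q (by simp [hq])) ?_
        exact (coprime_primes hpp (hD q (by simp [hq]))).2 (by rintro rfl; exact hp hq)
      · simp
    · intro b hb b' hb' hbb
      rw [Function.onFun, Finset.disjoint_left]
      intro t ht ht'
      simp only [mem_filter] at ht ht'
      have hc := (chineseRemainder (hcop p (by simp)) c b).2
      have hc' := (chineseRemainder (hcop p (by simp)) c b').2
      have h1 : t ≡ b [MOD p] := (ht.2.1.of_mul_left m).trans hc.2
      have h2 : t ≡ b' [MOD p] := (ht'.2.1.of_mul_left m).trans hc'.2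
      have h3 : b % p = b' % p := h1.symm.trans h2
      rw [mod_eq_of_lt (hR p (by simp) b hb), mod_eq_of_lt (hR p (by simp) b' hb')] at h3
      exact hbb h3

def Rough (z n : ℕ) : Prop := ∀ p, p.Prime → p ∣ n → z ≤ p

/-- sieving set -/
def sv (z q : ℕ) : Finset ℕ := {p ∈ range z | p.Prime ∧ ¬ p ∣ q}

open Classical in
def om (a a' p : ℕ) : ℝ := if a ≡ a' [MOD p] then 1 else 2

open Classical in
lemma root_card (p q a a' : ℕ) (hp : p.Prime) (hq : ¬ p ∣ q) :
    (#{b ∈ range p | p ∣ (a + q * b) * (a' + q * b)} : ℝ) = om a a' p := by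
  have := Fact.mk hp
  have hq0 : (q : ZMod p) ≠ 0 := by rwa [Ne, ZMod.natCast_eq_zero_iff]
  set r : ℕ → ℕ := fun x => (-(x : ZMod p) / q).val with hr
  have hroot : ∀ x b, b < p → (p ∣ x + q * b ↔ b = r x) := by
    intro x b hb
    rw [← ZMod.natCast_eq_zero_iff]
    push_cast
    constructor
    · intro h
      have : (b : ZMod p) = -(x : ZMod p) / q := by
        rw [eq_div_iff hq0]; linear_combination h
      simp only [hr, ← this, ZMod.val_natCast, mod_eq_of_lt hb]
    · intro h
      have : (b : ZMod p) = -(x : ZMod p) / q := by rw [h]; simp [hr]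
      rw [this]; field_simp; ring
  have hset : {b ∈ range p | p ∣ (a + q * b) * (a' + q * b)} = {r a, r a'} := by
    ext b
    simp only [mem_filter, mem_range, mem_insert, mem_singleton]
    constructor
    · rintro ⟨hb, h⟩
      rcases hp.dvd_mul.1 h with h | h
      · left; exact (hroot a b hb).1 h
      · right; exact (hroot a' b hb).1 h
    grind
  have hrr : r a = r a' ↔ a ≡ a' [MOD p] := by
    rw [← ZMod.natCast_eq_natCast_iff]
    simp only [hr]
    rw [(ZMod.val_injective p).eq_iff, div_left_inj' hq0, neg_inj]
  rw [hset, om]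
  split_ifs with h
  · rw [hrr.2 h]; simp
  · rw [card_pair (fun hh => h (hrr.1 hh))]; norm_num

open Classical in
theorem FLpair : ∃ B0 : ℕ, ∀ (q a a' t0 H J B : ℕ), B0 ≤ B → a.Coprime q → a'.Coprime q →
    (2 ∣ q ∨ a = a') →
    |(#{t ∈ Ico t0 (t0+H) | Rough (2^2^J) (a + q * t) ∧ Rough (2^2^J) (a' + q * t)} : ℝ) -
        H * ∏ p ∈ sv (2^2^J) q, (1 - om a a' p / p)| ≤
      H * (∏ p ∈ sv (2^2^J) q, (1 - om a a' p / p)) * exp (-B) + 2 ^ (2 ^ J * (40 * B)) := by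
  obtain ⟨B0, hFL⟩ := FL
  refine ⟨B0, ?_⟩
  intro q a a' t0 H J B hB ha ha' h2
  have hsv : ∀ p ∈ sv (2^2^J) q, p.Prime ∧ p < 2^2^J ∧ ¬ p ∣ q := by
    intro p hp
    simp only [sv, mem_filter, mem_range] at hp
    tauto
  have := hFL (Ico t0 (t0+H)) (fun p t => if p ∣ (a + q * t) * (a' + q * t) then 1 else 0) H (om a a')
    (sv (2^2^J) q) J B hB (by positivity) (fun p hp => ⟨(hsv p hp).1, (hsv p hp).2.1⟩) ?_ ?_ ?_
  · convert this using 3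
    rw [card_filter]
    push_cast
    apply sum_congr rfl
    intro t _
    by_cases hR : Rough (2^2^J) (a + q * t) ∧ Rough (2^2^J) (a' + q * t)
    · rw [if_pos hR, eq_comm]
      apply prod_eq_one
      intro p hp
      rw [if_neg, sub_zero]
      intro hd
      have := hsv p hp
      rcases this.1.dvd_mul.1 hd with h | h
      · have := hR.1 p this.1 h; omega
      · have := hR.2 p this.1 h; omega
    · rw [if_neg hR, eq_comm]
      have hx : ∃ p, p.Prime ∧ p < 2^2^J ∧ p ∣ (a + q * t) * (a' + q * t) := by
        by_contra! hcon
        apply hR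
        constructor
        · intro p hp hd
          by_contra! hlt
          exact hcon p hp hlt (hd.mul_right _)
        · intro p hp hd
          by_contra! hlt
          exact hcon p hp hlt (hd.mul_left _)
      obtain ⟨p, hp, hlt, hd⟩ := hx
      refine prod_eq_zero (i := p) ?_ (by rw [if_pos hd, sub_self])
      simp only [sv, mem_filter, mem_range]
      refine ⟨hlt, hp, fun hq => ?_⟩
      rcases hp.dvd_mul.1 hd with h | h
      · have h1 : p ∣ a := (Nat.dvd_add_left (hq.mul_right t)).1 h
        exact hp.one_lt.ne' (dvd_one.1 (ha ▸ Nat.dvd_gcd h1 hq))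
      · have h1 : p ∣ a' := (Nat.dvd_add_left (hq.mul_right t)).1 h
        exact hp.one_lt.ne' (dvd_one.1 (ha' ▸ Nat.dvd_gcd h1 hq))
  · intro p hp
    obtain ⟨h1, h3, h4⟩ := hsv p hp
    have hpos : (0:ℝ) < p := mod_cast h1.pos
    unfold om
    split_ifs with h
    · refine ⟨by norm_num, by norm_num, ?_⟩
      have : (2:ℝ) ≤ p := mod_cast h1.two_le
      rw [div_le_iff₀ hpos]; linarith
    · refine ⟨by norm_num, le_rfl, ?_⟩
      have : 3 ≤ p := by
        rcases h2 with h2 | h2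
        · have := h1.two_le
          have : p ≠ 2 := by rintro rfl; exact h4 h2
          omega
        · exact absurd (by rw [h2]) h
      have : (3:ℝ) ≤ p := mod_cast this
      rw [div_le_iff₀ hpos]; linarith
  · intro p t; split_ifs <;> norm_num
  · intro D hD
    have := crt_count t0 H (fun p => {b ∈ range p | p ∣ (a + q * b) * (a' + q * b)}) D
      (fun p hp => (hsv p (hD hp)).1) (by intro p _ b hb; simpa using (mem_filter.1 hb).1) 1 0 le_rfl
      (fun p _ => Nat.coprime_one_left p)
    have hc : ∀ p ∈ D, (#{b ∈ range p | p ∣ (a + q * b) * (a' + q * b)} : ℝ) = om a a' p := fun p hp =>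
      root_card p q a a' (hsv p (hD hp)).1 (hsv p (hD hp)).2.2
    rw [prod_congr rfl hc] at this
    have h5 : ∏ p ∈ D, ((#{b ∈ range p | p ∣ (a + q * b) * (a' + q * b)} : ℝ) / p) = ∏ p ∈ D, (om a a' p / p) :=
      prod_congr rfl (fun p hp => by rw [hc p hp])
    rw [h5] at this
    convert this using 3
    · rw [card_filter]
      push_cast
      apply sum_congr rfl
      intro t _
      rw [prod_ite_zero]
      simp only [prod_const_one]
      congr 1
      simp only [Nat.modEq_one, true_and, mem_filter, mem_range, eq_iff_iff]
      apply forall₂_congr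
      intro p hp
      have hpp := (hsv p (hD hp)).1
      have h6 : (a + q * t) * (a' + q * t) ≡ (a + q * (t % p)) * (a' + q * (t % p)) [MOD p] := by
        have : t ≡ t % p [MOD p] := (mod_modEq t p).symm
        gcongr
      constructor
      · intro h; exact ⟨mod_lt _ hpp.pos, (h6.dvd_iff dvd_rfl).1 h⟩
      · intro h; exact (h6.dvd_iff dvd_rfl).2 h.2
    · simp

lemma prodPB_pos (z : ℕ) : 0 < ∏ p ∈ z.primesBelow, (1 - 1/(p:ℝ)) := by
  apply prod_pos
  intro p hp
  have : (2:ℝ) ≤ p := mod_cast (prime_of_mem_primesBelow hp).two_le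
  rw [sub_pos, div_lt_one (by linarith)]; linarith

/-- `∏_{p<z} (1-1/p) ≤ 1/log z`. -/
lemma mertens_low (z : ℕ) (hz : 2 ≤ z) : ∏ p ∈ z.primesBelow, (1 - 1/(p:ℝ)) ≤ 1 / log z := by
  have hlog : 0 < log z := log_pos (mod_cast hz)
  let f : ℕ →* ℝ := ⟨⟨fun n => ((n:ℝ))⁻¹, by simp⟩, by intro a b; simp [mul_comm]⟩
  have hf : ∀ n, f n = ((n:ℝ))⁻¹ := fun _ => rfl
  have h := EulerProduct.summable_and_hasSum_smoothNumbers_prod_primesBelow_geometric (f := f)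
    (by
      intro p hp
      rw [hf, Real.norm_of_nonneg (by positivity)]
      exact inv_lt_one_of_one_lt₀ (mod_cast hp.one_lt)) z
  have h1 : log z ≤ ∏ p ∈ z.primesBelow, (1 - f p)⁻¹ := by
    have h2 := log_add_one_le_harmonic (z-1)
    rw [Nat.sub_add_cancel (by omega)] at h2
    refine h2.trans ?_
    rw [harmonic_eq_sum_Icc]
    push_cast
    have hmem : ∀ n ∈ Icc 1 (z-1), n ∈ z.smoothNumbers := by
      intro n hn
      rw [mem_Icc] at hn
      exact Nat.mem_smoothNumbers_of_lt (by omega) (by omega)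
    rw [← sum_attach]
    let e : {x // x ∈ Icc 1 (z-1)} ↪ z.smoothNumbers :=
      ⟨fun x => ⟨x.1, hmem x.1 x.2⟩, by intro a b hab; exact Subtype.ext (congrArg (fun x : z.smoothNumbers => x.1) hab)⟩
    have h3 := sum_le_hasSum ((Icc 1 (z-1)).attach.map e) (fun i _ => by rw [hf]; positivity) h.2
    rw [sum_map] at h3
    exact h3
  rw [prod_inv_distrib] at h1
  have h5 : ∏ p ∈ z.primesBelow, (1 - f p) = ∏ p ∈ z.primesBelow, (1 - 1/(p:ℝ)) := by
    simp [hf]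
  rw [h5] at h1
  rw [le_div_iff₀ hlog]
  have hp := prodPB_pos z
  calc _ ≤ (∏ p ∈ z.primesBelow, (1 - 1/(p:ℝ))) * (∏ p ∈ z.primesBelow, (1 - 1/(p:ℝ)))⁻¹ := by gcongr
    _ = 1 := mul_inv_cancel₀ hp.ne'

noncomputable def Vq (z q : ℕ) : ℝ := ∏ p ∈ sv z q, (1 - 1/(p:ℝ))

lemma one_sub_inv_mem {p : ℕ} (hp : p.Prime) : 0 < 1 - 1/(p:ℝ) ∧ 1 - 1/(p:ℝ) < 1 := by
  have : (2:ℝ) ≤ p := mod_cast hp.two_le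
  constructor
  · rw [sub_pos, div_lt_one (by linarith)]; linarith
  · simp; exact hp.pos

lemma Vq_pos (z q : ℕ) : 0 < Vq z q := by
  apply prod_pos
  intro p hp
  simp only [sv, mem_filter] at hp
  exact (one_sub_inv_mem hp.2.1).1

lemma Vq_le_one (z q : ℕ) : Vq z q ≤ 1 := by
  apply prod_le_one
  · intro p hp
    simp only [sv, mem_filter] at hp
    exact (one_sub_inv_mem hp.2.1).1.le
  simp

lemma totient_real (q : ℕ) : (q.totient : ℝ) = q * ∏ p ∈ q.primeFactors, (1 - 1/(p:ℝ)) := by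
  have := Nat.totient_eq_mul_prod_factors q
  have h : ((q.totient : ℚ) : ℝ) = ((q * ∏ p ∈ q.primeFactors, (1 - (p:ℚ)⁻¹) : ℚ) : ℝ) := by rw [this]
  push_cast at h
  simpa using h

lemma Vq_le (z q : ℕ) (hz : 2 ≤ z) (hq : 1 ≤ q) : Vq z q ≤ (q / q.totient) / log z := by
  have h1 : ∏ p ∈ z.primesBelow, (1 - 1/(p:ℝ)) =
      Vq z q * ∏ p ∈ z.primesBelow with p ∣ q, (1 - 1/(p:ℝ)) := by
    rw [← prod_filter_mul_prod_filter_not z.primesBelow (fun p => p ∣ q), mul_comm]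
    congr 1
    unfold Vq
    apply prod_congr _ (fun _ _ => rfl)
    ext p
    simp only [sv, Nat.primesBelow, mem_filter, mem_range]
    tauto
  have h2 : ∏ p ∈ q.primeFactors, (1 - 1/(p:ℝ)) ≤ ∏ p ∈ z.primesBelow with p ∣ q, (1 - 1/(p:ℝ)) := by
    have hsub : {p ∈ z.primesBelow | p ∣ q} ⊆ q.primeFactors := by
      intro p hp
      simp only [Nat.primesBelow, mem_filter, mem_range] at hp
      grind
    rw [← prod_sdiff hsub]
    refine mul_le_of_le_one_left (prod_nonneg ?_) (prod_le_one ?_ ?_)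
    · intro p hp
      exact (one_sub_inv_mem (prime_of_mem_primeFactors (hsub hp))).1.le
    · intro p hp
      exact (one_sub_inv_mem (prime_of_mem_primeFactors (mem_sdiff.1 hp).1)).1.le
    simp
  have h3 := mertens_low z hz
  rw [h1] at h3
  have h4 : Vq z q * ((q.totient:ℝ)/q) ≤ 1 / log z := by
    refine le_trans ?_ h3
    apply mul_le_mul_of_nonneg_left _ (Vq_pos z q).le
    refine le_trans (le_of_eq ?_) h2
    rw [totient_real]; field_simp
  have h6 : Vq z q = Vq z q * ((q.totient:ℝ)/q) * (q / q.totient) := by field_simp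
  calc Vq z q = Vq z q * ((q.totient:ℝ)/q) * (q / q.totient) := h6
    _ ≤ 1 / log z * (q / q.totient) := by gcongr
    _ = _ := by ring

open Classical in
/-- passing from residue class in an interval to a progression -/
lemma count_ap (P : ℕ → Prop) (x H q a : ℕ) (hq : 1 ≤ q) : ∃ t0 H' : ℕ, |(H':ℝ) - H / q| ≤ 1 ∧
    #{n ∈ Ico x (x+H) | n ≡ a [MOD q] ∧ P n} = #{t ∈ Ico t0 (t0+H') | P (a % q + q * t)} := by
  have ha : a % q < q := mod_lt _ hq
  set c := q - 1 - a % q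
  have hmono : (x + c) / q ≤ (x + H + c) / q := div_le_div_right (by omega)
  refine ⟨(x + c)/q, (x+H+c)/q - (x+c)/q, ?_, ?_⟩
  · rw [cast_sub hmono]
    have hq' : (0:ℝ) < q := mod_cast hq
    have e1 := div_add_mod (x+c) q
    have e2 := div_add_mod (x+H+c) q
    have m1 := mod_lt (x+c) hq
    have m2 := mod_lt (x+H+c) hq
    set d1 := (x+c)/q
    set d2 := (x+H+c)/q
    set r1 := (x+c)%q
    set r2 := (x+H+c)%q
    have e3 : (q:ℝ) * d2 + r2 - (q * d1 + r1) = H := by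
      have : ((q * d2 + r2 : ℕ):ℝ) - ((q * d1 + r1 : ℕ) : ℝ) = H := by rw [e1, e2]; push_cast; ring
      push_cast at this; exact this
    have m1' : (r1:ℝ) < q := mod_cast m1
    have m2' : (r2:ℝ) < q := mod_cast m2
    have : (d2:ℝ) - d1 - H / q = (r1 - r2)/q := by field_simp; linarith
    rw [this, abs_le]
    constructor
    · rw [le_div_iff₀ hq']; linarith
    · rw [div_le_iff₀ hq']; linarith
  · symm
    apply card_bij (fun t _ => a % q + q * t)
    · intro t ht
      simp only [mem_filter, mem_Ico] at ht ⊢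
      obtain ⟨⟨h1, h2⟩, h3⟩ := ht
      rw [Nat.add_sub_cancel' hmono] at h2
      refine ⟨⟨?_, ?_⟩, ?_, h3⟩
      · by_contra! hlt
        have : t + 1 ≤ (x+c)/q := by
          rw [Nat.le_div_iff_mul_le hq]
          grind
        omega
      · by_contra! hge
        have : (x+H+c)/q < t + 1 := by
          rw [Nat.div_lt_iff_lt_mul hq]
          grind
        omega
      · simp [ModEq, Nat.add_mod]
    · intro t ht t' ht' h
      have : q * t = q * t' := by simpa using h
      exact Nat.eq_of_mul_eq_mul_left hq this
    · intro n hn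
      simp only [mem_filter, mem_Ico] at hn
      obtain ⟨⟨h1, h2⟩, h3, h4⟩ := hn
      have h5 : a % q + q * (n / q) = n := by
        have := mod_add_div n q
        rw [show n % q = a % q from h3] at this; exact this
      refine ⟨n / q, ?_, h5⟩
      simp only [mem_filter, mem_Ico]
      rw [h5]
      refine ⟨⟨?_, ?_⟩, h4⟩
      · have : (x + c)/q < n / q + 1 := by
          rw [Nat.div_lt_iff_lt_mul hq]
          grind
        omega
      · rw [Nat.add_sub_cancel' hmono]
        have : n / q + 1 ≤ (x+H+c)/q := by
          rw [Nat.le_div_iff_mul_le hq]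
          grind
        omega

open Classical in
noncomputable def RC (z q a x H : ℕ) : ℕ := #{n ∈ Ico x (x+H) | n ≡ a [MOD q] ∧ Rough z n}

open Classical in
/-- fundamental lemma for a single progression -/
theorem SV : ∃ B0 : ℕ, ∀ (q a x H J B : ℕ), B0 ≤ B → 1 ≤ q → a.Coprime q →
    |(RC (2^2^J) q a x H : ℝ) - H / q * Vq (2^2^J) q| ≤
      H / q * Vq (2^2^J) q * exp (-B) + 3 * 2 ^ (2 ^ J * (40 * B)) := by
  obtain ⟨B0, h⟩ := FLpair
  refine ⟨B0, ?_⟩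
  intro q a x H J B hB hq ha
  obtain ⟨t0, H', hH, hc⟩ := count_ap (Rough (2^2^J)) x H q a hq
  have ha' : (a % q).Coprime q := by
    rw [Nat.coprime_iff_gcd_eq_one, ← ha, ← Nat.gcd_rec, Nat.gcd_comm]
  have := h q (a % q) (a % q) t0 H' J B hB ha' ha' (Or.inr rfl)
  simp only [and_self] at this
  have hV : ∏ p ∈ sv (2^2^J) q, (1 - om (a%q) (a%q) p / p) = Vq (2^2^J) q := by
    unfold Vq; apply prod_congr rfl; intro p _; simp [om, ModEq.refl]
  rw [hV] at this
  unfold RC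
  rw [hc]
  set N : ℝ := (#{t ∈ Ico t0 (t0+H') | Rough (2^2^J) (a % q + q * t)} : ℝ)
  set V := Vq (2^2^J) q
  have hVp : 0 < V := Vq_pos _ _
  have hV1 : V ≤ 1 := Vq_le_one _ _
  have he : exp (-(B:ℝ)) ≤ 1 := exp_le_one_iff.2 (by simp)
  have hep := exp_pos (-(B:ℝ))
  have hpow : (1:ℝ) ≤ 2 ^ (2 ^ J * (40 * B)) := one_le_pow₀ (by norm_num)
  set E : ℝ := 2 ^ (2 ^ J * (40 * B))
  rw [abs_le] at hH this ⊢
  have k1 : (H':ℝ) * V * exp (-B) ≤ H/q * V * exp (-B) + 1 := by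
    have a1 : V * exp (-B) ≤ 1 := mul_le_one₀ hV1 hep.le he
    have a2 : 0 < V * exp (-B) := by positivity
    nlinarith [hH.2]
  constructor
  · nlinarith [this.1, hH.1, mul_le_mul_of_nonneg_right hH.1 hVp.le]
  · nlinarith [this.2, hH.2, mul_le_mul_of_nonneg_right hH.2 hVp.le]

lemma log_z (J : ℕ) : log ((2^2^J : ℕ):ℝ) = 2^J * log 2 := by
  push_cast; rw [log_pow]; push_cast; ring

lemma log_z_ge (J : ℕ) : (2:ℝ)^J / 2 ≤ log ((2^2^J : ℕ):ℝ) := by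
  rw [log_z]
  have := log_two_gt_d9
  have h : (0:ℝ) < 2^J := by positivity
  nlinarith

lemma two_le_z (J : ℕ) : 2 ≤ 2^2^J := by
  grind

lemma Rough.mono {z z' n : ℕ} (h : z' ≤ z) (hr : Rough z n) : Rough z' n :=
  fun p hp hd => h.trans (hr p hp hd)

lemma RC_mono {z z' : ℕ} (h : z' ≤ z) (q a x H : ℕ) : RC z q a x H ≤ RC z' q a x H := by
  classical
  unfold RC
  apply card_le_card
  intro n hn
  simp only [mem_filter] at hn ⊢
  exact ⟨hn.1, hn.2.1, hn.2.2.mono h⟩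

lemma HqV_le (q H J : ℕ) (hq : 1 ≤ q) :
    (H:ℝ) / q * Vq (2^2^J) q ≤ 2 * H / (q.totient * 2^J) := by
  have h1 := Vq_le (2^2^J) q (two_le_z J) hq
  have h2 := log_z_ge J
  calc (H:ℝ) / q * Vq (2^2^J) q ≤ H / q * ((q / q.totient) / log ((2^2^J:ℕ):ℝ)) := by gcongr
    _ ≤ H / q * ((q / q.totient) / (2^J/2)) := by gcongr
    _ = _ := by field_simp

/-- Brun–Titchmarsh for rough numbers -/
theorem BT : ∃ D : ℕ, 1 ≤ D ∧ ∀ (q a x H J : ℕ), 1 ≤ q → a.Coprime q →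
    (RC (2^2^J) q a x H : ℝ) ≤ 4 * H / (q.totient * 2^J) + 3 * 2 ^ (2 ^ J * D) := by
  obtain ⟨B0, h⟩ := SV
  refine ⟨40 * (B0 + 1), by omega, ?_⟩
  intro q a x H J hq ha
  have h1 := (abs_le.1 (h q a x H J (B0+1) (by omega) hq ha)).2
  have h2 := HqV_le q H J hq
  have h4 : exp (-((B0+1:ℕ):ℝ)) ≤ 1 := exp_le_one_iff.2 (neg_nonpos.2 (cast_nonneg _))
  have h5 : 0 ≤ (H:ℝ) / q * Vq (2^2^J) q := mul_nonneg (by positivity) (Vq_pos _ _).le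
  have h6 : (H:ℝ) / q * Vq (2^2^J) q * exp (-((B0+1:ℕ):ℝ)) ≤ (H:ℝ) / q * Vq (2^2^J) q :=
    mul_le_of_le_one_right h5 h4
  grind

open Classical in
noncomputable def PC (q a x H : ℕ) : ℕ := #{n ∈ Ico x (x+H) | n ≡ a [MOD q] ∧ n.Prime}

lemma PC_le_RC (z q a x H : ℕ) : PC q a x H ≤ RC z q a x H + z := by
  classical
  unfold PC RC
  nth_rewrite 4 [← card_range z]
  refine le_trans (card_le_card (t := {n ∈ Ico x (x+H) | n ≡ a [MOD q] ∧ Rough z n} ∪ range z) ?_) (card_union_le _ _)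
  intro n hn
  simp only [mem_filter, mem_union, mem_range] at hn ⊢
  by_cases hz : n < z
  · right; exact hz
  · left
    refine ⟨hn.1, hn.2.1, ?_⟩
    intro p hp hd
    rw [(Nat.prime_dvd_prime_iff_eq hp hn.2.2).1 hd]; omega

lemma PC_triv (q a x H : ℕ) (hq : 1 ≤ q) : (PC q a x H : ℝ) ≤ H / q + 1 := by
  classical
  have h := (abs_le.1 (modeq_count x H q a hq)).2
  have : PC q a x H ≤ #{n ∈ Ico x (x+H) | n ≡ a [MOD q]} := by
    unfold PC
    apply card_le_card
    grind
  have : (PC q a x H : ℝ) ≤ #{n ∈ Ico x (x+H) | n ≡ a [MOD q]} := mod_cast this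
  linarith

lemma nat_lt_two_pow_real (n : ℕ) : (n:ℝ) ≤ 2^n := mod_cast (lt_two_pow_self).le

/-- Brun–Titchmarsh for primes -/
theorem BTp : ∃ C : ℝ, 1 ≤ C ∧ ∀ (q a x H k : ℕ), 1 ≤ q → a.Coprime q → 1 ≤ k → q * 2^k ≤ H →
    (PC q a x H : ℝ) ≤ C * H / (q.totient * k) := by
  obtain ⟨D, hD1, h⟩ := BT
  refine ⟨16 * (D+1) * 2 + 32, by have : (0:ℝ) ≤ D := by positivity
                                  linarith, ?_⟩
  intro q a x H k hq ha hk hH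
  have hphiq : (q.totient:ℝ) ≤ q := mod_cast totient_le q
  have hq' : (0:ℝ) < q := mod_cast hq
  have hH' : (q:ℝ) * 2^k ≤ H := mod_cast hH
  have hH0 : (0:ℝ) < H := lt_of_lt_of_le (by positivity) hH'
  by_cases hsmall : k < 4 * (D+1)
  · have h1 := PC_triv q a x H hq
    have h2 : (1:ℝ) ≤ H / q := by
      rw [le_div_iff₀ hq']
      have : (1:ℝ) ≤ 2^k := one_le_pow₀ (by norm_num)
      nlinarith
    have h3 : (k:ℝ) ≤ 4 * (D+1) := mod_cast hsmall.le
    calc (PC q a x H:ℝ) ≤ 2 * (H/q) := by linarith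
      _ ≤ 2 * (H/q.totient) := by gcongr
      _ = 2 * k * H / (q.totient * k) := by field_simp
      _ ≤ _ := by
        gcongr
        linarith
  · push Not at hsmall
    obtain ⟨J, hJ1, hJ2⟩ : ∃ J, 2^J ≤ k / (4*(D+1)) ∧ k / (4*(D+1)) < 2^(J+1) := by
      have h0 : k / (4*(D+1)) ≠ 0 := by
        have := (Nat.one_le_div_iff (by omega)).2 hsmall
        omega
      exact ⟨Nat.log 2 (k / (4*(D+1))), pow_log_le_self 2 h0, lt_pow_succ_log_self (by norm_num) _⟩
    have hJ3 : 2^J * (4*(D+1)) ≤ k := (Nat.le_div_iff_mul_le (by omega)).1 hJ1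
    have hJ4 : k < 2^(J+1) * (4*(D+1)) := (Nat.div_lt_iff_lt_mul (by omega)).1 hJ2
    have h1 := h q a x H J hq ha
    have h2 : (PC q a x H : ℝ) ≤ RC (2^2^J) q a x H + (2:ℝ)^2^J := mod_cast PC_le_RC (2^2^J) q a x H
    set e := 2^J * (D+1) with he
    have he1 : (2:ℝ)^(2^J * D) ≤ 2^e := pow_le_pow_right₀ (by norm_num) (Nat.mul_le_mul_left _ (by omega))
    have he2 : (2:ℝ)^2^J ≤ 2^e := pow_le_pow_right₀ (by norm_num) (Nat.le_mul_of_pos_right _ (by omega))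
    have he3 : 4 * e ≤ k := by rw [he]; linarith
    have he4 : k < 8 * e := by rw [he]; rw [pow_succ] at hJ4; linarith
    have hJ5 : (k:ℝ) ≤ 8 * (2^J * (D+1)) := by
      have : (k:ℝ) ≤ ((8 * e : ℕ) : ℝ) := mod_cast he4.le
      grind
    have h3 : 4 * (H:ℝ) / (q.totient * 2^J) ≤ 16 * (D+1) * 2 * H / (q.totient * k) := by
      rw [div_le_div_iff₀ (by positivity) (by positivity)]
      have : 0 ≤ 4 * (H:ℝ) * q.totient := by positivity
      nlinarith [mul_le_mul_of_nonneg_left hJ5 this]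
    have h4 : 4 * (2:ℝ)^e ≤ 32 * H / (q.totient * k) := by
      rw [le_div_iff₀ (by positivity)]
      have a1 : (k:ℝ) ≤ 8 * 2^e := by
        have : (k:ℝ) ≤ ((8 * e : ℕ) : ℝ) := mod_cast he4.le
        push_cast at this
        have := nat_lt_two_pow_real e
        linarith
      have a2 : (2:ℝ)^e * 2^e ≤ 2^k := by
        rw [← pow_add]; exact pow_le_pow_right₀ (by norm_num) (by omega)
      calc 4 * (2:ℝ)^e * (q.totient * k) ≤ 4 * (2:ℝ)^e * (q * (8 * 2^e)) := by gcongr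
        _ = 32 * (q * (2^e * 2^e)) := by ring
        _ ≤ 32 * (q * 2^k) := by gcongr
        _ ≤ _ := by linarith
    have h5 : (16 * ((D:ℝ)+1) * 2 + 32) * H / (q.totient * k) = 16 * (D+1) * 2 * H / (q.totient * k) + 32 * H / (q.totient * k) := by ring
    rw [h5]; linarith

theorem R12 : ∃ (C : ℝ) (J0 : ℕ), 0 < C ∧ ∀ J q k H a : ℕ, J0 ≤ J → 1 ≤ q → q^4 ≤ 2^2^J → 2^J ≤ k → H ≤ 2^k →
    a.Coprime q → ((RC (2^2^J) q a (2^k) H : ℝ) ≤ C * 2^k / (q.totient * 2^J) ∧ ∀ a' : ℕ, a'.Coprime q →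
      |(RC (2^2^J) q a (2^k) H : ℝ) - RC (2^2^J) q a' (2^k) H| ≤
        C * 2^k / (q.totient * 2^J) * exp (-(k / (160 * 2^J) : ℝ))) := by
  obtain ⟨D, hD1, hBT⟩ := BT
  obtain ⟨B0, hSV⟩ := SV
  obtain ⟨d, hd⟩ : ∃ d, D ≤ 2^d := ⟨D, lt_two_pow_self.le⟩
  set C1 : ℝ := 4 * 2^(d+2) + 12 with hC1
  have hC1p : 0 < C1 := by positivity
  -- R1
  have R1 : ∀ J q k H a : ℕ, d + 2 ≤ J → 1 ≤ q → q^4 ≤ 2^2^J → 2^J ≤ k → H ≤ 2^k →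
    a.Coprime q → (RC (2^2^J) q a (2^k) H : ℝ) ≤ C1 * 2^k / (q.totient * 2^J) := by
    intro J q k H a hJ hq hqz hk hH ha
    have hphiq : (q.totient:ℝ) ≤ q := mod_cast totient_le q
    obtain ⟨J', rfl⟩ := Nat.exists_eq_add_of_le' hJ
    have h1 := hBT q a (2^k) H J' hq ha
    have h2 : (RC (2^2^(J'+(d+2))) q a (2^k) H : ℝ) ≤ RC (2^2^J') q a (2^k) H := by
      exact_mod_cast RC_mono (pow_le_pow_right (by norm_num) (pow_le_pow_right (by norm_num) (by omega))) q a (2^k) H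
    set m := 2^J' * 2^d with hm
    have h4m : 2^(J'+(d+2)) = 4 * m := by rw [hm]; ring
    rw [h4m] at hk hqz
    have hqm : q ≤ 2^m := by
      have : q^4 ≤ (2^m)^4 := by rw [← pow_mul, mul_comm m 4]; exact hqz
      exact (Nat.pow_le_pow_iff_left (by norm_num)).1 this
    have hqm' : (q:ℝ) ≤ 2^m := mod_cast hqm
    have hH' : (H:ℝ) ≤ 2^k := mod_cast hH
    have e1 : 4 * (H:ℝ) / (q.totient * 2^J') ≤ 4 * 2^(d+2) * 2^k / (q.totient * 2^(J'+(d+2))) := by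
      calc 4 * (H:ℝ) / (q.totient * 2^J') ≤ 4 * 2^k / (q.totient * 2^J') := by gcongr
        _ = _ := by rw [pow_add 2 J']; field_simp
    have e2 : 3 * (2:ℝ)^(2^J' * D) ≤ 12 * 2^k / (q.totient * 2^(J'+(d+2))) := by
      have b1 : (2:ℝ)^(2^J' * D) ≤ 2^m := pow_le_pow_right₀ (by norm_num) (Nat.mul_le_mul_left _ hd)
      have b2 : (2:ℝ)^(J'+(d+2)) = 4 * m := mod_cast h4m
      rw [le_div_iff₀ (by positivity), b2]
      have b3 := nat_lt_two_pow_real m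
      calc 3 * (2:ℝ)^(2^J' * D) * (q.totient * (4 * m)) ≤ 3 * 2^m * (2^m * (4 * 2^m)) := by
            gcongr; exact hphiq.trans hqm'
        _ = 12 * 2^(m+m+m) := by ring
        _ ≤ 12 * 2^k := by gcongr <;> [norm_num; omega]
    grind
  refine ⟨C1 * exp (B0+1) + 24 * exp 1 + 24, d + 2, by positivity, ?_⟩
  intro J q k H a hJ hq hqz hk hH ha
  have hphiq : (q.totient:ℝ) ≤ q := mod_cast totient_le q
  have hH' : (H:ℝ) ≤ 2^k := mod_cast hH
  have hR := R1 J q k H a hJ hq hqz hk hH ha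
  set U : ℝ := 2^k / (q.totient * 2^J) with hU
  have hUp : 0 < U := by positivity
  have hR' : (RC (2^2^J) q a (2^k) H : ℝ) ≤ C1 * U := by rw [hU, ← mul_div_assoc]; exact hR
  have hCge : C1 ≤ C1 * exp (B0+1) := le_mul_of_one_le_right hC1p.le (one_le_exp (by positivity))
  have hee := exp_pos 1
  constructor
  · rw [mul_div_assoc, ← hU]
    refine hR'.trans ?_
    gcongr
    linarith
  intro a' ha'
  have hR2 : (RC (2^2^J) q a' (2^k) H : ℝ) ≤ C1 * U := by
    grind
  rw [mul_div_assoc, ← hU]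
  set θ : ℝ := k / (160 * 2^J) with hθ
  have hex := exp_pos (-θ)
  by_cases hkk : k < 160 * 2^J * (B0+1)
  · have h1 : θ ≤ B0+1 := by
      rw [hθ, div_le_iff₀ (by positivity)]
      have : (k:ℝ) ≤ ((160 * 2^J * (B0+1) : ℕ):ℝ) := mod_cast hkk.le
      push_cast at this; linarith
    have h2 : |(RC (2^2^J) q a (2^k) H : ℝ) - RC (2^2^J) q a' (2^k) H| ≤ C1 * U := by
      rw [abs_le]
      constructor <;> linarith
    refine h2.trans ?_
    have h3 : 1 ≤ exp (B0+1) * exp (-θ) := by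
      rw [← exp_add]; exact one_le_exp (by linarith)
    calc C1 * U ≤ C1 * U * (exp (B0+1) * exp (-θ)) := le_mul_of_one_le_right (by positivity) h3
      _ = C1 * exp (B0+1) * U * exp (-θ) := by ring
      _ ≤ _ := by gcongr; linarith
  · push Not at hkk
    set B := k / (160 * 2^J) with hB
    have hB1 : B0 + 1 ≤ B := by
      rw [hB, Nat.le_div_iff_mul_le (by positivity)]; linarith
    have hB2 : B * (160 * 2^J) ≤ k := Nat.div_mul_le_self _ _
    have hB3 : θ < B + 1 := by
      rw [hθ, div_lt_iff₀ (by positivity)]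
      have : k < (B+1) * (160 * 2^J) := by
        rw [hB]; exact Nat.lt_div_mul_add (b := 160 * 2^J) (by positivity) |>.trans_eq (by ring)
      have : (k:ℝ) < (((B+1) * (160 * 2^J) : ℕ):ℝ) := mod_cast this
      push_cast at this; exact this
    have s1 := hSV q a (2^k) H J B (by omega) hq ha
    have s2 := hSV q a' (2^k) H J B (by omega) hq ha'
    have hV := HqV_le q H J hq
    set M : ℝ := (H:ℝ) / q * Vq (2^2^J) q
    have hM : M ≤ 2 * U := by
      refine hV.trans ?_
      rw [hU, ← mul_div_assoc]; gcongr
    have e1 : exp (-(B:ℝ)) ≤ exp 1 * exp (-θ) := by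
      rw [← exp_add]; exact exp_le_exp.2 (by linarith)
    set e := 2^J * (40 * B) with he
    have he4 : 4 * e ≤ k := by rw [he]; linarith
    have hJ1 : (1:ℝ) ≤ 2^J := one_le_pow₀ (by norm_num)
    have e2 : 6 * (2:ℝ)^e ≤ 24 * U * exp (-θ) := by
      obtain ⟨j, rfl⟩ : ∃ j, J = j + 2 := ⟨J - 2, by omega⟩
      set m := 2^j with hm
      have h4m : 2^(j+2) = 4 * m := by rw [hm]; ring
      have b2 : (2:ℝ)^(j+2) = 4 * m := mod_cast h4m
      rw [h4m] at hk hqz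
      have hqm : q ≤ 2^m := by
        have : q^4 ≤ (2^m)^4 := by rw [← pow_mul, mul_comm m 4]; exact hqz
        exact (Nat.pow_le_pow_iff_left (by norm_num)).1 this
      have hqm' : (q:ℝ) ≤ 2^m := mod_cast hqm
      have b3 := nat_lt_two_pow_real m
      have hexp : exp θ ≤ 2^(k/4) := by
        have hl := log_two_gt_d9
        have : (2:ℝ)^(k/4) = exp (log 2 * (k/4:ℕ)) := by
          rw [Real.exp_mul, exp_log (by norm_num)]; simp
        rw [this]
        apply exp_le_exp.2
        have hm1 : 1 ≤ m := one_le_two_pow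
        have hk8 : k ≤ 8 * (k/4) := by omega
        have hk8' : (k:ℝ) ≤ 8 * (k/4:ℕ) := mod_cast hk8
        have : θ ≤ k / 160 := by
          rw [hθ]; apply div_le_div_of_nonneg_left (by positivity) (by norm_num); linarith
        nlinarith
      rw [exp_neg, hU, b2]
      rw [← mul_div_assoc, ← div_eq_mul_inv, div_div, le_div_iff₀ (by positivity)]
      calc 6 * (2:ℝ)^e * (q.totient * (4 * m) * exp θ) ≤ 6 * 2^e * (2^m * (4 * 2^m) * 2^(k/4)) := by
            gcongr; exact hphiq.trans hqm'
        _ = 24 * 2^(e+m+m+k/4) := by ring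
        _ ≤ 24 * 2^k := by gcongr <;> [norm_num; omega]
    have e3 : 2 * (M * exp (-(B:ℝ))) ≤ 24 * exp 1 * U * exp (-θ) := by
      have : M * exp (-(B:ℝ)) ≤ 2 * U * (exp 1 * exp (-θ)) := by gcongr
      have : 0 < U * (exp 1 * exp (-θ)) := by positivity
      nlinarith
    have e4 : 0 < C1 * exp (B0+1) * U * exp (-θ) := by positivity
    have e5 : (C1 * exp (B0+1) + 24 * exp 1 + 24) * U * exp (-θ) =
      C1 * exp (B0+1) * U * exp (-θ) + 24 * exp 1 * U * exp (-θ) + 24 * U * exp (-θ) := by ring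
    rw [e5]
    rw [abs_le] at s1 s2 ⊢
    constructor <;> linarith [s1.1, s1.2, s2.1, s2.2]

noncomputable def Sing (z q a a' : ℕ) : ℝ := ∏ p ∈ sv z q with a ≡ a' [MOD p], (1 - 1/(p:ℝ))⁻¹

lemma prod_om_le (z q a a' : ℕ) (h2 : 2 ∣ q) :
    ∏ p ∈ sv z q, (1 - om a a' p / p) ≤ Vq z q ^ 2 * Sing z q a a' := by
  unfold Vq Sing
  rw [← prod_pow, prod_filter, ← prod_mul_distrib]
  apply prod_le_prod
  · intro p hp
    simp only [sv, mem_filter] at hp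
    have hp3 : 3 ≤ p := by
      have := hp.2.1.two_le
      grind
    have hp3' : (3:ℝ) ≤ p := mod_cast hp3
    have : om a a' p ≤ 2 := by unfold om; split_ifs <;> norm_num
    rw [sub_nonneg, div_le_one (by linarith)]; linarith
  · intro p hp
    simp only [sv, mem_filter] at hp
    have h := one_sub_inv_mem hp.2.1
    unfold om
    split_ifs with hc
    · rw [sq, mul_assoc, mul_inv_cancel₀ h.1.ne', mul_one]
    · rw [mul_one]
      have : (1 - 1/(p:ℝ))^2 = 1 - 2 / p + (1/(p:ℝ))^2 := by ring
      rw [this]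
      have : 0 ≤ (1/(p:ℝ))^2 := by positivity
      linarith

lemma Sing_pos (z q a a' : ℕ) : 0 < Sing z q a a' := by
  apply prod_pos
  intro p hp
  simp only [sv, mem_filter] at hp
  exact inv_pos.2 (one_sub_inv_mem hp.1.2.1).1

open Classical in
theorem PB : ∃ D : ℕ, ∀ (q a a' t0 H J : ℕ), 1 ≤ q → 2 ∣ q → a.Coprime q → a'.Coprime q →
    (#{t ∈ Ico t0 (t0+H) | Rough (2^2^J) (a + q * t) ∧ Rough (2^2^J) (a' + q * t)} : ℝ) ≤
      8 * H * ((q:ℝ) / q.totient)^2 / (2^J)^2 * Sing (2^2^J) q a a' + 2 ^ (2 ^ J * D) := by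
  obtain ⟨B0, h⟩ := FLpair
  refine ⟨40 * B0, ?_⟩
  intro q a a' t0 H J hq h2 ha ha'
  have h1 := (abs_le.1 (h q a a' t0 H J B0 le_rfl ha ha' (Or.inl h2))).2
  have hV := Vq_le (2^2^J) q (two_le_z J) hq
  have hS := Sing_pos (2^2^J) q a a'
  have hl := log_z_ge J
  have hV2 : Vq (2^2^J) q ≤ 2 * (q / q.totient) / 2^J := by
    refine hV.trans ?_
    calc _ ≤ (q / q.totient : ℝ) / (2^J/2) := by gcongr
      _ = _ := by field_simp
  have hprod := prod_om_le (2^2^J) q a a' h2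
  set P := ∏ p ∈ sv (2^2^J) q, (1 - om a a' p / p)
  have hP0 : 0 ≤ P := by
    apply prod_nonneg
    intro p hp
    simp only [sv, mem_filter] at hp
    have hp3 : 3 ≤ p := by
      have := hp.2.1.two_le
      grind
    have hp3' : (3:ℝ) ≤ p := mod_cast hp3
    have : om a a' p ≤ 2 := by unfold om; split_ifs <;> norm_num
    rw [sub_nonneg, div_le_one (by linarith)]; linarith
  have he : exp (-(B0:ℝ)) ≤ 1 := exp_le_one_iff.2 (neg_nonpos.2 (cast_nonneg _))
  have h5 : (H:ℝ) * P * exp (-B0) ≤ H * P := mul_le_of_le_one_right (by positivity) he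
  have h6 : (H:ℝ) * P ≤ H * ((2 * (q / q.totient) / 2^J)^2 * Sing (2^2^J) q a a') := by
    have hVp := Vq_pos (2^2^J) q
    gcongr
    exact hprod.trans (by gcongr)
  have h7 : 8 * (H:ℝ) * ((q:ℝ) / q.totient)^2 / (2^J)^2 * Sing (2^2^J) q a a' = 2 * (H * ((2 * (q / q.totient) / 2^J)^2 * Sing (2^2^J) q a a')) := by ring
  linarith

lemma sum_logp (y : ℕ) (hy : 2 ≤ y) : ∑ p ∈ y.primesBelow, log p / p ≤ 8 * log y := by
  set A := Nat.log 2 y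
  have hmaps : ∀ p ∈ y.primesBelow, Nat.log 2 p ∈ Icc 1 A := by
    intro p hp
    have hp' := prime_of_mem_primesBelow hp
    have hlt := Nat.lt_of_mem_primesBelow hp
    rw [mem_Icc]
    exact ⟨le_log_of_pow_le (by norm_num) (by simpa using hp'.two_le), Nat.log_mono_right hlt.le⟩
  rw [← sum_fiberwise_of_maps_to hmaps]
  have hAl : A * log 2 ≤ log y := by
    rw [← log_pow]
    apply log_le_log (by positivity)
    exact_mod_cast pow_log_le_self 2 (by omega)
  calc _ ≤ ∑ a ∈ Icc 1 A, 8 * log 2 := by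
        apply sum_le_sum
        intro a ha
        rw [mem_Icc] at ha
        have ha' : (1:ℝ) ≤ a := mod_cast ha.1
        have hin : ∀ p ∈ {p ∈ y.primesBelow | Nat.log 2 p = a}, p.Prime ∧ 2 ^ a ≤ p ∧ p < 2 ^ (a+1) := by
          intro p hp
          rw [mem_filter] at hp
          have hp' := prime_of_mem_primesBelow hp.1
          refine ⟨hp', ?_, ?_⟩
          · rw [← hp.2]; exact pow_log_le_self 2 hp'.ne_zero
          · rw [← hp.2]; exact lt_pow_succ_log_self (by norm_num) p
        have hs := sum_dyadic a ha.1 _ hin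
        calc ∑ p ∈ y.primesBelow with Nat.log 2 p = a, log p / p
            ≤ ∑ p ∈ y.primesBelow with Nat.log 2 p = a, ((a+1) * log 2) * (1 / p) := by
              apply sum_le_sum
              intro p hp
              have h3 := hin p hp
              have hp0 : (0:ℝ) < p := mod_cast h3.1.pos
              rw [div_eq_mul_one_div]
              gcongr
              have : log p ≤ log ((2:ℝ)^(a+1)) := by
                apply log_le_log hp0
                exact_mod_cast h3.2.2.le
              rw [log_pow] at this; push_cast at this; exact this
          _ = ((a+1) * log 2) * ∑ p ∈ y.primesBelow with Nat.log 2 p = a, (1:ℝ) / p := by rw [mul_sum]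
          _ ≤ ((a+1) * log 2) * (4 / a) := by gcongr
          _ ≤ ((a+a) * log 2) * (4 / a) := by gcongr
          _ = 8 * log 2 := by field_simp; ring
    _ = 8 * (A * log 2) := by simp; ring
    _ ≤ _ := by linarith

lemma zeta_le (κ : ℝ) (hκ : 0 < κ) : Summable (fun n : ℕ => (n:ℝ) ^ (-(1+κ))) ∧
    ∑' n : ℕ, (n:ℝ) ^ (-(1+κ)) ≤ 1 + 1/κ := by
  have hs : Summable (fun n : ℕ => (n:ℝ) ^ (-(1+κ))) := Real.summable_nat_rpow.2 (by linarith)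
  refine ⟨hs, ?_⟩
  rw [hs.tsum_eq_zero_add]
  have h := ZetaAsymptotics.zeta_limit_aux1 (s := 1+κ) (by linarith)
  have h2 : 0 ≤ ZetaAsymptotics.termTSum (1+κ) := tsum_nonneg (fun n => ZetaAsymptotics.term_nonneg _ _)
  have h3 : ∑' n : ℕ, ((n+1:ℕ):ℝ) ^ (-(1+κ)) = ∑' n : ℕ, 1 / (n + 1 : ℝ) ^ (1+κ) := by
    apply tsum_congr; intro n
    rw [rpow_neg (by positivity)]; push_cast; rw [one_div]
  rw [h3]
  have h4 : ((0:ℕ):ℝ) ^ (-(1+κ)) = 0 := by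
    rw [cast_zero, zero_rpow (by linarith)]
  rw [h4]
  have h5 : 0 ≤ (1+κ) * ZetaAsymptotics.termTSum (1+κ) := by positivity
  grind

lemma mertens_up : ∃ C : ℝ, 0 < C ∧ ∀ y : ℕ, 2 ≤ y →
    ∏ p ∈ y.primesBelow, (1 - 1/(p:ℝ))⁻¹ ≤ C * log y := by
  refine ⟨exp 16 * 3, by positivity, ?_⟩
  intro y hy
  have hly : log 2 ≤ log y := log_le_log (by norm_num) (mod_cast hy)
  have hl2 := log_two_gt_d9
  have hL : 0 < log y := by linarith
  set κ := 1 / log y with hκ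
  have hκ0 : 0 < κ := by positivity
  obtain ⟨hs, hz⟩ := zeta_le κ hκ0
  let f : ℕ →* ℝ := ⟨⟨fun n => (n:ℝ) ^ (-(1+κ)), by simp⟩, by
    intro a b; simp only [Nat.cast_mul]; rw [Real.mul_rpow (by positivity) (by positivity)]⟩
  have hf : ∀ n, f n = (n:ℝ) ^ (-(1+κ)) := fun _ => rfl
  have h1 := EulerProduct.prod_primesBelow_geometric_eq_tsum_smoothNumbers (f := f) hs y
  have h2 : ∑' m : y.smoothNumbers, f m ≤ 1 + 1/κ := by
    refine le_trans ?_ hz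
    exact hs.tsum_subtype_le (fun n : ℕ => (n:ℝ) ^ (-(1+κ))) _ (fun n => by positivity)
  have h3 : 1 + 1/κ ≤ 3 * log y := by rw [hκ, one_div_one_div]; linarith
  have hstep : ∀ p ∈ y.primesBelow, (1 - 1/(p:ℝ))⁻¹ ≤ (1 - f p)⁻¹ * exp (2 * κ * (log p / p)) := by
    intro p hp
    have hp' := prime_of_mem_primesBelow hp
    have hp2 : (2:ℝ) ≤ p := mod_cast hp'.two_le
    have hp0 : (0:ℝ) < p := by linarith
    have hlp : 0 < log p := log_pos (by linarith)
    have hfp : f p = (1/p) * exp (-(κ * log p)) := by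
      rw [hf, show -(1+κ) = -1 + -κ by ring, rpow_add hp0, rpow_neg_one, rpow_def_of_pos hp0]
      rw [one_div]; congr 2; ring
    have he1 : exp (-(κ * log p)) ≤ 1 := exp_le_one_iff.2 (by have := mul_pos hκ0 hlp; linarith)
    have he2 : 1 - κ * log p ≤ exp (-(κ * log p)) := by
      have := add_one_le_exp (-(κ * log p)); linarith
    have hip : 1/(p:ℝ) ≤ 1/2 := by rw [div_le_div_iff₀ hp0 (by norm_num)]; linarith
    have hip0 : 0 < 1/(p:ℝ) := by positivity
    have hf1 : f p ≤ 1/p := by rw [hfp]; exact mul_le_of_le_one_right hip0.le he1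
    have hf2 : 1/p - κ * (log p / p) ≤ f p := by
      rw [hfp]
      have := mul_le_mul_of_nonneg_left he2 hip0.le
      grind
    have ha : 0 < 1 - 1/(p:ℝ) := by linarith
    have hb : 0 < 1 - f p := by linarith
    have hexp := add_one_le_exp (2 * κ * (log p / p))
    rw [inv_mul_eq_div, inv_eq_one_div, div_le_div_iff₀ ha hb]
    calc 1 * (1 - f p) ≤ (2 * κ * (log p / p) + 1) * (1 - 1/p) := by nlinarith
      _ ≤ _ := by gcongr
  calc ∏ p ∈ y.primesBelow, (1 - 1/(p:ℝ))⁻¹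
      ≤ ∏ p ∈ y.primesBelow, ((1 - f p)⁻¹ * exp (2 * κ * (log p / p))) := by
        apply prod_le_prod _ hstep
        intro p hp
        exact (inv_pos.2 (one_sub_inv_mem (prime_of_mem_primesBelow hp)).1).le
    _ = (∏ p ∈ y.primesBelow, (1 - f p)⁻¹) * exp (2 * κ * ∑ p ∈ y.primesBelow, log p / p) := by
        rw [prod_mul_distrib, ← exp_sum, mul_sum]
    _ ≤ (3 * log y) * exp 16 := by
        rw [h1]
        gcongr
        · exact h2.trans h3
        · have := sum_logp y hy
          calc 2 * κ * ∑ p ∈ y.primesBelow, log p / p ≤ 2 * κ * (8 * log y) := by gcongr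
            _ = 16 := by rw [hκ]; field_simp; norm_num
    _ = _ := by ring
open ArithmeticFunction (vonMangoldt moebius)

lemma conv_tsum (u v c : ℕ → ℝ) (hu : Summable (fun n => |u n|)) (hv : Summable (fun n => |v n|))
    (u0 : u 0 = 0) (v0 : v 0 = 0) (hc : ∀ n, |c n| ≤ 1) :
    HasSum (fun n => c n * ∑ p ∈ n.divisorsAntidiagonal, u p.1 * v p.2)
      (∑' p : ℕ × ℕ, c (p.1*p.2) * (u p.1 * v p.2)) := by
  have H0 : Summable (fun p : ℕ × ℕ => ‖u p.1 * v p.2‖) := by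
    have := Summable.mul_of_nonneg hu hv (fun n => abs_nonneg _) (fun n => abs_nonneg _)
    simpa [abs_mul] using this
  have H : Summable (fun p : ℕ × ℕ => c (p.1*p.2) * (u p.1 * v p.2)) := by
    refine Summable.of_norm_bounded H0 ?_
    intro p
    rw [norm_mul]
    exact mul_le_of_le_one_left (norm_nonneg _) (hc _)
  have h1 := H.hasSum.tsum_fiberwise (fun p => p.1 * p.2)
  refine Eq.mp (congrArg (fun f => HasSum f _) ?_) h1
  funext n
  symm
  by_cases hn : n = 0
  · subst hn
    simp only [Nat.divisorsAntidiagonal_zero, sum_empty, mul_zero]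
    symm
    refine (tsum_congr (g := fun _ => (0:ℝ)) ?_).trans tsum_zero
    rintro ⟨⟨a, b⟩, hab⟩
    have : a * b = 0 := hab
    rcases Nat.mul_eq_zero.1 this with h | h <;> simp [h, u0, v0]
  · have hset : (fun p : ℕ × ℕ => p.1 * p.2) ⁻¹' {n} = ↑(n.divisorsAntidiagonal) := by
      ext p; simp [hn]
    rw [hset, Finset.tsum_subtype' n.divisorsAntidiagonal (fun p : ℕ × ℕ => c (p.1*p.2) * (u p.1 * v p.2)), mul_sum]
    apply sum_congr rfl
    intro p hp
    rw [(mem_divisorsAntidiagonal.1 hp).1]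

open Classical in
noncomputable def uu (z : ℕ) (κ : ℝ) (f : ℕ → ℝ) (n : ℕ) : ℝ :=
  if Rough z n then f n * (n:ℝ) ^ (-(1+κ)) else 0

lemma Rough_mul {z m n : ℕ} : Rough z (m * n) ↔ Rough z m ∧ Rough z n := by
  constructor
  · intro h
    exact ⟨fun p hp hd => h p hp (hd.mul_right _), fun p hp hd => h p hp (hd.mul_left _)⟩
  · rintro ⟨h1, h2⟩ p hp hd
    rcases hp.dvd_mul.1 hd with h | h
    · exact h1 p hp h
    · exact h2 p hp h

lemma uu_zero (z : ℕ) (κ : ℝ) (hκ : 0 < κ) (f : ℕ → ℝ) : uu z κ f 0 = 0 := by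
  unfold uu
  rw [cast_zero, zero_rpow (by linarith)]; simp

lemma uu_mul (z : ℕ) (κ : ℝ) (f g : ArithmeticFunction ℝ) (n : ℕ) :
    uu z κ (f * g : ArithmeticFunction ℝ) n = ∑ p ∈ n.divisorsAntidiagonal, uu z κ f p.1 * uu z κ g p.2 := by
  unfold uu
  rw [ArithmeticFunction.mul_apply]
  split_ifs with h
  · rw [sum_mul]
    apply sum_congr rfl
    intro p hp
    have hpn := (mem_divisorsAntidiagonal.1 hp).1
    rw [← hpn, Rough_mul] at h
    rw [if_pos h.1, if_pos h.2, ← hpn]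
    push_cast
    rw [Real.mul_rpow (by positivity) (by positivity)]; ring
  · symm
    apply sum_eq_zero
    intro p hp
    have hpn := (mem_divisorsAntidiagonal.1 hp).1
    rw [← hpn, Rough_mul, not_and_or] at h
    rcases h with h | h <;> simp [h]

lemma uu_mul_summable (z : ℕ) (κ : ℝ) (hκ : 0 < κ) (f g : ArithmeticFunction ℝ)
    (hf : Summable (fun n => |uu z κ f n|)) (hg : Summable (fun n => |uu z κ g n|)) :
    Summable (fun n => |uu z κ (f * g : ArithmeticFunction ℝ) n|) := by
  have h := (conv_tsum (fun n => |uu z κ f n|) (fun n => |uu z κ g n|) (fun _ => 1) (by simpa using hf) (by simpa using hg)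
    (by simp [uu_zero z κ hκ]) (by simp [uu_zero z κ hκ]) (by simp)).summable
  refine Summable.of_nonneg_of_le (fun _ => abs_nonneg _) ?_ h
  intro n
  rw [uu_mul, one_mul]
  refine (abs_sum_le_sum_abs _ _).trans (le_of_eq ?_)
  simp [abs_mul]

/-- the residue class sums -/
noncomputable def GG (z : ℕ) (κ : ℝ) (q : ℕ) (f : ℕ → ℝ) (a : ZMod q) : ℝ :=
  ∑' n : ℕ, if (n : ZMod q) = a then uu z κ f n else 0

lemma summable_ite {u : ℕ → ℝ} (hu : Summable (fun n => |u n|)) (P : ℕ → Prop) [DecidablePred P] :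
    Summable (fun n => |if P n then u n else 0|) := by
  refine Summable.of_nonneg_of_le (fun _ => abs_nonneg _) ?_ hu
  intro n; split_ifs <;> simp

lemma rough_coprime {z q n : ℕ} (hqz : q < z) (hq : 1 ≤ q) (hr : Rough z n) : n.Coprime q := by
  rw [Nat.coprime_iff_gcd_eq_one]
  by_contra hne
  obtain ⟨p, hp, hd⟩ := Nat.exists_prime_and_dvd hne
  have h1 := hr p hp (hd.trans (Nat.gcd_dvd_left _ _))
  have h2 := le_of_dvd hq (hd.trans (Nat.gcd_dvd_right _ _))
  omega

lemma GG_conv (z : ℕ) (κ : ℝ) (hκ : 0 < κ) (q : ℕ) [NeZero q] (hqz : q < z) (f g : ArithmeticFunction ℝ)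
    (hf : Summable (fun n => |uu z κ f n|)) (hg : Summable (fun n => |uu z κ g n|)) (a : (ZMod q)ˣ) :
    GG z κ q (f * g : ArithmeticFunction ℝ) a = ∑ b : (ZMod q)ˣ, GG z κ q f b * GG z κ q g ((b⁻¹ * a : (ZMod q)ˣ)) := by
  classical
  have h := (conv_tsum (uu z κ f) (uu z κ g) (fun n => if (n : ZMod q) = a then 1 else 0) hf hg
    (uu_zero z κ hκ _) (uu_zero z κ hκ _) (by intro n; split_ifs <;> simp)).tsum_eq
  have h1 : GG z κ q (f * g : ArithmeticFunction ℝ) a =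
      ∑' p : ℕ × ℕ, (if ((p.1 * p.2 : ℕ) : ZMod q) = a then (1:ℝ) else 0) * (uu z κ f p.1 * uu z κ g p.2) := by
    rw [← h]
    unfold GG
    apply tsum_congr
    intro n
    rw [uu_mul]; split_ifs <;> simp
  rw [h1]
  have h2 : ∀ b : (ZMod q)ˣ, GG z κ q f b * GG z κ q g ((b⁻¹ * a : (ZMod q)ˣ)) =
      ∑' p : ℕ × ℕ, (if (p.1 : ZMod q) = b then uu z κ f p.1 else 0) * (if (p.2 : ZMod q) = ((b⁻¹ * a : (ZMod q)ˣ) : ZMod q) then uu z κ g p.2 else 0) := by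
    intro b
    unfold GG
    exact tsum_mul_tsum_of_summable_norm (summable_ite hf _) (summable_ite hg _)
  simp_rw [h2]
  rw [← Summable.tsum_finsetSum]
  · apply tsum_congr
    rintro ⟨d, m⟩
    simp only
    by_cases hd : Rough z d
    · have hdu : IsUnit (d : ZMod q) := by
        rw [ZMod.isUnit_iff_coprime]
        exact rough_coprime hqz (one_le_iff_ne_zero.2 (NeZero.ne q)) hd
      obtain ⟨b0, hb0⟩ := hdu
      rw [sum_eq_single b0]
      · rw [if_pos hb0.symm]
        push_cast
        rw [← hb0]
        have : (b0 : ZMod q) * m = a ↔ (m : ZMod q) = (b0⁻¹ : (ZMod q)ˣ) * a := by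
          rw [Units.eq_inv_mul_iff_mul_eq]
        simp only [this]
        split_ifs <;> simp
      · intro b _ hb
        rw [if_neg, zero_mul]
        rw [← hb0]
        intro hh
        exact hb (Units.ext hh).symm
      · simp
    · have : uu z κ f d = 0 := by unfold uu; rw [if_neg hd]
      simp [this]
  · intro b _
    have := (Summable.mul_of_nonneg (summable_ite hf (fun n : ℕ => (n : ZMod q) = b)) (summable_ite hg (fun n : ℕ => (n : ZMod q) = ((b⁻¹ * a : (ZMod q)ˣ) : ZMod q)))
       (fun n => abs_nonneg _) (fun n => abs_nonneg _))
    refine Summable.of_abs ?_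
    simpa only [abs_mul] using this

/-! derivation -/
noncomputable def Dl (f : ArithmeticFunction ℝ) : ArithmeticFunction ℝ := f.pmul ArithmeticFunction.log

lemma Dl_apply (f : ArithmeticFunction ℝ) (n : ℕ) : Dl f n = f n * log n := by
  simp [Dl, ArithmeticFunction.log_apply]

lemma Dl_mul (f g : ArithmeticFunction ℝ) : Dl (f * g) = Dl f * g + f * Dl g := by
  ext n
  rw [Dl_apply, ArithmeticFunction.add_apply, ArithmeticFunction.mul_apply, ArithmeticFunction.mul_apply,
    ArithmeticFunction.mul_apply, sum_mul, ← sum_add_distrib]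
  apply sum_congr rfl
  intro p hp
  obtain ⟨h1, h2⟩ := mem_divisorsAntidiagonal.1 hp
  rw [Dl_apply, Dl_apply, ← h1]
  rw [← h1] at h2
  have ha : p.1 ≠ 0 := left_ne_zero_of_mul h2
  have hb : p.2 ≠ 0 := right_ne_zero_of_mul h2
  push_cast
  rw [log_mul (mod_cast ha) (mod_cast hb)]; ring

noncomputable def zR : ArithmeticFunction ℝ := (ArithmeticFunction.zeta : ArithmeticFunction ℝ)
noncomputable def mR : ArithmeticFunction ℝ := ((moebius : ArithmeticFunction ℤ) : ArithmeticFunction ℝ)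
noncomputable def vM : ArithmeticFunction ℝ := vonMangoldt

lemma Dl_add (f g : ArithmeticFunction ℝ) : Dl (f + g) = Dl f + Dl g := by
  ext n; simp only [Dl_apply, ArithmeticFunction.add_apply]; ring

lemma key_identity : Dl (Dl vM) = 2 * (vM * vM * vM) + 3 * (Dl mR * Dl (Dl zR)) + mR * Dl (Dl (Dl zR)) := by
  have hz : Dl zR = vM * zR := by
    have : Dl zR = ArithmeticFunction.log := by
      ext n
      rw [Dl_apply, ArithmeticFunction.log_apply, zR, ArithmeticFunction.natCoe_apply, ArithmeticFunction.zeta_apply]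
      split_ifs with h <;> simp [h]
    rw [this, vM, zR, ArithmeticFunction.vonMangoldt_mul_zeta]
  have hm : mR * zR = 1 := ArithmeticFunction.coe_moebius_mul_coe_zeta
  have hD1 : Dl (1 : ArithmeticFunction ℝ) = 0 := by
    ext n
    rw [Dl_apply]
    by_cases h : n = 1
    · simp [h]
    · simp [ArithmeticFunction.one_apply_ne h]
  have hm2 : Dl mR * zR + mR * Dl zR = 0 := by rw [← Dl_mul, hm, hD1]
  have hDm : Dl mR = - (mR * vM) := by
    grind
  have h2 : Dl (Dl zR) = (Dl vM + vM * vM) * zR := by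
    rw [hz, Dl_mul, hz]; ring
  have h3 : Dl (Dl (Dl zR)) = (Dl (Dl vM) + 3 * (vM * Dl vM) + vM * vM * vM) * zR := by
    rw [h2, Dl_mul, Dl_add, Dl_mul, hz]; ring
  grind

lemma exp_neg_le {t : ℝ} (h0 : 0 ≤ t) (h1 : t ≤ 1) : exp (-t) ≤ 1 - t/2 := by
  rw [exp_neg]
  have h := add_one_le_exp t
  have hp : 0 < t + 1 := by linarith
  have : (exp t)⁻¹ ≤ (t+1)⁻¹ := inv_anti₀ hp h
  refine this.trans ?_
  rw [inv_eq_one_div, div_le_iff₀ hp]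
  nlinarith

lemma geo_sum (j : ℕ) {t : ℝ} (h0 : 0 < t) (h1 : t ≤ 1) (K : ℕ) :
    ∑ k ∈ range K, ((k:ℝ)+1)^j * exp (-t)^k ≤ j.factorial * (2/t)^(j+1) := by
  have hx0 := (exp_pos (-t))
  have hx1 : exp (-t) < 1 := by rw [Real.exp_lt_one_iff]; linarith
  have hn : ‖exp (-t)‖ < 1 := by rwa [norm_eq_abs, abs_of_pos hx0]
  have hs := summable_choose_mul_geometric_of_norm_lt_one j hn
  have ht := tsum_choose_mul_geometric_of_norm_lt_one j hn
  calc ∑ k ∈ range K, ((k:ℝ)+1)^j * exp (-t)^k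
      ≤ ∑ k ∈ range K, j.factorial * (((k+j).choose j : ℕ) * exp (-t)^k) := by
        apply sum_le_sum
        intro k _
        rw [← mul_assoc]
        apply mul_le_mul_of_nonneg_right _ (by positivity)
        have : (k+1)^j ≤ j.factorial * (k+j).choose j := by
          have := Nat.pow_succ_le_ascFactorial (k+1) j
          rw [Nat.ascFactorial_eq_factorial_mul_choose'] at this
          simpa using this
        exact_mod_cast this
    _ = j.factorial * ∑ k ∈ range K, (((k+j).choose j : ℕ) * exp (-t)^k) := by rw [mul_sum]
    _ ≤ j.factorial * (1 / (1 - exp (-t))^(j+1)) := by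
        apply mul_le_mul_of_nonneg_left _ (by positivity)
        rw [← ht]
        exact hs.sum_le_tsum _ (fun i _ => by positivity)
    _ ≤ _ := by
        apply mul_le_mul_of_nonneg_left _ (by positivity)
        rw [← one_div_pow]
        apply pow_le_pow_left₀
        · apply one_div_nonneg.2; linarith
        · rw [div_le_div_iff₀ (by linarith) h0]
          have := exp_neg_le h0.le h1
          linarith

lemma sum_range_two_pow (g : ℕ → ℝ) (K : ℕ) :
    ∑ n ∈ range (2^K), g n = g 0 + ∑ k ∈ range K, ∑ n ∈ Ico (2^k) (2^k+2^k), g n := by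
  induction K with
  | zero => simp
  | succ K ih =>
    rw [sum_range_succ, ← add_assoc, ← ih, show 2^(K+1) = 2^K+2^K by ring, Finset.sum_range_add_sum_Ico _ (Nat.le_add_right _ _)]

lemma summable_of_blocks (g : ℕ → ℝ) (hg : ∀ n, 0 ≤ g n) (C : ℝ)
    (hC : ∀ K, g 0 + ∑ k ∈ range K, ∑ n ∈ Ico (2^k) (2^k+2^k), g n ≤ C) : Summable g ∧ ∑' n, g n ≤ C := by
  have h : ∀ N, ∑ n ∈ range N, g n ≤ C := by
    intro N
    refine le_trans ?_ (hC N)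
    rw [← sum_range_two_pow]
    exact sum_le_sum_of_subset_of_nonneg (range_mono lt_two_pow_self.le) (fun i _ _ => hg i)
  exact ⟨summable_of_sum_range_le hg h, Real.tsum_le_of_sum_range_le hg h⟩

lemma abs_tsum_le_blocks (g : ℕ → ℝ) (hs : Summable g) (C : ℝ)
    (hC : ∀ K, |g 0| + ∑ k ∈ range K, |∑ n ∈ Ico (2^k) (2^k+2^k), g n| ≤ C) : |∑' n, g n| ≤ C := by
  have h1 := hs.hasSum.tendsto_sum_nat
  have h2 := (h1.comp (tendsto_pow_atTop_atTop_of_one_lt (r := 2) (by norm_num))).abs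
  refine le_of_tendsto h2 (Filter.Eventually.of_forall ?_)
  intro K
  refine le_trans ?_ (hC K)
  simp only [Function.comp]
  rw [sum_range_two_pow]
  exact (abs_add_le _ _).trans (add_le_add le_rfl (abs_sum_le_sum_abs _ _))

lemma abel_le (w d : ℕ → ℝ) (H : ℕ) (M : ℝ) (hw : ∀ i, i + 1 < H → w (i+1) ≤ w i) (hw0 : ∀ i < H, 0 ≤ w i)
    (hd : ∀ m ≤ H, |∑ i ∈ range m, d i| ≤ M) : |∑ i ∈ range H, w i * d i| ≤ M * w 0 ∨ H = 0 := by
  rcases Nat.eq_zero_or_pos H with h | h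
  · right; exact h
  left
  obtain ⟨H, rfl⟩ : ∃ H', H = H' + 1 := ⟨H-1, by omega⟩
  have id : ∀ H, ∑ i ∈ range (H+1), w i * d i = w H * ∑ i ∈ range (H+1), d i + ∑ i ∈ range H, (w i - w (i+1)) * ∑ k ∈ range (i+1), d k := by
    intro H
    induction H with
    | zero => simp
    | succ H ih =>
      rw [sum_range_succ, ih, sum_range_succ (fun i => d i) (H+1), sum_range_succ (fun i => (w i - w (i+1)) * ∑ k ∈ range (i+1), d k) H]; ring
  rw [id H]
  calc _ ≤ |w H * ∑ i ∈ range (H+1), d i| + ∑ i ∈ range H, |(w i - w (i+1)) * ∑ k ∈ range (i+1), d k| :=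
        (abs_add_le _ _).trans (add_le_add le_rfl (abs_sum_le_sum_abs _ _))
    _ ≤ w H * M + ∑ i ∈ range H, (w i - w (i+1)) * M := by
        apply add_le_add
        · rw [abs_mul, abs_of_nonneg (hw0 H (by omega))]
          exact mul_le_mul_of_nonneg_left (hd _ le_rfl) (hw0 H (by omega))
        · apply sum_le_sum
          intro i hi
          have hi := mem_range.1 hi
          have := hw i (by omega)
          rw [abs_mul, abs_of_nonneg (by linarith : 0 ≤ w i - w (i+1))]
          exact mul_le_mul_of_nonneg_left (hd _ (by omega)) (by linarith)
    _ = M * w 0 := by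
        rw [← sum_mul, Finset.sum_range_sub' w H]; ring

lemma block_w {κ : ℝ} (hκ : 0 < κ) {k n : ℕ} (hn : n ∈ Ico (2^k) (2^k+2^k)) :
    (n:ℝ)^(-(1+κ)) ≤ (1/2^k) * exp (-(κ * log 2))^k ∧ 0 ≤ log n ∧ log n ≤ k+1 := by
  rw [mem_Ico] at hn
  have h1 : (2:ℝ)^k ≤ n := mod_cast hn.1
  have h2 : (n:ℝ) ≤ 2^(k+1) := by
    have : n ≤ 2^(k+1) := by rw [pow_succ]; omega
    exact_mod_cast this
  have hp : (0:ℝ) < 2^k := by positivity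
  have hn1 : (1:ℝ) ≤ n := le_trans (one_le_pow₀ (by norm_num)) h1
  have hl2 := log_two_lt_d9
  have hl2' := log_two_gt_d9
  refine ⟨?_, log_nonneg hn1, ?_⟩
  · calc (n:ℝ)^(-(1+κ)) ≤ ((2:ℝ)^k)^(-(1+κ)) := Real.rpow_le_rpow_of_nonpos hp h1 (by linarith)
      _ = _ := by
        rw [neg_add, rpow_add hp, rpow_neg_one, one_div, ← exp_nat_mul]
        congr 1
        rw [rpow_def_of_pos hp, log_pow]; congr 1; ring
  · calc log n ≤ log (2^(k+1)) := log_le_log (by linarith) h2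
      _ = (k+1) * log 2 := by rw [log_pow]; push_cast; ring
      _ ≤ (k+1) * 1 := by apply mul_le_mul_of_nonneg_left (by linarith) (by positivity)
      _ = _ := by ring

/-- general block estimate -/
lemma block_bound {κ : ℝ} (hκ : 0 < κ) (k j : ℕ) (P : ℕ → Prop) [DecidablePred P] (f : ℕ → ℝ)
    (hf : ∀ n, 1 ≤ n → |f n| ≤ log n ^ j) (c : ℝ) (hc : (#{n ∈ Ico (2^k) (2^k+2^k) | P n} : ℝ) ≤ c) :
    ∑ n ∈ Ico (2^k) (2^k+2^k), |if P n then f n * (n:ℝ)^(-(1+κ)) else 0| ≤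
      c / 2^k * (((k:ℝ)+1)^j * exp (-(κ * log 2))^k) := by
  calc _ ≤ ∑ n ∈ Ico (2^k) (2^k+2^k), if P n then ((k:ℝ)+1)^j * ((1/2^k) * exp (-(κ * log 2))^k) else 0 := by
        apply sum_le_sum
        intro n hn
        obtain ⟨h1, h2, h3⟩ := block_w hκ hn
        split_ifs
        · rw [abs_mul, abs_of_nonneg (by positivity : 0 ≤ (n:ℝ)^(-(1+κ)))]
          have hn1 : 1 ≤ n := le_trans one_le_two_pow (mem_Ico.1 hn).1
          apply mul_le_mul ((hf n hn1).trans (pow_le_pow_left₀ h2 h3 j)) h1 (by positivity) (by positivity)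
        · simp
    _ = (#{n ∈ Ico (2^k) (2^k+2^k) | P n} : ℝ) * (((k:ℝ)+1)^j * ((1/2^k) * exp (-(κ * log 2))^k)) := by
        rw [← sum_filter, sum_const, nsmul_eq_mul]
    _ ≤ c * (((k:ℝ)+1)^j * ((1/2^k) * exp (-(κ * log 2))^k)) :=
        mul_le_mul_of_nonneg_right hc (by positivity)
    _ = _ := by ring

lemma kl_bounds {κ : ℝ} (hκ : 0 < κ) (hκ1 : κ ≤ 1) : 0 < κ * log 2 ∧ κ * log 2 ≤ 1 ∧ 2/(κ * log 2) ≤ 4/κ := by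
  have hl2 := log_two_lt_d9
  have hl2' := log_two_gt_d9
  refine ⟨by positivity, by nlinarith, ?_⟩
  rw [div_le_div_iff₀ (by positivity) hκ]
  nlinarith

lemma summable_log {κ : ℝ} (hκ : 0 < κ) (hκ1 : κ ≤ 1) (j : ℕ) (f : ℕ → ℝ) (hf : ∀ n, 1 ≤ n → |f n| ≤ log n ^ j) :
    Summable (fun n : ℕ => |f n * (n:ℝ)^(-(1+κ))|) := by
  obtain ⟨ht0, ht1, ht2⟩ := kl_bounds hκ hκ1
  refine (summable_of_blocks _ (fun n => abs_nonneg _) (j.factorial * (2/(κ * log 2))^(j+1)) ?_).1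
  intro K
  refine le_trans ?_ (geo_sum j ht0 ht1 K)
  rw [cast_zero, zero_rpow (by linarith), mul_zero, abs_zero, zero_add]
  apply sum_le_sum
  intro k _
  have := block_bound hκ k j (fun _ => True) f hf (2^k) (by simp)
  simpa using this

lemma uu_summable (z : ℕ) {κ : ℝ} (hκ : 0 < κ) (hκ1 : κ ≤ 1) (j : ℕ) (f : ℕ → ℝ) (hf : ∀ n, 1 ≤ n → |f n| ≤ log n ^ j) :
    Summable (fun n : ℕ => |uu z κ f n|) := by
  classical
  refine Summable.of_nonneg_of_le (fun _ => abs_nonneg _) ?_ (summable_log hκ hκ1 j f hf)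
  intro n
  unfold uu
  split_ifs
  · exact le_rfl
  · rw [abs_zero]; exact abs_nonneg _

lemma rough_block {J k n : ℕ} (hn : n ∈ Ico (2^k) (2^k+2^k)) (hk : k < 2^J) (hr : Rough (2^2^J) n) : n = 1 := by
  by_contra hne
  obtain ⟨p, hp, hd⟩ := Nat.exists_prime_and_dvd hne
  have h1 := hr p hp hd
  rw [mem_Ico] at hn
  have h2 := le_of_dvd (by have := one_le_two_pow (n := k); omega) hd
  have h3 : 2^(k+1) ≤ 2^2^J := pow_le_pow_right (by norm_num) hk
  rw [pow_succ] at h3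
  omega

lemma zmod_modeq {q : ℕ} [NeZero q] (n : ℕ) (a : ZMod q) : (n : ZMod q) = a ↔ n ≡ a.val [MOD q] := by
  conv_lhs => rw [← ZMod.natCast_zmod_val a]
  rw [ZMod.natCast_eq_natCast_iff]

theorem EstUp (j : ℕ) : ∃ (C : ℝ) (J0 : ℕ), 0 < C ∧ ∀ (J q : ℕ) [NeZero q] (κ : ℝ), J0 ≤ J → q^4 ≤ 2^2^J → 0 < κ → κ ≤ 1 →
    ∀ (f : ℕ → ℝ), (∀ n, 1 ≤ n → |f n| ≤ log n ^ j) → ∀ a : (ZMod q)ˣ,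
      |GG (2^2^J) κ q f a| ≤ (if (a:ZMod q) = 1 then 0^j else 0) + C / (q.totient * 2^J * κ^(j+1)) := by
  obtain ⟨C, J0, hC, hR⟩ := R12
  refine ⟨C * (j.factorial * 4^(j+1)), J0, by positivity, ?_⟩
  intro J q _ κ hJ hq hκ hκ1 f hf a
  classical
  obtain ⟨ht0, ht1, ht2⟩ := kl_bounds hκ hκ1
  have hq1 : 1 ≤ q := one_le_iff_ne_zero.2 (NeZero.ne q)
  have hsum := summable_ite (uu_summable (2^2^J) hκ hκ1 j f hf) (fun n : ℕ => (n:ZMod q) = a)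
  unfold GG
  refine abs_tsum_le_blocks _ (Summable.of_abs hsum) _ ?_
  intro K
  have h0 : uu (2^2^J) κ f 0 = 0 := uu_zero _ _ hκ _
  simp only [h0, ite_self, abs_zero, zero_add]
  have hterm : ∀ k : ℕ, |∑ n ∈ Ico (2^k) (2^k+2^k), if ((n:ℕ):ZMod q) = a then uu (2^2^J) κ f n else 0| ≤
      (if k = 0 then (if (a:ZMod q) = 1 then (0:ℝ)^j else 0) else 0) + C / (q.totient * 2^J) * (((k:ℝ)+1)^j * exp (-(κ * log 2))^k) := by
    intro k
    by_cases hk : 2^J ≤ k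
    · refine (abs_sum_le_sum_abs _ _).trans ?_
      have hR1 := (hR J q k (2^k) (a:ZMod q).val hJ hq1 hq hk le_rfl (ZMod.val_coe_unit_coprime a)).1
      have := block_bound hκ k j (fun n => n ≡ (a:ZMod q).val [MOD q] ∧ Rough (2^2^J) n) f hf _ (by unfold RC at hR1; convert hR1)
      have e : ∑ n ∈ Ico (2^k) (2^k+2^k), |if ((n:ℕ):ZMod q) = a then uu (2^2^J) κ f n else 0| =
          ∑ n ∈ Ico (2^k) (2^k+2^k), |if n ≡ (a:ZMod q).val [MOD q] ∧ Rough (2^2^J) n then f n * (n:ℝ)^(-(1+κ)) else 0| := by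
        apply sum_congr rfl
        intro n _
        rw [ite_and]
        simp only [zmod_modeq, uu]
      rw [e]
      refine this.trans ?_
      rw [show C * 2^k / (q.totient * 2^J) / 2^k = C / (q.totient * 2^J) by field_simp]
      rw [if_neg (by have : 0 < 2^J := by positivity
                     omega), zero_add]
    · have hz : ∀ n : ℕ, n ∈ Ico (2^k) (2^k+2^k) → n ≠ 1 → (if (n:ZMod q) = a then uu (2^2^J) κ f n else 0) = 0 := by
        intro n hn hn1
        unfold uu
        rw [if_neg (fun hr => hn1 (rough_block hn (by omega) hr))]; simp
      have hpos : 0 ≤ C / (q.totient * 2^J) * (((k:ℝ)+1)^j * exp (-(κ * log 2))^k) := by positivity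
      refine le_trans ?_ (le_add_of_nonneg_right hpos)
      by_cases hk0 : k = 0
      · subst hk0
        have : Ico (2^0) (2^0+2^0) = ({1} : Finset ℕ) := by decide
        rw [this, sum_singleton, if_pos rfl]
        rw [cast_one]
        have hu1 : |uu (2^2^J) κ f 1| ≤ 0^j := by
          unfold uu
          have := hf 1 le_rfl
          rw [cast_one, Real.log_one] at this
          split_ifs
          · simpa using this
          · simp
        by_cases ha : (1:ZMod q) = a
        · rw [if_pos ha, if_pos ha.symm]; exact hu1
        · rw [if_neg ha, if_neg (fun h => ha h.symm)]; simp
      · rw [if_neg hk0, sum_eq_zero]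
        · simp
        · intro n hn
          apply hz n hn
          rintro rfl
          rw [mem_Ico] at hn
          have : 2^1 ≤ 2^k := pow_le_pow_right (by norm_num) (by omega)
          omega
  refine (sum_le_sum (fun k _ => hterm k)).trans ?_
  rw [sum_add_distrib, ← mul_sum]
  apply add_le_add
  · rw [sum_ite_eq']
    split_ifs <;> simp_all
  · calc _ ≤ C / (q.totient * 2^J) * (j.factorial * (4/κ)^(j+1)) := by
          apply mul_le_mul_of_nonneg_left _ (by positivity)
          refine (geo_sum j ht0 ht1 K).trans ?_
          gcongr
      _ = _ := by rw [div_pow]; field_simp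

lemma w_anti {κ : ℝ} (hκ : 0 < κ) (j : ℕ) (hj1 : 1 ≤ j) (hj : j ≤ 3) (x y : ℝ) (hx : 32 ≤ x) (hxy : x ≤ y) :
    log y ^ j * y ^ (-(1+κ)) ≤ log x ^ j * x ^ (-(1+κ)) := by
  have hj0 : (0:ℝ) < j := mod_cast hj1
  have hj3 : (j:ℝ) ≤ 3 := mod_cast hj
  set a : ℝ := (1+κ)/j with ha
  have hap : 0 < a := by positivity
  have he : exp a⁻¹ ≤ 32 := by
    have h1 : a⁻¹ ≤ 3 := by
      rw [ha, inv_div, div_le_iff₀ (by linarith)]; nlinarith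
    have h2 : exp 3 ≤ 32 := by
      have := exp_one_lt_d9
      have e3 : exp 3 = exp 1 ^ 3 := by rw [← exp_nat_mul]; norm_num
      rw [e3]
      calc exp 1 ^ 3 ≤ (2.7182818286:ℝ)^3 := pow_le_pow_left₀ (exp_pos _).le this.le 3
        _ ≤ 32 := by norm_num
    exact (exp_le_exp.2 h1).trans h2
  have key : ∀ t : ℝ, 32 ≤ t → log t ^ j * t ^ (-(1+κ)) = (log t / t ^ a) ^ j := by
    intro t ht
    rw [div_pow, ← Real.rpow_natCast (t^a) j, ← Real.rpow_mul (by linarith), ha, div_mul_cancel₀ _ hj0.ne', rpow_neg (by linarith)]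
    rfl
  rw [key y (hx.trans hxy), key x hx]
  have hl : 0 ≤ log y := log_nonneg (by linarith)
  apply pow_le_pow_left₀ (by have : 0 < y := by linarith
                             positivity)
  exact Real.log_div_self_rpow_antitoneOn hap (he.trans hx) (he.trans (hx.trans hxy)) hxy

theorem EstDiff (j : ℕ) (hj1 : 1 ≤ j) (hj : j ≤ 3) : ∃ (C : ℝ) (J0 : ℕ), 0 < C ∧ ∀ (J q : ℕ) [NeZero q] (κ : ℝ), J0 ≤ J → q^4 ≤ 2^2^J → 0 < κ → κ ≤ 1 →
    ∀ a b : (ZMod q)ˣ,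
      |GG (2^2^J) κ q (fun n => log n ^ j) a - GG (2^2^J) κ q (fun n => log n ^ j) b| ≤ C * (2^J)^j / q.totient := by
  obtain ⟨C, J0, hC, hR⟩ := R12
  refine ⟨C * (j.factorial * 320^(j+1)), max J0 3, by positivity, ?_⟩
  intro J q _ κ hJ hq hκ hκ1 a b
  classical
  have hJ0 : J0 ≤ J := le_trans (le_max_left _ _) hJ
  have hJ3 : 3 ≤ J := le_trans (le_max_right _ _) hJ
  obtain ⟨ht0, ht1, ht2⟩ := kl_bounds hκ hκ1
  have hq1 : 1 ≤ q := one_le_iff_ne_zero.2 (NeZero.ne q)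
  set f : ℕ → ℝ := fun n => log n ^ j with hfdef
  have hf : ∀ n, 1 ≤ n → |f n| ≤ log n ^ j := by
    intro n hn
    rw [hfdef, abs_of_nonneg]
    positivity
  have hsum := uu_summable (2^2^J) hκ hκ1 j f hf
  have hsa := Summable.of_abs (summable_ite hsum (fun n : ℕ => (n:ZMod q) = a))
  have hsb := Summable.of_abs (summable_ite hsum (fun n : ℕ => (n:ZMod q) = b))
  unfold GG
  rw [← Summable.tsum_sub hsa hsb]
  refine abs_tsum_le_blocks _ (hsa.sub hsb) _ ?_
  intro K
  have h0 : uu (2^2^J) κ f 0 = 0 := uu_zero _ _ hκ _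
  simp only [h0, ite_self, abs_zero, zero_add, sub_self]
  set t : ℝ := 1 / (160 * 2^J) with ht
  have ht0' : 0 < t := by positivity
  have ht1' : t ≤ 1 := by
    rw [ht, div_le_one (by positivity)]
    have : (1:ℝ) ≤ 2^J := one_le_pow₀ (by norm_num)
    linarith
  have hterm : ∀ k : ℕ, |∑ n ∈ Ico (2^k) (2^k+2^k), ((if ((n:ℕ):ZMod q) = a then uu (2^2^J) κ f n else 0) - (if ((n:ℕ):ZMod q) = b then uu (2^2^J) κ f n else 0))| ≤
      C / (q.totient * 2^J) * (((k:ℝ)+1)^j * exp (-t)^k) := by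
    intro k
    by_cases hk : 2^J ≤ k
    · set w : ℕ → ℝ := fun n => f n * (n:ℝ)^(-(1+κ)) with hw
      set d : ℕ → ℝ := fun n => (if n ≡ (a:ZMod q).val [MOD q] ∧ Rough (2^2^J) n then 1 else 0) - (if n ≡ (b:ZMod q).val [MOD q] ∧ Rough (2^2^J) n then 1 else 0) with hd
      have e : ∑ n ∈ Ico (2^k) (2^k+2^k), ((if ((n:ℕ):ZMod q) = a then uu (2^2^J) κ f n else 0) - (if ((n:ℕ):ZMod q) = b then uu (2^2^J) κ f n else 0)) =
          ∑ i ∈ range (2^k), w (2^k+i) * d (2^k+i) := by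
        rw [sum_Ico_eq_sum_range, Nat.add_sub_cancel_left]
        apply sum_congr rfl
        intro i _
        simp only [zmod_modeq, uu, hw, hd, ite_and]
        split_ifs <;> ring
      rw [e]
      have hk5 : 5 ≤ k := by
        have : 2^3 ≤ 2^J := pow_le_pow_right (by norm_num) hJ3
        omega
      have h32 : 32 ≤ 2^k := by
        calc 32 = 2^5 := by norm_num
          _ ≤ 2^k := pow_le_pow_right (by norm_num) hk5
      set M : ℝ := C * 2^k / (q.totient * 2^J) * exp (-(k / (160 * 2^J) : ℝ)) with hM
      have hab := abel_le (fun i => w (2^k+i)) (fun i => d (2^k+i)) (2^k) M ?_ ?_ ?_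
      · rcases hab with hab | hab
        · refine hab.trans ?_
          simp only [add_zero, hw]
          have hmem : 2^k ∈ Ico (2^k) (2^k+2^k) := by
            simp
          obtain ⟨h1, h2, h3⟩ := block_w hκ hmem
          have hE : exp (-(κ * log 2))^k ≤ 1 := by
            apply pow_le_one₀ (exp_pos _).le
            rw [exp_le_one_iff]; linarith
          have hM' : M = C * 2^k / (q.totient * 2^J) * exp (-t)^k := by
            rw [hM, ← exp_nat_mul, ht]; congr 2; ring
          have hMp : 0 ≤ M := by positivity
          have hff : f (2^k) ≤ ((k:ℝ)+1)^j := pow_le_pow_left₀ h2 h3 j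
          calc M * (f (2^k) * (((2^k : ℕ)):ℝ)^(-(1+κ))) ≤ M * (((k:ℝ)+1)^j * (1/2^k)) := by
                apply mul_le_mul_of_nonneg_left _ hMp
                apply mul_le_mul hff _ (by positivity) (by positivity)
                refine h1.trans ?_
                exact mul_le_of_le_one_right (by positivity) hE
            _ = _ := by rw [hM']; field_simp
        · have : 0 < 2^k := by positivity
          omega
      · intro i _
        have := w_anti hκ j hj1 hj (((2^k+i : ℕ)):ℝ) (((2^k+(i+1) : ℕ)):ℝ) (mod_cast (by omega : 32 ≤ 2^k+i)) (mod_cast (by omega))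
        simpa only [hw, hfdef] using this
      · intro i _
        simp only [hw, hfdef]
        have : 0 ≤ log ((2^k+i : ℕ):ℝ) := log_natCast_nonneg _
        positivity
      · intro m hm
        have hR1 := (hR J q k m (a:ZMod q).val hJ0 hq1 hq hk hm (ZMod.val_coe_unit_coprime a)).2 (b:ZMod q).val (ZMod.val_coe_unit_coprime b)
        refine le_trans (le_of_eq ?_) hR1
        congr 1
        have hRC : ∀ c : ℕ, (RC (2^2^J) q c (2^k) m : ℝ) = ∑ i ∈ range m, if (2^k+i) ≡ c [MOD q] ∧ Rough (2^2^J) (2^k+i) then (1:ℝ) else 0 := by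
          intro c
          have : ∑ n ∈ Ico (2^k) (2^k+m), (if n ≡ c [MOD q] ∧ Rough (2^2^J) n then (1:ℝ) else 0) = RC (2^2^J) q c (2^k) m := by
            unfold RC
            simp
          rw [← this, sum_Ico_eq_sum_range, Nat.add_sub_cancel_left]
        rw [hRC, hRC, ← sum_sub_distrib]
    · rw [sum_eq_zero]
      · rw [abs_zero]; positivity
      · intro n hn
        by_cases hr : Rough (2^2^J) n
        · have := rough_block hn (by omega) hr
          have hu : uu (2^2^J) κ f n = 0 := by
            unfold uu; rw [this]; simp [hfdef, show j ≠ 0 by omega]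
          simp [hu]
        · have hu : uu (2^2^J) κ f n = 0 := by
            unfold uu; rw [if_neg hr]
          simp [hu]
  refine (sum_le_sum (fun k _ => hterm k)).trans ?_
  rw [← mul_sum]
  calc _ ≤ C / (q.totient * 2^J) * (j.factorial * (2/t)^(j+1)) := by
          apply mul_le_mul_of_nonneg_left _ (by positivity)
          exact geo_sum j ht0' ht1' K
      _ = _ := by
          have : 2/t = 320 * 2^J := by rw [ht]; field_simp; norm_num
          rw [this, mul_pow]; field_simp; try ring
open Filter Topology
open ArithmeticFunction.vonMangoldt (residueClass LFunctionResidueClassAux)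

/-- prime power weight in a residue class -/
noncomputable def pw (q : ℕ) (a : ZMod q) (κ : ℝ) (n : ℕ) : ℝ := residueClass a n * (n:ℝ)^(-(1+κ))

lemma pw_nonneg (q : ℕ) (a : ZMod q) (κ : ℝ) (n : ℕ) : 0 ≤ pw q a κ n :=
  mul_nonneg (ArithmeticFunction.vonMangoldt.residueClass_nonneg a n) (by positivity)

lemma pw_zero (q : ℕ) (a : ZMod q) (κ : ℝ) : pw q a κ 0 = 0 := by
  simp [pw]

lemma residueClass_abs (q : ℕ) (a : ZMod q) (n : ℕ) (_ : 1 ≤ n) : |residueClass a n| ≤ log n ^ 1 := by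
  rw [pow_one, abs_of_nonneg (ArithmeticFunction.vonMangoldt.residueClass_nonneg a n)]
  exact (ArithmeticFunction.vonMangoldt.residueClass_le a n).trans vonMangoldt_le_log

lemma pw_summable (q : ℕ) (a : ZMod q) {κ : ℝ} (hκ : 0 < κ) : Summable (pw q a κ) := by
  have h1 := summable_log (κ := min κ 1) (by positivity) (min_le_right _ _) 1 (residueClass a) (residueClass_abs q a)
  refine Summable.of_nonneg_of_le (pw_nonneg q a κ) ?_ h1
  intro n
  refine le_trans ?_ (le_abs_self _)
  rcases Nat.eq_zero_or_pos n with rfl | hn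
  · simp [pw]
  · apply mul_le_mul_of_nonneg_left _ (ArithmeticFunction.vonMangoldt.residueClass_nonneg a n)
    apply rpow_le_rpow_of_exponent_le (mod_cast hn)
    have := min_le_left κ 1
    linarith

theorem LResC (q : ℕ) [NeZero q] (a : ZMod q) (ha : IsUnit a) (t : ℝ) :
    Tendsto (fun κ : ℝ => (κ:ℂ) * ∑' n : ℕ, (pw q a κ n : ℂ) * Complex.exp (-(t * log n : ℝ) * Complex.I))
      (𝓝[>] 0) (𝓝 (if t = 0 then ((q.totient:ℂ)⁻¹) else 0)) := by
  have hcont := ArithmeticFunction.vonMangoldt.continuousOn_LFunctionResidueClassAux a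
  have hpath : Tendsto (fun κ : ℝ => (1 + κ + t * Complex.I : ℂ)) (𝓝[>] 0) (𝓝[{s | 1 ≤ s.re}] (1 + t * Complex.I)) := by
    rw [tendsto_nhdsWithin_iff]
    constructor
    · have : Continuous (fun κ : ℝ => (1 + κ + t * Complex.I : ℂ)) := by fun_prop
      have h := (this.tendsto 0).mono_left (nhdsWithin_le_nhds (s := Set.Ioi 0))
      simpa using h
    · filter_upwards [self_mem_nhdsWithin] with κ hκ
      have : (0:ℝ) < κ := hκ
      simp [this.le]
  have h1 : Tendsto (fun κ : ℝ => LFunctionResidueClassAux a (1 + κ + t * Complex.I : ℂ)) (𝓝[>] 0)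
      (𝓝 (LFunctionResidueClassAux a (1 + t * Complex.I))) :=
    (hcont (1 + t * Complex.I) (by simp)).tendsto.comp hpath
  have hk : Tendsto (fun κ : ℝ => (κ:ℂ)) (𝓝[>] 0) (𝓝 0) := by
    have := (Complex.continuous_ofReal.tendsto 0).mono_left (nhdsWithin_le_nhds (s := Set.Ioi 0))
    simpa using this
  have h2 := hk.mul h1
  have h3 : Tendsto (fun κ : ℝ => (κ:ℂ) * ((q.totient:ℂ)⁻¹ / (κ + t * Complex.I))) (𝓝[>] 0) (𝓝 (if t = 0 then ((q.totient:ℂ)⁻¹) else 0)) := by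
    by_cases ht : t = 0
    · rw [if_pos ht]
      refine tendsto_const_nhds.congr' ?_
      filter_upwards [self_mem_nhdsWithin] with κ hκ
      have : (κ:ℂ) ≠ 0 := mod_cast (ne_of_gt hκ)
      rw [ht, Complex.ofReal_zero, zero_mul, add_zero, mul_div_assoc', mul_div_cancel_left₀ _ this]
    · rw [if_neg ht]
      have hd : Tendsto (fun κ : ℝ => (κ + t * Complex.I : ℂ)) (𝓝[>] 0) (𝓝 (0 + t * Complex.I)) := hk.add_const _
      have hne : (0 + t * Complex.I : ℂ) ≠ 0 := by simp [ht]
      have := hk.mul ((tendsto_const_nhds (x := (q.totient:ℂ)⁻¹)).div hd hne)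
      simpa using this
  have h4 := h2.add h3
  rw [zero_mul, zero_add] at h4
  refine h4.congr' ?_
  filter_upwards [self_mem_nhdsWithin] with κ hκ
  have hκ0 : (0:ℝ) < κ := hκ
  have hs : (1 + κ + t * Complex.I : ℂ) ∈ {s : ℂ | 1 < s.re} := by simp [hκ0]
  rw [ArithmeticFunction.vonMangoldt.eqOn_LFunctionResidueClassAux ha hs, ← mul_add]
  congr 1
  have e1 : (1 + κ + t * Complex.I - 1 : ℂ) = κ + t * Complex.I := by ring
  simp only [e1, sub_add_cancel]
  unfold LSeries
  apply tsum_congr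
  intro n
  rcases Nat.eq_zero_or_pos n with rfl | hn
  · simp [pw_zero]
  · rw [LSeries.term_of_ne_zero hn.ne']
    unfold pw
    have hn0 : (n:ℂ) ≠ 0 := mod_cast hn.ne'
    push_cast
    rw [div_eq_mul_inv, mul_assoc]
    congr 1
    rw [Complex.cpow_def_of_ne_zero hn0, ← Complex.exp_neg, Complex.ofReal_cpow (by positivity)]
    push_cast
    rw [Complex.cpow_def_of_ne_zero hn0, ← Complex.exp_add]
    congr 1
    ring

theorem LRes (q : ℕ) [NeZero q] (a : ZMod q) (ha : IsUnit a) :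
    Tendsto (fun κ : ℝ => κ * ∑' n : ℕ, pw q a κ n) (𝓝[>] 0) (𝓝 ((q.totient:ℝ)⁻¹)) := by
  have h := (Complex.continuous_re.tendsto _).comp (LResC q a ha 0)
  have e : (if (0:ℝ) = 0 then ((q.totient:ℂ)⁻¹) else 0).re = (q.totient:ℝ)⁻¹ := by
    simp
  rw [e] at h
  refine h.congr ?_
  intro κ
  simp only [Function.comp]
  rw [Complex.re_ofReal_mul]
  congr 1
  have : ∀ n : ℕ, (pw q a κ n : ℂ) * Complex.exp (-(((0:ℝ) * log n : ℝ):ℂ) * Complex.I) = ((pw q a κ n : ℝ) : ℂ) := by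
    intro n; simp
  simp_rw [this]
  rw [← Complex.ofReal_tsum, Complex.ofReal_re]

/-- total von Mangoldt sum -/
lemma total_asymp : ∃ κ0 : ℝ, 0 < κ0 ∧ κ0 ≤ 1 ∧ ∀ κ, 0 < κ → κ ≤ κ0 →
    1/2 ≤ κ * ∑' n : ℕ, pw 1 1 κ n ∧ κ * ∑' n : ℕ, pw 1 1 κ n ≤ 2 := by
  have h := LRes 1 1 isUnit_one
  simp only [Nat.totient_one, cast_one, inv_one] at h
  have h1 := h.eventually (Icc_mem_nhds (show (1/2:ℝ) < 1 by norm_num) (show (1:ℝ) < 2 by norm_num))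
  rw [eventually_nhdsWithin_iff, Metric.eventually_nhds_iff] at h1
  obtain ⟨ε, hε, h2⟩ := h1
  refine ⟨min (ε/2) 1, by positivity, min_le_right _ _, ?_⟩
  intro κ hκ hκ0
  have h3 := min_le_left (ε/2) 1
  exact h2 (y := κ) (by rw [Real.dist_eq, sub_zero, abs_of_pos hκ]; linarith) hκ

lemma pw_one (κ : ℝ) (n : ℕ) : pw 1 1 κ n = vonMangoldt n * (n:ℝ)^(-(1+κ)) := by
  unfold pw residueClass
  rw [Set.indicator_of_mem]
  exact Subsingleton.elim _ _

/-- sum over n ≤ exp T of Λ n / n -/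
lemma sum_vM_le {κ0 : ℝ} (h : ∀ κ, 0 < κ → κ ≤ κ0 →
    1/2 ≤ κ * ∑' n : ℕ, pw 1 1 κ n ∧ κ * ∑' n : ℕ, pw 1 1 κ n ≤ 2) (T : ℝ) (hT : 0 < T) (hT1 : 1/T ≤ κ0) (s : Finset ℕ)
    (hs : ∀ n ∈ s, (n:ℝ) ≤ exp T) : ∑ n ∈ s, vonMangoldt n / n ≤ 6 * T := by
  have h1 := (h (1/T) (by positivity) hT1).2
  have hsum := pw_summable 1 1 (κ := 1/T) (by positivity)
  have h2 : ∑ n ∈ s, vonMangoldt n / n ≤ ∑ n ∈ s, exp 1 * pw 1 1 (1/T) n := by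
    apply sum_le_sum
    intro n hn
    rw [pw_one]
    rcases Nat.eq_zero_or_pos n with rfl | hn0
    · simp
    · have hnp : (0:ℝ) < n := mod_cast hn0
      have hl : log n ≤ T := by
        rw [log_le_iff_le_exp hnp]; exact hs n hn
      have : 1 ≤ exp 1 * (n:ℝ)^(-(1/T)) := by
        rw [rpow_def_of_pos hnp, ← exp_add, Real.one_le_exp_iff]
        have : log n * (1/T) ≤ 1 := by
          rw [mul_one_div, div_le_one hT]; exact hl
        linarith
      rw [neg_add, rpow_add hnp, rpow_neg_one, div_eq_mul_inv]
      have hv : 0 ≤ vonMangoldt n * (n:ℝ)⁻¹ := mul_nonneg vonMangoldt_nonneg (by positivity)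
      nlinarith
  rw [← mul_sum] at h2
  have h3 : ∑ n ∈ s, pw 1 1 (1/T) n ≤ ∑' n, pw 1 1 (1/T) n := hsum.sum_le_tsum _ (fun n _ => pw_nonneg _ _ _ _)
  have h4 : ∑' n, pw 1 1 (1/T) n ≤ 2 * T := by
    rw [one_div_mul_eq_div, div_le_iff₀ hT] at h1; exact h1
  have he := exp_one_lt_d9
  have hpos : 0 ≤ ∑ n ∈ s, pw 1 1 (1/T) n := sum_nonneg (fun n _ => pw_nonneg _ _ _ _)
  nlinarith

lemma nonprime_sum : ∃ C : ℝ, 0 < C ∧ Summable (fun n : ℕ => if n.Prime then 0 else vonMangoldt n / n) ∧ ∑' n : ℕ, (if n.Prime then 0 else vonMangoldt n / n) ≤ C := by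
  have h := ArithmeticFunction.vonMangoldt.summable_residueClass_non_primes_div (1 : ZMod 1)
  have e : ∀ n : ℕ, (if n.Prime then 0 else residueClass (1:ZMod 1) n) / n = if n.Prime then 0 else vonMangoldt n / n := by
    intro n
    have : residueClass (1:ZMod 1) n = vonMangoldt n := by
      unfold residueClass
      rw [Set.indicator_of_mem]
      exact Subsingleton.elim _ _
    rw [this]; split_ifs <;> simp
  simp_rw [e] at h
  refine ⟨|∑' n : ℕ, (if n.Prime then 0 else vonMangoldt n / n)| + 1, by positivity, h, ?_⟩
  grind

lemma DDvM_apply (n : ℕ) : Dl (Dl vM) n = vonMangoldt n * log n ^ 2 := by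
  rw [Dl_apply, Dl_apply, vM]; ring

lemma DDvM_abs (n : ℕ) (_ : 1 ≤ n) : |Dl (Dl vM) n| ≤ log n ^ 3 := by
  have h1 : vonMangoldt n ≤ log n := vonMangoldt_le_log
  rw [DDvM_apply, abs_of_nonneg (by positivity)]
  calc vonMangoldt n * log n ^ 2 ≤ log n * log n^2 := by gcongr
    _ = _ := by ring

lemma uu_nonneg (z : ℕ) (κ : ℝ) (f : ℕ → ℝ) (hf : ∀ n, 0 ≤ f n) (n : ℕ) : 0 ≤ uu z κ f n := by
  unfold uu; split_ifs
  · exact mul_nonneg (hf n) (by positivity)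
  · exact le_rfl

theorem LB : ∃ c : ℝ, 0 < c ∧ ∀ δ : ℝ, 0 < δ → δ ≤ 1/48 → ∃ J0 : ℕ, ∀ J : ℕ, J0 ≤ J →
    c / (δ / 2^J)^3 ≤ ∑' n, uu (2^2^J) (δ / 2^J) (Dl (Dl vM)) n := by
  obtain ⟨κ0, hκ0, hκ01, hA⟩ := total_asymp
  obtain ⟨C, hC, hsC, htC⟩ := nonprime_sum
  refine ⟨(1/48)^2/4, by norm_num, ?_⟩
  intro δ hδ hδ1
  obtain ⟨J0, hJ0⟩ := pow_unbounded_of_one_lt (48 / κ0 + 8 * C) (show (1:ℝ) < 2 by norm_num)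
  refine ⟨J0, ?_⟩
  intro J hJ
  have hJ2 : 48 / κ0 + 8 * C < 2^J := hJ0.trans_le (pow_le_pow_right₀ (by norm_num) hJ)
  have h2J : (0:ℝ) < 2^J := by positivity
  set κ : ℝ := δ / 2^J with hκd
  have hκ : 0 < κ := by positivity
  have h48 : 0 < 48/κ0 := by positivity
  have hκ48 : κ * 48 ≤ κ0 := by
    rw [hκd, div_mul_eq_mul_div, div_le_iff₀ h2J]
    have : 48 < 2^J * κ0 := by
      rw [← div_lt_iff₀ hκ0]; linarith
    nlinarith
  have hCk : C ≤ 1/(8*κ) := by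
    rw [le_div_iff₀ (by positivity), hκd]
    have : C * (8 * (δ/2^J)) = (8 * C) * δ / 2^J := by ring
    rw [this, div_le_one h2J]
    nlinarith
  have hκ1 : κ ≤ 1 := by linarith
  set T : ℝ := 1/(48*κ) with hT
  have hTp : 0 < T := by positivity
  have h1T : 1/T = 48*κ := by rw [hT]; simp
  obtain ⟨hA1, -⟩ := hA κ hκ (by linarith)
  have hzT : (2^2^J : ℝ) ≤ exp T := by
    have hl2 := log_two_lt_d9
    have hT' : T = 2^J/(48*δ) := by rw [hT, hκd]; field_simp
    rw [show (2^2^J : ℝ) = exp (2^J * log 2) by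
      rw [← log_z J, exp_log (by positivity)]; push_cast; rfl]
    apply exp_le_exp.2
    rw [hT', le_div_iff₀ (by positivity)]
    have : log 2 * (48*δ) ≤ 1 := by
      have : 48 * δ ≤ 1 := by linarith
      nlinarith
    calc 2^J * log 2 * (48*δ) = 2^J * (log 2 * (48*δ)) := by ring
      _ ≤ 2^J * 1 := by gcongr
      _ = _ := by ring
  set N : ℕ := ⌊exp T⌋₊ + 1 with hN
  have hsU := uu_summable (2^2^J) hκ hκ1 3 (Dl (Dl vM)) DDvM_abs
  have hU0 : ∀ n, 0 ≤ Dl (Dl vM) n := by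
    intro n; rw [DDvM_apply]
    positivity
  have hsU' : Summable (uu (2^2^J) κ (Dl (Dl vM))) := Summable.of_abs hsU
  have hsN : ∀ n, n ∉ range N → (if n ∈ range N then vonMangoldt n / n else 0) = 0 := by
    intro n hn; rw [if_neg hn]
  have hS2 : Summable (fun n => if n ∈ range N then vonMangoldt n / n else 0) := (hasSum_sum_of_ne_finset_zero hsN).summable
  have hT2 : ∑' n, (if n ∈ range N then vonMangoldt n / n else 0) ≤ 1/(8*κ) := by
    rw [tsum_eq_sum hsN, sum_congr rfl (fun n hn => if_pos hn)]
    have := sum_vM_le hA T hTp (by rw [h1T]; linarith) (range N) (by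
      intro n hn
      rw [mem_range, hN] at hn
      have : n ≤ ⌊exp T⌋₊ := by omega
      exact (Nat.le_floor_iff (exp_pos _).le).1 this)
    refine this.trans (le_of_eq ?_)
    rw [hT]; field_simp; norm_num
  have hle : ∀ n : ℕ, pw 1 1 κ n ≤ T⁻¹^2 * uu (2^2^J) κ (Dl (Dl vM)) n + (if n ∈ range N then vonMangoldt n / n else 0) + (if n.Prime then 0 else vonMangoldt n / n) := by
    intro n
    rw [pw_one]
    have hv : 0 ≤ vonMangoldt n := vonMangoldt_nonneg
    have hvn : 0 ≤ vonMangoldt n / n := by positivity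
    have hu := uu_nonneg (2^2^J) κ _ hU0 n
    have hTu : 0 ≤ T⁻¹^2 * uu (2^2^J) κ (Dl (Dl vM)) n := by positivity
    have hb : vonMangoldt n * (n:ℝ)^(-(1+κ)) ≤ vonMangoldt n / n := by
      rcases Nat.eq_zero_or_pos n with rfl | hn0
      · simp
      · rw [div_eq_mul_inv]
        apply mul_le_mul_of_nonneg_left _ hv
        rw [← rpow_neg_one]
        apply rpow_le_rpow_of_exponent_le (mod_cast hn0); linarith
    by_cases h1 : n ∈ range N
    · rw [if_pos h1]
      split_ifs <;> linarith
    · rw [if_neg h1]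
      by_cases h2 : n.Prime
      · rw [if_pos h2, add_zero, add_zero]
        rw [mem_range, not_lt, hN] at h1
        have h3 : exp T < n := by
          refine (Nat.lt_floor_add_one _).trans_le ?_
          exact_mod_cast h1
        have hnp : (0:ℝ) < n := (exp_pos _).trans h3
        have hlT : T ≤ log n := by
          rw [le_log_iff_exp_le hnp]; exact h3.le
        have hr : Rough (2^2^J) n := by
          intro p hp hd
          rw [(Nat.prime_dvd_prime_iff_eq hp h2).1 hd]
          have : (2^2^J : ℝ) ≤ n := hzT.trans h3.le
          exact_mod_cast this
        unfold uu
        rw [if_pos hr, DDvM_apply]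
        have h4 : 1 ≤ T⁻¹^2 * log n^2 := by
          rw [← mul_pow]
          apply one_le_pow₀
          rw [inv_mul_eq_div, one_le_div hTp]; exact hlT
        have h5 : 0 ≤ vonMangoldt n * (n:ℝ)^(-(1+κ)) := by positivity
        calc vonMangoldt n * (n:ℝ)^(-(1+κ)) ≤ (T⁻¹^2 * log n^2) * (vonMangoldt n * (n:ℝ)^(-(1+κ))) := le_mul_of_one_le_left h5 h4
          _ = _ := by ring
      · rw [if_neg h2]; linarith
  have hfin := Summable.tsum_le_tsum hle (pw_summable 1 1 hκ) (((hsU'.mul_left _).add hS2).add hsC)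
  rw [Summable.tsum_add ((hsU'.mul_left _).add hS2) hsC, Summable.tsum_add (hsU'.mul_left _) hS2, tsum_mul_left] at hfin
  set U := ∑' n, uu (2^2^J) κ (Dl (Dl vM)) n
  have h6 : 1/(2*κ) ≤ ∑' n : ℕ, pw 1 1 κ n := by
    rw [div_le_iff₀ (by positivity)]; linarith
  have h7 : 1/(2*κ) - 1/(8*κ) - 1/(8*κ) ≤ T⁻¹^2 * U := by linarith
  have h8 : 1/(2*κ) - 1/(8*κ) - 1/(8*κ) = 1/(4*κ) := by field_simp; norm_num
  have h9 : T⁻¹ = 48*κ := by rw [← one_div]; exact h1T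
  rw [h8, h9] at h7
  rw [div_le_iff₀ (by positivity)]
  rw [div_le_iff₀ (by positivity)] at h7
  nlinarith

lemma q_lt_z {q J : ℕ} (hq : 1 ≤ q) (h : q^4 ≤ 2^2^J) : q < 2^2^J := by
  have hz := two_le_z J
  rcases Nat.lt_or_ge 1 q with h1 | h1
  · refine lt_of_lt_of_le ?_ h
    calc q = q^1 := (pow_one q).symm
      _ < q^4 := Nat.pow_lt_pow_right h1 (by norm_num)
  · omega

lemma GG_add (z : ℕ) (κ : ℝ) (q : ℕ) (f g : ArithmeticFunction ℝ)
    (hf : Summable (fun n => |uu z κ f n|)) (hg : Summable (fun n => |uu z κ g n|)) (a : ZMod q) :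
    GG z κ q (f + g : ArithmeticFunction ℝ) a = GG z κ q f a + GG z κ q g a ∧ Summable (fun n => |uu z κ (f+g : ArithmeticFunction ℝ) n|) := by
  classical
  have e : ∀ n, uu z κ (f+g : ArithmeticFunction ℝ) n = uu z κ f n + uu z κ g n := by
    intro n; unfold uu
    split_ifs
    · rw [ArithmeticFunction.add_apply]; ring
    · simp
  constructor
  · unfold GG
    rw [← Summable.tsum_add (Summable.of_abs (summable_ite hf _)) (Summable.of_abs (summable_ite hg _))]
    apply tsum_congr
    intro n
    rw [e]; split_ifs <;> simp
  · refine Summable.of_nonneg_of_le (fun _ => abs_nonneg _) ?_ (hf.add hg)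
    intro n
    rw [e]; exact abs_add_le _ _

lemma sum_units_ite {q : ℕ} [NeZero q] {z : ℕ} {κ : ℝ} (hqz : q < z) (f : ℕ → ℝ) (n : ℕ) (g : ZMod q → ℂ) :
    ∑ a : (ZMod q)ˣ, g a * ((if (n:ZMod q) = a then uu z κ f n else 0 : ℝ) : ℂ) = g n * (uu z κ f n : ℂ) := by
  classical
  by_cases hr : Rough z n
  · have hdu : IsUnit (n : ZMod q) := by
      rw [ZMod.isUnit_iff_coprime]
      exact rough_coprime hqz (one_le_iff_ne_zero.2 (NeZero.ne q)) hr
    obtain ⟨b0, hb0⟩ := hdu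
    rw [sum_eq_single b0]
    · rw [if_pos hb0.symm, hb0]
    · intro b _ hb
      rw [if_neg]
      · simp
      · rw [← hb0]; intro hh; exact hb (Units.ext hh).symm
    · simp
  · have : uu z κ f n = 0 := by unfold uu; rw [if_neg hr]
    simp [this]

/-- the character sum -/
noncomputable def Zc (z : ℕ) (κ : ℝ) {q : ℕ} (χ : DirichletCharacter ℂ q) : ℂ := ∑' n : ℕ, χ n * (uu z κ vM n : ℂ)

lemma sum_units_GG {q : ℕ} [NeZero q] {z : ℕ} {κ : ℝ} (hqz : q < z) (f : ℕ → ℝ) (hf : Summable (fun n => |uu z κ f n|)) (g : ZMod q → ℂ) :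
    ∑ a : (ZMod q)ˣ, g a * (GG z κ q f a : ℂ) = ∑' n : ℕ, g n * (uu z κ f n : ℂ) := by
  classical
  have h1 : ∀ a : (ZMod q)ˣ, g a * (GG z κ q f a : ℂ) = ∑' n : ℕ, g a * ((if (n:ZMod q) = a then uu z κ f n else 0 : ℝ) : ℂ) := by
    intro a
    unfold GG
    rw [Complex.ofReal_tsum, tsum_mul_left]
  simp_rw [h1]
  rw [← Summable.tsum_finsetSum]
  · apply tsum_congr
    intro n
    exact sum_units_ite hqz f n g
  · intro a _
    apply Summable.mul_left
    have := Summable.of_abs (summable_ite hf (fun n : ℕ => (n:ZMod q) = a))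
    exact_mod_cast this

lemma sum_GG {q : ℕ} [NeZero q] {z : ℕ} {κ : ℝ} (hqz : q < z) (f : ℕ → ℝ) (hf : Summable (fun n => |uu z κ f n|)) :
    ∑ a : (ZMod q)ˣ, GG z κ q f a = ∑' n : ℕ, uu z κ f n := by
  have h := sum_units_GG hqz f hf (fun _ => 1)
  simp only [one_mul] at h
  exact_mod_cast h

section fourier
variable {q : ℕ} [NeZero q]

noncomputable def hat (F : (ZMod q)ˣ → ℝ) (χ : DirichletCharacter ℂ q) : ℂ := ∑ a : (ZMod q)ˣ, χ a * (F a : ℂ)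

noncomputable def cv (F H : (ZMod q)ˣ → ℝ) (a : (ZMod q)ˣ) : ℝ := ∑ b : (ZMod q)ˣ, F b * H (b⁻¹ * a)

lemma hat_cv (F H : (ZMod q)ˣ → ℝ) (χ : DirichletCharacter ℂ q) : hat (cv F H) χ = hat F χ * hat H χ := by
  unfold hat cv
  push_cast
  rw [sum_mul]
  simp_rw [mul_sum]
  rw [sum_comm]
  apply sum_congr rfl
  intro b _
  rw [← Equiv.sum_comp (Equiv.mulLeft b)]
  apply sum_congr rfl
  intro a _
  simp only [Equiv.coe_mulLeft, inv_mul_cancel_left, Units.val_mul, map_mul]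
  ring

lemma orth (a b : (ZMod q)ˣ) : ∑ χ : DirichletCharacter ℂ q, χ (a⁻¹ : (ZMod q)ˣ) * χ b = if a = b then (q.totient : ℂ) else 0 := by
  have h := DirichletCharacter.sum_char_inv_mul_char_eq ℂ (a := (a:ZMod q)) a.isUnit (b:ZMod q)
  rw [ZMod.inv_coe_unit] at h
  rw [h]
  simp only [Units.ext_iff]

lemma hat_inv (F : (ZMod q)ˣ → ℝ) (a : (ZMod q)ˣ) :
    ∑ χ : DirichletCharacter ℂ q, χ (a⁻¹ : (ZMod q)ˣ) * hat F χ = q.totient * F a := by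
  unfold hat
  simp_rw [mul_sum, ← mul_assoc]
  rw [sum_comm]
  simp_rw [← sum_mul, orth]
  simp

lemma char_norm (χ : DirichletCharacter ℂ q) (a : (ZMod q)ˣ) : ‖χ a‖ = 1 := DirichletCharacter.unit_norm_eq_one χ a

lemma char_conj (χ : DirichletCharacter ℂ q) (a : (ZMod q)ˣ) : (starRingEnd ℂ) (χ a) = χ (a⁻¹ : (ZMod q)ˣ) := by
  have h1 : χ (a⁻¹ : (ZMod q)ˣ) * χ a = 1 := by
    rw [← map_mul, ← Units.val_mul]; simp
  rw [← Complex.inv_eq_conj (char_norm χ a)]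
  exact (eq_inv_of_mul_eq_one_left h1).symm

lemma parseval (F : (ZMod q)ˣ → ℝ) : ∑ χ : DirichletCharacter ℂ q, ‖hat F χ‖^2 = q.totient * ∑ a, F a^2 := by
  have h : ((∑ χ : DirichletCharacter ℂ q, ‖hat F χ‖^2 : ℝ) : ℂ) = ((q.totient * ∑ a, F a^2 : ℝ) : ℂ) := by
    push_cast
    have : ∀ χ : DirichletCharacter ℂ q, (‖hat F χ‖:ℂ)^2 = ∑ a : (ZMod q)ˣ, F a * (χ (a⁻¹ : (ZMod q)ˣ) * hat F χ) := by
      intro χ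
      rw [← Complex.conj_mul']
      nth_rw 1 [hat]
      rw [map_sum, sum_mul]
      apply sum_congr rfl
      intro a _
      rw [map_mul, char_conj, Complex.conj_ofReal]; ring
    simp_rw [this]
    rw [sum_comm]
    simp_rw [← mul_sum, hat_inv]
    rw [mul_sum]
    apply sum_congr rfl
    intro a _
    ring
  exact_mod_cast h

lemma cv_diff (F H : (ZMod q)ˣ → ℝ) (A B : ℝ) (hA : ∑ b, |F b| ≤ A) (hB : ∀ x y, |H x - H y| ≤ B) (a a' : (ZMod q)ˣ) :
    |cv F H a - cv F H a'| ≤ A * B := by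
  have hB0 : 0 ≤ B := (abs_nonneg _).trans (hB 1 1)
  unfold cv
  rw [← sum_sub_distrib]
  calc _ ≤ ∑ b, |F b * H (b⁻¹ * a) - F b * H (b⁻¹ * a')| := abs_sum_le_sum_abs _ _
    _ ≤ ∑ b, |F b| * B := by
      apply sum_le_sum
      intro b _
      rw [← mul_sub, abs_mul]
      exact mul_le_mul_of_nonneg_left (hB _ _) (abs_nonneg _)
    _ ≤ _ := by rw [← sum_mul]; exact mul_le_mul_of_nonneg_right hA hB0

lemma hat_one (F : (ZMod q)ˣ → ℝ) : hat F 1 = ((∑ a, F a : ℝ) : ℂ) := by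
  unfold hat
  simp

lemma triple_lower (F : (ZMod q)ˣ → ℝ) (E : ℝ) (h0 : 0 ≤ E) (hE : ∀ χ : DirichletCharacter ℂ q, χ ≠ 1 → ‖hat F χ‖ ≤ E) (a : (ZMod q)ˣ) :
    ∑ b, cv (cv F F) F b - E * (q.totient * ∑ a, F a^2) ≤ q.totient * cv (cv F F) F a := by
  classical
  have h := hat_inv (cv (cv F F) F) a
  rw [← add_sum_erase univ _ (mem_univ (1 : DirichletCharacter ℂ q)), hat_one, MulChar.one_apply_coe, one_mul] at h
  set R : ℂ := ∑ χ ∈ univ.erase (1 : DirichletCharacter ℂ q), χ (a⁻¹ : (ZMod q)ˣ) * hat (cv (cv F F) F) χ with hR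
  have hRn : ‖R‖ ≤ ∑ χ ∈ univ.erase (1 : DirichletCharacter ℂ q), E * ‖hat F χ‖^2 := by
    rw [hR]
    refine (norm_sum_le _ _).trans (sum_le_sum ?_)
    intro χ hχ
    rw [norm_mul, char_norm, one_mul, hat_cv, hat_cv, norm_mul, norm_mul]
    have := hE χ (ne_of_mem_erase hχ)
    nlinarith [mul_nonneg h0 h0]
  have hre := congrArg Complex.re h
  rw [Complex.add_re, Complex.ofReal_re] at hre
  have hre2 : ((q.totient:ℂ) * ((cv (cv F F) F a : ℝ):ℂ)).re = q.totient * cv (cv F F) F a := by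
    simp
  rw [hre2] at hre
  have hRre : -‖R‖ ≤ R.re := (abs_le.1 (Complex.abs_re_le_norm R)).1
  have hsq : 0 ≤ (q.totient:ℝ) * ∑ a, F a^2 := by positivity
  rw [← parseval] at hsq ⊢
  have : ∑ χ ∈ univ.erase (1 : DirichletCharacter ℂ q), E * ‖hat F χ‖^2 ≤ E * ∑ χ : DirichletCharacter ℂ q, ‖hat F χ‖^2 := by
      rw [← mul_sum]
      apply mul_le_mul_of_nonneg_left _ h0
      simp
  linarith

end fourier

lemma vM_abs (n : ℕ) (_ : 1 ≤ n) : |vM n| ≤ log n ^ 1 := by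
  rw [vM, pow_one, abs_of_nonneg vonMangoldt_nonneg]
  exact vonMangoldt_le_log

lemma mR_abs (n : ℕ) (_ : 1 ≤ n) : |mR n| ≤ log n ^ 0 := by
  rw [mR, pow_zero, ArithmeticFunction.intCoe_apply]
  exact_mod_cast ArithmeticFunction.abs_moebius_le_one

lemma DmR_abs (n : ℕ) (hn : 1 ≤ n) : |Dl mR n| ≤ log n ^ 1 := by
  rw [Dl_apply, abs_mul, pow_one, abs_of_nonneg (log_natCast_nonneg n)]
  have := mR_abs n hn
  rw [pow_zero] at this
  exact mul_le_of_le_one_left (log_natCast_nonneg n) this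

lemma zR_apply' (n : ℕ) (hn : n ≠ 0) : zR n = 1 := by
  rw [zR, ArithmeticFunction.natCoe_apply, ArithmeticFunction.zeta_apply, if_neg hn]; simp

lemma DDzR_fun : (Dl (Dl zR) : ℕ → ℝ) = fun n : ℕ => log n ^ 2 := by
  funext n
  rw [Dl_apply, Dl_apply]
  by_cases hn : n = 0
  · simp [hn]
  · rw [zR_apply' n hn]; ring

lemma DDDzR_fun : (Dl (Dl (Dl zR)) : ℕ → ℝ) = fun n : ℕ => log n ^ 3 := by
  funext n
  rw [Dl_apply, Dl_apply, Dl_apply]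
  by_cases hn : n = 0
  · simp [hn]
  · rw [zR_apply' n hn]; ring

lemma logpow_abs (j n : ℕ) (_ : 1 ≤ n) : |log n ^ j| ≤ log n ^ j := by
  rw [abs_of_nonneg]
  positivity

theorem ThmB : ∃ (δ η c C0 : ℝ) (J0 : ℕ), 0 < δ ∧ δ ≤ 1/48 ∧ 0 < η ∧ 0 < c ∧ 0 < C0 ∧ ∀ (J q : ℕ) [NeZero q], J0 ≤ J → q^4 ≤ 2^2^J →
    ((∀ χ : DirichletCharacter ℂ q, χ ≠ 1 → ‖Zc (2^2^J) (δ/2^J) χ‖ ≤ η/(δ/2^J)) →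
      ∀ a : (ZMod q)ˣ, c / ((δ/2^J)^3 * q.totient) ≤ GG (2^2^J) (δ/2^J) q (Dl (Dl vM)) a) ∧
    (∀ s : Finset (DirichletCharacter ℂ q), (∀ χ ∈ s, η/(δ/2^J) < ‖Zc (2^2^J) (δ/2^J) χ‖) → (#s : ℝ) ≤ C0) := by
  obtain ⟨c, hc, hLB⟩ := LB
  obtain ⟨C1, J1, hC1, hE1⟩ := EstUp 1
  obtain ⟨C2, J2, hC2, hE2⟩ := EstUp 0
  obtain ⟨C3, J3, hC3, hE3⟩ := EstDiff 2 (by norm_num) (by norm_num)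
  obtain ⟨C4, J4, hC4, hE4⟩ := EstDiff 3 (by norm_num) (by norm_num)
  set δ : ℝ := min (1/48) (c / (4 * (3*C1*C3 + (1+C2)*C4)))
  have hδ : 0 < δ := by positivity
  have hδ1 : δ ≤ 1/48 := min_le_left _ _
  have hδ2 : δ * (3*C1*C3 + (1+C2)*C4) ≤ c/4 := by
    have h1 : δ ≤ c / (4 * (3*C1*C3 + (1+C2)*C4)) := min_le_right _ _
    rw [le_div_iff₀ (by positivity)] at h1
    linarith
  obtain ⟨J5, hLB⟩ := hLB δ hδ hδ1
  set η : ℝ := c * δ^2 / (8 * C1^2) with hηd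
  have hη : 0 < η := by positivity
  refine ⟨δ, η, c/2, C1^2 / (δ*η)^2, J1 + J2 + J3 + J4 + J5, hδ, hδ1, hη, by positivity, by positivity, ?_⟩
  intro J q _ hJ hq
  have hq1 : 1 ≤ q := one_le_iff_ne_zero.2 (NeZero.ne q)
  have hphi : (0:ℝ) < q.totient := mod_cast totient_pos.2 hq1
  have h2J : (0:ℝ) < 2^J := by positivity
  have h2J1 : (1:ℝ) ≤ 2^J := one_le_pow₀ (by norm_num)
  set z : ℕ := 2^2^J
  set κ : ℝ := δ / 2^J with hκd
  have hκ : 0 < κ := by positivity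
  have hκ1 : κ ≤ 1 := by
    rw [hκd, div_le_one h2J]; linarith
  have h2Jκ : (2:ℝ)^J = δ / κ := by rw [hκd]; field_simp
  have hqz : q < z := q_lt_z hq1 hq
  have hcard : (Fintype.card (ZMod q)ˣ : ℝ) = q.totient := by rw [ZMod.card_units_eq_totient]
  set F : (ZMod q)ˣ → ℝ := fun a => GG z κ q vM a
  have sv := uu_summable z hκ hκ1 1 vM vM_abs
  have sm := uu_summable z hκ hκ1 0 mR mR_abs
  have sdm := uu_summable z hκ hκ1 1 (Dl mR) DmR_abs
  have s2 : Summable (fun n => |uu z κ (Dl (Dl zR)) n|) := by rw [DDzR_fun]; exact uu_summable z hκ hκ1 2 _ (logpow_abs 2)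
  have s3 : Summable (fun n => |uu z κ (Dl (Dl (Dl zR))) n|) := by rw [DDDzR_fun]; exact uu_summable z hκ hκ1 3 _ (logpow_abs 3)
  have sA := uu_summable z hκ hκ1 3 (Dl (Dl vM)) DDvM_abs
  have svv := uu_mul_summable z κ hκ vM vM sv sv
  have svvv := uu_mul_summable z κ hκ (vM * vM) vM svv sv
  have sI := uu_mul_summable z κ hκ (Dl mR) (Dl (Dl zR)) sdm s2
  have sI3 := uu_mul_summable z κ hκ mR (Dl (Dl (Dl zR))) sm s3
  have hhat : ∀ χ : DirichletCharacter ℂ q, hat F χ = Zc z κ χ := by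
    intro χ
    exact sum_units_GG hqz vM sv (fun a => χ a)
  have hFb : ∀ a, |F a| ≤ C1 / (q.totient * (δ * κ)) := by
    intro a
    have := hE1 J q κ (by omega) hq hκ hκ1 vM vM_abs a
    refine this.trans (le_of_eq ?_)
    rw [h2Jκ]
    simp only [pow_one, ite_self, zero_add]
    congr 1; field_simp
  have hF2 : (q.totient:ℝ) * ∑ a, F a^2 ≤ C1^2 / (δ*κ)^2 := by
    calc (q.totient:ℝ) * ∑ a, F a^2 ≤ q.totient * ∑ a : (ZMod q)ˣ, (C1 / (q.totient * (δ * κ)))^2 := by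
          apply mul_le_mul_of_nonneg_left _ hphi.le
          apply sum_le_sum
          intro a _
          rw [← sq_abs]
          exact pow_le_pow_left₀ (abs_nonneg _) (hFb a) 2
      _ = _ := by
          rw [sum_const, card_univ, nsmul_eq_mul, hcard]; field_simp
  constructor
  · intro hbad a
    set T : (ZMod q)ˣ → ℝ := cv (cv F F) F with hT
    set A : (ZMod q)ˣ → ℝ := fun a => GG z κ q (Dl (Dl vM)) a with hA
    set I2 : (ZMod q)ˣ → ℝ := cv (fun b => GG z κ q (Dl mR) b) (fun b => GG z κ q (Dl (Dl zR)) b)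
    set I3 : (ZMod q)ˣ → ℝ := cv (fun b => GG z κ q mR b) (fun b => GG z κ q (Dl (Dl (Dl zR))) b)
    have hid : ∀ b, A b = 2 * T b + 3 * I2 b + I3 b := by
      intro b
      have e1 : GG z κ q (vM * vM * vM : ArithmeticFunction ℝ) b = T b := by
        rw [GG_conv z κ hκ q hqz (vM*vM) vM svv sv b]
        simp only [hT]
        unfold cv
        apply sum_congr rfl
        intro x _
        rw [GG_conv z κ hκ q hqz vM vM sv sv x]
      have e2 : GG z κ q (Dl mR * Dl (Dl zR) : ArithmeticFunction ℝ) b = I2 b :=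
        GG_conv z κ hκ q hqz (Dl mR) (Dl (Dl zR)) sdm s2 b
      have e3 : GG z κ q (mR * Dl (Dl (Dl zR)) : ArithmeticFunction ℝ) b = I3 b :=
        GG_conv z κ hκ q hqz mR (Dl (Dl (Dl zR))) sm s3 b
      have key : Dl (Dl vM) = ((vM * vM * vM + vM * vM * vM) + ((Dl mR * Dl (Dl zR)) + (Dl mR * Dl (Dl zR)) + (Dl mR * Dl (Dl zR)))) + mR * Dl (Dl (Dl zR)) := by
        rw [key_identity]; ring
      have g1 := GG_add z κ q _ _ svvv svvv b
      have g2 := GG_add z κ q _ _ sI sI b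
      have g3 := GG_add z κ q _ _ g2.2 sI b
      have g4 := GG_add z κ q _ _ g1.2 g3.2 b
      have g5 := GG_add z κ q _ _ g4.2 sI3 b
      grind
    have hd2 : ∀ x y : (ZMod q)ˣ, |GG z κ q (Dl (Dl zR)) x - GG z κ q (Dl (Dl zR)) y| ≤ C3 * (2^J)^2 / q.totient := by
      intro x y; rw [DDzR_fun]; exact hE3 J q κ (by omega) hq hκ hκ1 x y
    have hd3 : ∀ x y : (ZMod q)ˣ, |GG z κ q (Dl (Dl (Dl zR))) x - GG z κ q (Dl (Dl (Dl zR))) y| ≤ C4 * (2^J)^3 / q.totient := by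
      intro x y; rw [DDDzR_fun]; exact hE4 J q κ (by omega) hq hκ hκ1 x y
    have hm1 : ∑ b : (ZMod q)ˣ, |GG z κ q (Dl mR) b| ≤ C1 / (δ * κ) := by
      calc _ ≤ ∑ b : (ZMod q)ˣ, C1 / (q.totient * (δ * κ)) := by
            apply sum_le_sum
            intro b _
            have := hE1 J q κ (by omega) hq hκ hκ1 (Dl mR) DmR_abs b
            refine this.trans (le_of_eq ?_)
            rw [h2Jκ]
            simp only [pow_one, ite_self, zero_add]
            congr 1; field_simp
        _ = _ := by rw [sum_const, card_univ, nsmul_eq_mul, hcard]; field_simp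
    have hm0 : ∑ b : (ZMod q)ˣ, |GG z κ q mR b| ≤ 1 + C2 / δ := by
      calc _ ≤ ∑ b : (ZMod q)ˣ, ((if b = 1 then 1 else 0) + C2 / (q.totient * δ)) := by
            apply sum_le_sum
            intro b _
            have := hE2 J q κ (by omega) hq hκ hκ1 mR mR_abs b
            refine this.trans (le_of_eq ?_)
            rw [h2Jκ]
            simp only [pow_zero, zero_add, pow_one, Units.val_eq_one]
            congr 2; field_simp
        _ = _ := by
          rw [sum_add_distrib, sum_ite_eq', if_pos (mem_univ _), sum_const, card_univ, nsmul_eq_mul, hcard]; field_simp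
    have hX : ∀ b b', |(A b - 2 * T b) - (A b' - 2 * T b')| ≤ (c/4) / (κ^3 * q.totient) := by
      intro b b'
      have i2 := cv_diff _ _ _ _ hm1 hd2 b b'
      have i3 := cv_diff _ _ _ _ hm0 hd3 b b'
      rw [hid b, hid b']
      have e : (2 * T b + 3 * I2 b + I3 b - 2 * T b) - (2 * T b' + 3 * I2 b' + I3 b' - 2 * T b') = 3 * (I2 b - I2 b') + (I3 b - I3 b') := by ring
      rw [e]
      calc _ ≤ 3 * |I2 b - I2 b'| + |I3 b - I3 b'| := by
            refine (abs_add_le _ _).trans (le_of_eq ?_)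
            simp
        _ ≤ 3 * (C1 / (δ * κ) * (C3 * (2^J)^2 / q.totient)) + (1 + C2/δ) * (C4 * (2^J)^3 / q.totient) := by linarith
        _ ≤ 3 * (C1 / (δ * κ) * (C3 * (2^J)^2 / q.totient)) + ((1 + C2)/δ^2) * (C4 * (2^J)^3 / q.totient) := by
            apply add_le_add le_rfl
            apply mul_le_mul_of_nonneg_right _ (by positivity)
            rw [le_div_iff₀ (by positivity)]
            have : (1 + C2/δ) * δ^2 = δ^2 + C2 * δ := by field_simp
            rw [this]; nlinarith
        _ = (δ * (3*C1*C3 + (1+C2)*C4)) / (κ^3 * q.totient) := by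
            rw [h2Jκ]; field_simp
        _ ≤ _ := by gcongr
    have htri := triple_lower F (η/κ) (by positivity) (by intro χ hχ; rw [hhat]; exact hbad χ hχ) a
    have hsumA : c / κ^3 ≤ ∑ b, A b := by
      rw [show ∑ b, A b = ∑' n, uu z κ (Dl (Dl vM)) n from sum_GG hqz _ sA]
      exact hLB J (by omega)
    have hsumX : ∑ b, (A b - 2 * T b) - (c/4) / κ^3 ≤ q.totient * (A a - 2 * T a) := by
      have : ∑ b, ((A b - 2 * T b) - (c/4) / (κ^3 * q.totient)) ≤ ∑ b : (ZMod q)ˣ, (A a - 2 * T a) := by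
        apply sum_le_sum
        intro b _
        have := (abs_le.1 (hX a b)).1
        linarith
      rw [sum_sub_distrib, sum_const, sum_const, card_univ, nsmul_eq_mul, nsmul_eq_mul, hcard] at this
      have e : (q.totient:ℝ) * ((c/4) / (κ^3 * q.totient)) = (c/4) / κ^3 := by field_simp
      rw [e] at this
      exact this
    rw [sum_sub_distrib, ← mul_sum] at hsumX
    have hEE : η/κ * (q.totient * ∑ a, F a^2) ≤ (c/8) / κ^3 := by
      calc η/κ * (q.totient * ∑ a, F a^2) ≤ η/κ * (C1^2 / (δ*κ)^2) := mul_le_mul_of_nonneg_left hF2 (by positivity)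
        _ = _ := by rw [hηd]; field_simp
    have hfin : (c/2) / κ^3 ≤ q.totient * A a := by
      grind
    rw [← div_div, div_le_iff₀ hphi, mul_comm]
    exact hfin
  · intro s hs
    have h1 : ∑ χ ∈ s, (η/κ)^2 ≤ ∑ χ : DirichletCharacter ℂ q, ‖hat F χ‖^2 := by
      calc ∑ χ ∈ s, (η/κ)^2 ≤ ∑ χ ∈ s, ‖hat F χ‖^2 := by
            apply sum_le_sum
            intro χ hχ
            rw [hhat]
            exact pow_le_pow_left₀ (by positivity) (hs χ hχ).le 2
        _ ≤ _ := sum_le_sum_of_subset_of_nonneg (subset_univ _) (fun _ _ _ => by positivity)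
    rw [parseval, sum_const, nsmul_eq_mul] at h1
    have h2 := h1.trans hF2
    rw [le_div_iff₀ (by positivity)] at h2 ⊢
    have key : ∀ S d e k : ℝ, k ≠ 0 → S * (d*e)^2 = S * (e/k)^2 * (d*k)^2 := by
      intro S d e k hk; field_simp
    rw [key _ δ η κ hκ.ne']
    exact h2

lemma npow_mem (n : ℕ) {κ : ℝ} (hκ : 0 < κ) : 0 ≤ (n:ℝ)^(-κ) ∧ (n:ℝ)^(-κ) ≤ 1 := by
  refine ⟨by positivity, ?_⟩
  rcases Nat.eq_zero_or_pos n with rfl | hn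
  · rw [cast_zero, zero_rpow (by linarith)]; norm_num
  · exact rpow_le_one_of_one_le_of_nonpos (mod_cast hn) (by linarith)

lemma pw_mul_summable (q : ℕ) (a : ZMod q) {κ : ℝ} (hκ : 0 < κ) (g : ℕ → ℝ) (B : ℝ) (hB : ∀ n, |g n| ≤ B) :
    Summable (fun n => pw q a κ n * g n) := by
  refine Summable.of_norm_bounded ((pw_summable q a hκ).mul_right B) ?_
  intro n
  rw [norm_eq_abs, abs_mul, abs_of_nonneg (pw_nonneg q a κ n)]
  exact mul_le_mul_of_nonneg_left (hB n) (pw_nonneg q a κ n)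

lemma poly_bdd (P : Polynomial ℝ) : ∃ B : ℝ, ∀ x : ℝ, 0 ≤ x → x ≤ 1 → |P.eval x| ≤ B := by
  have hc : ContinuousOn (fun x => P.eval x) (Set.Icc (0:ℝ) 1) := P.continuous.continuousOn
  obtain ⟨B, hB⟩ := isCompact_Icc.exists_bound_of_continuousOn hc
  exact ⟨B, fun x h0 h1 => hB x ⟨h0, h1⟩⟩

lemma pw_poly_summable (q : ℕ) (a : ZMod q) {κ : ℝ} (hκ : 0 < κ) (P : Polynomial ℝ) :
    Summable (fun n : ℕ => pw q a κ n * P.eval ((n:ℝ)^(-κ))) := by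
  obtain ⟨B, hB⟩ := poly_bdd P
  exact pw_mul_summable q a hκ _ B (fun n => hB _ (npow_mem n hκ).1 (npow_mem n hκ).2)

lemma kar_poly (q : ℕ) [NeZero q] (a : ZMod q) (ha : IsUnit a) (P : Polynomial ℝ) :
    Tendsto (fun κ : ℝ => κ * ∑' n : ℕ, pw q a κ n * P.eval ((n:ℝ)^(-κ))) (𝓝[>] 0)
      (𝓝 ((q.totient:ℝ)⁻¹ * ∫ x in (0:ℝ)..1, P.eval x)) := by
  induction P using Polynomial.induction_on' with
  | add P Q hP hQ =>
    have h := hP.add hQ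
    have e : (q.totient:ℝ)⁻¹ * ∫ x in (0:ℝ)..1, (P + Q).eval x =
        (q.totient:ℝ)⁻¹ * (∫ x in (0:ℝ)..1, P.eval x) + (q.totient:ℝ)⁻¹ * ∫ x in (0:ℝ)..1, Q.eval x := by
      simp_rw [Polynomial.eval_add]
      rw [intervalIntegral.integral_add (P.continuous.intervalIntegrable _ _) (Q.continuous.intervalIntegrable _ _)]
      ring
    rw [e]
    refine h.congr' ?_
    filter_upwards [self_mem_nhdsWithin] with κ hκ
    rw [← mul_add, ← (pw_poly_summable q a hκ P).tsum_add (pw_poly_summable q a hκ Q)]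
    congr 1
    apply tsum_congr
    intro n
    rw [Polynomial.eval_add]; ring
  | monomial m c =>
    have hm : (0:ℝ) < m + 1 := by positivity
    have hlin : Tendsto (fun κ : ℝ => (m+1) * κ) (𝓝[>] 0) (𝓝[>] 0) := by
      rw [tendsto_nhdsWithin_iff]
      constructor
      · have : Continuous (fun κ : ℝ => (m+1:ℝ) * κ) := by fun_prop
        have h := (this.tendsto 0).mono_left (nhdsWithin_le_nhds (s := Set.Ioi 0))
        simpa using h
      · filter_upwards [self_mem_nhdsWithin] with κ hκ
        exact mul_pos hm hκ
    have h := ((LRes q a ha).comp hlin).const_mul (c / (m+1))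
    have e : (q.totient:ℝ)⁻¹ * ∫ x in (0:ℝ)..1, (Polynomial.monomial m c).eval x = c / (m+1) * (q.totient:ℝ)⁻¹ := by
      simp_rw [Polynomial.eval_monomial]
      rw [intervalIntegral.integral_const_mul, integral_pow]
      simp
      ring
    rw [e]
    refine h.congr' ?_
    filter_upwards [self_mem_nhdsWithin] with κ hκ
    have hκ0 : (0:ℝ) < κ := hκ
    simp only [Function.comp]
    have e2 : ∀ n : ℕ, pw q a κ n * (Polynomial.monomial m c).eval ((n:ℝ)^(-κ)) = c * pw q a ((m+1)*κ) n := by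
      intro n
      rw [Polynomial.eval_monomial]
      rcases Nat.eq_zero_or_pos n with rfl | hn
      · simp [pw_zero]
      · have hn0 : (0:ℝ) < n := mod_cast hn
        unfold pw
        rw [← Real.rpow_mul_natCast hn0.le]
        have : (n:ℝ)^(-(1 + (m+1)*κ)) = (n:ℝ)^(-(1+κ)) * (n:ℝ)^(-κ * m) := by
          rw [← rpow_add hn0]; congr 1; ring
        rw [this]; ring
    simp_rw [e2]
    rw [tsum_mul_left]
    field_simp

lemma poly_up {c ε : ℝ} (hc : 0 < c) (hε : 0 < ε) (hcε : c + ε < 1) : ∃ P : Polynomial ℝ,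
    (∀ x, 0 ≤ x → x ≤ 1 → 0 ≤ P.eval x) ∧ (∀ x, 0 ≤ x → x ≤ c → 1 ≤ P.eval x) ∧ ∫ x in (0:ℝ)..1, P.eval x ≤ c + 3 * ε := by
  set h : ℝ → ℝ := fun x => min 1 (max 0 ((c + ε - x)/ε)) with hh
  have hcont : Continuous h := by rw [hh]; fun_prop
  obtain ⟨P, hP⟩ := exists_polynomial_near_of_continuousOn 0 1 h hcont.continuousOn ε hε
  have hh0 : ∀ x, 0 ≤ h x := fun x => le_min zero_le_one (le_max_left _ _)
  have hh1 : ∀ x, h x ≤ 1 := fun x => min_le_left _ _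
  have hh2 : ∀ x, x ≤ c → h x = 1 := by
    intro x hx
    apply min_eq_left
    apply le_max_of_le_right
    rw [le_div_iff₀ hε]; linarith
  have hh3 : ∀ x, c + ε ≤ x → h x = 0 := by
    intro x hx
    have : (c + ε - x)/ε ≤ 0 := div_nonpos_of_nonpos_of_nonneg (by linarith) hε.le
    grind
  have hev : ∀ x, (P + Polynomial.C ε).eval x = P.eval x + ε := by intro x; simp
  refine ⟨P + Polynomial.C ε, ?_, ?_, ?_⟩
  · intro x h0 h1
    rw [hev]
    have := abs_lt.1 (hP x ⟨h0, h1⟩)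
    linarith [hh0 x]
  · intro x h0 h1
    rw [hev]
    have := abs_lt.1 (hP x ⟨h0, by linarith⟩)
    linarith [hh2 x h1]
  · have hi : ∀ u v : ℝ, IntervalIntegrable (fun x => (P + Polynomial.C ε).eval x) MeasureTheory.volume u v :=
      fun u v => (P + Polynomial.C ε).continuous.intervalIntegrable _ _
    rw [← intervalIntegral.integral_add_adjacent_intervals (hi 0 (c+ε)) (hi (c+ε) 1)]
    have h1 : ∫ x in (0:ℝ)..(c+ε), (P + Polynomial.C ε).eval x ≤ ∫ x in (0:ℝ)..(c+ε), (1 + 2*ε) := by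
      apply intervalIntegral.integral_mono_on (by linarith) (hi _ _) (by simp)
      grind
    have h2 : ∫ x in (c+ε)..1, (P + Polynomial.C ε).eval x ≤ ∫ x in (c+ε)..1, (2*ε) := by
      apply intervalIntegral.integral_mono_on (by linarith) (hi _ _) (by simp)
      grind
    rw [intervalIntegral.integral_const, smul_eq_mul] at h1 h2
    linarith

lemma poly_low {c ε : ℝ} (hc : c < 1) (hε : 0 < ε) (hcε : ε < c) : ∃ P : Polynomial ℝ,
    (∀ x, 0 ≤ x → x ≤ 1 → P.eval x ≤ 1) ∧ (∀ x, c < x → x ≤ 1 → P.eval x ≤ 0) ∧ c - 3 * ε ≤ ∫ x in (0:ℝ)..1, P.eval x := by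
  obtain ⟨Q, h1, h2, h3⟩ := poly_up (c := 1 - c) (ε := ε) (by linarith) hε (by linarith)
  have hev : ∀ x, (1 - Q.comp (1 - Polynomial.X)).eval x = 1 - Q.eval (1 - x) := by
    intro x; simp
  refine ⟨1 - Q.comp (1 - Polynomial.X), ?_, ?_, ?_⟩
  · intro x h0 hx1
    rw [hev]
    linarith [h1 (1-x) (by linarith) (by linarith)]
  · intro x h0 hx1
    rw [hev]
    linarith [h2 (1-x) (by linarith) (by linarith)]
  · simp_rw [hev]
    have hi : IntervalIntegrable (fun x => Q.eval (1 - x)) MeasureTheory.volume (0:ℝ) 1 := by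
      apply Continuous.intervalIntegrable
      exact Q.continuous.comp (by fun_prop)
    rw [intervalIntegral.integral_sub (by simp) hi,
      intervalIntegral.integral_comp_sub_left (fun x => Q.eval x) 1]
    simp
    linarith

lemma kar_ind (q : ℕ) [NeZero q] (a : ZMod q) (ha : IsUnit a) {c : ℝ} (hc0 : 0 < c) (hc1 : c < 1) :
    Tendsto (fun κ : ℝ => κ * ∑' n : ℕ, if (n:ℝ)^(-κ) ≤ c then pw q a κ n else 0) (𝓝[>] 0) (𝓝 ((q.totient:ℝ)⁻¹ * c)) := by
  have hphi : (0:ℝ) < q.totient := mod_cast totient_pos.2 (Nat.pos_of_ne_zero (NeZero.ne q))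
  rw [Metric.tendsto_nhds]
  intro e he
  set ε : ℝ := min (min (c/2) ((1-c)/2)) (e * q.totient / 8)
  have hε : 0 < ε := by
    positivity
  have hε1 : ε ≤ c/2 := (min_le_left _ _).trans (min_le_left _ _)
  have hε2 : ε ≤ (1-c)/2 := (min_le_left _ _).trans (min_le_right _ _)
  have hε3 : ε ≤ e * q.totient / 8 := min_le_right _ _
  obtain ⟨P, hP0, hP1, hPi⟩ := poly_up hc0 hε (by linarith)
  obtain ⟨R, hR0, hR1, hRi⟩ := poly_low hc1 hε (by linarith)
  have tP := (Metric.tendsto_nhds.1 (kar_poly q a ha P)) (e/4) (by linarith)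
  have tR := (Metric.tendsto_nhds.1 (kar_poly q a ha R)) (e/4) (by linarith)
  have b1 : (q.totient:ℝ)⁻¹ * ε ≤ e/8 := by
    rw [inv_mul_le_iff₀ hphi]; linarith
  have b2 := mul_le_mul_of_nonneg_left hPi (inv_nonneg.2 hphi.le)
  have b3 := mul_le_mul_of_nonneg_left hRi (inv_nonneg.2 hphi.le)
  filter_upwards [tP, tR, self_mem_nhdsWithin] with κ h1 h2 hκ
  have hκ0 : (0:ℝ) < κ := hκ
  rw [Real.dist_eq, abs_lt] at *
  have hs : Summable (fun n : ℕ => if (n:ℝ)^(-κ) ≤ c then pw q a κ n else 0) := by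
    refine Summable.of_nonneg_of_le (fun n => ?_) (fun n => ?_) (pw_summable q a hκ0)
    · split_ifs; exacts [pw_nonneg _ _ _ _, le_rfl]
    · split_ifs; exacts [le_rfl, pw_nonneg _ _ _ _]
  have u1 : ∑' n : ℕ, (if (n:ℝ)^(-κ) ≤ c then pw q a κ n else 0) ≤ ∑' n : ℕ, pw q a κ n * P.eval ((n:ℝ)^(-κ)) := by
    refine hs.tsum_le_tsum (fun n => ?_) (pw_poly_summable q a hκ0 P)
    obtain ⟨m1, m2⟩ := npow_mem n hκ0
    have hp := pw_nonneg q a κ n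
    split_ifs with hh
    · exact le_mul_of_one_le_right hp (hP1 _ m1 hh)
    · exact mul_nonneg hp (hP0 _ m1 m2)
  have u2 : ∑' n : ℕ, pw q a κ n * R.eval ((n:ℝ)^(-κ)) ≤ ∑' n : ℕ, (if (n:ℝ)^(-κ) ≤ c then pw q a κ n else 0) := by
    refine (pw_poly_summable q a hκ0 R).tsum_le_tsum (fun n => ?_) hs
    obtain ⟨m1, m2⟩ := npow_mem n hκ0
    have hp := pw_nonneg q a κ n
    split_ifs with hh
    · exact mul_le_of_le_one_right hp (hR0 _ m1 m2)
    · exact mul_nonpos_of_nonneg_of_nonpos hp (hR1 _ (not_le.1 hh) m2)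
  have v1 := mul_le_mul_of_nonneg_left u1 hκ0.le
  have v2 := mul_le_mul_of_nonneg_left u2 hκ0.le
  constructor <;> nlinarith

lemma z_le_iff {δ : ℝ} (hδ : 0 < δ) (J n : ℕ) (hn : 1 ≤ n) :
    (n:ℝ)^(-(δ/2^J)) ≤ exp (-(δ * log 2)) ↔ 2^2^J ≤ n := by
  have hn0 : (0:ℝ) < n := mod_cast hn
  rw [rpow_def_of_pos hn0, exp_le_exp]
  have hz : (0:ℝ) < ((2^2^J:ℕ):ℝ) := by positivity
  have e : δ * log 2 = (δ/2^J) * log ((2^2^J:ℕ):ℝ) := by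
    rw [log_z]; field_simp
  rw [e]
  have hk : 0 < δ/2^J := by positivity
  constructor
  · intro h
    have h' : log ((2^2^J:ℕ):ℝ) ≤ log n := by
      have : (δ/2^J) * log ((2^2^J:ℕ):ℝ) ≤ (δ/2^J) * log n := by linarith
      exact le_of_mul_le_mul_left this hk
    exact_mod_cast (Real.log_le_log_iff hz hn0).1 h'
  · intro h
    have h' : log ((2^2^J:ℕ):ℝ) ≤ log n := log_le_log hz (mod_cast h)
    have := mul_le_mul_of_nonneg_left h' hk.le
    linarith

theorem C2 (W : ℕ) [NeZero W] (χ : DirichletCharacter ℂ W) (hχ : χ ≠ 1) {δ η : ℝ} (hδ : 0 < δ) (hδ1 : δ ≤ 1) (hη : 0 < η) :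
    ∃ J0 : ℕ, ∀ J : ℕ, J0 ≤ J → ‖Zc (2^2^J) (δ/2^J) χ‖ ≤ η / (δ/2^J) := by
  classical
  obtain ⟨C, hC, hsC, htC⟩ := nonprime_sum
  set c : ℝ := exp (-(δ * log 2)) with hcd
  have hl2 : 0 < log 2 := log_pos (by norm_num)
  have hc0 : 0 < c := exp_pos _
  have hc1 : c < 1 := by
    rw [hcd, Real.exp_lt_one_iff]; nlinarith [mul_pos hδ hl2]
  set TT : ℝ → ZMod W → ℝ := fun κ a => ∑' n : ℕ, if (n:ℝ)^(-κ) ≤ c then pw W a κ n else 0 with hTT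
  have hlim : Tendsto (fun κ : ℝ => ∑ a : ZMod W, χ a * ((κ * TT κ a : ℝ) : ℂ)) (𝓝[>] 0) (𝓝 0) := by
    have h0 : ∑ a : ZMod W, χ a * (((W.totient:ℝ)⁻¹ * c : ℝ) : ℂ) = 0 := by
      rw [← sum_mul, MulChar.sum_eq_zero_of_ne_one hχ, zero_mul]
    rw [← h0]
    apply tendsto_finsetSum
    intro a _
    by_cases ha : IsUnit a
    · exact ((Complex.continuous_ofReal.tendsto _).comp (kar_ind W a ha hc0 hc1)).const_mul _
    · simp [χ.map_nonunit ha]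
  have hkC : Tendsto (fun κ : ℝ => κ * C) (𝓝[>] 0) (𝓝 0) := by
    have : Continuous (fun κ : ℝ => κ * C) := by fun_prop
    have h := (this.tendsto 0).mono_left (nhdsWithin_le_nhds (s := Set.Ioi 0))
    simpa using h
  have e1 := (Metric.tendsto_nhds.1 hlim) (η/2) (by linarith)
  have e2 := (Metric.tendsto_nhds.1 hkC) (η/2) (by linarith)
  have hseq : Tendsto (fun J : ℕ => δ/2^J) atTop (𝓝[>] (0:ℝ)) := by
    rw [tendsto_nhdsWithin_iff]
    constructor
    · have := (tendsto_pow_atTop_nhds_zero_of_lt_one (r := (1/2:ℝ)) (by norm_num) (by norm_num)).const_mul δ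
      rw [mul_zero] at this
      refine this.congr (fun J => ?_)
      rw [one_div, inv_pow]; rfl
    · exact Eventually.of_forall (fun J => by simp only [Set.mem_Ioi]; positivity)
  have e3 := hseq.eventually (e1.and e2)
  obtain ⟨J0, hJ0⟩ := eventually_atTop.1 e3
  refine ⟨J0, fun J hJ => ?_⟩
  obtain ⟨f1, f2⟩ := hJ0 J hJ
  set κ : ℝ := δ/2^J with hκd
  have hκ : 0 < κ := by positivity
  have hκ1 : κ ≤ 1 := by
    rw [hκd, div_le_one (by positivity)]
    exact hδ1.trans (one_le_pow₀ (by norm_num))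
  set v : ℕ → ℝ := fun n => if (n:ℝ)^(-κ) ≤ c then vonMangoldt n * (n:ℝ)^(-(1+κ)) else 0 with hv
  -- summabilities
  have hsu : Summable (fun n => |uu (2^2^J) κ vM n|) := uu_summable (2^2^J) hκ hκ1 1 vM vM_abs
  have hws : Summable (fun n : ℕ => if (n:ℝ)^(-κ) ≤ c then vonMangoldt n * (n:ℝ)^(-(1+κ)) else 0) := by
    have : Summable (fun n => pw 1 1 κ n) := pw_summable 1 1 hκ
    simp_rw [pw_one] at this
    refine Summable.of_nonneg_of_le (fun n => ?_) (fun n => ?_) this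
    · split_ifs
      · exact mul_nonneg vonMangoldt_nonneg (by positivity)
      · exact le_rfl
    · split_ifs
      · exact le_rfl
      · exact mul_nonneg vonMangoldt_nonneg (by positivity)
  have hv0 : ∀ n, 0 ≤ v n := by
    intro n; positivity
  have hχle : ∀ x : ZMod W, ‖χ x‖ ≤ 1 := χ.norm_le_one
  have hsv : Summable (fun n : ℕ => χ n * (v n : ℂ)) := by
    refine Summable.of_norm_bounded hws (fun n => ?_)
    rw [norm_mul, Complex.norm_real, norm_eq_abs, abs_of_nonneg (hv0 n)]
    exact mul_le_of_le_one_left (hv0 n) (hχle _)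
  have hsz : Summable (fun n : ℕ => χ n * (uu (2^2^J) κ vM n : ℂ)) := by
    refine Summable.of_norm_bounded hsu (fun n => ?_)
    rw [norm_mul, Complex.norm_real, norm_eq_abs]
    exact mul_le_of_le_one_left (abs_nonneg _) (hχle _)
  -- main sum identity
  have hmain : ∑ a : ZMod W, χ a * ((TT κ a : ℝ) : ℂ) = ∑' n : ℕ, χ n * (v n : ℂ) := by
    have hsa : ∀ a : ZMod W, Summable (fun n : ℕ => χ a * (((if (n:ℝ)^(-κ) ≤ c then pw W a κ n else 0 : ℝ)) : ℂ)) := by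
      intro a
      apply Summable.mul_left
      have : Summable (fun n : ℕ => if (n:ℝ)^(-κ) ≤ c then pw W a κ n else 0) := by
        refine Summable.of_nonneg_of_le (fun n => ?_) (fun n => ?_) (pw_summable W a hκ)
        · split_ifs; exacts [pw_nonneg _ _ _ _, le_rfl]
        · split_ifs; exacts [le_rfl, pw_nonneg _ _ _ _]
      exact_mod_cast this
    have : ∀ a : ZMod W, χ a * ((TT κ a : ℝ) : ℂ) = ∑' n : ℕ, χ a * (((if (n:ℝ)^(-κ) ≤ c then pw W a κ n else 0 : ℝ)) : ℂ) := by
      intro a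
      rw [tsum_mul_left, hTT, Complex.ofReal_tsum]
    simp_rw [this]
    rw [← Summable.tsum_finsetSum (fun a _ => hsa a)]
    apply tsum_congr
    intro n
    rw [sum_eq_single (n : ZMod W)]
    · congr 2
      rw [hv]; simp only
      congr 1
      unfold pw residueClass
      rw [Set.indicator_of_mem (by simp)]
    · intro b _ hb
      have : pw W b κ n = 0 := by
        unfold pw residueClass
        rw [Set.indicator_of_notMem (by simp only [Set.mem_ofPred_eq]; exact fun h => hb h.symm), zero_mul]
      rw [this]; simp
    · simp
  have hdiff : ‖Zc (2^2^J) κ χ - ∑' n : ℕ, χ n * (v n : ℂ)‖ ≤ C := by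
    unfold Zc
    rw [← hsz.tsum_sub hsv]
    refine (tsum_of_norm_bounded hsC.hasSum (fun n => ?_)).trans htC
    have hL0 : 0 ≤ vonMangoldt n := vonMangoldt_nonneg
    rw [← mul_sub, norm_mul]
    refine (mul_le_of_le_one_left (norm_nonneg _) (hχle _)).trans ?_
    rw [← Complex.ofReal_sub, Complex.norm_real, norm_eq_abs]
    have hnn : 0 ≤ (if n.Prime then 0 else vonMangoldt n / n : ℝ) := by
      positivity
    rcases Nat.lt_or_ge n 2 with hn | hn
    · have h0 : vonMangoldt n = 0 := by
        interval_cases n <;> simp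
      have h1 : uu (2^2^J) κ vM n = 0 := by
        unfold uu vM; rw [h0]; simp
      have h2 : v n = 0 := by rw [hv]; simp [h0]
      rw [h1, h2]; simpa using hnn
    · have hzn := z_le_iff hδ J n (by omega)
      rw [← hκd, ← hcd] at hzn
      have hn0 : (1:ℝ) ≤ n := mod_cast (by omega : 1 ≤ n)
      by_cases hr : Rough (2^2^J) n
      · have hle : 2^2^J ≤ n := (hr _ (Nat.minFac_prime (by omega)) (Nat.minFac_dvd n)).trans (Nat.minFac_le (by omega))
        have : uu (2^2^J) κ vM n = v n := by
          unfold uu; rw [if_pos hr, hv]; simp only; rw [if_pos (hzn.2 hle)]; rfl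
        rw [this, sub_self, abs_zero]; exact hnn
      · have h1 : uu (2^2^J) κ vM n = 0 := by unfold uu; rw [if_neg hr]
        rw [h1, zero_sub, abs_neg, abs_of_nonneg (hv0 n), hv]
        simp only
        split_ifs with hle hp
        · exfalso
          apply hr
          intro p hp1 hp2
          rw [(Nat.prime_dvd_prime_iff_eq hp1 hp).1 hp2]
          exact hzn.1 hle
        · rw [div_eq_mul_inv]
          apply mul_le_mul_of_nonneg_left _ hL0
          rw [← rpow_neg_one]
          exact rpow_le_rpow_of_exponent_le hn0 (by linarith)
        · exact le_rfl
        · positivity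
  rw [← hmain] at hdiff
  rw [le_div_iff₀ hκ]
  have f1' : ‖∑ a : ZMod W, χ a * ((TT κ a : ℝ) : ℂ)‖ * κ < η/2 := by
    rw [dist_zero_right] at f1
    have : ∑ a : ZMod W, χ a * ((κ * TT κ a : ℝ) : ℂ) = (κ:ℂ) * ∑ a : ZMod W, χ a * ((TT κ a : ℝ) : ℂ) := by
      rw [mul_sum]; apply sum_congr rfl; intro a _; push_cast; ring
    rw [this, norm_mul, Complex.norm_real, norm_eq_abs, abs_of_pos hκ] at f1
    linarith
  rw [Real.dist_eq, sub_zero, abs_of_pos (by positivity)] at f2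
  have h3 : ‖Zc (2^2^J) κ χ‖ ≤ C + ‖∑ a : ZMod W, χ a * ((TT κ a : ℝ) : ℂ)‖ := by
    calc ‖Zc (2^2^J) κ χ‖ = ‖(Zc (2^2^J) κ χ - ∑ a : ZMod W, χ a * ((TT κ a : ℝ) : ℂ)) + ∑ a : ZMod W, χ a * ((TT κ a : ℝ) : ℂ)‖ := by
          rw [sub_add_cancel]
      _ ≤ _ := norm_add_le _ _
      _ ≤ _ := by linarith
  calc ‖Zc (2^2^J) κ χ‖ * κ ≤ (C + ‖∑ a : ZMod W, χ a * ((TT κ a : ℝ) : ℂ)‖) * κ := mul_le_mul_of_nonneg_right h3 hκ.le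
    _ ≤ η := by linarith

lemma C1_circle (q : ℕ) [NeZero q] (a : ZMod q) (ha : IsUnit a) (F : C(AddCircle (1:ℝ), ℂ)) :
    Tendsto (fun κ : ℝ => (κ:ℂ) * ∑' n : ℕ, (pw q a κ n : ℂ) * F ((log n : ℝ) : AddCircle (1:ℝ))) (𝓝[>] 0)
      (𝓝 ((q.totient:ℂ)⁻¹ * ∫ t, F t ∂AddCircle.haarAddCircle)) := by
  have hphi : (0:ℝ) < q.totient := mod_cast totient_pos.2 (Nat.pos_of_ne_zero (NeZero.ne q))
  have hint : ∀ G : C(AddCircle (1:ℝ), ℂ), MeasureTheory.Integrable G AddCircle.haarAddCircle := by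
    intro G
    exact G.continuous.integrable_of_hasCompactSupport (HasCompactSupport.of_compactSpace _)
  have hsum : ∀ (G : C(AddCircle (1:ℝ), ℂ)) {κ : ℝ}, 0 < κ →
      Summable (fun n : ℕ => (pw q a κ n : ℂ) * G ((log n : ℝ) : AddCircle (1:ℝ))) := by
    intro G κ hκ
    refine Summable.of_norm_bounded ((pw_summable q a hκ).mul_right ‖G‖) (fun n => ?_)
    rw [norm_mul, Complex.norm_real, norm_eq_abs, abs_of_nonneg (pw_nonneg q a κ n)]
    exact mul_le_mul_of_nonneg_left (G.norm_coe_le_norm _) (pw_nonneg q a κ n)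
  set Pr : C(AddCircle (1:ℝ), ℂ) → Prop := fun G =>
    Tendsto (fun κ : ℝ => (κ:ℂ) * ∑' n : ℕ, (pw q a κ n : ℂ) * G ((log n : ℝ) : AddCircle (1:ℝ))) (𝓝[>] 0)
      (𝓝 ((q.totient:ℂ)⁻¹ * ∫ t, G t ∂AddCircle.haarAddCircle)) with hPr
  have hspan : ∀ G ∈ Submodule.span ℂ (Set.range (@fourier (1:ℝ))), Pr G := by
    intro G hG
    induction hG using Submodule.span_induction with
    | mem G hG =>
      obtain ⟨j, rfl⟩ := hG
      have h := LResC q a ha (-(2 * Real.pi * j))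
      have e : (if -(2 * Real.pi * j) = 0 then ((q.totient:ℂ)⁻¹) else 0) = (q.totient:ℂ)⁻¹ * ∫ t, (@fourier (1:ℝ) j) t ∂AddCircle.haarAddCircle := by
        by_cases hj : j = 0
        · subst hj; simp
        · have h1 : -(2 * Real.pi * (j:ℝ)) ≠ 0 := by
            have := Real.pi_pos.ne'
            have : (j:ℝ) ≠ 0 := mod_cast hj
            simp [*]
          rw [if_neg h1, MeasureTheory.integral_eq_zero_of_add_right_eq_neg (fourier_add_half_inv_index hj one_pos), mul_zero]
      rw [e] at h
      refine h.congr (fun κ => ?_)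
      congr 1
      apply tsum_congr
      intro n
      congr 1
      rw [fourier_coe_apply]
      congr 1
      push_cast
      ring
    | zero => simp [hPr]
    | add G H _ _ hG hH =>
      have h := hG.add hH
      have e : (q.totient:ℂ)⁻¹ * ∫ t, (G + H) t ∂AddCircle.haarAddCircle =
        (q.totient:ℂ)⁻¹ * ∫ t, G t ∂AddCircle.haarAddCircle + (q.totient:ℂ)⁻¹ * ∫ t, H t ∂AddCircle.haarAddCircle := by
        simp_rw [ContinuousMap.add_apply]
        rw [MeasureTheory.integral_add (hint G) (hint H)]; ring
      rw [hPr]; simp only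
      rw [e]
      refine h.congr' ?_
      filter_upwards [self_mem_nhdsWithin] with κ hκ
      rw [← mul_add, ← (hsum G hκ).tsum_add (hsum H hκ)]
      congr 1
      apply tsum_congr
      intro n
      rw [ContinuousMap.add_apply]; ring
    | smul c G _ hG =>
      have h := hG.const_mul c
      have e : (q.totient:ℂ)⁻¹ * ∫ t, (c • G) t ∂AddCircle.haarAddCircle =
        c * ((q.totient:ℂ)⁻¹ * ∫ t, G t ∂AddCircle.haarAddCircle) := by
        simp_rw [ContinuousMap.smul_apply, smul_eq_mul]
        rw [MeasureTheory.integral_const_mul]; ring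
      rw [hPr]; simp only
      rw [e]
      refine h.congr (fun κ => ?_)
      rw [← mul_assoc, mul_comm c, mul_assoc, ← tsum_mul_left]
      congr 1
      apply tsum_congr
      intro n
      rw [ContinuousMap.smul_apply, smul_eq_mul]; ring
  rw [Metric.tendsto_nhds]
  intro e he
  have hF : F ∈ (Submodule.span ℂ (Set.range (@fourier (1:ℝ)))).topologicalClosure := by
    rw [span_fourier_closure_eq_top]; trivial
  have hF' : F ∈ closure ((Submodule.span ℂ (Set.range (@fourier (1:ℝ))) : Set C(AddCircle (1:ℝ), ℂ))) := hF
  obtain ⟨G, hG, hFG⟩ := Metric.mem_closure_iff.1 hF' (e * q.totient / 8) (by positivity)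
  have t1 := (Metric.tendsto_nhds.1 (hspan G hG)) (e/4) (by linarith)
  have t2 := (Metric.tendsto_nhds.1 (LRes q a ha)) ((q.totient:ℝ)⁻¹) (by positivity)
  filter_upwards [t1, t2, self_mem_nhdsWithin] with κ h1 h2 hκ
  have hκ0 : (0:ℝ) < κ := hκ
  rw [dist_eq_norm] at hFG h1 ⊢
  have hpt : ∀ x, ‖F x - G x‖ ≤ e * q.totient / 8 := fun x => ((F - G).norm_coe_le_norm x).trans hFG.le
  have d1 : ‖(κ:ℂ) * ∑' n : ℕ, (pw q a κ n : ℂ) * F ((log n : ℝ) : AddCircle (1:ℝ)) -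
      (κ:ℂ) * ∑' n : ℕ, (pw q a κ n : ℂ) * G ((log n : ℝ) : AddCircle (1:ℝ))‖ ≤ e/4 := by
    rw [← mul_sub, ← (hsum F hκ0).tsum_sub (hsum G hκ0), norm_mul, Complex.norm_real, norm_eq_abs, abs_of_pos hκ0]
    have : ‖∑' n : ℕ, ((pw q a κ n : ℂ) * F ((log n : ℝ) : AddCircle (1:ℝ)) - (pw q a κ n : ℂ) * G ((log n : ℝ) : AddCircle (1:ℝ)))‖
        ≤ (∑' n, pw q a κ n) * (e * q.totient / 8) := by
      refine tsum_of_norm_bounded ((pw_summable q a hκ0).hasSum.mul_right _) (fun n => ?_)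
      rw [← mul_sub, norm_mul, Complex.norm_real, norm_eq_abs, abs_of_nonneg (pw_nonneg q a κ n)]
      exact mul_le_mul_of_nonneg_left (hpt _) (pw_nonneg q a κ n)
    rw [Real.dist_eq, abs_lt] at h2
    have h3 : κ * ∑' n, pw q a κ n ≤ 2 * (q.totient:ℝ)⁻¹ := by linarith
    calc _ ≤ κ * ((∑' n, pw q a κ n) * (e * q.totient / 8)) := mul_le_mul_of_nonneg_left this hκ0.le
      _ = (κ * ∑' n, pw q a κ n) * (e * q.totient / 8) := by ring
      _ ≤ (2 * (q.totient:ℝ)⁻¹) * (e * q.totient / 8) := mul_le_mul_of_nonneg_right h3 (by positivity)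
      _ = e/4 := by field_simp; norm_num
  have d2 : ‖(q.totient:ℂ)⁻¹ * ∫ t, G t ∂AddCircle.haarAddCircle - (q.totient:ℂ)⁻¹ * ∫ t, F t ∂AddCircle.haarAddCircle‖ ≤ e/8 := by
    rw [← mul_sub, ← MeasureTheory.integral_sub (hint G) (hint F), norm_mul]
    have : ‖∫ t, (G t - F t) ∂(@AddCircle.haarAddCircle (1:ℝ) _)‖ ≤ (e * q.totient / 8) * (AddCircle.haarAddCircle (T := (1:ℝ))).real Set.univ := by
      apply MeasureTheory.norm_integral_le_of_norm_le_const
      exact Eventually.of_forall (fun x => by rw [norm_sub_rev]; exact hpt x)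
    rw [MeasureTheory.probReal_univ, mul_one] at this
    rw [norm_inv, Complex.norm_natCast, inv_mul_le_iff₀ hphi]
    linarith
  calc _ = ‖((κ:ℂ) * ∑' n : ℕ, (pw q a κ n : ℂ) * F ((log n : ℝ) : AddCircle (1:ℝ)) -
      (κ:ℂ) * ∑' n : ℕ, (pw q a κ n : ℂ) * G ((log n : ℝ) : AddCircle (1:ℝ))) + ((κ:ℂ) * ∑' n : ℕ, (pw q a κ n : ℂ) * G ((log n : ℝ) : AddCircle (1:ℝ)) - (q.totient:ℂ)⁻¹ * ∫ t, G t ∂AddCircle.haarAddCircle) + ((q.totient:ℂ)⁻¹ * ∫ t, G t ∂AddCircle.haarAddCircle - (q.totient:ℂ)⁻¹ * ∫ t, F t ∂AddCircle.haarAddCircle)‖ := by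
        congr 1; ring
    _ ≤ _ := norm_add₃_le
    _ < e := by linarith

theorem C1 (q : ℕ) [NeZero q] (a : ZMod q) (ha : IsUnit a) {α ε : ℝ} (hα : 0 ≤ α) (hε : 0 < ε) (hαε : α + ε ≤ 1) :
    ∃ κ0 : ℝ, 0 < κ0 ∧ ∀ κ, 0 < κ → κ ≤ κ0 →
      ε / (8 * q.totient) ≤ κ * ∑' n : ℕ, if (α ≤ Int.fract (log n) ∧ Int.fract (log n) ≤ α + ε) then pw q a κ n else 0 := by
  have hphi : (0:ℝ) < q.totient := mod_cast totient_pos.2 (Nat.pos_of_ne_zero (NeZero.ne q))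
  set f : ℝ → ℝ := fun x => max 0 (1 - |x - (α + ε/2)| * (2/ε)) with hf
  have hfc : Continuous f := by rw [hf]; fun_prop
  have hf0 : ∀ x, 0 ≤ f x := fun x => le_max_left _ _
  have hf1 : ∀ x, f x ≤ 1 := by
    intro x; apply max_le zero_le_one
    have : 0 ≤ |x - (α + ε/2)| * (2/ε) := by positivity
    linarith
  have hfz : ∀ x, ε/2 ≤ |x - (α + ε/2)| → f x = 0 := by
    intro x hx
    apply max_eq_left
    have : ε/2 * (2/ε) ≤ |x - (α + ε/2)| * (2/ε) := mul_le_mul_of_nonneg_right hx (by positivity)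
    grind
  have hf00 : f 0 = 0 := hfz 0 (by rw [zero_sub, abs_neg, abs_of_nonneg (by linarith)]; linarith)
  have hf11 : f 1 = 0 := hfz 1 (by rw [abs_of_nonneg (by linarith)]; linarith)
  set fc : ℝ → ℂ := fun x => (f x : ℂ) with hfcd
  have hFc : Continuous (AddCircle.liftIco (1:ℝ) 0 fc) := by
    apply AddCircle.liftIco_zero_continuous
    · rw [hfcd]; simp only; rw [hf00, hf11]
    · rw [hfcd]; exact (Complex.continuous_ofReal.comp hfc).continuousOn
  set F : C(AddCircle (1:ℝ), ℂ) := ⟨AddCircle.liftIco (1:ℝ) 0 fc, hFc⟩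
  have hFx : ∀ x : ℝ, F (x : AddCircle (1:ℝ)) = (f (Int.fract x) : ℂ) := by
    intro x
    have e : (x : AddCircle (1:ℝ)) = ((Int.fract x : ℝ) : AddCircle (1:ℝ)) := by
      simp
    rw [e]
    exact AddCircle.liftIco_zero_coe_apply (f := fc) ⟨Int.fract_nonneg x, Int.fract_lt_one x⟩
  have hI : ∫ t, F t ∂(AddCircle.haarAddCircle (T := (1:ℝ))) = ((∫ x in (0:ℝ)..1, f x : ℝ) : ℂ) := by
    rw [AddCircle.integral_haarAddCircle, inv_one, one_smul, ← AddCircle.intervalIntegral_preimage 1 0, zero_add, ← intervalIntegral.integral_ofReal]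
    apply intervalIntegral.integral_congr_ae
    have : ∀ᵐ x : ℝ, x ≠ 1 := by simp [MeasureTheory.ae_iff]
    filter_upwards [this] with x hx1 hx
    rw [Set.uIoc_of_le zero_le_one] at hx
    rw [hFx, Int.fract_eq_self.2 ⟨hx.1.le, lt_of_le_of_ne hx.2 hx1⟩]
  have hIl : ε/4 ≤ ∫ x in (0:ℝ)..1, f x := by
    have h1 : ∫ x in (α+ε/4)..(α+3*ε/4), f x ≤ ∫ x in (0:ℝ)..1, f x := by
      apply intervalIntegral.integral_mono_interval (by linarith) (by linarith) (by linarith)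
      · exact Eventually.of_forall hf0
      · exact hfc.intervalIntegrable _ _
    have h2 : ∫ x in (α+ε/4)..(α+3*ε/4), (1/2:ℝ) ≤ ∫ x in (α+ε/4)..(α+3*ε/4), f x := by
      apply intervalIntegral.integral_mono_on (by linarith) (by simp) (hfc.intervalIntegrable _ _)
      intro x hx
      apply le_max_of_le_right
      have : |x - (α + ε/2)| ≤ ε/4 := by rw [abs_le]; constructor <;> linarith [hx.1, hx.2]
      have : |x - (α + ε/2)| * (2/ε) ≤ ε/4 * (2/ε) := mul_le_mul_of_nonneg_right this (by positivity)
      grind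
    rw [intervalIntegral.integral_const, smul_eq_mul] at h2
    linarith
  have h := (Complex.continuous_re.tendsto _).comp (C1_circle q a ha F)
  rw [hI] at h
  have e1 : ((q.totient:ℂ)⁻¹ * ((∫ x in (0:ℝ)..1, f x : ℝ) : ℂ)).re = (q.totient:ℝ)⁻¹ * ∫ x in (0:ℝ)..1, f x := by
    simp
  rw [e1] at h
  have hlt : ε / (8 * q.totient) < (q.totient:ℝ)⁻¹ * ∫ x in (0:ℝ)..1, f x := by
    rw [div_lt_iff₀ (by positivity)]
    have : (q.totient:ℝ)⁻¹ * (∫ x in (0:ℝ)..1, f x) * (8 * q.totient) = 8 * ∫ x in (0:ℝ)..1, f x := by field_simp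
    rw [this]; linarith
  have h1 := h.eventually (lt_mem_nhds hlt)
  rw [eventually_nhdsWithin_iff, Metric.eventually_nhds_iff] at h1
  obtain ⟨e, he, h2⟩ := h1
  refine ⟨e/2, by positivity, fun κ hκ hκ0 => ?_⟩
  have h3 := h2 (y := κ) (by rw [Real.dist_eq, sub_zero, abs_of_pos hκ]; linarith) hκ
  refine h3.le.trans ?_
  simp only [Function.comp]
  rw [Complex.re_ofReal_mul]
  apply mul_le_mul_of_nonneg_left _ hκ.le
  have e3 : ∀ n : ℕ, (pw q a κ n : ℂ) * F ((log n : ℝ) : AddCircle (1:ℝ)) = ((pw q a κ n * f (Int.fract (log n)) : ℝ) : ℂ) := by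
    intro n; rw [hFx]; push_cast; rfl
  simp_rw [e3]
  rw [← Complex.ofReal_tsum, Complex.ofReal_re]
  refine Summable.tsum_le_tsum (fun n => ?_) (pw_mul_summable q a hκ _ 1 (fun n => by rw [abs_of_nonneg (hf0 _)]; exact hf1 _)) ?_
  · split_ifs with hh
    · exact mul_le_of_le_one_right (pw_nonneg _ _ _ _) (hf1 _)
    · rw [hfz, mul_zero]
      rw [not_and_or, not_le, not_le] at hh
      rcases hh with hh | hh
      · rw [abs_of_nonpos (by linarith)]; linarith
      · rw [abs_of_nonneg (by linarith)]; linarith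
  · refine Summable.of_nonneg_of_le (fun n => ?_) (fun n => ?_) (pw_summable q a hκ)
    · split_ifs; exacts [pw_nonneg _ _ _ _, le_rfl]
    · split_ifs; exacts [le_rfl, pw_nonneg _ _ _ _]

lemma Zc_changeLevel {z : ℕ} (κ : ℝ) {q q' : ℕ} [NeZero q] (hqz : q < z) (hd : q' ∣ q) (χ : DirichletCharacter ℂ q') :
    Zc z κ (DirichletCharacter.changeLevel hd χ) = Zc z κ χ := by
  unfold Zc
  apply tsum_congr
  intro n
  by_cases hr : Rough z n
  · have hc := rough_coprime hqz (one_le_iff_ne_zero.2 (NeZero.ne q)) hr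
    have := DirichletCharacter.changeLevel_eq_cast_of_dvd' χ hd (a := (n:ℤ)) (Nat.isCoprime_iff_coprime.2 hc)
    push_cast at this
    rw [this]
  · simp [uu, hr]

theorem ThmP : ∃ (δ c : ℝ) (C0 : ℕ), 0 < δ ∧ δ ≤ 1/48 ∧ 0 < c ∧ ∀ W : ℕ, 1 ≤ W → ∃ J0 : ℕ, ∀ J, J0 ≤ J → ∀ U : Finset ℕ,
    (∀ p ∈ U, p.Prime ∧ ¬ p ∣ W) → (W * ∏ p ∈ U, p)^4 ≤ 2^2^J → ∃ Dr ⊆ U, #Dr ≤ C0 ∧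
      ∀ q' : ℕ, q' = W * ∏ p ∈ U \ Dr, p → ∀ a : (ZMod q')ˣ,
        c / ((δ/2^J)^3 * q'.totient) ≤ GG (2^2^J) (δ/2^J) q' (Dl (Dl vM)) a := by
  classical
  obtain ⟨δ, η, c, C0, J1, hδ, hδ1, hη, hc, hC0, hB⟩ := ThmB
  refine ⟨δ, c, ⌊C0⌋₊, hδ, hδ1, hc, ?_⟩
  intro W hW
  have : NeZero W := ⟨by omega⟩
  have hJχ : ∀ χ : DirichletCharacter ℂ W, ∃ J0 : ℕ, χ ≠ 1 → ∀ J, J0 ≤ J → ‖Zc (2^2^J) (δ/2^J) χ‖ ≤ η/(δ/2^J) := by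
    intro χ
    by_cases h : χ = 1
    · exact ⟨0, fun h' => absurd h h'⟩
    · obtain ⟨J0, hJ0⟩ := C2 W χ h hδ (by linarith) hη
      exact ⟨J0, fun _ => hJ0⟩
  choose Jf hJf using hJχ
  refine ⟨J1 + ∑ χ : DirichletCharacter ℂ W, Jf χ, ?_⟩
  intro J hJ U hU hq4
  have hUpos : 1 ≤ ∏ p ∈ U, p := Finset.prod_pos (fun p hp => (hU p hp).1.pos)
  set q := W * ∏ p ∈ U, p with hqd
  have hq1 : 1 ≤ q := Nat.mul_pos hW hUpos
  have : NeZero q := ⟨by omega⟩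
  have hqz := q_lt_z hq1 hq4
  have hB1 := hB J q (by omega) hq4
  set s : Finset (DirichletCharacter ℂ q) := Finset.univ.filter (fun χ => η/(δ/2^J) < ‖Zc (2^2^J) (δ/2^J) χ‖) with hs
  have hsc := hB1.2 s (fun χ hχ => by simpa [hs] using hχ)
  -- choose primes
  have hch : ∀ χ : DirichletCharacter ℂ q, ∃ p, ¬ χ.conductor ∣ W → p ∈ U ∧ p ∣ χ.conductor := by
    intro χ
    by_contra hcon
    push Not at hcon
    have h1 := (hcon 0).1
    have h2 : ∀ p ∈ U, ¬ p ∣ χ.conductor := fun p hp => (hcon p).2 hp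
    have hcop : Coprime χ.conductor (∏ p ∈ U, p) := by
      apply Coprime.prod_right
      intro p hp
      exact ((hU p hp).1.coprime_iff_not_dvd.2 (h2 p hp)).symm
    exact h1 (hcop.dvd_of_dvd_mul_right χ.conductor_dvd_level)
  choose pc hpc using hch
  set Dr := (s.filter (fun χ => ¬ χ.conductor ∣ W)).image pc with hDr
  refine ⟨Dr, ?_, ?_, ?_⟩
  · intro p hp
    rw [hDr, mem_image] at hp
    obtain ⟨χ, hχ, rfl⟩ := hp
    exact (hpc χ (mem_filter.1 hχ).2).1
  · apply le_floor
    refine le_trans ?_ hsc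
    exact_mod_cast le_trans card_image_le (card_filter_le _ _)
  · intro q' hq'
    have hq'1 : 1 ≤ q' := by
      rw [hq']; exact Nat.mul_pos hW (Finset.prod_pos (fun p hp => (hU p (mem_sdiff.1 hp).1).1.pos))
    have : NeZero q' := ⟨by omega⟩
    have hdq : q' ∣ q := by
      rw [hq', hqd]; exact Nat.mul_dvd_mul_left _ (Finset.prod_dvd_prod_of_subset _ _ _ sdiff_subset)
    have hWq' : W ∣ q' := by rw [hq']; exact Nat.dvd_mul_right _ _
    have hle := le_of_dvd hq1 hdq
    refine (hB J q' (by omega) (le_trans (pow_le_pow_left hle 4) hq4)).1 ?_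
    intro χ hχ
    by_contra hbad
    push Not at hbad
    set ψ := DirichletCharacter.changeLevel hdq χ with hψ
    have hψbad : ψ ∈ s := by
      rw [hs, mem_filter]
      exact ⟨mem_univ _, by rw [hψ, Zc_changeLevel _ hqz]; exact hbad⟩
    have hcd : ψ.conductor ∣ q' :=
      (DirichletCharacter.mem_conductorSet_iff_conductor_dvd _ hdq).1 (DirichletCharacter.changeLevel_factorsThrough χ hdq)
    by_cases hcW : ψ.conductor ∣ W
    · have hft := (DirichletCharacter.mem_conductorSet_iff_conductor_dvd ψ (dvd_trans hWq' hdq)).2 hcW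
      have hft : ψ.FactorsThrough W := hft
      obtain ⟨hd, χ0, h0⟩ := hft
      have hne : χ0 ≠ 1 := by
        intro h1
        apply hχ
        have : ψ = 1 := by rw [h0, h1]; simp
        exact (DirichletCharacter.changeLevel_eq_one_iff hdq).1 this
      have hb := hJf χ0 hne J (le_trans (Finset.single_le_sum (f := Jf) (fun _ _ => Nat.zero_le _) (mem_univ χ0)) (by omega))
      have h2 : Zc (2^2^J) (δ/2^J) χ = Zc (2^2^J) (δ/2^J) χ0 := by
        rw [← Zc_changeLevel _ hqz hdq χ, ← hψ, h0, Zc_changeLevel _ hqz]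
      rw [h2] at hbad
      linarith
    · have hp := hpc ψ hcW
      have hpD : pc ψ ∈ Dr := by
        rw [hDr]; exact mem_image_of_mem _ (mem_filter.2 ⟨hψbad, hcW⟩)
      have hpp := (hU _ hp.1).1
      have : pc ψ ∣ q' := dvd_trans hp.2 hcd
      rw [hq', hpp.dvd_mul] at this
      rcases this with h | h
      · exact (hU _ hp.1).2 h
      · rw [Prime.dvd_finsetProd_iff hpp.prime] at h
        obtain ⟨p, hpm, hpd⟩ := h
        replace hpm := Finset.mem_sdiff.1 hpm
        have := (Nat.prime_dvd_prime_iff_eq hpp (hU p hpm.1).1).1 hpd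
        rw [← this] at hpm
        exact hpm.2 hpD

noncomputable def PPC (q a k : ℕ) : ℕ := #{n ∈ Ico (2^k) (2^k+2^k) | n ≡ a [MOD q] ∧ IsPrimePow n}

lemma PPC_le (q a k : ℕ) : PPC q a k ≤ PC q a (2^k) (2^k) + 2^(k/2+1) * (k+1) := by
  classical
  unfold PPC PC
  have hsub : {n ∈ Ico (2^k) (2^k+2^k) | n ≡ a [MOD q] ∧ IsPrimePow n} ⊆
      {n ∈ Ico (2^k) (2^k+2^k) | n ≡ a [MOD q] ∧ n.Prime} ∪ ((range (2^(k/2+1)) ×ˢ range (k+1)).image (fun x => x.1^x.2)) := by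
    intro n hn
    rw [mem_filter] at hn
    obtain ⟨hI, ha, hpp⟩ := hn
    rw [isPrimePow_nat_iff] at hpp
    obtain ⟨p, j, hp, hj, rfl⟩ := hpp
    rw [mem_union]
    rw [mem_Ico] at hI
    have hI2 : p^j < 2^(k+1) := by rw [pow_succ]; omega
    rcases Nat.lt_or_ge 1 j with h1 | h1
    · right
      rw [mem_image]
      refine ⟨(p, j), ?_, rfl⟩
      rw [mem_product, mem_range, mem_range]
      constructor
      · by_contra hcon
        push Not at hcon
        have h2 : (2^(k/2+1))^2 ≤ p^j := le_trans (pow_le_pow_left hcon 2) (pow_le_pow_right hp.pos h1)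
        rw [← pow_mul] at h2
        have h3 := lt_of_le_of_lt h2 hI2
        have := (Nat.pow_lt_pow_iff_right (by norm_num : 1 < 2)).1 h3
        omega
      · have h3 := lt_of_le_of_lt (pow_le_pow_left hp.two_le j) hI2
        exact (Nat.pow_lt_pow_iff_right (by norm_num : 1 < 2)).1 h3
    · left
      have : j = 1 := by omega
      subst this
      rw [mem_filter, mem_Ico]
      exact ⟨hI, ha, by simpa using hp⟩
  refine le_trans (card_le_card hsub) (le_trans (card_union_le _ _) ?_)
  refine Nat.add_le_add_left (le_trans card_image_le ?_) _
  rw [card_product, card_range, card_range]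

lemma DDvM_nonneg (n : ℕ) : 0 ≤ Dl (Dl vM) n := by
  rw [DDvM_apply]
  positivity

lemma GG_split {J q K1 : ℕ} [NeZero q] {κ : ℝ} (hκ : 0 < κ) (hκ1 : κ ≤ 1) (a : ZMod q) :
    GG (2^2^J) κ q (Dl (Dl vM)) a ≤ (∑ k ∈ Ico (2^J) K1, ((k:ℝ)+1)^3/2^k * PPC q a.val k) +
      ((2:ℝ)^K1)^(-(κ/2)) * GG (2^2^J) (κ/2) q (Dl (Dl vM)) a := by
  classical
  set z := 2^2^J
  have hs1 := summable_ite (uu_summable z hκ hκ1 3 (Dl (Dl vM)) DDvM_abs) (fun n => (n : ZMod q) = a)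
  have hs2 := summable_ite (uu_summable z (half_pos hκ) (by linarith) 3 (Dl (Dl vM)) DDvM_abs) (fun n => (n : ZMod q) = a)
  set g : ℕ → ℝ := fun n => if (n : ZMod q) = a then uu z κ (Dl (Dl vM)) n else 0 with hg
  set hd : ℕ → ℝ := fun n => if n ∈ range (2^K1) then g n else 0 with hhd
  have hsd : HasSum hd (∑ n ∈ range (2^K1), g n) := by
    have : HasSum hd (∑ n ∈ range (2^K1), hd n) := hasSum_sum_of_ne_finset_zero (fun n hn => by rw [hhd]; simp only [if_neg hn])
    convert this using 1
    exact sum_congr rfl (fun n hn => by rw [hhd]; simp only [if_pos hn])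
  have h1 : GG z κ q (Dl (Dl vM)) a ≤ (∑ n ∈ range (2^K1), g n) + ((2:ℝ)^K1)^(-(κ/2)) * GG z (κ/2) q (Dl (Dl vM)) a := by
    have hR := hsd.add ((Summable.of_abs hs2).hasSum.mul_left (((2:ℝ)^K1)^(-(κ/2))))
    refine hasSum_le ?_ (Summable.of_abs hs1).hasSum hR
    intro n
    have h2n : (0:ℝ) ≤ ((2:ℝ)^K1)^(-(κ/2)) := by positivity
    by_cases ha : (n : ZMod q) = a
    · rw [if_pos ha, if_pos ha]
      by_cases hn : n ∈ range (2^K1)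
      · have : hd n = uu z κ (Dl (Dl vM)) n := by rw [hhd]; simp only [if_pos hn, hg, if_pos ha]
        rw [this]
        have := mul_nonneg h2n (uu_nonneg z (κ/2) _ DDvM_nonneg n)
        linarith
      · have : hd n = 0 := by rw [hhd]; simp only [if_neg hn]
        rw [this, zero_add]
        have hn' : 2^K1 ≤ n := by simpa using hn
        have hnr : (2:ℝ)^K1 ≤ n := mod_cast hn'
        have hn0 : (0:ℝ) < n := lt_of_lt_of_le (by positivity) hnr
        unfold uu
        split_ifs
        · have e : (n:ℝ)^(-(1+κ)) = (n:ℝ)^(-(κ/2)) * (n:ℝ)^(-(1+κ/2)) := by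
            rw [← rpow_add hn0]; congr 1; ring
          rw [e]
          have h3 : (n:ℝ)^(-(κ/2)) ≤ ((2:ℝ)^K1)^(-(κ/2)) :=
            Real.rpow_le_rpow_of_nonpos (by positivity) hnr (by linarith)
          have h4 : 0 ≤ Dl (Dl vM) n * (n:ℝ)^(-(1+κ/2)) := mul_nonneg (DDvM_nonneg n) (by positivity)
          calc _ = (n:ℝ)^(-(κ/2)) * (Dl (Dl vM) n * (n:ℝ)^(-(1+κ/2))) := by ring
            _ ≤ _ := mul_le_mul_of_nonneg_right h3 h4
        · simp
    · rw [if_neg ha, if_neg ha]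
      have : hd n = 0 := by rw [hhd]; simp only [hg, if_neg ha, ite_self]
      rw [this]; simp
  refine le_trans h1 (add_le_add_left ?_ _)
  have hg00 : g 0 = 0 := by
    simp only [hg, uu]; simp
  rw [sum_range_two_pow, hg00, zero_add]
  have hz0 : ∀ k : ℕ, k < 2^J → ∑ n ∈ Ico (2^k) (2^k+2^k), g n = 0 := by
    intro k hk
    apply sum_eq_zero
    intro n hn
    simp only [hg]
    split_ifs
    · unfold uu
      split_ifs with hr
      · have := rough_block hn hk hr
        subst this
        rw [DDvM_apply]; simp
      · rfl
    · rfl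
  have hkb : ∀ k : ℕ, ∑ n ∈ Ico (2^k) (2^k+2^k), g n ≤ ((k:ℝ)+1)^3/2^k * PPC q a.val k := by
    intro k
    have : ((k:ℝ)+1)^3/2^k * PPC q a.val k = ∑ n ∈ Ico (2^k) (2^k+2^k), if (n ≡ a.val [MOD q] ∧ IsPrimePow n) then ((k:ℝ)+1)^3/2^k else 0 := by
      rw [← sum_filter, sum_const, nsmul_eq_mul, PPC]; ring
    rw [this]
    apply sum_le_sum
    intro n hn
    obtain ⟨hw1, hw2, hw3⟩ := block_w hκ hn
    by_cases hc : n ≡ a.val [MOD q] ∧ IsPrimePow n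
    · rw [if_pos hc]
      simp only [hg]
      rw [if_pos ((zmod_modeq n a).2 hc.1)]
      unfold uu
      split_ifs
      · have hn1 : 1 ≤ n := by rw [mem_Ico] at hn; have := one_le_two_pow (n := k); omega
        have h3 := DDvM_abs n hn1
        have h4 : Dl (Dl vM) n ≤ ((k:ℝ)+1)^3 := le_trans (le_abs_self _) (le_trans h3 (by gcongr))
        have h5 : (n:ℝ)^(-(1+κ)) ≤ 1/2^k := by
          refine le_trans hw1 ?_
          have : exp (-(κ * log 2))^k ≤ 1 := by
            apply pow_le_one₀ (exp_pos _).le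
            rw [exp_le_one_iff]
            have := kl_bounds hκ hκ1
            linarith
          exact mul_le_of_le_one_right (by positivity) this
        calc _ ≤ ((k:ℝ)+1)^3 * (1/2^k) := mul_le_mul h4 h5 (by positivity) (by positivity)
          _ = _ := by ring
      · positivity
    · rw [if_neg hc]
      simp only [hg]
      split_ifs with ha
      · unfold uu
        split_ifs
        · have : ¬ IsPrimePow n := fun h => hc ⟨(zmod_modeq n a).1 ha, h⟩
          rw [DDvM_apply, ArithmeticFunction.vonMangoldt_eq_zero_iff.2 this]; simp
        · exact le_rfl
      · exact le_rfl
  rw [← sum_filter_add_sum_filter_not (range K1) (fun k => k < 2^J)]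
  have e0 : ∑ k ∈ (range K1).filter (fun k => k < 2^J), ∑ n ∈ Ico (2^k) (2^k+2^k), g n = 0 :=
    sum_eq_zero (fun k hk => hz0 k (mem_filter.1 hk).2)
  rw [e0, zero_add]
  have e1 : (range K1).filter (fun k => ¬ k < 2^J) = Ico (2^J) K1 := by
    ext k; simp only [mem_filter, mem_range, mem_Ico]; omega
  rw [e1]
  exact sum_le_sum (fun k _ => hkb k)

lemma exp_beats (A : ℝ) : ∃ m0 : ℕ, ∀ m : ℕ, m0 ≤ m → A * ((m:ℝ)+1)^2 ≤ 2^m := by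
  have h := tendsto_pow_const_div_const_pow_of_one_lt 2 (by norm_num : (1:ℝ) < 2)
  have h2 := (h.comp (tendsto_add_atTop_nat 1)).eventually (gt_mem_nhds (show (0:ℝ) < 1/(2*(|A|+1)) by positivity))
  rw [eventually_atTop] at h2
  obtain ⟨m0, hm⟩ := h2
  refine ⟨m0, fun m hm' => ?_⟩
  have h3 := hm m hm'
  simp only [Function.comp] at h3
  rw [div_lt_div_iff₀ (by positivity) (by positivity)] at h3
  push_cast at h3
  rw [pow_succ (2:ℝ) m] at h3
  have h4 : A ≤ |A|+1 := by have := le_abs_self A; linarith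
  have h5 : A * ((m:ℝ)+1)^2 ≤ (|A|+1) * ((m:ℝ)+1)^2 := by gcongr
  nlinarith

lemma pp_negl {c : ℝ} (hc : 0 < c) : ∃ k0 : ℕ, ∀ k φ : ℕ, k0 ≤ k → φ^4 ≤ 2^k → (φ:ℝ) * k * (2^(k/2+1) * (k+1)) ≤ c * 2^k := by
  obtain ⟨m0, hm⟩ := exp_beats (128/c)
  refine ⟨4*m0, fun k φ hk hφ => ?_⟩
  have hm1 := hm (k/4) (by omega)
  have h1 : φ ≤ 2^(k/4+1) := by
    by_contra hcon
    push Not at hcon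
    have h2 : (2^(k/4+1))^4 ≤ φ^4 := pow_le_pow_left hcon.le 4
    rw [← pow_mul] at h2
    have := (Nat.pow_le_pow_iff_right (by norm_num : 1 < 2)).1 (le_trans h2 hφ)
    omega
  have h1r : (φ:ℝ) ≤ 2^(k/4+1) := mod_cast h1
  have hk4 : (k:ℝ) + 1 ≤ 4 * (((k/4 : ℕ):ℝ) + 1) := by
    have : k + 1 ≤ 4 * (k/4+1) := by omega
    exact_mod_cast this
  rw [div_mul_eq_mul_div, div_le_iff₀ hc] at hm1
  calc (φ:ℝ) * k * (2^(k/2+1) * (k+1)) ≤ 2^(k/4+1) * (4 * (((k/4 : ℕ):ℝ) + 1)) * (2^(k/2+1) * (4 * (((k/4 : ℕ):ℝ) + 1))) := by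
        gcongr; linarith
    _ = (2^(k/4+1) * 2^(k/2+1)) * (16 * (((k/4 : ℕ):ℝ) + 1)^2) := by ring
    _ ≤ (2^(k/4+1) * 2^(k/2+1)) * (c * 2^(k/4) / 8) := by
        gcongr; linarith
    _ = c * (2^(k/4+k/2+k/4) / 2) := by rw [pow_add, pow_add, pow_add, pow_add]; ring
    _ ≤ c * 2^k := by
        have : (2:ℝ)^(k/4+k/2+k/4) ≤ 2^k := pow_le_pow_right₀ (by norm_num) (by omega)
        have h2 : (0:ℝ) < 2^k := by positivity
        gcongr; linarith

theorem ThmP' : ∃ (c : ℝ) (C C0 : ℕ), 0 < c ∧ 1 ≤ C ∧ ∀ W : ℕ, 1 ≤ W → ∃ J0 : ℕ, ∀ J, J0 ≤ J → ∀ U : Finset ℕ,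
    (∀ p ∈ U, p.Prime ∧ ¬ p ∣ W) → (W * ∏ p ∈ U, p)^4 ≤ 2^2^J → ∃ Dr ⊆ U, #Dr ≤ C0 ∧
      ∀ q' : ℕ, q' = W * ∏ p ∈ U \ Dr, p → ∀ G : Finset ℕ, (∀ h ∈ G, h.Coprime q') →
        ∃ k : ℕ, 2^J ≤ k ∧ k ≤ C * 2^J ∧ c * #G * 2^k / (q'.totient * k) ≤ ∑ h ∈ G, (PC q' h (2^k) (2^k) : ℝ) := by
  classical
  obtain ⟨δ, c, C0, hδ, hδ1, hc, hP⟩ := ThmP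
  obtain ⟨C3, J3, hC3, hE⟩ := EstUp 3
  obtain ⟨C, hC⟩ := exists_nat_ge (max 1 (32 * C3 / δ / c / (δ * log 2 / 2)))
  have hC1 : 1 ≤ C := by exact_mod_cast le_trans (le_max_left _ _) hC
  have hC2 := le_trans (le_max_right _ _) hC
  have hCr : (1:ℝ) ≤ C := mod_cast hC1
  set c2 : ℝ := c / (32 * δ^3 * C^3) with hc2
  have hc2p : 0 < c2 := by positivity
  obtain ⟨k0, hk0⟩ := pp_negl (half_pos hc2p)
  refine ⟨c2/2, C, C0, by positivity, hC1, ?_⟩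
  intro W hW
  obtain ⟨J0, hJ0⟩ := hP W hW
  refine ⟨J0 + J3 + k0, fun J hJ U hU hq4 => ?_⟩
  obtain ⟨Dr, hDrU, hDr, hmain⟩ := hJ0 J (by omega) U hU hq4
  refine ⟨Dr, hDrU, hDr, ?_⟩
  intro q' hq' G hG
  have hq'1 : 1 ≤ q' := by
    rw [hq']; exact Nat.mul_pos hW (Finset.prod_pos (fun p hp => (hU p (Finset.mem_sdiff.1 hp).1).1.pos))
  have : NeZero q' := ⟨by omega⟩
  have hle : q' ≤ W * ∏ p ∈ U, p := by
    rw [hq']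
    refine Nat.mul_le_mul_left _ (le_of_dvd (Finset.prod_pos (fun p hp => (hU p hp).1.pos)) ?_)
    exact Finset.prod_dvd_prod_of_subset _ _ _ Finset.sdiff_subset
  have hq'4 : q'^4 ≤ 2^2^J := le_trans (pow_le_pow_left hle 4) hq4
  have hmain := hmain q' hq'
  have hphi : (0:ℝ) < q'.totient := mod_cast totient_pos.2 hq'1
  rcases G.eq_empty_or_nonempty with hGe | hGn
  · refine ⟨2^J, le_rfl, Nat.le_mul_of_pos_left _ hC1, ?_⟩
    subst hGe; simp
  set κ : ℝ := δ/2^J with hκd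
  have h2J : (1:ℝ) ≤ 2^J := one_le_pow₀ (by norm_num)
  have hκ : 0 < κ := by positivity
  have hκ1 : κ ≤ 1 := by
    rw [hκd, div_le_one (by positivity)]; linarith
  set K1 := C * 2^J with hK1
  have hK1r : (K1:ℝ) = C * 2^J := by rw [hK1]; push_cast; ring
  have htail : ∀ a : (ZMod q')ˣ, ((2:ℝ)^K1)^(-(κ/2)) * GG (2^2^J) (κ/2) q' (Dl (Dl vM)) a ≤ c / (κ^3 * q'.totient) / 2 := by
    intro a
    have h1 := le_trans (le_abs_self _) (hE J q' (κ/2) (by omega) hq'4 (half_pos hκ) (by linarith) (Dl (Dl vM)) DDvM_abs a)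
    have h1' : GG (2^2^J) (κ/2) q' (Dl (Dl vM)) a ≤ 16 * C3 / δ / (κ^3 * q'.totient) := by
      refine le_trans h1 (le_of_eq ?_)
      have hd : (2:ℝ)^J = δ/κ := by rw [hκd]; field_simp
      rw [hd]
      simp only [ne_eq, OfNat.ofNat_ne_zero, not_false_eq_true, zero_pow, ite_self, zero_add]
      field_simp; ring
    set x : ℝ := C * (δ * log 2 / 2) with hx
    have hxp : 0 < x := by positivity
    have h2 : ((2:ℝ)^K1)^(-(κ/2)) = exp (-x) := by
      rw [← Real.rpow_natCast 2 K1, ← Real.rpow_mul (by norm_num), rpow_def_of_pos (by norm_num), hK1r, hx, hκd]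
      congr 1; field_simp
    have h3 : exp (-x) ≤ 1/x := by
      rw [exp_neg, ← one_div]
      apply one_div_le_one_div_of_le hxp
      have := add_one_le_exp x; linarith
    have h4 : 32 * C3 / δ / c ≤ x := by
      rw [div_le_iff₀ (by positivity)] at hC2; exact hC2
    have h5 : 32 * C3 / δ * (1/x) ≤ c := by
      rw [div_le_iff₀ hc] at h4
      rw [mul_one_div, div_le_iff₀ hxp]; linarith
    rw [h2]
    calc exp (-x) * GG (2^2^J) (κ/2) q' (Dl (Dl vM)) a ≤ exp (-x) * (16 * C3 / δ / (κ^3 * q'.totient)) := by gcongr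
      _ ≤ (1/x) * (16 * C3 / δ / (κ^3 * q'.totient)) := by gcongr
      _ = (32 * C3 / δ * (1/x)) / (κ^3 * q'.totient) / 2 := by ring
      _ ≤ _ := by gcongr
  have hhead : ∀ h ∈ G, c / (κ^3 * q'.totient) / 2 ≤ ∑ k ∈ Ico (2^J) K1, ((k:ℝ)+1)^3/2^k * PPC q' h k := by
    intro h hh
    set a := ZMod.unitOfCoprime h (hG h hh) with ha
    have h1 := hmain a
    have h2 := GG_split (J := J) (K1 := K1) hκ hκ1 (a : ZMod q')
    have h3 := htail a
    have h4 : ∀ k : ℕ, PPC q' (a : ZMod q').val k = PPC q' h k := by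
      intro k
      unfold PPC
      congr 1
      apply filter_congr
      intro n _
      have e : (a : ZMod q').val = h % q' := by rw [ha, ZMod.coe_unitOfCoprime, ZMod.val_natCast]
      rw [e]
      have : n ≡ h % q' [MOD q'] ↔ n ≡ h [MOD q'] := by simp [ModEq]
      rw [this]
    simp only [h4] at h2
    linarith
  have hsum : #G * (c / (κ^3 * q'.totient) / 2) ≤ ∑ k ∈ Ico (2^J) K1, ((k:ℝ)+1)^3/2^k * ∑ h ∈ G, (PPC q' h k : ℝ) := by
    rw [← nsmul_eq_mul, ← sum_const]
    refine le_trans (sum_le_sum hhead) ?_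
    rw [sum_comm]
    exact le_of_eq (sum_congr rfl (fun k _ => by rw [mul_sum]))
  have hex : ∃ k ∈ Ico (2^J) K1, c2 * #G * 2^k / (q'.totient * k) ≤ ∑ h ∈ G, (PPC q' h k : ℝ) := by
    by_contra hcon
    push Not at hcon
    have h1 : ∀ k ∈ Ico (2^J) K1, ((k:ℝ)+1)^3/2^k * ∑ h ∈ G, (PPC q' h k : ℝ) ≤ 8 * K1^2 * (c2 * #G / q'.totient) := by
      intro k hk
      have h2 := (hcon k hk).le
      rw [mem_Ico] at hk
      have hk1 : 1 ≤ k := le_trans one_le_two_pow hk.1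
      have hkr : (1:ℝ) ≤ k := mod_cast hk1
      have hkK : (k:ℝ) ≤ K1 := mod_cast hk.2.le
      calc ((k:ℝ)+1)^3/2^k * ∑ h ∈ G, (PPC q' h k : ℝ) ≤ (2*k)^3/2^k * (c2 * #G * 2^k / (q'.totient * k)) := by
            gcongr; linarith
        _ = 8 * k^2 * (c2 * #G / q'.totient) := by field_simp; ring
        _ ≤ _ := by gcongr
    have h2 := le_trans hsum (sum_le_sum h1)
    rw [sum_const, nsmul_eq_mul, card_Ico] at h2
    have h3 : ((K1 - 2^J : ℕ):ℝ) ≤ K1 := mod_cast Nat.sub_le _ _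
    have h4 : #G * (c / (κ^3 * q'.totient) / 2) ≤ K1 * (8 * K1^2 * (c2 * #G / q'.totient)) := by
      refine le_trans h2 ?_
      gcongr
    have h5 : (K1:ℝ) * (8 * K1^2 * (c2 * #G / q'.totient)) = (#G * (c / (κ^3 * q'.totient) / 2))/2 := by
      rw [hK1r, hc2, hκd]
      have := hCr
      field_simp; ring
    have h6 : 0 < #G * (c / (κ^3 * q'.totient) / 2) := by positivity
    linarith
  obtain ⟨k, hk, hkb⟩ := hex
  rw [mem_Ico] at hk
  refine ⟨k, hk.1, hk.2.le, ?_⟩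
  have hk1 : 1 ≤ k := le_trans one_le_two_pow hk.1
  have hkk0 : k0 ≤ k := by
    have := J.lt_two_pow_self; omega
  have hφ4 : q'.totient^4 ≤ 2^k :=
    le_trans (pow_le_pow_left (totient_le q') 4) (le_trans hq'4 (pow_le_pow_right (by norm_num) hk.1))
  have hn := hk0 k q'.totient hkk0 hφ4
  have h1 : ∑ h ∈ G, (PPC q' h k : ℝ) ≤ ∑ h ∈ G, (PC q' h (2^k) (2^k) : ℝ) + #G * (2^(k/2+1) * (k+1)) := by
    rw [← nsmul_eq_mul, ← sum_const, ← sum_add_distrib]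
    apply sum_le_sum
    intro h _
    exact_mod_cast PPC_le q' h k
  have h2 : (#G:ℝ) * (2^(k/2+1) * (k+1)) ≤ c2/2 * #G * 2^k / (q'.totient * k) := by
    rw [le_div_iff₀ (by positivity)]
    calc (#G:ℝ) * (2^(k/2+1) * (k+1)) * (q'.totient * k) = #G * ((q'.totient:ℝ) * k * (2^(k/2+1) * (k+1))) := by ring
      _ ≤ #G * (c2/2 * 2^k) := by gcongr
      _ = _ := by ring
  have h3 : c2 * #G * 2^k / (q'.totient * k) = c2/2 * #G * 2^k / (q'.totient * k) + c2/2 * #G * 2^k / (q'.totient * k) := by ring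
  linarith

theorem BTq : ∃ C : ℝ, 1 ≤ C ∧ ∀ q a x H : ℕ, 1 ≤ q → a.Coprime q → q^2 ≤ H → 2 ≤ H →
    (PC q a x H : ℝ) ≤ C * H / (q.totient * log H) := by
  obtain ⟨C, hC, h⟩ := BTp
  refine ⟨4*C, by linarith, fun q a x H hq hc hqH hH => ?_⟩
  set d := H / q with hd
  have hd2 : 2 ≤ d := by
    rw [hd, Nat.le_div_iff_mul_le (by omega)]
    rcases Nat.lt_or_ge q 2 with h1 | h1
    · have : q = 1 := by omega
      subst this; omega
    · nlinarith
  have hlt : H < (d+1) * q := by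
    rw [hd]; have := Nat.lt_div_mul_add (a := H) (b := q) (by omega); nlinarith
  have hlt2 : q ≤ d := by
    rw [hd, Nat.le_div_iff_mul_le (by omega)]; nlinarith
  set k := Nat.log 2 d with hk
  have hk1 : 1 ≤ k := by
    rw [hk]; exact Nat.log_pos (by norm_num) hd2
  have h2k : 2^k ≤ d := pow_log_le_self 2 (by omega)
  have hdk : d < 2^(k+1) := lt_pow_succ_log_self (by norm_num) d
  have hH2 : H ≤ 2^(2*k+2) := by
    have e : 2^(2*k+2) = 2^(k+1) * 2^(k+1) := by ring
    rw [e]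
    exact le_trans hlt.le (Nat.mul_le_mul hdk (by omega))
  have h1 := h q a x H k hq hc hk1 (by
    calc q * 2^k ≤ q * d := Nat.mul_le_mul_left _ h2k
      _ ≤ H := Nat.mul_div_le H q)
  refine le_trans h1 ?_
  have hkr : (1:ℝ) ≤ k := mod_cast hk1
  have hHr : (2:ℝ) ≤ H := mod_cast hH
  have hlog : log H ≤ 4 * k := by
    have : log H ≤ log ((2:ℝ)^(2*k+2)) := log_le_log (by linarith) (mod_cast hH2)
    rw [log_pow] at this
    push_cast at this
    have hl := log_two_lt_d9
    nlinarith
  have hlp : 0 < log H := log_pos (by linarith)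
  rw [div_le_div_iff₀ (by positivity) (by positivity)]
  have : C * H * (q.totient * log H) ≤ C * H * (q.totient * (4*k)) := by gcongr
  linarith

theorem int_cnt : ∃ C : ℝ, 1 ≤ C ∧ ∀ ε : ℝ, 0 < ε → ε ≤ 1 → ∃ j0 : ℕ, ∀ j : ℕ, j0 ≤ j → ∀ s : ℝ, (j:ℝ) ≤ s → s ≤ j+1 →
    ∀ q c : ℕ, 1 ≤ q → c.Coprime q → (q:ℝ)^3 ≤ exp j → ∀ T : Finset ℕ,
      (∀ p ∈ T, p.Prime ∧ p ≡ c [MOD q] ∧ s ≤ log p ∧ log p ≤ s + ε) →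
        (#T : ℝ) ≤ C * ε * exp j / (q.totient * j) := by
  obtain ⟨C, hC, hB⟩ := BTq
  refine ⟨14*C, by linarith, fun ε hε hε1 => ?_⟩
  have ev : ∀ᶠ j : ℕ in atTop, 2/ε ≤ exp j ∧ 1/(8*ε^3) ≤ exp j ∧ 2 * (-log (2*ε)) ≤ j ∧ (1:ℝ) ≤ j := by
    have t1 : Tendsto (fun j : ℕ => exp j) atTop atTop := Real.tendsto_exp_atTop.comp tendsto_natCast_atTop_atTop
    have t2 : Tendsto (fun j : ℕ => (j:ℝ)) atTop atTop := tendsto_natCast_atTop_atTop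
    exact (t1.eventually_ge_atTop _).and ((t1.eventually_ge_atTop _).and ((t2.eventually_ge_atTop _).and (t2.eventually_ge_atTop _)))
  obtain ⟨j0, hj0⟩ := eventually_atTop.1 ev
  refine ⟨j0, fun j hj s hs1 hs2 q c hq hc hq3 T hT => ?_⟩
  obtain ⟨e1, e2, e3, e4⟩ := hj0 j hj
  set x := ⌈exp s⌉₊
  set H := ⌈2*ε*exp s⌉₊ + 1 with hH
  have hes1 : exp j ≤ exp s := exp_le_exp.2 hs1
  have hes2 : exp s ≤ 3 * exp j := by
    have : exp s ≤ exp (j+1) := exp_le_exp.2 hs2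
    rw [exp_add] at this
    have h1 := exp_one_lt_d9
    have h2 := exp_pos (j:ℝ)
    nlinarith
  rw [div_le_iff₀ hε] at e1
  have hHlow : 2*ε*exp j ≤ H := by
    have := le_ceil (2*ε*exp s)
    rw [hH]; push_cast
    have h3 : 2*ε*exp j ≤ 2*ε*exp s := by gcongr
    linarith
  have hHup : (H:ℝ) ≤ 7*ε*exp j := by
    have := Nat.ceil_lt_add_one (show 0 ≤ 2*ε*exp s by positivity)
    rw [hH]; push_cast
    have h3 : 2*ε*exp s ≤ 2*ε*(3*exp j) := by gcongr
    nlinarith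
  have hH2 : 2 ≤ H := by
    have : (2:ℝ) ≤ H := by nlinarith
    exact_mod_cast this
  have hqH : q^2 ≤ H := by
    have : (q:ℝ)^2 ≤ H := by
      refine le_trans ?_ hHlow
      by_contra hcon
      push Not at hcon
      have h1 : (2*ε*exp j)^3 < ((q:ℝ)^2)^3 := pow_lt_pow_left₀ hcon (by positivity) (by norm_num)
      have h2 : ((q:ℝ)^2)^3 ≤ (exp j)^2 := by
        calc ((q:ℝ)^2)^3 = ((q:ℝ)^3)^2 := by ring
          _ ≤ _ := by gcongr
      rw [div_le_iff₀ (by positivity)] at e2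
      have h3 : exp j^2 * 1 ≤ exp j^2 * (exp j * (8*ε^3)) := by gcongr
      nlinarith
    exact_mod_cast this
  have hlog : (j:ℝ)/2 ≤ log H := by
    have h1 : log (2*ε*exp j) ≤ log H := log_le_log (by positivity) hHlow
    rw [log_mul (by positivity) (by positivity), Real.log_exp] at h1
    linarith
  have hexp : exp ε ≤ 1 + 2*ε := by
    have := Real.abs_exp_sub_one_sub_id_le (x := ε) (by rw [abs_of_pos hε]; exact hε1)
    have h2 := (abs_le.1 this).2
    nlinarith
  have hTc : #T ≤ PC q c x H := by
    unfold PC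
    apply card_le_card
    intro p hp
    obtain ⟨hpp, hpc, hp1, hp2⟩ := hT p hp
    have hp0 : (0:ℝ) < p := mod_cast hpp.pos
    rw [le_log_iff_exp_le hp0] at hp1
    rw [log_le_iff_le_exp hp0, exp_add] at hp2
    rw [mem_filter, mem_Ico]
    refine ⟨⟨ceil_le.2 hp1, ?_⟩, hpc, hpp⟩
    have h1 : (p:ℝ) < (x + H : ℕ) := by
      push_cast
      have h2 := le_ceil (exp s)
      have h3 := le_ceil (2*ε*exp s)
      rw [hH]; push_cast
      have h4 : exp s * exp ε ≤ exp s * (1 + 2*ε) := by gcongr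
      linarith
    exact_mod_cast h1
  have h1 := hB q c x H hq hc hqH hH2
  calc (#T : ℝ) ≤ PC q c x H := mod_cast hTc
    _ ≤ C * H / (q.totient * log H) := h1
    _ ≤ C * (7*ε*exp j) / (q.totient * (j/2)) := by gcongr
    _ = _ := by field_simp; ring
open ArithmeticFunction (cardFactors)

/-- parameters of the construction -/
structure Par where
  N : ℕ
  l0 : ℕ
  a : ℕ
  w : ℕ
  w1 : ℕ
  ε : ℝ
  r : ℕ → ℕ
  S : Finset ℕ
  hN : 1 ≤ N
  hε : 0 < ε
  hεN : (l0+1) * ε * (4*N) ≤ 1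
  hw : 2 ≤ w
  hr : ∀ i, (r i).Coprime (2 * primorial w)
  hS : ∀ p ∈ S, p.Prime ∧ p ≡ 1 [MOD 2 * primorial w] ∧ Int.fract (log p) ≤ ε ∧ exp (a+2) ≤ p ∧ w < p ∧ p < w1
  hw1 : exp (a + 1 + ((∏ p ∈ S, p)^l0 : ℕ)) < w1

namespace Par
variable (P : Par)

def Q : ℕ := 2 * primorial P.w
def E : ℕ := (∏ p ∈ P.S, p)^P.l0
noncomputable def Ms : Finset ℕ := {m ∈ Icc 2 P.E | m.primeFactors ⊆ P.S ∧ cardFactors m ≤ P.l0}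
noncomputable def Wg : ℝ := ∑ m ∈ P.Ms, (1:ℝ)/m
noncomputable def em (m : ℕ) : ℕ := ⌊log m⌋₊
noncomputable def Pset (i j : ℕ) : Finset ℕ := {p ∈ range ⌈exp (j+1)⌉₊ | p.Prime ∧ p ≡ P.r i [MOD P.Q] ∧
  (j:ℝ) + i/P.N ≤ log p ∧ log p ≤ j + i/P.N + P.ε}
noncomputable def Gs (b i : ℕ) : Finset ℕ := P.Ms.biUnion (fun m => (P.Pset i (P.a + b - em m)).image (fun p => m * p))
noncomputable def Gh (b : ℕ) : ℝ := P.ε * P.Wg * exp (P.a + b) / (P.Q.totient * (P.a + b))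

lemma Q_pos : 1 ≤ P.Q := by
  unfold Q; have := primorial_pos P.w; omega

lemma N_pos : (0:ℝ) < P.N := mod_cast P.hN

lemma ε_le : P.ε ≤ 1/4 := by
  have h := P.hεN
  have hN : (1:ℝ) ≤ P.N := mod_cast P.hN
  have h1 : 1 * P.ε * (4*1) ≤ (P.l0+1) * P.ε * (4*P.N) := by
    have := P.hε
    gcongr; linarith
  linarith

lemma lε_le : (P.l0 + 1) * P.ε ≤ 1/(4*P.N) := by
  have := P.N_pos
  rw [le_div_iff₀ (by positivity)]
  exact P.hεN

lemma lε_le' : (P.l0 + 1) * P.ε ≤ 1/4 := by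
  have hN : (1:ℝ) ≤ P.N := mod_cast P.hN
  refine le_trans P.lε_le ?_
  apply one_div_le_one_div_of_le (by norm_num); linarith

lemma Smul {m : ℕ} (hm : m ≠ 0) (h : m.primeFactors ⊆ P.S) :
    (∃ e : ℕ, (e:ℝ) ≤ log m ∧ log m ≤ e + cardFactors m * P.ε ∧ (m ≠ 1 → P.a + 2 ≤ e)) ∧
      m ≤ (∏ p ∈ P.S, p)^(cardFactors m) ∧ m ≡ 1 [MOD P.Q] := by
  induction m using induction_on_primes with
  | zero => exact absurd rfl hm
  | one => 
    refine ⟨⟨0, by simp⟩, by simp, rfl⟩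
  | prime_mul p m hp ih =>
    have hm0 : m ≠ 0 := right_ne_zero_of_mul hm
    have hsub : m.primeFactors ⊆ P.S := (primeFactors_mono (Dvd.intro_left p rfl) hm).trans h
    have hpS : p ∈ P.S := h (mem_primeFactors.2 ⟨hp, Dvd.intro _ rfl, hm⟩)
    obtain ⟨⟨e, he1, he2, -⟩, hle, hmod⟩ := ih hm0 hsub
    obtain ⟨-, hp1, hp2, hp3, -, -⟩ := P.hS p hpS
    have hp0 : (0:ℝ) < p := mod_cast hp.pos
    have hmr : (0:ℝ) < m := mod_cast Nat.pos_of_ne_zero hm0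
    have hcf : cardFactors (p*m) = 1 + cardFactors m := by
      rw [cardFactors_mul hp.ne_zero hm0, ArithmeticFunction.cardFactors_apply_prime hp]
    have hlog : log ((p*m : ℕ):ℝ) = log p + log m := by
      push_cast; exact log_mul hp0.ne' hmr.ne'
    have hlp : 0 ≤ log p := log_natCast_nonneg p
    have hfl : ((⌊log p⌋₊ : ℕ):ℝ) = log p - Int.fract (log p) := by
      rw [natCast_floor_eq_intCast_floor hlp, Int.self_sub_fract]
    have hfr := Int.fract_nonneg (log p)
    refine ⟨⟨⌊log p⌋₊ + e, ?_, ?_, ?_⟩, ?_, ?_⟩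
    · rw [hlog]; push_cast; rw [hfl]; linarith
    · rw [hlog, hcf]; push_cast; rw [hfl]; linarith
    · intro _
      have : P.a + 2 ≤ ⌊log p⌋₊ := by
        apply le_floor
        push_cast
        rw [le_log_iff_exp_le hp0]; exact hp3
      omega
    · rw [hcf, pow_add, pow_one]
      refine Nat.mul_le_mul ?_ hle
      exact le_of_dvd (Finset.prod_pos (fun q hq => (P.hS q hq).1.pos)) (Finset.dvd_prod_of_mem _ hpS)
    · have := ModEq.mul hp1 hmod
      simpa [Q] using this

lemma prodS_pos : 1 ≤ ∏ p ∈ P.S, p := Finset.prod_pos (fun q hq => (P.hS q hq).1.pos)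

lemma mem_Ms_of {m : ℕ} (hm : 2 ≤ m) (h : m.primeFactors ⊆ P.S) (hc : cardFactors m ≤ P.l0) : m ∈ P.Ms := by
  unfold Ms
  rw [mem_filter, mem_Icc]
  refine ⟨⟨hm, ?_⟩, h, hc⟩
  exact le_trans (P.Smul (by omega) h).2.1 (pow_le_pow_right P.prodS_pos hc)

lemma Ms_spec {m : ℕ} (hm : m ∈ P.Ms) : 2 ≤ m ∧ m.primeFactors ⊆ P.S ∧ cardFactors m ≤ P.l0 ∧ (em m : ℝ) ≤ log m ∧
    log m ≤ em m + P.l0 * P.ε ∧ P.a + 2 ≤ em m ∧ em m ≤ P.E ∧ m ≡ 1 [MOD P.Q] := by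
  unfold Ms at hm
  rw [mem_filter, mem_Icc] at hm
  obtain ⟨⟨h2, hE⟩, hs, hc⟩ := hm
  obtain ⟨⟨e, he1, he2, he3⟩, -, hmod⟩ := P.Smul (by omega) hs
  have hcr : (cardFactors m : ℝ) ≤ P.l0 := mod_cast hc
  have h1 : log m ≤ e + P.l0 * P.ε := le_trans he2 (by have := P.hε; gcongr)
  have h4 := P.lε_le'
  have hε := P.hε
  have hee : em m = e := by
    unfold em
    rw [Nat.floor_eq_iff (log_natCast_nonneg m)]
    refine ⟨he1, by nlinarith⟩
  refine ⟨h2, hs, hc, by rw [hee]; exact he1, by rw [hee]; exact h1, by rw [hee]; exact he3 (by omega), ?_, hmod⟩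
  have h5 : (em m : ℝ) ≤ m := by
    rw [hee]
    have := Real.log_le_sub_one_of_pos (show (0:ℝ) < m by exact_mod_cast (by omega : 0 < m))
    linarith
  exact le_trans (mod_cast h5) hE

lemma Pset_spec {i j p : ℕ} (hp : p ∈ P.Pset i j) : p.Prime ∧ p ≡ P.r i [MOD P.Q] ∧
  (j:ℝ) + i/P.N ≤ log p ∧ log p ≤ j + i/P.N + P.ε := (mem_filter.1 hp).2

lemma mem_Gs {b i h : ℕ} : h ∈ P.Gs b i ↔ ∃ m ∈ P.Ms, ∃ p ∈ P.Pset i (P.a + b - em m), m * p = h := by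
  unfold Gs
  simp only [mem_biUnion, mem_image]

lemma Gs_spec {b i h : ℕ} (hb : P.E ≤ b) (hh : h ∈ P.Gs b i) : ((P.a:ℝ) + b + i/P.N ≤ log h ∧
    log h ≤ P.a + b + i/P.N + (P.l0+1) * P.ε) ∧ h ≡ P.r i [MOD P.Q] ∧ 0 < h := by
  obtain ⟨m, hm, p, hp, rfl⟩ := P.mem_Gs.1 hh
  obtain ⟨h2, -, -, h3, h4, -, h5, h6⟩ := P.Ms_spec hm
  obtain ⟨hpp, hpr, hp1, hp2⟩ := P.Pset_spec hp
  have hp0 : (0:ℝ) < p := mod_cast hpp.pos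
  have hmr : (0:ℝ) < m := mod_cast (by omega : 0 < m)
  have hlog : log ((m*p : ℕ):ℝ) = log m + log p := by
    push_cast; exact log_mul hmr.ne' hp0.ne'
  have hj : ((P.a + b - em m : ℕ):ℝ) = P.a + b - em m := by
    rw [cast_sub (by omega)]; push_cast; ring
  rw [hj] at hp1 hp2
  refine ⟨⟨?_, ?_⟩, ?_, ?_⟩
  · rw [hlog]; linarith
  · rw [hlog]; linarith
  · have := ModEq.mul h6 hpr
    simpa using this
  · exact Nat.mul_pos (by omega) hpp.pos

end Par

lemma ev_nat (A : ℝ) : ∃ b0 : ℕ, ∀ b : ℕ, b0 ≤ b → A ≤ b := by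
  obtain ⟨n, hn⟩ := exists_nat_ge A
  exact ⟨n, fun b hb => le_trans hn (mod_cast hb)⟩

theorem pm_cnt : ∃ C : ℝ, 1 ≤ C ∧ ∀ P : Par, ∃ b0 : ℕ, P.E ≤ b0 ∧ ∀ b : ℕ, b0 ≤ b → ∀ i : ℕ, i < P.N → ∀ m ∈ P.Ms, ∀ q : ℕ, 1 ≤ q →
    (q:ℝ) ≤ P.Q * exp (b/4) → ∀ T ⊆ P.Pset i (P.a + b - Par.em m), (∀ p ∈ T, ∀ p' ∈ T, p ≡ p' [MOD q]) →
      (#T : ℝ) ≤ C * P.ε * exp (P.a + b) / (m * q.totient * (P.a + b)) := by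
  obtain ⟨C, hC, hI⟩ := int_cnt
  refine ⟨6*C, by linarith, fun P => ?_⟩
  obtain ⟨j0, hj0⟩ := hI P.ε P.hε (by have := P.ε_le; linarith)
  have hQ1 : (1:ℝ) ≤ P.Q := mod_cast P.Q_pos
  obtain ⟨b1, hb1⟩ := ev_nat (4 * (P.E + 3 * log P.Q + 1))
  refine ⟨b1 + j0 + P.a + 2 * P.E + 1, by omega, fun b hb i hi m hm q hq hqQ T hT hTT => ?_⟩
  obtain ⟨h2, -, -, h3, h4, h5a, h5, h6⟩ := P.Ms_spec hm
  set j := P.a + b - Par.em m with hj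
  have hjb : b - P.E ≤ j := by omega
  have hjr : (j:ℝ) = P.a + b - Par.em m := by
    rw [hj, cast_sub (by omega)]; push_cast; ring
  have hbr := hb1 b (by omega)
  have hjE : (b:ℝ) - P.E ≤ j := by
    have : b ≤ j + P.E := by omega
    have : (b:ℝ) ≤ j + P.E := mod_cast this
    linarith
  have hmr : (0:ℝ) < m := mod_cast (by omega : 0 < m)
  have hab : (0:ℝ) < P.a + b := by
    have : 0 < P.a + b := by omega
    exact_mod_cast this
  have hε := P.hε
  rcases T.eq_empty_or_nonempty with hTe | ⟨p1, hp1⟩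
  · subst hTe
    simp only [card_empty, cast_zero]
    positivity
  have hq3 : (q:ℝ)^3 ≤ exp j := by
    calc (q:ℝ)^3 ≤ (P.Q * exp (b/4))^3 := by gcongr
      _ = (exp (log P.Q) * exp (b/4))^3 := by rw [exp_log (by linarith)]
      _ = exp (3*log P.Q + 3*(b/4)) := by
          rw [← exp_add, ← exp_nat_mul]; congr 1; push_cast; ring
      _ ≤ exp j := by
          apply exp_le_exp.2; linarith
  have hcop : p1.Coprime q := by
    obtain ⟨hpp, -, hl, -⟩ := P.Pset_spec (hT hp1)
    rw [hpp.coprime_iff_not_dvd]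
    intro hd
    have h1 := le_of_dvd hq hd
    have hp0 : (0:ℝ) < p1 := mod_cast hpp.pos
    have hN := P.N_pos
    have h2 : exp j ≤ p1 := by
      rw [← le_log_iff_exp_le hp0]
      have : (0:ℝ) ≤ i/P.N := by positivity
      linarith
    have h3 : (p1:ℝ) ≤ q := mod_cast h1
    have hp2 : (2:ℝ) ≤ p1 := mod_cast hpp.two_le
    have h4 : (p1:ℝ)^3 ≤ p1 := by
      calc (p1:ℝ)^3 ≤ (q:ℝ)^3 := by gcongr
        _ ≤ (p1:ℝ) := by linarith
    nlinarith [mul_pos hp0 hp0, mul_self_nonneg ((p1:ℝ)-2)]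
  have hi1 : (i:ℝ)/P.N ≤ 1 := by
    rw [div_le_one P.N_pos]; exact_mod_cast hi.le
  have hi0 : (0:ℝ) ≤ i/P.N := by have := P.N_pos; positivity
  have hmain := hj0 j (by omega) (j + i/P.N) (by linarith) (by linarith) q p1 hq hcop hq3 T (fun p hp => by
    obtain ⟨hpp, -, hl, hu⟩ := P.Pset_spec (hT hp)
    exact ⟨hpp, hTT p hp p1 hp1, hl, hu⟩)
  have hjhalf : ((P.a:ℝ) + b)/2 ≤ j := by
    have : P.a + b ≤ 2 * j := by omega
    have : (P.a:ℝ) + b ≤ 2 * j := mod_cast this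
    linarith
  have hej : exp j ≤ 3 * exp (P.a + b) / m := by
    rw [le_div_iff₀ hmr]
    have h7 : (m:ℝ) ≤ exp (Par.em m + 1) := by
      rw [← log_le_iff_le_exp hmr]
      have := P.lε_le'
      nlinarith
    calc exp j * m ≤ exp j * exp (Par.em m + 1) := by gcongr
      _ = exp 1 * exp (P.a + b) := by
          rw [← exp_add, ← exp_add, hjr]; congr 1; ring
      _ ≤ _ := by
          have := exp_one_lt_d9
          gcongr; linarith
  calc (#T : ℝ) ≤ C * P.ε * exp j / (q.totient * j) := hmain
    _ ≤ C * P.ε * (3 * exp (P.a + b) / m) / (q.totient * ((P.a + b)/2)) := by gcongr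
    _ = _ := by field_simp; ring

lemma Par.Ms_dvd_sum (P : Par) {p : ℕ} (hp : p.Prime) : ∑ m ∈ P.Ms with p ∣ m, (1:ℝ)/m ≤ (1 + P.Wg)/p := by
  have hp0 : (0:ℝ) < p := mod_cast hp.pos
  have h1 : ∑ m ∈ P.Ms with p ∣ m, (1:ℝ)/m = ∑ m ∈ P.Ms with p ∣ m, (1:ℝ)/((m/p:ℕ):ℝ)/p := by
    refine sum_congr rfl (fun m hm => ?_)
    obtain ⟨hm1, k, rfl⟩ := mem_filter.1 hm
    rw [Nat.mul_div_cancel_left _ hp.pos]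
    push_cast
    rw [div_div, mul_comm]
  rw [h1, ← sum_div]
  gcongr
  have hinj : Set.InjOn (fun m => m/p) ({m ∈ P.Ms | p ∣ m} : Finset ℕ) := by
    intro x hx y hy hxy
    obtain ⟨-, hx⟩ := mem_filter.1 (mem_coe.1 hx)
    obtain ⟨-, hy⟩ := mem_filter.1 (mem_coe.1 hy)
    rw [← Nat.div_mul_cancel hx, ← Nat.div_mul_cancel hy]
    simp only at hxy
    rw [hxy]
  rw [← sum_image (f := fun n : ℕ => (1:ℝ)/n) hinj]
  have hsub : ({m ∈ P.Ms | p ∣ m}).image (fun m => m/p) ⊆ insert 1 P.Ms := by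
    intro x hx
    obtain ⟨m, hm, rfl⟩ := mem_image.1 hx
    obtain ⟨hm1, k, rfl⟩ := mem_filter.1 hm
    simp only [Nat.mul_div_cancel_left _ hp.pos]
    obtain ⟨h2, hs, hc, -⟩ := P.Ms_spec hm1
    have hk0 : k ≠ 0 := by rintro rfl; omega
    rw [mem_insert]
    by_cases hk : k = 1
    · exact Or.inl hk
    right
    apply P.mem_Ms_of (by omega) ((primeFactors_mono (Dvd.intro_left p rfl) (by positivity)).trans hs)
    rw [cardFactors_mul hp.ne_zero hk0] at hc
    omega
  refine le_trans (sum_le_sum_of_subset_of_nonneg hsub (fun _ _ _ => by positivity)) ?_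
  rw [sum_insert]
  · simp [Par.Wg]
  · intro h; have := (P.Ms_spec h).1; omega

lemma Par.cop_Q (P : Par) {p : ℕ} (hp : p.Prime) (hw : P.w < p) : P.Q.Coprime p := by
  rw [Nat.coprime_comm, hp.coprime_iff_not_dvd]
  unfold Par.Q
  intro h
  rcases hp.dvd_mul.1 h with h | h
  · have := le_of_dvd (by norm_num) h
    have := P.hw; omega
  · unfold primorial at h
    obtain ⟨r, hr, hd⟩ := (hp.prime.dvd_finsetProd_iff _).1 h
    obtain ⟨h1, h2⟩ := mem_filter.1 hr
    have := (Nat.prime_dvd_prime_iff_eq hp h2).1 hd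
    have := mem_range.1 h1
    omega

theorem cntG : ∃ C : ℝ, 1 ≤ C ∧ ∀ P : Par, 1 ≤ P.Wg → ∃ b0 : ℕ, P.E ≤ b0 ∧ ∀ b : ℕ, b0 ≤ b → ∀ i : ℕ, i < P.N →
    (#(P.Gs b i) : ℝ) ≤ C * P.Gh b ∧ ∀ p0 c : ℕ, p0.Prime → P.w < p0 → (p0:ℝ) ≤ exp (b/4) →
      (#{h ∈ P.Gs b i | h ≡ c [MOD p0]} : ℝ) ≤ C * P.Gh b / p0 := by
  obtain ⟨C, hC, hpm⟩ := pm_cnt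
  refine ⟨4*C, by linarith, fun P hWg => ?_⟩
  obtain ⟨b0, hb0E, hb0⟩ := hpm P
  refine ⟨b0 + 1, by omega, fun b hb i hi => ?_⟩
  have hmain := hb0 b (by omega) i hi
  have hε := P.hε
  have hQ1 : (1:ℝ) ≤ P.Q := mod_cast P.Q_pos
  have hphi : (0:ℝ) < P.Q.totient := mod_cast totient_pos.2 P.Q_pos
  have hab : (0:ℝ) < P.a + b := by
    have : 0 < P.a + b := by omega
    exact_mod_cast this
  set X : ℝ := C * P.ε * exp (P.a + b) / (P.Q.totient * (P.a + b)) with hX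
  have hGh : X * P.Wg = C * P.Gh b := by rw [hX]; unfold Par.Gh; ring
  have hGh0 : 0 ≤ C * P.Gh b := by rw [← hGh]; positivity
  have hQb : (P.Q:ℝ) ≤ P.Q * exp (b/4) := by
    have : 1 ≤ exp ((b:ℝ)/4) := one_le_exp (by positivity)
    nlinarith
  have hbase : ∀ m ∈ P.Ms, ∀ T ⊆ P.Pset i (P.a + b - Par.em m), (#T:ℝ) ≤ X * (1/m) := by
    intro m hm T hT
    have := hmain m hm P.Q P.Q_pos hQb T hT (fun p hp p' hp' => (P.Pset_spec (hT hp)).2.1.trans (P.Pset_spec (hT hp')).2.1.symm)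
    refine this.trans (le_of_eq ?_)
    rw [hX, mul_one_div, div_div]; congr 1; ring
  constructor
  · calc (#(P.Gs b i) : ℝ) ≤ ∑ m ∈ P.Ms, (#(P.Pset i (P.a + b - Par.em m)) : ℝ) := by
          have : #(P.Gs b i) ≤ ∑ m ∈ P.Ms, #(P.Pset i (P.a + b - Par.em m)) := by
            unfold Par.Gs
            exact card_biUnion_le.trans (sum_le_sum (fun m _ => card_image_le))
          exact_mod_cast this
      _ ≤ ∑ m ∈ P.Ms, X * (1/m) := sum_le_sum (fun m hm => hbase m hm _ subset_rfl)
      _ = X * P.Wg := by rw [← mul_sum]; rfl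
      _ ≤ 4 * C * P.Gh b := by rw [hGh]; linarith
  · intro p0 c hp0 hwp hpb
    have hp0r : (0:ℝ) < p0 := mod_cast hp0.pos
    have hp2 : (2:ℝ) ≤ p0 := mod_cast hp0.two_le
    have hterm : ∀ m ∈ P.Ms, (#{p ∈ P.Pset i (P.a + b - Par.em m) | m * p ≡ c [MOD p0]} : ℝ) ≤
        X * (2/p0 * (1/m) + if p0 ∣ m then (1:ℝ)/m else 0) := by
      intro m hm
      have hmr : (0:ℝ) < m := by
        have := (P.Ms_spec hm).1
        exact_mod_cast (by omega : 0 < m)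
      split_ifs with hd
      · refine (hbase m hm _ (filter_subset _ _)).trans ?_
        have : (0:ℝ) ≤ 2/p0 * (1/m) := by positivity
        gcongr; linarith
      · rw [add_zero]
        have hcop := P.cop_Q hp0 hwp
        have := hmain m hm (P.Q * p0) (Nat.mul_pos P.Q_pos hp0.pos) (by push_cast; gcongr) 
          {p ∈ P.Pset i (P.a + b - Par.em m) | m * p ≡ c [MOD p0]} (filter_subset _ _) (by
            intro p hp p' hp'
            obtain ⟨h1, h2⟩ := mem_filter.1 hp
            obtain ⟨h1', h2'⟩ := mem_filter.1 hp'
            rw [← Nat.modEq_and_modEq_iff_modEq_mul hcop]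
            refine ⟨(P.Pset_spec h1).2.1.trans (P.Pset_spec h1').2.1.symm, ?_⟩
            exact ModEq.cancel_left_of_coprime ((hp0.coprime_iff_not_dvd).2 hd) (h2.trans h2'.symm))
        refine this.trans ?_
        rw [Nat.totient_mul hcop, Nat.totient_prime hp0, hX]
        have h1 : (p0:ℝ)/2 ≤ ((p0 - 1 : ℕ):ℝ) := by
          rw [cast_sub hp0.one_lt.le]; push_cast; linarith
        push_cast
        push_cast at h1
        calc C * P.ε * exp (P.a + b) / (m * (P.Q.totient * ((p0 - 1 : ℕ):ℝ)) * (P.a + b)) ≤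
            C * P.ε * exp (P.a + b) / (m * (P.Q.totient * ((p0:ℝ)/2)) * (P.a + b)) := by
              gcongr
          _ = _ := by field_simp
    calc (#{h ∈ P.Gs b i | h ≡ c [MOD p0]} : ℝ) ≤ ∑ m ∈ P.Ms, (#{p ∈ P.Pset i (P.a + b - Par.em m) | m * p ≡ c [MOD p0]} : ℝ) := by
          have : #{h ∈ P.Gs b i | h ≡ c [MOD p0]} ≤ ∑ m ∈ P.Ms, #{p ∈ P.Pset i (P.a + b - Par.em m) | m * p ≡ c [MOD p0]} := by
            have hsub : {h ∈ P.Gs b i | h ≡ c [MOD p0]} ⊆ P.Ms.biUnion (fun m => 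
                ({p ∈ P.Pset i (P.a + b - Par.em m) | m * p ≡ c [MOD p0]}).image (fun p => m * p)) := by
              intro h hh
              obtain ⟨h1, h2⟩ := mem_filter.1 hh
              obtain ⟨m, hm, p, hp, rfl⟩ := P.mem_Gs.1 h1
              exact mem_biUnion.2 ⟨m, hm, mem_image.2 ⟨p, mem_filter.2 ⟨hp, h2⟩, rfl⟩⟩
            exact (card_le_card hsub).trans (card_biUnion_le.trans (sum_le_sum (fun m _ => card_image_le)))
          exact_mod_cast this
      _ ≤ ∑ m ∈ P.Ms, X * (2/p0 * (1/m) + if p0 ∣ m then (1:ℝ)/m else 0) := sum_le_sum hterm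
      _ = X * (2/p0 * P.Wg + ∑ m ∈ P.Ms with p0 ∣ m, (1:ℝ)/m) := by
          rw [← mul_sum, sum_add_distrib, ← mul_sum, sum_filter]; rfl
      _ ≤ X * (2/p0 * P.Wg + (P.Wg + P.Wg)/p0) := by
          gcongr
          exact (P.Ms_dvd_sum hp0).trans (by gcongr)
      _ = 4 * (X * P.Wg)/p0 := by field_simp; ring
      _ = _ := by rw [hGh]; ring

/-- the primes `p < L`, `p ≡ a mod q`, with `log p mod 1` in `[α, α+ε]` -/
noncomputable def CP (q a : ℕ) (α ε : ℝ) (L : ℕ) : Finset ℕ := {p ∈ range L | p.Prime ∧ p ≡ a [MOD q] ∧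
  α ≤ Int.fract (log p) ∧ Int.fract (log p) ≤ α + ε}

theorem C1p (q a : ℕ) (hq : 1 ≤ q) (ha : a.Coprime q) {α ε : ℝ} (hα : 0 ≤ α) (hε : 0 < ε) (hαε : α + ε ≤ 1) :
    ∃ κ0 : ℝ, 0 < κ0 ∧ ∀ κ, 0 < κ → κ ≤ κ0 → ∃ L : ℕ, ∀ L' : ℕ, L ≤ L' →
      ε / (10 * q.totient * κ) ≤ ∑ p ∈ CP q a α ε L', log p * (p:ℝ)^(-(1+κ)) := by
  have : NeZero q := ⟨by omega⟩
  obtain ⟨κ0, hκ0, h⟩ := C1 q (a : ZMod q) ((ZMod.isUnit_iff_coprime a q).2 ha) hα hε hαε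
  obtain ⟨C, hC, hsC, htC⟩ := nonprime_sum
  refine ⟨min κ0 (ε/(80*q.totient*C)), by positivity, fun κ hκ hκ1 => ?_⟩
  have h1 := h κ hκ (hκ1.trans (min_le_left _ _))
  have h2 : C ≤ ε/(80*q.totient*κ) := by
    have := hκ1.trans (min_le_right _ _)
    rw [le_div_iff₀ (by positivity)] at this ⊢
    linarith
  set f : ℕ → ℝ := fun n => if (α ≤ Int.fract (log n) ∧ Int.fract (log n) ≤ α + ε) then pw q a κ n else 0 with hf
  have hf0 : ∀ n, 0 ≤ f n := fun n => by
    rw [hf]; simp only; split_ifs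
    · exact pw_nonneg _ _ _ _
    · exact le_rfl
  have hfs : Summable f := by
    refine Summable.of_nonneg_of_le hf0 (fun n => ?_) (pw_summable q (a:ZMod q) hκ)
    rw [hf]; simp only; split_ifs
    · exact le_rfl
    · exact pw_nonneg _ _ _ _
  have ht : ε/(8*q.totient*κ) ≤ ∑' n, f n := by
    have e : ε/(8*q.totient*κ) = ε/(8*q.totient)/κ := by rw [div_div]
    rw [e, div_le_iff₀ hκ]; linarith
  have htend := hfs.hasSum.tendsto_sum_nat
  have hlt : ∑' n, f n - ε/(80*q.totient*κ) < ∑' n, f n := by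
    linarith
  obtain ⟨L, hL⟩ := eventually_atTop.1 (htend.eventually (lt_mem_nhds hlt))
  refine ⟨L, fun L' hL' => ?_⟩
  have h3 := hL L' hL'
  have h4 : ∑ n ∈ range L', f n ≤ ∑ p ∈ CP q a α ε L', log p * (p:ℝ)^(-(1+κ)) + C := by
    have h5 : ∀ n ∈ range L', f n ≤ (if (n.Prime ∧ n ≡ a [MOD q] ∧ α ≤ Int.fract (log n) ∧ Int.fract (log n) ≤ α + ε) then
        log n * (n:ℝ)^(-(1+κ)) else 0) + (if n.Prime then 0 else vonMangoldt n / n) := by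
      intro n _
      rcases Nat.eq_zero_or_pos n with rfl | hn
      · simp [hf, pw_zero]
      have hn1 : (1:ℝ) ≤ n := mod_cast hn
      by_cases hp : n.Prime
      · rw [if_pos hp, add_zero, hf]
        simp only
        by_cases hc : α ≤ Int.fract (log n) ∧ Int.fract (log n) ≤ α + ε
        · rw [if_pos hc]
          by_cases hm : n ≡ a [MOD q]
          · rw [if_pos ⟨hp, hm, hc⟩]
            unfold pw residueClass
            rw [Set.indicator_of_mem, ArithmeticFunction.vonMangoldt_apply_prime hp]
            exact (ZMod.natCast_eq_natCast_iff n a q).2 hm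
          · rw [if_neg (fun h => hm h.2.1)]
            unfold pw residueClass
            rw [Set.indicator_of_notMem, zero_mul]
            exact fun h => hm ((ZMod.natCast_eq_natCast_iff n a q).1 h)
        · rw [if_neg hc]
          split_ifs
          · positivity
          · exact le_rfl
      · rw [if_neg hp, if_neg (fun h => hp h.1), zero_add, hf]
        simp only
        have hpw : pw q (a:ZMod q) κ n ≤ vonMangoldt n / n := by
          unfold pw residueClass
          have h6 : (n:ℝ)^(-(1+κ)) ≤ (n:ℝ)⁻¹ := by
            rw [← rpow_neg_one]
            exact rpow_le_rpow_of_exponent_le hn1 (by linarith)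
          have h7 : Set.indicator {n : ℕ | (n : ZMod q) = (a:ZMod q)} (fun n => vonMangoldt n) n ≤ vonMangoldt n :=
            Set.indicator_le_self' (fun _ _ => vonMangoldt_nonneg) n
          rw [div_eq_mul_inv]
          gcongr
        split_ifs
        · exact hpw
        · positivity
    refine (sum_le_sum h5).trans ?_
    rw [sum_add_distrib, ← sum_filter]
    refine add_le_add (le_of_eq rfl) ((hsC.sum_le_tsum _ (fun n _ => ?_)).trans htC)
    positivity
  have e : ε/(8*q.totient*κ) = ε/(10*q.totient*κ) + 2 * (ε/(80*q.totient*κ)) := by field_simp; ring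
  linarith

namespace Par
variable (P : Par)

noncomputable def G (b : ℕ) : Finset ℕ := (range P.N).biUnion (P.Gs b)

noncomputable def tt (j : ℕ) : ℝ := ∑ i ∈ range P.N, ∑ p ∈ P.Pset i j, log p / p

lemma tt_nonneg (j : ℕ) : 0 ≤ P.tt j := sum_nonneg (fun _ _ => sum_nonneg (fun p _ => 
  div_nonneg (log_natCast_nonneg p) (cast_nonneg p)))

lemma frac_i {i : ℕ} (hi : i < P.N) : (i:ℝ)/P.N + P.ε ≤ 1 := by
  have hN := P.N_pos
  have h1 : (i:ℝ) + 1 ≤ P.N := mod_cast hi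
  have h2 := P.lε_le
  have h3 : P.ε ≤ (P.l0+1) * P.ε := by
    have := P.hε
    nlinarith
  have h4 : 1/(4*(P.N:ℝ)) ≤ 1/P.N := by
    apply one_div_le_one_div_of_le hN; linarith
  have h5 : ((i:ℝ)+1)/P.N ≤ 1 := by rw [div_le_one hN]; exact h1
  rw [add_div] at h5
  linarith

lemma ind_i {i i' : ℕ} {x δ : ℝ} (hδ : δ < 1/P.N) (h1 : (i:ℝ)/P.N ≤ x) (h2 : x ≤ i/P.N + δ) (h1' : (i':ℝ)/P.N ≤ x) (h2' : x ≤ i'/P.N + δ) : i = i' := by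
  have hN := P.N_pos
  rcases lt_trichotomy i i' with h | h | h
  · exfalso
    have : (i:ℝ) + 1 ≤ i' := mod_cast h
    have h3 : ((i:ℝ)+1)/P.N ≤ i'/P.N := by gcongr
    rw [add_div] at h3; linarith
  · exact h
  · exfalso
    have : (i':ℝ) + 1 ≤ i := mod_cast h
    have h3 : ((i':ℝ)+1)/P.N ≤ i/P.N := by gcongr
    rw [add_div] at h3; linarith

lemma ε_lt : P.ε < 1/P.N := by
  have hN := P.N_pos
  have h2 := P.lε_le
  have h3 : P.ε ≤ (P.l0+1) * P.ε := by
    have := P.hε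
    nlinarith
  have h4 : 1/(4*(P.N:ℝ)) < 1/P.N := by
    apply one_div_lt_one_div_of_lt hN; linarith
  linarith

lemma card_G : ∃ b0 : ℕ, P.E ≤ b0 ∧ ∀ b, b0 ≤ b → 
    exp (P.a + b) / (P.a + b) * ∑ m ∈ P.Ms, 1/(m:ℝ) * P.tt (P.a + b - em m) ≤ #(P.G b) := by
  obtain ⟨b1, hb1⟩ := ev_nat (P.E + log P.w1 + 1)
  refine ⟨b1 + P.E + 1, by omega, fun b hb => ?_⟩
  have hab : (0:ℝ) < P.a + b := by
    have : 0 < P.a + b := by omega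
    exact_mod_cast this
  have hN := P.N_pos
  have hbr := hb1 b (by omega)
  have hcard : ∑ m ∈ P.Ms, ∑ i ∈ range P.N, #(P.Pset i (P.a + b - em m)) ≤ #(P.G b) := by
    have e : ∑ m ∈ P.Ms, ∑ i ∈ range P.N, #(P.Pset i (P.a + b - em m)) = 
        #(P.Ms.sigma (fun m => (range P.N).sigma (fun i => P.Pset i (P.a + b - em m)))) := by
      simp only [card_sigma]
    rw [e]
    apply card_le_card_of_injOn (fun x => x.1 * x.2.2)
    · rintro ⟨m, i, p⟩ hx
      simp only [coe_sigma, Set.mem_sigma_iff, mem_coe] at hx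
      exact mem_coe.2 (mem_biUnion.2 ⟨i, hx.2.1, P.mem_Gs.2 ⟨m, hx.1, p, hx.2.2, rfl⟩⟩)
    · rintro ⟨m, i, p⟩ hx ⟨m', i', p'⟩ hx' heq
      simp only [coe_sigma, Set.mem_sigma_iff, mem_coe] at hx hx'
      simp only at heq
      have big : ∀ m ∈ P.Ms, ∀ i p, p ∈ P.Pset i (P.a + b - em m) → p.Prime ∧ p ∉ P.S := by
        intro m hm i p hp
        obtain ⟨hpp, -, hl, -⟩ := P.Pset_spec hp
        refine ⟨hpp, fun hS => ?_⟩
        have h1 := (P.hS p hS).2.2.2.2.2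
        have hp0 : (0:ℝ) < p := mod_cast hpp.pos
        have h2 : log p ≤ log P.w1 := log_le_log hp0 (mod_cast h1.le)
        have h3 := (P.Ms_spec hm).2.2.2.2.2.2.1
        have h4 : b ≤ P.a + b - em m + P.E := by omega
        have h5 : (b:ℝ) ≤ (P.a + b - em m : ℕ) + P.E := mod_cast h4
        have h6 : (0:ℝ) ≤ i/P.N := by positivity
        linarith
      obtain ⟨hp, hpS⟩ := big m hx.1 i p hx.2.2
      obtain ⟨hp', hpS'⟩ := big m' hx'.1 i' p' hx'.2.2
      have hpp : p = p' := by
        have hd : p ∣ m' * p' := by rw [← heq]; exact Dvd.intro_left m rfl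
        rcases hp.dvd_mul.1 hd with h | h
        · exfalso
          have h2 := P.Ms_spec hx'.1
          exact hpS (h2.2.1 (mem_primeFactors.2 ⟨hp, h, by omega⟩))
        · exact (Nat.prime_dvd_prime_iff_eq hp hp').1 h
      subst hpp
      have hmm : m = m' := Nat.eq_of_mul_eq_mul_right hp.pos heq
      subst hmm
      have hii : i = i' := by
        obtain ⟨-, -, h1, h2⟩ := P.Pset_spec hx.2.2
        obtain ⟨-, -, h1', h2'⟩ := P.Pset_spec hx'.2.2
        exact P.ind_i P.ε_lt (x := log p - (P.a + b - em m : ℕ)) (by linarith) (by linarith) (by linarith) (by linarith)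
      subst hii
      rfl
  have hcardr : ∑ m ∈ P.Ms, ∑ i ∈ range P.N, (#(P.Pset i (P.a + b - em m)) : ℝ) ≤ #(P.G b) := mod_cast hcard
  refine le_trans ?_ hcardr
  rw [mul_sum]
  refine sum_le_sum (fun m hm => ?_)
  obtain ⟨h2, -, -, h3, -, h5a, h5, -⟩ := P.Ms_spec hm
  unfold tt
  rw [mul_sum, mul_sum]
  refine sum_le_sum (fun i hi => ?_)
  have hiN := mem_range.1 hi
  rw [mul_sum, mul_sum, card_eq_sum_ones]
  push_cast
  refine sum_le_sum (fun p hp => ?_)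
  obtain ⟨hpp, -, hl, hu⟩ := P.Pset_spec hp
  have hp0 : (0:ℝ) < p := mod_cast hpp.pos
  have hmr : (0:ℝ) < m := mod_cast (by omega : 0 < m)
  have hj : ((P.a + b - em m : ℕ):ℝ) = P.a + b - em m := by
    rw [cast_sub (by omega)]; push_cast; ring
  rw [hj] at hl hu
  have h6 : (0:ℝ) ≤ i/P.N := by positivity
  have h7 := P.frac_i hiN
  have h8 : (2:ℝ) ≤ em m := mod_cast (by omega : 2 ≤ em m)
  have h9 : exp (P.a + b) ≤ m * p := by
    have : exp (P.a + b) ≤ exp (log m + log p) := by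
      apply exp_le_exp.2; linarith
    rwa [exp_add (log m), exp_log hmr, exp_log hp0] at this
  have h10 : log p ≤ P.a + b := by linarith
  have : exp (P.a + b) / (P.a + b) * (1/m * (log p/p)) = (exp (P.a+b) * log p)/((m*p)*(P.a+b)) := by
    field_simp
  rw [this, div_le_one (by positivity)]
  gcongr

/-- upper bound of the weighted prime sum by the `tt j` -/
lemma CP_le (B L : ℕ) {κ : ℝ} (hκ : 0 < κ) : ∑ i ∈ range P.N, ∑ p ∈ CP P.Q (P.r i) (i/P.N) P.ε L, log p * (p:ℝ)^(-(1+κ)) ≤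
    P.N * (∑ p ∈ range ⌈exp B⌉₊, log p) + ∑ j ∈ Ico B (B + L), P.tt j * exp (-κ*j) := by
  classical
  unfold tt
  simp only [sum_mul]
  rw [sum_comm (s := Ico B (B+L))]
  have e : (P.N:ℝ) * (∑ p ∈ range ⌈exp B⌉₊, log p) = ∑ i ∈ range P.N, ∑ p ∈ range ⌈exp B⌉₊, log p := by
    simp
  rw [e, ← sum_add_distrib]
  refine sum_le_sum (fun i hi => ?_)
  rw [← sum_filter_add_sum_filter_not (CP P.Q (P.r i) (i/P.N) P.ε L) (fun p => p < ⌈exp B⌉₊)]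
  apply add_le_add
  · calc _ ≤ ∑ p ∈ CP P.Q (P.r i) (i/P.N) P.ε L with p < ⌈exp B⌉₊, log p := by
          refine sum_le_sum (fun p hp => ?_)
          have hp1 := (mem_filter.1 (mem_filter.1 hp).1).2.1
          have h1 : (1:ℝ) ≤ p := mod_cast hp1.one_lt.le
          have h2 : (p:ℝ)^(-(1+κ)) ≤ 1 := rpow_le_one_of_one_le_of_nonpos h1 (by linarith)
          have := log_natCast_nonneg p
          nlinarith
      _ ≤ _ := by
          refine sum_le_sum_of_subset_of_nonneg (fun p hp => mem_range.2 (mem_filter.1 hp).2) (fun p _ _ => log_natCast_nonneg p)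
  · have hmaps : ∀ p ∈ ({p ∈ CP P.Q (P.r i) (i/P.N) P.ε L | ¬ p < ⌈exp B⌉₊} : Finset ℕ), ⌊log p⌋₊ ∈ Ico B (B+L) := by
      intro p hp
      obtain ⟨h1, h2⟩ := mem_filter.1 hp
      obtain ⟨h3, h4, -⟩ := mem_filter.1 h1
      have hp0 : (0:ℝ) < p := mod_cast h4.pos
      have h5 : exp B ≤ p := ceil_le.1 (not_lt.1 h2)
      rw [mem_Ico]
      constructor
      · apply le_floor
        rwa [le_log_iff_exp_le hp0]
      · have h6 : log p ≤ p := (Real.log_le_sub_one_of_pos hp0).trans (by linarith)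
        have h7 : ⌊log p⌋₊ ≤ p := Nat.floor_le_of_le h6
        have := mem_range.1 h3
        omega
    rw [← sum_fiberwise_of_maps_to hmaps]
    refine sum_le_sum (fun j hj => ?_)
    calc _ ≤ ∑ p ∈ CP P.Q (P.r i) (i/P.N) P.ε L with ¬ p < ⌈exp B⌉₊ ∧ ⌊log p⌋₊ = j, log p / p * exp (-κ*j) := by
          rw [filter_filter]
          refine sum_le_sum (fun p hp => ?_)
          obtain ⟨h1, h2, h3⟩ := mem_filter.1 hp
          obtain ⟨-, h4, -⟩ := mem_filter.1 h1
          have hp0 : (0:ℝ) < p := mod_cast h4.pos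
          have hl := log_natCast_nonneg p
          have h5 : (j:ℝ) ≤ log p := by rw [← h3]; exact floor_le hl
          have h6 : (p:ℝ)^(-(1+κ)) ≤ 1/p * exp (-κ*j) := by
            rw [rpow_def_of_pos hp0]
            have : (1:ℝ)/p = exp (-log p) := by
              rw [exp_neg, exp_log hp0, one_div]
            rw [this, ← exp_add]
            apply exp_le_exp.2
            nlinarith
          calc log p * (p:ℝ)^(-(1+κ)) ≤ log p * (1/p * exp (-κ*j)) := by gcongr
            _ = _ := by ring
      _ ≤ _ := by
          refine sum_le_sum_of_subset_of_nonneg (fun p hp => ?_) (fun p _ _ => by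
            have := log_natCast_nonneg p
            positivity)
          obtain ⟨h1, h2, h3⟩ := mem_filter.1 hp
          obtain ⟨h0, h4, h5, h6, h7⟩ := mem_filter.1 h1
          have hp0 : (0:ℝ) < p := mod_cast h4.pos
          have hl := log_natCast_nonneg p
          have hfl : ((⌊log p⌋₊ : ℕ):ℝ) = log p - Int.fract (log p) := by
            rw [natCast_floor_eq_intCast_floor hl, Int.self_sub_fract]
          have hfl2 := Int.fract_lt_one (log p)
          rw [h3] at hfl
          unfold Pset
          refine mem_filter.2 ⟨mem_range.2 (lt_ceil.2 ?_), h4, h5, by linarith, by linarith⟩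
          rw [← log_lt_iff_lt_exp hp0]
          linarith

theorem lowG (hW : 1 ≤ P.Wg) (B0 : ℕ) : ∃ b, B0 ≤ b ∧ P.N * P.Gh b / 16 ≤ #(P.G b) := by
  classical
  by_contra hcon
  push Not at hcon
  obtain ⟨b0, hb0, hG⟩ := P.card_G
  set B := B0 + b0 + 1
  have hphi : (0:ℝ) < P.Q.totient := mod_cast totient_pos.2 P.Q_pos
  have hN := P.N_pos
  have hε := P.hε
  set θ : ℝ := P.N * P.ε / (16 * P.Q.totient) with hθ
  have hθ0 : 0 < θ := by positivity
  -- the averaged bound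
  have hav : ∀ b, B ≤ b → ∑ m ∈ P.Ms, 1/(m:ℝ) * P.tt (P.a + b - em m) ≤ θ * P.Wg := by
    intro b hb
    have h1 := hG b (by omega)
    have h2 := (hcon b (by omega)).le
    have hab : (0:ℝ) < P.a + b := by
      have : 0 < P.a + b := by omega
      exact_mod_cast this
    have h3 : P.N * P.Gh b / 16 = exp (P.a + b) / (P.a + b) * (θ * P.Wg) := by
      unfold Gh; rw [hθ]; field_simp
    rw [h3] at h2
    exact le_of_mul_le_mul_left (h1.trans h2) (by positivity)
  choose! κ0 hκ0 hC using fun (i : ℕ) (hi : i ∈ range P.N) => C1p P.Q (P.r i) P.Q_pos (P.hr i) (α := i/P.N) (ε := P.ε) (by positivity) hε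
    (P.frac_i (mem_range.1 hi))
  set T0 : ℝ := P.N * (∑ p ∈ range ⌈exp ((P.a + B : ℕ):ℝ)⌉₊, log p)
  have hT0' : 0 ≤ T0 := by
    positivity
  -- choose κ
  have hev1 : ∀ᶠ κ : ℝ in 𝓝[>] 0, ∀ i ∈ range P.N, κ ≤ κ0 i := by
    rw [eventually_all_finset]
    intro i hi
    exact (nhdsWithin_le_nhds (Iic_mem_nhds (hκ0 i hi)))
  have hev2 : ∀ᶠ κ : ℝ in 𝓝[>] 0, κ * T0 + exp (κ * P.E) * (θ * (κ + 1)) < (8/5) * θ := by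
    apply nhdsWithin_le_nhds
    have hc : Continuous (fun κ : ℝ => κ * T0 + exp (κ * P.E) * (θ * (κ + 1))) := by fun_prop
    have := hc.tendsto 0
    simp only [zero_mul, Real.exp_zero, zero_add, one_mul, mul_one] at this
    exact this.eventually (gt_mem_nhds (by linarith))
  obtain ⟨κ, ⟨h1, h2⟩, hκ⟩ := ((hev1.and hev2).and self_mem_nhdsWithin).exists
  have hκ' : (0:ℝ) < κ := hκ
  choose! L hL using fun i hi => hC i hi κ hκ' (h1 i hi)
  set LL := ∑ i ∈ range P.N, L i
  have hlow : P.N * (P.ε / (10 * P.Q.totient * κ)) ≤ ∑ i ∈ range P.N, ∑ p ∈ CP P.Q (P.r i) (i/P.N) P.ε LL, log p * (p:ℝ)^(-(1+κ)) := by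
    calc P.N * (P.ε / (10 * P.Q.totient * κ)) = ∑ i ∈ range P.N, P.ε / (10 * P.Q.totient * κ) := by simp
      _ ≤ _ := sum_le_sum (fun i hi => hL i hi LL (single_le_sum (f := L) (fun _ _ => Nat.zero_le _) hi))
  have hup := hlow.trans (P.CP_le (P.a + B) LL hκ')
  -- geometric sum
  have hgeo : ∀ n : ℕ, ∑ k ∈ range n, exp (-κ * k) ≤ (κ+1)/κ := by
    intro n
    have e1 : ∀ k : ℕ, exp (-κ * k) = (exp (-κ))^k := by
      intro k; rw [← exp_nat_mul]; ring_nf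
    simp only [e1]
    have h3 := mul_neg_geom_sum (exp (-κ)) n
    have h4 : exp (-κ) * (κ+1) ≤ 1 := by
      rw [exp_neg, inv_mul_le_iff₀ (exp_pos _), mul_one]
      exact add_one_le_exp κ
    have h5 : 0 ≤ exp (-κ)^n := by positivity
    set s := ∑ k ∈ range n, exp (-κ)^k
    have hs0 : 0 ≤ s := sum_nonneg (fun k _ => by positivity)
    rw [le_div_iff₀ hκ']
    have h7 : κ ≤ (κ+1) * (1 - exp (-κ)) := by linarith
    nlinarith [mul_le_mul_of_nonneg_right h7 hs0]
  have hS : P.Wg * ∑ j ∈ Ico (P.a + B) (P.a + B + LL), P.tt j * exp (-κ*j) ≤ exp (κ * P.E) * (θ * P.Wg * ((κ+1)/κ)) := by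
    calc P.Wg * ∑ j ∈ Ico (P.a + B) (P.a + B + LL), P.tt j * exp (-κ*j) = 
        ∑ m ∈ P.Ms, 1/(m:ℝ) * ∑ j ∈ Ico (P.a + B) (P.a + B + LL), P.tt j * exp (-κ*j) := by
          rw [← sum_mul]; rfl
      _ ≤ ∑ m ∈ P.Ms, 1/(m:ℝ) * ∑ b ∈ Ico B (B + LL + P.E), exp (κ*P.E) * (P.tt (P.a + b - em m) * exp (-κ*b)) := by
          refine sum_le_sum (fun m hm => mul_le_mul_of_nonneg_left ?_ (by positivity))
          obtain ⟨-, -, -, -, -, h5a, h5, -⟩ := P.Ms_spec hm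
          have hinj : Set.InjOn (fun j => j + em m - P.a) (Ico (P.a + B) (P.a + B + LL)) := by
            intro x hx y hy hxy
            simp only at hxy
            omega
          calc ∑ j ∈ Ico (P.a + B) (P.a + B + LL), P.tt j * exp (-κ*j) ≤ 
              ∑ j ∈ Ico (P.a + B) (P.a + B + LL), exp (κ*P.E) * (P.tt (P.a + (j + em m - P.a) - em m) * exp (-κ*((j + em m - P.a : ℕ):ℝ))) := by
                refine sum_le_sum (fun j hj => ?_)
                have e1 : P.a + (j + em m - P.a) - em m = j := by omega
                have e2 : ((j + em m - P.a : ℕ):ℝ) ≤ j + P.E := by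
                  have : j + em m - P.a ≤ j + P.E := by omega
                  exact_mod_cast this
                rw [e1, mul_left_comm, ← exp_add]
                have := P.tt_nonneg j
                gcongr
                nlinarith
            _ = ∑ b ∈ (Ico (P.a + B) (P.a + B + LL)).image (fun j => j + em m - P.a), exp (κ*P.E) * (P.tt (P.a + b - em m) * exp (-κ*b)) := by
                rw [sum_image hinj]
            _ ≤ _ := by
                refine sum_le_sum_of_subset_of_nonneg (fun b hb => ?_) (fun b _ _ => ?_)
                · obtain ⟨j, hj, rfl⟩ := mem_image.1 hb
                  rw [mem_Ico] at hj ⊢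
                  omega
                · have := P.tt_nonneg (P.a + b - em m)
                  positivity
      _ = exp (κ*P.E) * ∑ b ∈ Ico B (B + LL + P.E), (∑ m ∈ P.Ms, 1/(m:ℝ) * P.tt (P.a + b - em m)) * exp (-κ*b) := by
          simp only [mul_sum, sum_mul]
          rw [sum_comm]
          refine sum_congr rfl (fun b _ => sum_congr rfl (fun m _ => by ring))
      _ ≤ exp (κ*P.E) * ∑ b ∈ Ico B (B + LL + P.E), (θ * P.Wg) * exp (-κ*b) := by
          gcongr with b hb
          exact hav b (mem_Ico.1 hb).1
      _ ≤ exp (κ*P.E) * ∑ b ∈ range (B + LL + P.E), (θ * P.Wg) * exp (-κ*b) := by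
          gcongr
          grind
      _ ≤ _ := by
          rw [← mul_sum]
          gcongr
          exact hgeo _
  have hS2 : ∑ j ∈ Ico (P.a + B) (P.a + B + LL), P.tt j * exp (-κ*j) ≤ exp (κ * P.E) * (θ * ((κ+1)/κ)) := by
    refine le_of_mul_le_mul_left (hS.trans (le_of_eq ?_)) (by linarith : 0 < P.Wg)
    ring
  have h3 : P.N * (P.ε / (10 * P.Q.totient * κ)) ≤ T0 + exp (κ * P.E) * (θ * ((κ+1)/κ)) := hup.trans (by gcongr)
  have h4 : P.N * (P.ε / (10 * P.Q.totient * κ)) = (8/5) * θ / κ := by rw [hθ]; field_simp; ring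
  have h5 : T0 + exp (κ * P.E) * (θ * ((κ+1)/κ)) = (κ * T0 + exp (κ * P.E) * (θ * (κ + 1)))/κ := by field_simp
  rw [h4, h5, div_le_div_iff_of_pos_right hκ'] at h3
  linarith

/-- the sieving limit -/
noncomputable def YY (b : ℕ) : ℕ := ⌈exp b⌉₊
def Wm : ℕ := 2 * ∏ p ∈ P.w1.primesBelow \ P.S, p
noncomputable def Big (b : ℕ) : Finset ℕ := {p ∈ (YY b).primesBelow | b ≤ ⌊log p⌋₊ + P.E ∧ ∃ i < P.N, p ∈ P.Pset i ⌊log p⌋₊}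
noncomputable def UU (b : ℕ) : Finset ℕ := {p ∈ (YY b).primesBelow | P.w1 ≤ p ∧ p ∉ P.Big b}
noncomputable def qm (b : ℕ) (Dr : Finset ℕ) : ℕ := P.Wm * ∏ p ∈ P.UU b \ Dr, p

lemma w1_exp : exp (P.a + 1 + P.E) < P.w1 := P.hw1

lemma w1_gt : 2 < P.w1 := by
  have h := P.w1_exp
  have h1 : exp 1 ≤ exp (P.a + 1 + P.E) := by
    apply exp_le_exp.2
    linarith
  have h2 : (2:ℝ) ≤ exp 1 := by
    have := add_one_le_exp (1:ℝ); linarith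
  have : (2:ℝ) < P.w1 := by linarith
  exact_mod_cast this

lemma two_notMem_S : 2 ∉ P.S := fun h => by
  have := (P.hS 2 h).2.2.2.2.1
  have := P.hw; omega

lemma prime_dvd_Wm {p : ℕ} (hp : p.Prime) : p ∣ P.Wm ↔ p < P.w1 ∧ p ∉ P.S := by
  unfold Wm
  rw [hp.dvd_mul, hp.prime.dvd_finsetProd_iff]
  constructor
  · rintro (h | ⟨q, hq, h⟩)
    · have := (Nat.prime_dvd_prime_iff_eq hp prime_two).1 h
      subst this
      exact ⟨P.w1_gt, P.two_notMem_S⟩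
    · obtain ⟨h1, h2⟩ := Finset.mem_sdiff.1 hq
      have h3 := mem_primesBelow.1 h1
      have := (Nat.prime_dvd_prime_iff_eq hp h3.2).1 h
      subst this
      exact ⟨h3.1, h2⟩
  · rintro ⟨h1, h2⟩
    exact Or.inr ⟨p, Finset.mem_sdiff.2 ⟨mem_primesBelow.2 ⟨h1, hp⟩, h2⟩, dvd_rfl⟩

lemma UU_spec {b p : ℕ} (h : p ∈ P.UU b) : p.Prime ∧ p < YY b ∧ P.w1 ≤ p ∧ p ∉ P.Big b := by
  obtain ⟨h1, h2, h3⟩ := mem_filter.1 h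
  have := mem_primesBelow.1 h1
  exact ⟨this.2, this.1, h2, h3⟩

lemma prime_dvd_qm {p b : ℕ} {Dr : Finset ℕ} (hp : p.Prime) : p ∣ P.qm b Dr ↔ (p < P.w1 ∧ p ∉ P.S) ∨ (p ∈ P.UU b ∧ p ∉ Dr) := by
  unfold qm
  rw [hp.dvd_mul, P.prime_dvd_Wm hp, hp.prime.dvd_finsetProd_iff]
  apply or_congr Iff.rfl
  constructor
  · rintro ⟨q, hq, h⟩
    obtain ⟨h1, h2⟩ := Finset.mem_sdiff.1 hq
    have := (Nat.prime_dvd_prime_iff_eq hp (P.UU_spec h1).1).1 h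
    subst this
    exact ⟨h1, h2⟩
  · rintro ⟨h1, h2⟩
    exact ⟨p, Finset.mem_sdiff.2 ⟨h1, h2⟩, dvd_rfl⟩

lemma Wm_pos : 1 ≤ P.Wm := by
  unfold Wm
  have : 0 < ∏ p ∈ P.w1.primesBelow \ P.S, p := prod_pos (fun p hp => 
    (mem_primesBelow.1 (Finset.mem_sdiff.1 hp).1).2.pos)
  omega

lemma qm_pos (b : ℕ) (Dr : Finset ℕ) : 1 ≤ P.qm b Dr := by
  unfold qm
  exact Nat.mul_pos P.Wm_pos (prod_pos (fun p hp => (P.UU_spec (Finset.mem_sdiff.1 hp).1).1.pos))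

lemma two_dvd_qm (b : ℕ) (Dr : Finset ℕ) : 2 ∣ P.qm b Dr := by
  unfold qm Wm
  rw [mul_assoc]
  exact Dvd.intro _ rfl

lemma w_lt_w1 (hne : P.S.Nonempty) : P.w < P.w1 := by
  obtain ⟨p, hp⟩ := hne
  have := (P.hS p hp).2.2.2.2; omega

lemma Q_dvd_qm (hne : P.S.Nonempty) (b : ℕ) (Dr : Finset ℕ) : P.Q ∣ P.qm b Dr := by
  unfold qm Wm Q primorial
  apply Dvd.dvd.mul_right
  apply mul_dvd_mul_left
  apply prod_dvd_prod_of_subset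
  intro p hp
  obtain ⟨h1, h2⟩ := mem_filter.1 hp
  have h3 := mem_range.1 h1
  have h4 := P.w_lt_w1 hne
  refine Finset.mem_sdiff.2 ⟨mem_primesBelow.2 ⟨by omega, h2⟩, fun h => ?_⟩
  have := (P.hS p h).2.2.2.2.1
  omega

lemma floor_log {i j p : ℕ} (hi : i < P.N) (hp : p ∈ P.Pset i j) : ⌊log p⌋₊ = j := by
  obtain ⟨hpp, -, h1, h2⟩ := P.Pset_spec hp
  have hN := P.N_pos
  rw [Nat.floor_eq_iff (log_natCast_nonneg p)]
  have h0 : (0:ℝ) ≤ i/P.N := by positivity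
  refine ⟨by linarith, ?_⟩
  have h7 : (i:ℝ)/P.N + P.ε < 1 := by
    have h5 : ((i:ℝ)+1)/P.N ≤ 1 := by rw [div_le_one hN]; exact_mod_cast hi
    rw [add_div] at h5
    have := P.ε_lt
    linarith
  linarith

lemma good_big : ∃ b0 : ℕ, P.E ≤ b0 ∧ ∀ b, b0 ≤ b → ∀ i < P.N, ∀ m ∈ P.Ms, ∀ p ∈ P.Pset i (P.a + b - em m), p ∈ P.Big b ∧ P.w1 ≤ p := by
  obtain ⟨b1, hb1⟩ := ev_nat (P.E + log P.w1 + 1)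
  refine ⟨b1 + P.E + 1, by omega, fun b hb i hi m hm p hp => ?_⟩
  obtain ⟨hpp, -, hl, hu⟩ := P.Pset_spec hp
  have hp0 : (0:ℝ) < p := mod_cast hpp.pos
  obtain ⟨-, -, -, -, -, h5a, h5, -⟩ := P.Ms_spec hm
  have hfl := P.floor_log hi hp
  have hN := P.N_pos
  have h3 := P.frac_i hi
  have h0 : (0:ℝ) ≤ i/P.N := by positivity
  have hj1 : (b:ℝ) ≤ (P.a + b - em m : ℕ) + P.E := mod_cast (by omega : b ≤ (P.a + b - em m : ℕ) + P.E)
  have hj2 : ((P.a + b - em m : ℕ):ℝ) + 2 ≤ b := mod_cast (by omega : (P.a + b - em m : ℕ) + 2 ≤ b)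
  constructor
  · unfold Big
    refine mem_filter.2 ⟨mem_primesBelow.2 ⟨?_, hpp⟩, by omega, i, hi, by rw [hfl]; exact hp⟩
    unfold YY
    rw [lt_ceil, ← log_lt_iff_lt_exp hp0]
    linarith
  · have := hb1 b (by omega)
    have hw1 : (0:ℝ) < P.w1 := by
      have := P.w1_gt
      exact_mod_cast (by omega : 0 < P.w1)
    have : log P.w1 ≤ log p := by linarith
    exact_mod_cast (Real.log_le_log_iff hw1 hp0).1 this

lemma good_coprime : ∃ b0 : ℕ, P.E ≤ b0 ∧ ∀ b, b0 ≤ b → ∀ h ∈ P.G b, ∀ Dr, h.Coprime (P.qm b Dr) := by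
  obtain ⟨b0, hb0E, hb0⟩ := P.good_big
  refine ⟨b0, hb0E, fun b hb h hh Dr => ?_⟩
  obtain ⟨i, hi, hh⟩ := mem_biUnion.1 hh
  obtain ⟨m, hm, p, hp, rfl⟩ := P.mem_Gs.1 hh
  obtain ⟨hB, hw⟩ := hb0 b hb i (mem_range.1 hi) m hm p hp
  have hpp := (P.Pset_spec hp).1
  apply Coprime.mul_left
  · apply Nat.coprime_of_dvd
    intro k hk hkm hkq
    have hkS := (P.Ms_spec hm).2.1 (mem_primeFactors.2 ⟨hk, hkm, by have := (P.Ms_spec hm).1; omega⟩)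
    rcases (P.prime_dvd_qm hk).1 hkq with h | h
    · exact h.2 hkS
    · have h1 := (P.UU_spec h.1).2.2.1
      have h2 := (P.hS k hkS).2.2.2.2.2
      omega
  · rw [hpp.coprime_iff_not_dvd, P.prime_dvd_qm hpp]
    rintro (h | h)
    · omega
    · exact (P.UU_spec h.1).2.2.2 hB

lemma survivors : ∃ b0 : ℕ, P.E ≤ b0 ∧ ∀ b, b0 ≤ b → ∀ Dr ⊆ P.UU b, ∀ h : ℕ, exp (P.a + b) ≤ h → h < exp (P.a + b + 1) → 
    h.Coprime (P.qm b Dr) → h ∈ P.G b ∨ h.Prime ∨ (∃ m p, h = m * p ∧ p.Prime ∧ m ≠ 0 ∧ m.primeFactors ⊆ P.S ∧ P.l0 < cardFactors m ∧ m < P.w1) ∨ 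
      h.primeFactors ⊆ P.S ∪ Dr := by
  obtain ⟨b1, hb1⟩ := ev_nat (P.E + P.a + 2)
  refine ⟨b1 + P.E + 1, by omega, fun b hb Dr hDr h hh1 hh2 hcop => ?_⟩
  have hbr := hb1 b (by omega)
  have hh0r : (0:ℝ) < h := lt_of_lt_of_le (exp_pos _) hh1
  have hh0 : 0 < h := mod_cast hh0r
  have hN := P.N_pos
  -- classification of prime factors
  have hcl : ∀ p, p.Prime → p ∣ h → p ∈ P.S ∨ p ∈ Dr ∨ p ∈ P.Big b ∨ exp b ≤ p := by
    intro p hp hd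
    have hn : ¬ p ∣ P.qm b Dr := fun h2 => hp.one_lt.ne' (Nat.eq_one_of_dvd_one (by rw [← hcop]; exact Nat.dvd_gcd hd h2))
    rw [P.prime_dvd_qm hp] at hn
    push Not at hn
    by_cases hlt : p < P.w1
    · exact Or.inl (hn.1 hlt)
    by_cases hY : p < YY b
    · by_cases hB : p ∈ P.Big b
      · exact Or.inr (Or.inr (Or.inl hB))
      · exact Or.inr (Or.inl (hn.2 (mem_filter.2 ⟨mem_primesBelow.2 ⟨hY, hp⟩, by omega, hB⟩)))
    · exact Or.inr (Or.inr (Or.inr (ceil_le.1 (not_lt.1 hY))))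
  by_cases hA : ∃ p, p.Prime ∧ p ∣ h ∧ exp b ≤ p
  · obtain ⟨p, hp, ⟨k, rfl⟩, hpb⟩ := hA
    right; left
    have hk0 : k ≠ 0 := by rintro rfl; simp at hh0
    have hk1 : (k:ℝ) < exp (P.a + 1) := by
      push_cast at hh2
      have h2 : exp (P.a + b + 1) = exp b * exp (P.a + 1) := by rw [← exp_add]; congr 1; ring
      rw [h2] at hh2
      have h3 : exp b * k ≤ p * k := by gcongr
      exact lt_of_mul_lt_mul_left (lt_of_le_of_lt h3 hh2) (exp_pos _).le
    have : k = 1 := by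
      by_contra hne
      obtain ⟨r, hr, hrd⟩ := Nat.exists_prime_and_dvd hne
      have hrk : (r:ℝ) ≤ k := mod_cast le_of_dvd (by omega) hrd
      have hrw : (r:ℝ) < P.w1 := by
        have h3 : exp (P.a + 1) ≤ exp (P.a + 1 + P.E) := exp_le_exp.2 (by linarith)
        have := P.w1_exp
        linarith
      rcases hcl r hr (Dvd.dvd.mul_left hrd p) with h | h | h | h
      · have h3 := (P.hS r h).2.2.2.1
        have h4 : exp (P.a + 1) ≤ exp (P.a + 2) := exp_le_exp.2 (by linarith)
        linarith
      · have h3 := (P.UU_spec (hDr h)).2.2.1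
        have h4 : (P.w1:ℝ) ≤ r := mod_cast h3
        linarith
      · obtain ⟨-, h3, -⟩ := mem_filter.1 h
        have hr0 : (0:ℝ) < r := mod_cast hr.pos
        have h4 := floor_le (log_natCast_nonneg r)
        have h5 : (b:ℝ) ≤ ⌊log r⌋₊ + P.E := mod_cast h3
        have h6 : log r < P.a + 1 := by
          rw [log_lt_iff_lt_exp hr0]; linarith
        linarith
      · have h4 : exp (P.a + 1) ≤ exp b := exp_le_exp.2 (by linarith)
        linarith
    rw [this, mul_one]; exact hp
  push Not at hA
  by_cases hBg : ∃ p, p ∣ h ∧ p ∈ P.Big b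
  · obtain ⟨p, ⟨m, rfl⟩, hpB⟩ := hBg
    obtain ⟨hpY, hpE, i, hi, hpi⟩ := mem_filter.1 hpB
    obtain ⟨hpY, hp⟩ := mem_primesBelow.1 hpY
    have hp0 : (0:ℝ) < p := mod_cast hp.pos
    have hm0 : m ≠ 0 := by rintro rfl; simp at hh0
    have hm0r : (0:ℝ) < m := mod_cast Nat.pos_of_ne_zero hm0
    have hlog : log ((p * m : ℕ):ℝ) = log p + log m := by
      push_cast; exact log_mul hp0.ne' hm0r.ne'
    have hL1 : (P.a:ℝ) + b ≤ log p + log m := by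
      rw [← hlog, le_log_iff_exp_le hh0r]; exact hh1
    have hL2 : log p + log m < P.a + b + 1 := by
      rw [← hlog, log_lt_iff_lt_exp hh0r]; exact hh2
    have hpb : log p < b := by
      rw [log_lt_iff_lt_exp hp0]; exact lt_ceil.1 hpY
    have hfl := floor_le (log_natCast_nonneg p)
    have hEr : (b:ℝ) ≤ ⌊log p⌋₊ + P.E := mod_cast hpE
    have hmw : m < P.w1 := by
      have : (m:ℝ) < P.w1 := by
        refine lt_trans ?_ P.w1_exp
        rw [← log_lt_iff_lt_exp hm0r]; linarith
      exact_mod_cast this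
    have hm2 : 2 ≤ m := by
      by_contra hlt
      have : m = 1 := by omega
      subst this
      simp at hL1
      linarith
    have hmS : m.primeFactors ⊆ P.S := by
      intro r hr
      obtain ⟨hr, hrm, -⟩ := mem_primeFactors.1 hr
      have hrlt : r < P.w1 := lt_of_le_of_lt (le_of_dvd (by omega) hrm) hmw
      have hn : ¬ r ∣ P.qm b Dr := fun h2 => hr.one_lt.ne' (Nat.eq_one_of_dvd_one (by rw [← hcop]; exact Nat.dvd_gcd (Dvd.dvd.mul_left hrm p) h2))
      rw [P.prime_dvd_qm hr] at hn
      push Not at hn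
      exact hn.1 hrlt
    by_cases hc : cardFactors m ≤ P.l0
    · left
      have hmM := P.mem_Ms_of hm2 hmS hc
      obtain ⟨-, -, -, h3, h4, h5a, h5, -⟩ := P.Ms_spec hmM
      obtain ⟨-, -, hl, hu⟩ := P.Pset_spec hpi
      have hiN : ((i:ℝ)+1)/P.N ≤ 1 := by rw [div_le_one hN]; exact_mod_cast hi
      rw [add_div] at hiN
      have hlε := P.lε_le
      have h14 : 1/(4*(P.N:ℝ)) < 1/P.N := one_div_lt_one_div_of_lt hN (by linarith)
      have hj : ⌊log p⌋₊ = P.a + b - em m := by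
        have h6 : ((⌊log p⌋₊ + em m : ℕ):ℝ) < ((P.a + b + 1 : ℕ):ℝ) := by push_cast; linarith
        have h7 : ((P.a + b : ℕ):ℝ) < ((⌊log p⌋₊ + em m + 1 : ℕ):ℝ) := by push_cast; linarith
        have h6 := Nat.cast_lt.1 h6
        have h7 := Nat.cast_lt.1 h7
        omega
      refine mem_biUnion.2 ⟨i, mem_range.2 hi, P.mem_Gs.2 ⟨m, hmM, p, ?_, mul_comm _ _⟩⟩
      rw [← hj]; exact hpi
    · right; right; left
      exact ⟨m, p, mul_comm _ _, hp, hm0, hmS, by omega, hmw⟩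
  grind

end Par

lemma smooth_cnt (T : Finset ℕ) (x : ℕ) : #{n ∈ Icc 1 x | n.primeFactors ⊆ T} ≤ 2^#T * x.sqrt := by
  classical
  have hsub : {n ∈ Icc 1 x | n.primeFactors ⊆ T} ⊆ (T.powerset ×ˢ Icc 1 x.sqrt).image (fun y => y.2^2 * ∏ p ∈ y.1, p) := by
    intro n hn
    obtain ⟨h1, h2⟩ := mem_filter.1 hn
    obtain ⟨h3, h4⟩ := mem_Icc.1 h1
    obtain ⟨r, k, hkr, hr⟩ := Nat.sq_mul_squarefree n
    have hr0 : r ≠ 0 := hr.ne_zero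
    have hk0 : k ≠ 0 := by rintro rfl; simp at hkr; omega
    refine mem_image.2 ⟨(r.primeFactors, k), mem_product.2 ⟨mem_powerset.2 ?_, mem_Icc.2 ⟨by omega, ?_⟩⟩, ?_⟩
    · refine (primeFactors_mono ?_ (by omega)).trans h2
      exact ⟨k^2, by rw [← hkr]; ring⟩
    · rw [Nat.le_sqrt']
      simp only
      have : k^2 * 1 ≤ k^2 * r := Nat.mul_le_mul_left _ (by omega)
      omega
    · simp only
      rw [Nat.prod_primeFactors_of_squarefree hr, hkr]
  refine (card_le_card hsub).trans (card_image_le.trans ?_)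
  rw [card_product, card_powerset]
  simp

namespace Par
variable (P : Par)

noncomputable def WS : ℝ := ∏ p ∈ P.S, (1 - 1/(p:ℝ))⁻¹

structure Ok (C0 : ℕ) : Prop where
  WSle : P.WS ≤ 2 * P.Wg
  Wgle : P.Wg ≤ P.WS
  one_le : 1 ≤ P.Wg
  tail : ∀ F : Finset ℕ, (∀ m ∈ F, m ≠ 0 ∧ m.primeFactors ⊆ P.S ∧ P.l0 < cardFactors m) → ∑ m ∈ F, (1:ℝ)/m ≤ 1
  sq : P.WS * ∑ p ∈ P.S, 2/(p:ℝ)^2 ≤ 1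
  C0le : 2 * C0 ≤ P.w1

noncomputable def Ib (b : ℕ) : Finset ℕ := Ico ⌈exp (P.a + b)⌉₊ ⌈exp (P.a + b + 1)⌉₊

lemma mem_Ib {b h : ℕ} : h ∈ P.Ib b ↔ exp (P.a + b) ≤ h ∧ h < exp (P.a + b + 1) := by
  unfold Ib
  rw [mem_Ico, ceil_le, lt_ceil]

noncomputable def Bd (b : ℕ) (Dr : Finset ℕ) : Finset ℕ := {h ∈ P.Ib b | h.Coprime (P.qm b Dr) ∧ h ∉ P.G b}

end Par

theorem bad_cnt : ∃ C : ℝ, 1 ≤ C ∧ ∀ (P : Par) (C0 : ℕ), P.Ok C0 → ∃ b0 : ℕ, ∀ b, b0 ≤ b → ∀ Dr ⊆ P.UU b, #Dr ≤ C0 → 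
    (#(P.Bd b Dr) : ℝ) ≤ C * exp (P.a + b) / (P.a + b) := by
  classical
  obtain ⟨C, hC, hI⟩ := int_cnt
  obtain ⟨j0, hj0⟩ := hI 1 one_pos le_rfl
  refine ⟨C + 2*C + 1, by linarith, fun P C0 hok => ?_⟩
  obtain ⟨b0, hb0E, hsv⟩ := P.survivors
  obtain ⟨b1, hb1⟩ := ev_nat (8 * (2^(#P.S + C0) * exp (1/2)) + 2 * log P.w1 + 2 + j0)
  refine ⟨b0 + b1 + j0 + 1, fun b hb Dr hDr hDrc => ?_⟩
  have hbr := hb1 b (by omega)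
  set x : ℝ := P.a + b with hx
  have hw1r : (1:ℝ) ≤ P.w1 := by
    have := P.w1_gt
    exact_mod_cast (by omega : 1 ≤ P.w1)
  have hlw : 0 ≤ log P.w1 := log_nonneg hw1r
  have hx0 : 0 < x := by
    have : (0:ℝ) ≤ 8 * (2^(#P.S + C0) * exp (1/2)) := by positivity
    linarith
  -- generic
  have hgen : ∀ s : ℝ, (j0:ℝ) + 1 ≤ s → x/2 ≤ s - 1 → ∀ T : Finset ℕ, (∀ p ∈ T, p.Prime ∧ s ≤ log p ∧ log p ≤ s + 1) → 
      (#T:ℝ) ≤ 2 * C * exp s / x := by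
    intro s hs hsx T hT
    have hs0 : 0 ≤ s := by
      linarith
    have h1 := floor_le hs0
    have h2 := Nat.lt_floor_add_one s
    have hj : j0 ≤ ⌊s⌋₊ := by
      apply le_floor; linarith
    have h3 := hj0 ⌊s⌋₊ hj s h1 h2.le 1 1 le_rfl (by simp) (by simp) T (fun p hp => ⟨(hT p hp).1, Nat.modEq_one, (hT p hp).2⟩)
    refine h3.trans ?_
    simp only [Nat.totient_one, cast_one, one_mul, mul_one]
    calc C * exp ⌊s⌋₊ / ⌊s⌋₊ ≤ C * exp s / (x/2) := by
          gcongr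
          linarith
      _ = _ := by field_simp
  set F1 : Finset ℕ := {h ∈ P.Ib b | h.Prime}
  set Mt : Finset ℕ := {m ∈ range P.w1 | m ≠ 0 ∧ m.primeFactors ⊆ P.S ∧ P.l0 < cardFactors m}
  set F2 : ℕ → Finset ℕ := fun m => {p ∈ range ⌈exp (P.a + b + 1)⌉₊ | p.Prime ∧ m * p ∈ P.Ib b}
  set F3 : Finset ℕ := {n ∈ Icc 1 ⌊exp (P.a + b + 1)⌋₊ | n.primeFactors ⊆ P.S ∪ Dr}
  have hsub : P.Bd b Dr ⊆ F1 ∪ (Mt.biUnion (fun m => (F2 m).image (fun p => m * p)) ∪ F3) := by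
    intro h hh
    obtain ⟨h1, h2, h3⟩ := mem_filter.1 hh
    obtain ⟨h4, h5⟩ := P.mem_Ib.1 h1
    have hh0r : (0:ℝ) < h := lt_of_lt_of_le (exp_pos _) h4
    have hh0 : 0 < h := mod_cast hh0r
    rcases hsv b (by omega) Dr hDr h h4 h5 h2 with h6 | h6 | h6 | h6
    · exact absurd h6 h3
    · exact mem_union_left _ (mem_filter.2 ⟨h1, h6⟩)
    · apply mem_union_right; apply mem_union_left
      obtain ⟨m, p, rfl, hp, hm0, hmS, hml, hmw⟩ := h6
      refine mem_biUnion.2 ⟨m, mem_filter.2 ⟨mem_range.2 hmw, hm0, hmS, hml⟩, mem_image.2 ⟨p, mem_filter.2 ⟨mem_range.2 ?_, hp, h1⟩, rfl⟩⟩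
      rw [lt_ceil]
      refine lt_of_le_of_lt ?_ h5
      have : p ≤ m * p := Nat.le_mul_of_pos_left p (by omega)
      exact_mod_cast this
    · apply mem_union_right; apply mem_union_right
      exact mem_filter.2 ⟨mem_Icc.2 ⟨hh0, le_floor h5.le⟩, h6⟩
  have hc1 : (#F1 : ℝ) ≤ C * exp x / x := by
    have hjx : ((P.a + b : ℕ):ℝ) = x := by rw [hx]; push_cast; ring
    have := hj0 (P.a + b) (by omega) x (by rw [hjx]) (by rw [hjx]; linarith) 1 1 le_rfl (by simp) (by rw [hjx]; simpa using hx0.le) F1 (fun p hp => by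
      obtain ⟨h1, h2⟩ := mem_filter.1 hp
      obtain ⟨h4, h5⟩ := P.mem_Ib.1 h1
      have hp0 : (0:ℝ) < p := mod_cast h2.pos
      refine ⟨h2, Nat.modEq_one, ?_, ?_⟩
      · rw [le_log_iff_exp_le hp0]; exact h4
      · rw [log_le_iff_le_exp hp0]; exact h5.le)
    rw [hjx] at this
    simpa using this
  have hc2 : ∀ m ∈ Mt, (#(F2 m) : ℝ) ≤ 2 * C * exp x / x * (1/m) := by
    intro m hm
    obtain ⟨h1, h2, -⟩ := mem_filter.1 hm
    have hm0 : (0:ℝ) < m := mod_cast Nat.pos_of_ne_zero h2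
    have hlm : log m ≤ log P.w1 := log_le_log hm0 (mod_cast (mem_range.1 h1).le)
    have : (0:ℝ) ≤ 8 * (2^(#P.S + C0) * exp (1/2)) := by positivity
    have h3 := hgen (x - log m) (by linarith) (by linarith) (F2 m) (fun p hp => by
      obtain ⟨-, hpp, hpI⟩ := mem_filter.1 hp
      obtain ⟨h4, h5⟩ := P.mem_Ib.1 hpI
      have hp0 : (0:ℝ) < p := mod_cast hpp.pos
      have hmp : (0:ℝ) < ((m*p : ℕ):ℝ) := by push_cast; positivity
      rw [← le_log_iff_exp_le hmp] at h4
      rw [← log_lt_iff_lt_exp hmp] at h5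
      have hlog : log ((m * p : ℕ):ℝ) = log m + log p := by
        push_cast; exact log_mul hm0.ne' hp0.ne'
      rw [hlog] at h4 h5
      exact ⟨hpp, by linarith, by linarith⟩)
    refine h3.trans (le_of_eq ?_)
    rw [Real.exp_sub, exp_log hm0]
    field_simp
  have hc3 : (#F3 : ℝ) ≤ exp x / x := by
    have h1 := smooth_cnt (P.S ∪ Dr) ⌊exp (P.a + b + 1)⌋₊
    have h2 : #(P.S ∪ Dr) ≤ #P.S + C0 := (card_union_le _ _).trans (by omega)
    have h3 : (Nat.sqrt ⌊exp (P.a + b + 1)⌋₊ : ℝ) ≤ exp (x/2) * exp (1/2) := by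
      refine Real.nat_sqrt_le_real_sqrt.trans ?_
      apply Real.sqrt_le_iff.2 ⟨by positivity, ?_⟩
      refine (floor_le (exp_pos _).le).trans (le_of_eq ?_)
      rw [← exp_add, ← exp_nat_mul]; congr 1; rw [hx]; push_cast; ring
    have h4 : (#F3 : ℝ) ≤ 2^(#P.S + C0) * (exp (x/2) * exp (1/2)) := by
      calc (#F3 : ℝ) ≤ ((2^#(P.S ∪ Dr) * Nat.sqrt ⌊exp (P.a + b + 1)⌋₊ : ℕ):ℝ) := Nat.cast_le.2 h1
        _ = (2:ℝ)^#(P.S ∪ Dr) * (Nat.sqrt ⌊exp (P.a + b + 1)⌋₊ : ℝ) := by push_cast; ring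
        _ ≤ _ := by
            gcongr
            norm_num
    refine h4.trans ?_
    rw [le_div_iff₀ hx0]
    have h5 : (x/2)^2/2 ≤ exp (x/2) := by
      have := Real.quadratic_le_exp_of_nonneg (show 0 ≤ x/2 by linarith)
      linarith
    have h6 : exp x = exp (x/2) * exp (x/2) := by rw [← exp_add]; congr 1; ring
    have h8 : 2^(#P.S + C0) * exp (1/2) * x ≤ exp (x/2) := by nlinarith
    rw [h6]
    calc _ = exp (x/2) * (2^(#P.S + C0) * exp (1/2) * x) := by ring
      _ ≤ _ := by gcongr
  have hcard : (#(P.Bd b Dr) : ℝ) ≤ #F1 + (∑ m ∈ Mt, (#(F2 m):ℝ) + #F3) := by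
    have : #(P.Bd b Dr) ≤ #F1 + (∑ m ∈ Mt, #(F2 m) + #F3) := by
      refine (card_le_card hsub).trans ((card_union_le _ _).trans ?_)
      gcongr
      refine (card_union_le _ _).trans ?_
      gcongr
      exact card_biUnion_le.trans (sum_le_sum (fun m _ => card_image_le))
    exact_mod_cast this
  have hs2 : ∑ m ∈ Mt, (#(F2 m):ℝ) ≤ 2 * C * exp x / x := by
    refine (sum_le_sum hc2).trans ?_
    rw [← mul_sum]
    have := hok.tail Mt (fun m hm => (mem_filter.1 hm).2)
    calc _ ≤ 2 * C * exp x / x * 1 := by gcongr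
      _ = _ := mul_one _
  calc (#(P.Bd b Dr) : ℝ) ≤ C * exp x / x + (2 * C * exp x / x + exp x / x) := by linarith
    _ = _ := by ring

lemma inv_le_exp {p : ℕ} (hp : p.Prime) : (1 - 1/(p:ℝ))⁻¹ ≤ exp (2/p) := by
  have h2 : (2:ℝ) ≤ p := mod_cast hp.two_le
  have h0 : (0:ℝ) < p := by linarith
  have h := add_one_le_exp (2/(p:ℝ))
  refine le_trans ?_ h
  rw [inv_le_iff_one_le_mul₀ (one_sub_inv_mem hp).1]
  have : (2/(p:ℝ)+1) * (1 - 1/p) = 1 + (1/p)*(1 - 2/p) := by field_simp; ring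
  rw [this]
  have : 0 ≤ 1 - 2/(p:ℝ) := by rw [sub_nonneg, div_le_one h0]; exact h2
  have : 0 ≤ 1/(p:ℝ)*(1 - 2/p) := by positivity
  linarith

lemma prod_inv_le_exp (T : Finset ℕ) (hT : ∀ p ∈ T, p.Prime) : ∏ p ∈ T, (1 - 1/(p:ℝ))⁻¹ ≤ exp (2 * ∑ p ∈ T, 1/(p:ℝ)) := by
  rw [mul_sum, exp_sum]
  refine prod_le_prod (fun p hp => (inv_pos.2 (one_sub_inv_mem (hT p hp)).1).le) (fun p hp => ?_)
  refine (inv_le_exp (hT p hp)).trans (le_of_eq ?_)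
  congr 1; ring

lemma one_le_prod_inv (T : Finset ℕ) (hT : ∀ p ∈ T, p.Prime) : 1 ≤ ∏ p ∈ T, (1 - 1/(p:ℝ))⁻¹ :=
  Finset.one_le_prod (fun p hp => (one_le_inv₀ (one_sub_inv_mem (hT p hp)).1).2 (one_sub_inv_mem (hT p hp)).2.le)

lemma sum_range_dyadic (u v : ℕ) (hu : 1 ≤ u) (s : Finset ℕ) (hs : ∀ p ∈ s, p.Prime ∧ 2^u ≤ p ∧ p < 2^v) :
    ∑ p ∈ s, (1:ℝ)/p ≤ (v - u : ℕ) * (4/u) := by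
  have hmaps : ∀ p ∈ s, Nat.log 2 p ∈ Ico u v := by
    intro p hp
    have := hs p hp
    rw [mem_Ico]
    exact ⟨le_log_of_pow_le (by norm_num) this.2.1, log_lt_of_lt_pow this.1.ne_zero this.2.2⟩
  rw [← sum_fiberwise_of_maps_to hmaps]
  calc _ ≤ ∑ j ∈ Ico u v, (4:ℝ)/u := by
        apply sum_le_sum
        intro j hj
        have hj := (mem_Ico.1 hj).1
        refine (sum_dyadic j (by omega) _ ?_).trans ?_
        · intro p hp
          obtain ⟨h1, h2⟩ := mem_filter.1 hp
          have hpp := (hs p h1).1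
          subst h2
          exact ⟨hpp, pow_log_le_self 2 hpp.ne_zero, lt_pow_succ_log_self (by norm_num) p⟩
        · gcongr
    _ = _ := by rw [sum_const, card_Ico, nsmul_eq_mul]

lemma two_pow_le_exp (n : ℕ) : (2:ℝ)^n ≤ exp n := by
  have h2 : (2:ℝ) ≤ exp 1 := by
    have := add_one_le_exp (1:ℝ); linarith
  calc (2:ℝ)^n ≤ (exp 1)^n := by gcongr
    _ = _ := by rw [← exp_nat_mul, mul_one]

lemma exp_le_two_pow (n : ℕ) : exp n ≤ (2:ℝ)^(2*n) := by
  have h2 : exp 1 ≤ 4 := by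
    have := exp_one_lt_d9; linarith
  calc exp n = (exp 1)^n := by rw [← exp_nat_mul, mul_one]
    _ ≤ 4^n := by gcongr
    _ = _ := by rw [pow_mul]; norm_num

lemma Par.big_sum (P : Par) (b : ℕ) (hb : 3 * P.E + 1 ≤ b) : ∑ p ∈ P.Big b, (1:ℝ)/p ≤ 8 := by
  have hu : 1 ≤ b - P.E := by omega
  refine (sum_range_dyadic (b - P.E) (2*b) hu _ ?_).trans ?_
  · intro p hp
    obtain ⟨h1, h2, -⟩ := mem_filter.1 hp
    obtain ⟨h3, hpp⟩ := mem_primesBelow.1 h1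
    have hp0 : (0:ℝ) < p := mod_cast hpp.pos
    refine ⟨hpp, ?_, ?_⟩
    · have h4 := floor_le (log_natCast_nonneg p)
      have h5 : ((b - P.E : ℕ):ℝ) ≤ ⌊log p⌋₊ := mod_cast (by omega)
      have h6 := (le_log_iff_exp_le hp0).1 (h5.trans h4)
      have := (two_pow_le_exp (b - P.E)).trans h6
      exact_mod_cast this
    · have h4 : (p:ℝ) < exp b := lt_ceil.1 h3
      have := h4.trans_le (exp_le_two_pow b)
      exact_mod_cast this
  · have hu0 : (0:ℝ) < (b - P.E : ℕ) := mod_cast hu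
    have : ((2*b - (b - P.E) : ℕ):ℝ) ≤ 2 * (b - P.E : ℕ) := mod_cast (by omega)
    rw [mul_div_assoc', div_le_iff₀ hu0]
    linarith

theorem rho : ∃ C : ℝ, 1 ≤ C ∧ ∀ (P : Par) (C0 : ℕ), P.Ok C0 → ∃ b0 : ℕ, ∀ b, b0 ≤ b → ∀ Dr ⊆ P.UU b, #Dr ≤ C0 → 
    (b:ℝ) / (C * P.WS) ≤ (P.qm b Dr : ℝ) / (P.qm b Dr).totient ∧ (P.qm b Dr : ℝ) / (P.qm b Dr).totient ≤ C * b / P.WS := by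
  classical
  obtain ⟨Cm, hCm, hm⟩ := mertens_up
  refine ⟨exp 17 + 2*Cm, by have := add_one_le_exp (17:ℝ); linarith, fun P C0 hok => ?_⟩
  obtain ⟨b1, hb1⟩ := ev_nat (P.w1 + 1)
  refine ⟨b1 + 3 * P.E + 1, fun b hb Dr hDr hDrc => ?_⟩
  have hbw := hb1 b (by omega)
  have hw1 := P.w1_gt
  have hw1r : (2:ℝ) < P.w1 := mod_cast hw1
  have hbe := add_one_le_exp (b:ℝ)
  have hYb : exp b ≤ Par.YY b := le_ceil _
  have hYb' : (Par.YY b : ℝ) < exp b + 1 := Nat.ceil_lt_add_one (exp_pos _).le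
  have hwY : P.w1 ≤ Par.YY b := by
    have : (P.w1:ℝ) ≤ Par.YY b := by linarith
    exact_mod_cast this
  set g : ℕ → ℝ := fun p => (1 - 1/(p:ℝ))⁻¹ with hg
  set q := P.qm b Dr
  have hq1 : 1 ≤ q := P.qm_pos b Dr
  set L := (Par.YY b).primesBelow
  have hLp : ∀ p ∈ L, p.Prime := fun p hp => (mem_primesBelow.1 hp).2
  have hFL : q.primeFactors ⊆ L := by
    intro p hp
    obtain ⟨hpp, hpd, -⟩ := mem_primeFactors.1 hp
    rcases (P.prime_dvd_qm hpp).1 hpd with h | h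
    · exact mem_primesBelow.2 ⟨by omega, hpp⟩
    · exact mem_primesBelow.2 ⟨(P.UU_spec h.1).2.1, hpp⟩
  have hSL : P.S ⊆ L \ q.primeFactors := by
    intro p hp
    have h1 := P.hS p hp
    refine Finset.mem_sdiff.2 ⟨mem_primesBelow.2 ⟨by omega, h1.1⟩, fun h => ?_⟩
    obtain ⟨hpp, hpd, -⟩ := mem_primeFactors.1 h
    rcases (P.prime_dvd_qm hpp).1 hpd with h | h
    · exact h.2 hp
    · have := (P.UU_spec h.1).2.2.1; omega
  have hR : (L \ q.primeFactors) \ P.S ⊆ P.Big b ∪ Dr := by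
    intro p hp
    obtain ⟨h1, h2⟩ := Finset.mem_sdiff.1 hp
    obtain ⟨h3, h4⟩ := Finset.mem_sdiff.1 h1
    have hpp := hLp p h3
    have h5 : ¬ p ∣ q := fun h => h4 (mem_primeFactors.2 ⟨hpp, h, by omega⟩)
    rw [P.prime_dvd_qm hpp] at h5
    push Not at h5
    by_cases hB : p ∈ P.Big b
    · exact mem_union_left _ hB
    · refine mem_union_right _ (h5.2 (mem_filter.2 ⟨h3, ?_, hB⟩))
      by_contra hlt
      exact h2 (h5.1 (by omega))
  have hLprod : ∏ p ∈ L, g p = (∏ p ∈ q.primeFactors, g p) * (P.WS * ∏ p ∈ (L \ q.primeFactors) \ P.S, g p) := by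
    rw [← prod_sdiff hFL, ← prod_sdiff hSL]
    unfold Par.WS
    ring
  have hratio : (q:ℝ)/q.totient = ∏ p ∈ q.primeFactors, g p := by
    rw [totient_real, hg, prod_inv_distrib]
    have : (q:ℝ) ≠ 0 := mod_cast (by omega : q ≠ 0)
    grind
  set R := ∏ p ∈ (L \ q.primeFactors) \ P.S, g p
  have hRp : ∀ p ∈ (L \ q.primeFactors) \ P.S, p.Prime := fun p hp => hLp p (Finset.mem_sdiff.1 (Finset.mem_sdiff.1 hp).1).1
  have hR1 : 1 ≤ R := one_le_prod_inv _ hRp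
  have hR2 : R ≤ exp 17 := by
    refine (prod_inv_le_exp _ hRp).trans (exp_le_exp.2 ?_)
    have hs1 : ∑ p ∈ (L \ q.primeFactors) \ P.S, 1/(p:ℝ) ≤ ∑ p ∈ P.Big b, 1/(p:ℝ) + ∑ p ∈ Dr, 1/(p:ℝ) := by
      refine (sum_le_sum_of_subset_of_nonneg hR (fun _ _ _ => by positivity)).trans ?_
      rw [← sum_union_inter]
      have : 0 ≤ ∑ p ∈ P.Big b ∩ Dr, 1/(p:ℝ) := sum_nonneg (fun _ _ => by positivity)
      linarith
    have hs2 : ∑ p ∈ Dr, 1/(p:ℝ) ≤ 1/2 := by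
      calc ∑ p ∈ Dr, 1/(p:ℝ) ≤ ∑ p ∈ Dr, 1/(P.w1:ℝ) := by
            apply sum_le_sum
            intro p hp
            have : (P.w1:ℝ) ≤ p := mod_cast (P.UU_spec (hDr hp)).2.2.1
            gcongr
        _ = #Dr * (1/(P.w1:ℝ)) := by rw [sum_const, nsmul_eq_mul]
        _ ≤ 1/2 := by
            have : 2*(#Dr:ℝ) ≤ P.w1 := mod_cast (by have := hok.C0le; omega)
            rw [mul_one_div, div_le_iff₀ (by linarith)]; linarith
    have := P.big_sum b (by omega)
    linarith
  have hWS : 0 < P.WS := lt_of_lt_of_le one_pos (hok.one_le.trans hok.Wgle)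
  have hb0 : (0:ℝ) < b := by linarith
  have hY2 : 2 ≤ Par.YY b := by omega
  have hYpos : (0:ℝ) < Par.YY b := mod_cast (by omega : 0 < Par.YY b)
  have hlo : (b:ℝ) ≤ ∏ p ∈ L, g p := by
    have h := mertens_low _ hY2
    have h1 : (b:ℝ) ≤ log (Par.YY b) := (le_log_iff_exp_le hYpos).2 hYb
    rw [hg, prod_inv_distrib]
    rw [le_inv_comm₀ hb0 (prodPB_pos _)]
    refine h.trans ?_
    rw [one_div]
    gcongr
  have hup : ∏ p ∈ L, g p ≤ 2 * Cm * b := by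
    refine (hm _ hY2).trans ?_
    have h1 : log (Par.YY b) ≤ 2 * b := by
      rw [log_le_iff_le_exp hYpos]
      have : exp (2*(b:ℝ)) = exp b * exp b := by rw [← exp_add]; ring_nf
      rw [this]
      nlinarith
    calc Cm * log (Par.YY b) ≤ Cm * (2*b) := by gcongr
      _ = _ := by ring
  have hF1 : 0 < ∏ p ∈ q.primeFactors, g p := lt_of_lt_of_le one_pos (one_le_prod_inv _ (fun p hp => hLp p (hFL hp)))
  rw [hratio]
  set PF := ∏ p ∈ q.primeFactors, g p
  rw [hLprod] at hlo hup
  constructor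
  · rw [div_le_iff₀ (by positivity)]
    calc (b:ℝ) ≤ PF * P.WS * R := by linarith
      _ ≤ PF * P.WS * (exp 17 + 2*Cm) := by gcongr; linarith
      _ = _ := by ring
  · rw [le_div_iff₀ hWS]
    calc PF * P.WS = PF * P.WS * 1 := by ring
      _ ≤ PF * P.WS * R := by gcongr
      _ ≤ 2 * Cm * b := by linarith
      _ ≤ _ := by gcongr; have := exp_pos 17; linarith

lemma div_step (q a : ℕ) (hq : 1 ≤ q) (ha : a.Coprime q) {ε : ℝ} (hε : 0 < ε) (hε1 : ε ≤ 1) (p0 : ℕ) :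
    ∃ L, ε / (20 * q.totient) ≤ ∑ p ∈ CP q a 0 ε L with p0 ≤ p, 1/(p:ℝ) := by
  obtain ⟨κ0, hκ0, h⟩ := C1p q a hq ha le_rfl hε (by linarith)
  set M0 := ∑ p ∈ range p0, log p
  set δ := ε / (20 * q.totient) with hδ
  set κ := min κ0 (δ/(M0+1))
  have hκp : 0 < κ := lt_min hκ0 (by positivity)
  have hκM : κ * M0 ≤ δ := by
    have : κ ≤ δ/(M0+1) := min_le_right _ _
    rw [le_div_iff₀ (by positivity)] at this
    nlinarith
  obtain ⟨L, hL⟩ := h κ hκp (min_le_left _ _)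
  refine ⟨L, ?_⟩
  have h1 := hL L le_rfl
  rw [← sum_filter_add_sum_filter_not _ (fun p => p0 ≤ p)] at h1
  have h2 : ∑ p ∈ CP q a 0 ε L with ¬ p0 ≤ p, log p * (p:ℝ)^(-(1+κ)) ≤ M0 := by
    calc _ ≤ ∑ p ∈ CP q a 0 ε L with ¬ p0 ≤ p, log p := by
          apply sum_le_sum
          intro p hp
          have hpp := (mem_filter.1 (mem_filter.1 hp).1).2.1
          have : (p:ℝ)^(-(1+κ)) ≤ 1 := rpow_le_one_of_one_le_of_nonpos (mod_cast hpp.one_le) (by linarith)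
          exact mul_le_of_le_one_right (log_natCast_nonneg p) this
      _ ≤ M0 := by
          apply sum_le_sum_of_subset_of_nonneg
          · intro p hp
            have := (mem_filter.1 hp).2
            exact mem_range.2 (by omega)
          · intro p _ _; exact log_natCast_nonneg p
  have h3 : ∑ p ∈ CP q a 0 ε L with p0 ≤ p, log p * (p:ℝ)^(-(1+κ)) ≤ (1/κ) * ∑ p ∈ CP q a 0 ε L with p0 ≤ p, 1/(p:ℝ) := by
    rw [mul_sum]
    apply sum_le_sum
    intro p hp
    have hpp := (mem_filter.1 (mem_filter.1 hp).1).2.1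
    have hp0 : (0:ℝ) < p := mod_cast hpp.pos
    have h4 : κ * log p ≤ (p:ℝ)^κ := by
      rw [rpow_def_of_pos hp0]
      have := add_one_le_exp (log p * κ)
      linarith
    have h5 : (p:ℝ)^(-(1+κ)) = 1/((p:ℝ) * (p:ℝ)^κ) := by
      rw [rpow_neg hp0.le, rpow_add hp0, Real.rpow_one, one_div]
    rw [h5, mul_one_div, div_mul_div_comm, one_mul, div_le_div_iff₀ (by positivity) (by positivity)]
    calc log p * (κ * p) = (κ * log p) * p := by ring
      _ ≤ (p:ℝ)^κ * p := by gcongr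
      _ = _ := by ring
  have h7 : ε / (10 * q.totient * κ) = 2*δ/κ := by rw [hδ]; field_simp; norm_num
  rw [h7] at h1
  have h8 : 2*δ/κ ≤ (1/κ) * (∑ p ∈ CP q a 0 ε L with p0 ≤ p, 1/(p:ℝ)) + M0 := h1.trans (add_le_add h3 h2)
  rw [div_le_iff₀ hκp] at h8
  have h9 : ((1/κ) * (∑ p ∈ CP q a 0 ε L with p0 ≤ p, 1/(p:ℝ)) + M0) * κ = ∑ p ∈ CP q a 0 ε L with p0 ≤ p, 1/(p:ℝ) + κ * M0 := by
    field_simp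
  rw [h9] at h8
  linarith

lemma CP_mono (q a : ℕ) (α ε : ℝ) {L L' : ℕ} (h : L ≤ L') : CP q a α ε L ⊆ CP q a α ε L' :=
  filter_subset_filter _ (range_mono h)

lemma div_CP (q a : ℕ) (hq : 1 ≤ q) (ha : a.Coprime q) {ε : ℝ} (hε : 0 < ε) (hε1 : ε ≤ 1) (p0 : ℕ) (M : ℝ) :
    ∃ L, M ≤ ∑ p ∈ CP q a 0 ε L with p0 ≤ p, 1/(p:ℝ) := by
  set δ := ε / (20 * q.totient)
  have hδ0 : 0 < δ := by positivity
  have key : ∀ n : ℕ, ∃ L, n * δ ≤ ∑ p ∈ CP q a 0 ε L with p0 ≤ p, 1/(p:ℝ) := by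
    intro n
    induction n with
    | zero => exact ⟨0, by simp; exact sum_nonneg (fun _ _ => by positivity)⟩
    | succ n ih =>
      obtain ⟨L, hL⟩ := ih
      obtain ⟨L2, hL2⟩ := div_step q a hq ha hε hε1 (max p0 L)
      refine ⟨max L L2, ?_⟩
      have hdis : Disjoint {p ∈ CP q a 0 ε L | p0 ≤ p} {p ∈ CP q a 0 ε L2 | max p0 L ≤ p} := by
        rw [Finset.disjoint_left]
        intro p h1 h2
        have h3 := mem_range.1 (mem_filter.1 (mem_filter.1 h1).1).1
        grind
      have : ({p ∈ CP q a 0 ε L | p0 ≤ p} ∪ {p ∈ CP q a 0 ε L2 | max p0 L ≤ p}) ⊆ {p ∈ CP q a 0 ε (max L L2) | p0 ≤ p} := by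
        intro p hp
        rcases mem_union.1 hp with h | h
        · obtain ⟨h1, h2⟩ := mem_filter.1 h
          exact mem_filter.2 ⟨CP_mono q a 0 ε (le_max_left _ _) h1, h2⟩
        · obtain ⟨h1, h2⟩ := mem_filter.1 h
          exact mem_filter.2 ⟨CP_mono q a 0 ε (le_max_right _ _) h1, (le_max_left _ _).trans h2⟩
      have h5 := sum_le_sum_of_subset_of_nonneg (f := fun p : ℕ => 1/(p:ℝ)) this (fun _ _ _ => by positivity)
      rw [sum_union hdis] at h5
      push_cast
      linarith
  obtain ⟨n, hn⟩ := exists_nat_ge (M/δ)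
  obtain ⟨L, hL⟩ := key n
  refine ⟨L, le_trans ?_ hL⟩
  rwa [div_le_iff₀ hδ0] at hn

lemma sub_sum (T : Finset ℕ) (f : ℕ → ℝ) (hf : ∀ p ∈ T, f p ≤ 1) (Λ : ℝ) (h : Λ ≤ ∑ p ∈ T, f p) (hΛ : 0 ≤ Λ) :
    ∃ S ⊆ T, Λ ≤ ∑ p ∈ S, f p ∧ ∑ p ∈ S, f p ≤ Λ + 1 := by
  classical
  induction T using Finset.induction_on with
  | empty => exact ⟨∅, Subset.rfl, h, by simp; linarith⟩
  | insert x T hx ih =>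
    by_cases h1 : Λ ≤ ∑ p ∈ T, f p
    · obtain ⟨S, hS, h2⟩ := ih (fun p hp => hf p (mem_insert_of_mem hp)) h1
      exact ⟨S, hS.trans (subset_insert _ _), h2⟩
    · refine ⟨insert x T, Subset.rfl, h, ?_⟩
      rw [sum_insert hx]
      have := hf x (mem_insert_self _ _)
      push Not at h1
      linarith

noncomputable def fΩ (t : ℝ) : ℕ →* ℝ where
  toFun n := t^(cardFactors n) / n
  map_one' := by simp
  map_mul' := by
    intro m n
    rcases eq_or_ne m 0 with rfl | hm
    · simp
    rcases eq_or_ne n 0 with rfl | hn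
    · simp
    rw [cardFactors_mul hm hn, pow_add]
    push_cast
    rw [mul_div_mul_comm]

lemma fΩ_apply (t : ℝ) (n : ℕ) : fΩ t n = t^(cardFactors n) / n := rfl
lemma fΩ_prime (t : ℝ) {p : ℕ} (hp : p.Prime) : fΩ t p = t / p := by
  rw [fΩ_apply, ArithmeticFunction.cardFactors_apply_prime hp, pow_one]

lemma fΩ_hasSum {t : ℝ} (h0 : 0 < t) (h2 : t < 2) (S : Finset ℕ) (hS : ∀ p ∈ S, p.Prime) :
    HasSum (fun m : factoredNumbers S => fΩ t m) (∏ p ∈ S, (1 - t/(p:ℝ))⁻¹) := by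
  have h := (EulerProduct.summable_and_hasSum_factoredNumbers_prod_filter_prime_geometric (f := fΩ t) (by
    intro p hp
    have hp2 : (2:ℝ) ≤ p := mod_cast hp.two_le
    rw [fΩ_prime t hp, Real.norm_of_nonneg (by positivity), div_lt_one (by linarith)]
    linarith) S).2
  rw [filter_true_of_mem hS] at h
  have e : ∏ p ∈ S, (1 - t/(p:ℝ))⁻¹ = ∏ p ∈ S, (1 - fΩ t p)⁻¹ := prod_congr rfl (fun p hp => by rw [fΩ_prime t (hS p hp)])
  rw [e]; exact h

lemma fΩ_sum {t : ℝ} (h0 : 0 < t) (h2 : t < 2) (S : Finset ℕ) (hS : ∀ p ∈ S, p.Prime) (F : Finset ℕ)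
    (hF : ∀ m ∈ F, m ≠ 0 ∧ m.primeFactors ⊆ S) : ∑ m ∈ F, t^(cardFactors m) / (m:ℝ) ≤ ∏ p ∈ S, (1 - t/(p:ℝ))⁻¹ := by
  have h := fΩ_hasSum h0 h2 S hS
  have hmem : ∀ m ∈ F, m ∈ factoredNumbers S := fun m hm => Nat.mem_factoredNumbers_iff_primeFactors_subset.2 (hF m hm)
  rw [← sum_attach]
  let e : {x // x ∈ F} ↪ factoredNumbers S :=
      ⟨fun x => ⟨x.1, hmem x.1 x.2⟩, by intro a b hab; exact Subtype.ext (congrArg (fun x : factoredNumbers S => x.1) hab)⟩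
  have h3 := sum_le_hasSum (F.attach.map e) (fun i _ => by rw [fΩ_apply]; positivity) h
  rw [sum_map] at h3
  exact h3

lemma Par.mkOk (P : Par) (Λ C0 : ℕ) (hΛ : 3 ≤ Λ) (hl : P.l0 = 10*Λ) (hS : ∀ p ∈ P.S, exp (4*Λ+4) ≤ p)
    (h1 : (Λ:ℝ) ≤ ∑ p ∈ P.S, 1/(p:ℝ)) (h2 : ∑ p ∈ P.S, 1/(p:ℝ) ≤ Λ + 1) (hC : 2*C0 ≤ P.w1) : P.Ok C0 ∧ exp Λ ≤ P.WS := by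
  classical
  have hSp : ∀ p ∈ P.S, p.Prime := fun p hp => (P.hS p hp).1
  have hΛr : (3:ℝ) ≤ Λ := mod_cast hΛ
  have hlow : exp Λ ≤ P.WS := by
    refine (exp_le_exp.2 h1).trans ?_
    rw [exp_sum]
    unfold Par.WS
    refine prod_le_prod (fun p hp => (exp_pos _).le) (fun p hp => ?_)
    rw [le_inv_comm₀ (exp_pos _) (one_sub_inv_mem (hSp p hp)).1, ← exp_neg]
    have := add_one_le_exp (-(1/(p:ℝ)))
    linarith
  have hup : P.WS ≤ exp (2*Λ+2) := (prod_inv_le_exp _ hSp).trans (exp_le_exp.2 (by linarith))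
  have h4 : 4 ≤ P.WS := by
    have := add_one_le_exp (Λ:ℝ)
    linarith
  have htail : ∀ F : Finset ℕ, (∀ m ∈ F, m ≠ 0 ∧ m.primeFactors ⊆ P.S ∧ P.l0 < cardFactors m) → ∑ m ∈ F, (1:ℝ)/m ≤ 1 := by
    intro F hF
    have h5 := fΩ_sum (t := 3/2) (by norm_num) (by norm_num) P.S hSp F (fun m hm => ⟨(hF m hm).1, (hF m hm).2.1⟩)
    have h6 : ∏ p ∈ P.S, (1 - (3/2)/(p:ℝ))⁻¹ ≤ exp (3 * ∑ p ∈ P.S, 1/(p:ℝ)) := by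
      rw [mul_sum, exp_sum]
      refine prod_le_prod (fun p hp => ?_) (fun p hp => ?_)
      · have hp2 : (2:ℝ) ≤ p := mod_cast (hSp p hp).two_le
        rw [inv_nonneg, sub_nonneg, div_le_one (by linarith)]; linarith
      · have hp3 : (3:ℝ) ≤ p := mod_cast (by have := (P.hS p hp).2.2.2.2.1; have := P.hw; omega : 3 ≤ p)
        have h := add_one_le_exp (3*(1/(p:ℝ)))
        refine le_trans ?_ h
        have hpos : 0 < 1 - (3/2)/(p:ℝ) := by rw [sub_pos, div_lt_one (by linarith)]; linarith
        rw [inv_le_iff_one_le_mul₀ hpos]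
        have hp0 : (p:ℝ) ≠ 0 := by linarith
        have e : (3*(1/(p:ℝ))+1) * (1 - (3/2)/p) = 1 + (3/2)*(1/p)*(1 - 3/p) := by field_simp; ring
        rw [e]
        have : 0 ≤ 1 - 3/(p:ℝ) := by rw [sub_nonneg, div_le_one (by linarith)]; exact hp3
        have : 0 ≤ (3/2)*(1/(p:ℝ))*(1 - 3/p) := by positivity
        linarith
    have h7 : exp (3 * ∑ p ∈ P.S, 1/(p:ℝ)) ≤ (3/2:ℝ)^P.l0 := by
      calc exp (3 * ∑ p ∈ P.S, 1/(p:ℝ)) ≤ exp (Λ * 4) := exp_le_exp.2 (by linarith)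
        _ = ((exp 1)^4)^Λ := by rw [exp_nat_mul, ← exp_nat_mul 1 4]; norm_num
        _ ≤ ((3/2:ℝ)^10)^Λ := by
            gcongr
            have h8 := exp_one_lt_d9
            calc (exp 1)^4 ≤ (2.7182818286:ℝ)^4 := by gcongr
              _ ≤ _ := by norm_num
        _ = _ := by rw [← pow_mul, hl]
    have h9 : ∑ m ∈ F, (3/2:ℝ)^P.l0 * ((1:ℝ)/m) ≤ ∑ m ∈ F, (3/2:ℝ)^(cardFactors m) / (m:ℝ) := by
      apply sum_le_sum
      intro m hm
      rw [mul_one_div]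
      gcongr
      · norm_num
      · exact (hF m hm).2.2.le
    rw [← mul_sum] at h9
    have h10 : (3/2:ℝ)^P.l0 * ∑ m ∈ F, (1:ℝ)/m ≤ (3/2:ℝ)^P.l0 * 1 := by linarith
    exact le_of_mul_le_mul_left h10 (by positivity)
  have hWg : P.Wg ≤ P.WS := by
    have h5 := fΩ_sum (t := 1) (by norm_num) (by norm_num) P.S hSp P.Ms (fun m hm => by
      have := P.Ms_spec hm
      exact ⟨by omega, this.2.1⟩)
    simp only [one_pow] at h5
    exact h5
  have hWS : P.WS ≤ 1 + P.Wg + 1 := by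
    have h := fΩ_hasSum (t := 1) (by norm_num) (by norm_num) P.S hSp
    refine hasSum_le_of_sum_le h (fun s => ?_)
    have e : ∑ i ∈ s, fΩ 1 (i:ℕ) = ∑ m ∈ s.map (Function.Embedding.subtype _), (1:ℝ)/m := by
      rw [sum_map]
      apply sum_congr rfl
      intro i _
      rw [fΩ_apply]; simp
    rw [e]
    set F := s.map (Function.Embedding.subtype _)
    have hFm : ∀ m ∈ F, m ≠ 0 ∧ m.primeFactors ⊆ P.S := by
      intro m hm
      obtain ⟨x, _, rfl⟩ := mem_map.1 hm
      exact Nat.mem_factoredNumbers_iff_primeFactors_subset.1 x.2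
    have hsub : F ⊆ ({1} ∪ P.Ms) ∪ {m ∈ F | P.l0 < cardFactors m} := by
      intro m hm
      by_cases h5 : P.l0 < cardFactors m
      · exact mem_union_right _ (mem_filter.2 ⟨hm, h5⟩)
      · apply mem_union_left
        by_cases h6 : m = 1
        · exact mem_union_left _ (mem_singleton.2 h6)
        · have := (hFm m hm).1
          exact mem_union_right _ (P.mem_Ms_of (by omega) (hFm m hm).2 (by omega))
    have hun : ∀ A B : Finset ℕ, ∑ m ∈ A ∪ B, (1:ℝ)/m ≤ ∑ m ∈ A, (1:ℝ)/m + ∑ m ∈ B, (1:ℝ)/m := by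
      intro A B
      rw [← sum_union_inter]
      have : 0 ≤ ∑ m ∈ A ∩ B, (1:ℝ)/m := sum_nonneg (fun _ _ => by positivity)
      linarith
    have h5 := sum_le_sum_of_subset_of_nonneg (f := fun m : ℕ => (1:ℝ)/m) hsub (fun _ _ _ => by positivity)
    have h6 := hun ({1} ∪ P.Ms) {m ∈ F | P.l0 < cardFactors m}
    have h7 := hun {1} P.Ms
    have h8 := htail {m ∈ F | P.l0 < cardFactors m} (fun m hm => by
      obtain ⟨h9, h10⟩ := mem_filter.1 hm
      exact ⟨(hFm m h9).1, (hFm m h9).2, h10⟩)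
    rw [sum_singleton] at h7
    simp only [cast_one, div_one] at h7
    have : P.Wg = ∑ m ∈ P.Ms, (1:ℝ)/m := rfl
    linarith
  refine ⟨⟨by linarith, hWg, by linarith, htail, ?_, hC⟩, hlow⟩
  have h5 : ∑ p ∈ P.S, 2/(p:ℝ)^2 ≤ 2 / exp (4*Λ+4) * (Λ+1) := by
    calc _ ≤ ∑ p ∈ P.S, 2 / exp (4*Λ+4) * (1/(p:ℝ)) := by
          apply sum_le_sum
          intro p hp
          have := hS p hp
          have hp0 : (0:ℝ) < p := mod_cast (hSp p hp).pos
          rw [div_mul_div_comm, mul_one, sq]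
          gcongr
      _ ≤ _ := by rw [← mul_sum]; gcongr
  have h6 : exp (4*Λ+4) = exp (2*Λ+2) * exp (2*Λ+2) := by rw [← exp_add]; ring_nf
  have h7 := add_one_le_exp (2*(Λ:ℝ)+2)
  have h8 : 0 < exp (2*(Λ:ℝ)+2) := exp_pos _
  calc _ ≤ exp (2*Λ+2) * (2 / exp (4*Λ+4) * (Λ+1)) := by gcongr
    _ = (2*(Λ+1)) / exp (2*Λ+2) := by rw [h6]; field_simp
    _ ≤ 1 := by rw [div_le_one h8]; linarith

theorem exPar (N w : ℕ) (hN : 1 ≤ N) (hw : 2 ≤ w) (r : ℕ → ℕ) (hr : ∀ i, (r i).Coprime (2 * primorial w)) (K2 τ0 : ℝ)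
    (hτ : 0 < τ0) (hNτ : 1/τ0 ≤ N) (C0 : ℕ) : ∃ P : Par, P.N = N ∧ P.w = w ∧ P.r = r ∧ P.Ok C0 ∧ P.S.Nonempty ∧
      K2 ≤ N * P.ε * P.Wg / P.Q.totient ∧ τ0/3 ≤ P.ε * exp P.a / P.Q.totient ∧ P.ε * exp P.a / P.Q.totient ≤ τ0 := by
  classical
  set Q := 2 * primorial w
  have hQ1 : 1 ≤ Q := by have := primorial_pos w; omega
  have hφ1 : (1:ℝ) ≤ Q.totient := mod_cast totient_pos.2 hQ1
  have hφ : (0:ℝ) < Q.totient := by linarith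
  obtain ⟨m0, hm0⟩ := exp_beats (80 * |K2| * Q.totient)
  set Λ := max 3 m0
  have hΛ3 : 3 ≤ Λ := le_max_left _ _
  have hΛK := hm0 Λ (le_max_right _ _)
  have hNr : (1:ℝ) ≤ N := mod_cast hN
  set ε : ℝ := 1/(4*N*(10*Λ+1)) with hεd
  have hε : 0 < ε := by positivity
  have hε1 : ε ≤ 1/(4*N) := by
    apply one_div_le_one_div_of_le (by positivity)
    have : (0:ℝ) ≤ Λ := cast_nonneg _
    nlinarith
  have hε2 : ε ≤ 1 := hε1.trans (by rw [div_le_one (by positivity)]; linarith)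
  have hx1 : 1 ≤ τ0 * Q.totient / ε := by
    rw [le_div_iff₀ hε, one_mul]
    have h1 : 1/(4*(N:ℝ)) ≤ τ0 := by
      rw [div_le_iff₀ hτ] at hNτ
      rw [div_le_iff₀ (by positivity)]; nlinarith
    nlinarith
  have hlx := log_nonneg hx1
  set a := ⌊log (τ0 * Q.totient / ε)⌋₊ with ha
  have ha1 := floor_le hlx
  have ha2 := Nat.lt_floor_add_one (log (τ0 * Q.totient / ε))
  rw [← ha] at ha1 ha2
  rw [le_log_iff_exp_le (by linarith)] at ha1
  rw [log_lt_iff_lt_exp (by linarith), exp_add] at ha2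
  set p0 := ⌈exp (a+2)⌉₊ + ⌈exp (4*Λ+4)⌉₊ + w + 1
  obtain ⟨L, hL⟩ := div_CP Q 1 hQ1 (Nat.coprime_one_left Q) hε hε2 p0 Λ
  obtain ⟨S, hST, hS1, hS2⟩ := sub_sum _ (fun p : ℕ => 1/(p:ℝ)) (fun p hp => by
    have hpp := (mem_filter.1 (mem_filter.1 hp).1).2.1
    have : (1:ℝ) ≤ p := mod_cast hpp.one_le
    rw [div_le_one (by linarith)]; exact this) Λ hL (cast_nonneg _)
  obtain ⟨n1, hn1⟩ := exists_nat_gt (exp (a + 1 + ((∏ p ∈ S, p)^(10*Λ) : ℕ)))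
  have hSs : ∀ p ∈ S, p.Prime ∧ p ≡ 1 [MOD Q] ∧ Int.fract (log p) ≤ ε ∧ p < L ∧ p0 ≤ p := by
    intro p hp
    obtain ⟨h1, h2⟩ := mem_filter.1 (hST hp)
    obtain ⟨h3, h4, h5, -, h6⟩ := mem_filter.1 h1
    grind
  let P : Par := {
    N := N, l0 := 10*Λ, a := a, w := w, w1 := L + n1 + 2*C0, ε := ε, r := r, S := S
    hN := hN, hε := hε, hw := hw, hr := hr
    hεN := by
      grind
    hS := by
      intro p hp
      obtain ⟨h1, h2, h3, h4, h5⟩ := hSs p hp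
      refine ⟨h1, h2, h3, ?_, by omega, by omega⟩
      refine (le_ceil _).trans ?_
      exact_mod_cast (by omega : ⌈exp (a+2)⌉₊ ≤ p)
    hw1 := by
      grind }
  have hPφ : P.Q.totient = Q.totient := rfl
  obtain ⟨hok, hWS⟩ := P.mkOk Λ C0 hΛ3 rfl (fun p hp => by
      obtain ⟨h1, h2, h3, h4, h5⟩ := hSs p hp
      refine (le_ceil _).trans ?_
      exact_mod_cast (by omega : ⌈exp (4*Λ+4)⌉₊ ≤ p)) hS1 hS2 (show 2*C0 ≤ L + n1 + 2*C0 by omega)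
  refine ⟨P, rfl, rfl, rfl, hok, ?_, ?_, ?_, ?_⟩
  · apply Finset.nonempty_of_ne_empty
    intro he
    have : S = ∅ := he
    rw [this, sum_empty] at hS1
    have : (3:ℝ) ≤ Λ := mod_cast hΛ3
    linarith
  · rw [hPφ]
    show K2 ≤ N * ε * P.Wg / Q.totient
    have h1 : N * ε * P.Wg / Q.totient = P.Wg / (4 * (10*Λ+1) * Q.totient) := by
      rw [hεd]; field_simp
    rw [h1, le_div_iff₀ (by positivity)]
    have h2 := two_pow_le_exp Λ
    have h3 := hok.WSle
    have h4 : K2 ≤ |K2| := le_abs_self _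
    have h5 : K2 * (4 * (10*Λ+1) * Q.totient) ≤ |K2| * (4 * (10*((Λ:ℝ)+1)^2) * Q.totient) := by
      gcongr
      nlinarith
    linarith
  · rw [hPφ]
    show τ0/3 ≤ ε * exp a / Q.totient
    rw [div_lt_iff₀ hε] at ha2
    rw [le_div_iff₀ hφ]
    have := Real.exp_one_lt_three
    have h1 : exp a * exp 1 * ε ≤ exp a * 3 * ε := by gcongr
    linarith
  · rw [hPφ]
    show ε * exp a / Q.totient ≤ τ0
    rw [le_div_iff₀ hε] at ha1
    rw [div_le_iff₀ hφ]; linarith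

namespace Par
variable (P : Par)

/-- the data obtained for one (large) value of `b` -/
structure Cx (C0 Ck b : ℕ) (Dr : Finset ℕ) (J k : ℕ) : Prop where
  hDr : Dr ⊆ P.UU b
  hDrc : #Dr ≤ C0
  J1 : exp b ≤ 2^J
  J2 : (2:ℝ)^J ≤ 64 * exp b
  k1 : 2^J ≤ k
  k2 : k ≤ Ck * 2^J
  q4 : (P.qm b Dr)^4 ≤ 2^k
  cop : ∀ h ∈ P.G b, h.Coprime (P.qm b Dr)
  qbig : exp (P.a + b + 1) ≤ P.qm b Dr

lemma q_big (C0 : ℕ) : ∃ b0 : ℕ, ∀ b, b0 ≤ b → ∀ Dr : Finset ℕ, #Dr ≤ C0 → exp (P.a + b + 1) ≤ P.qm b Dr := by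
  classical
  refine ⟨2*(C0 + P.E + P.a + P.w1 + 20), fun b hb Dr hDr => ?_⟩
  have hB : ∀ j : ℕ, ∃ p, p.Prime ∧ 2^(b/2+j) < p ∧ p ≤ 2 * 2^(b/2+j) := fun j => 
    Nat.exists_prime_lt_and_le_two_mul _ (by positivity)
  choose f hfp hf1 hf2 using hB
  have hmono : StrictMono f := strictMono_nat_of_lt_succ (fun j => by
    have h1 := hf2 j
    have h2 := hf1 (j+1)
    rw [← add_assoc, pow_succ] at h2
    omega)
  set T := (range (C0+8)).image f with hT
  have hTc : #T = C0 + 8 := by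
    rw [hT, card_image_of_injective _ hmono.injective, card_range]
  have hTU : T ⊆ P.UU b := by
    intro p hp
    obtain ⟨j, hj, rfl⟩ := mem_image.1 hp
    have hj := mem_range.1 hj
    have hp0 : (0:ℝ) < f j := mod_cast (hfp j).pos
    have h1 : (f j : ℝ) ≤ exp (b/2 + j + 1 : ℕ) := by
      refine le_trans ?_ (two_pow_le_exp _)
      have := hf2 j
      rw [pow_succ]
      exact_mod_cast (by omega)
    have h2 : log (f j) ≤ (b/2 + j + 1 : ℕ) := (log_le_iff_le_exp hp0).2 h1
    refine mem_filter.2 ⟨mem_primesBelow.2 ⟨?_, hfp j⟩, ?_, fun h => ?_⟩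
    · unfold YY
      rw [lt_ceil, ← log_lt_iff_lt_exp hp0]
      refine lt_of_le_of_lt h2 ?_
      exact_mod_cast (by omega)
    · have h3 : b/2 < 2^(b/2) := lt_two_pow_self
      have h4 : 2^(b/2) ≤ 2^(b/2+j) := pow_le_pow_right (by norm_num) (by omega)
      have := hf1 j
      omega
    · have h3 := (mem_filter.1 h).2.1
      have h4 : ⌊log (f j)⌋₊ ≤ b/2 + j + 1 := Nat.floor_le_of_le h2
      omega
  have hc : 8 ≤ #(T \ Dr) := by
    have := le_card_sdiff Dr T
    omega
  have h1 : (2^(b/2))^8 ≤ P.qm b Dr := by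
    calc (2^(b/2))^8 ≤ (2^(b/2))^#(T \ Dr) := pow_le_pow_right (by positivity) hc
      _ ≤ ∏ p ∈ T \ Dr, p := by
          apply Finset.pow_card_le_prod
          intro p hp
          obtain ⟨j, hj, rfl⟩ := mem_image.1 (Finset.mem_sdiff.1 hp).1
          have h4 : 2^(b/2) ≤ 2^(b/2+j) := pow_le_pow_right (by norm_num) (by omega)
          exact h4.trans (hf1 j).le
      _ ≤ ∏ p ∈ P.UU b \ Dr, p := by
          apply le_of_dvd
          · exact prod_pos (fun p hp => (P.UU_spec (Finset.mem_sdiff.1 hp).1).1.pos)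
          · exact prod_dvd_prod_of_subset _ _ _ (sdiff_subset_sdiff hTU Subset.rfl)
      _ ≤ P.qm b Dr := by
          unfold qm
          exact Nat.le_mul_of_pos_left _ P.Wm_pos
  have h2 := exp_le_two_pow (P.a + b + 1)
  push_cast at h2
  refine h2.trans ?_
  have h3 : 2^(2*(P.a+b+1)) ≤ (2^(b/2))^8 := by
    rw [← pow_mul]
    exact pow_le_pow_right (by norm_num) (by omega)
  exact_mod_cast h3.trans h1

lemma G_sub_Ib {b : ℕ} (hb : P.E ≤ b) : P.G b ⊆ P.Ib b := by
  intro h hh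
  obtain ⟨i, hi, hh⟩ := mem_biUnion.1 hh
  obtain ⟨⟨h1, h2⟩, -, h0⟩ := P.Gs_spec hb hh
  have h0r : (0:ℝ) < h := mod_cast h0
  have hN := P.N_pos
  rw [P.mem_Ib, ← le_log_iff_exp_le h0r, ← log_lt_iff_lt_exp h0r]
  have h3 : (0:ℝ) ≤ i/P.N := by positivity
  refine ⟨by linarith, ?_⟩
  have h4 := P.lε_le
  have h5 : ((i:ℝ)+1)/P.N ≤ 1 := by rw [div_le_one hN]; exact_mod_cast mem_range.1 hi
  rw [add_div] at h5
  have h6 : 1/(4*(P.N:ℝ)) < 1/P.N := by apply one_div_lt_one_div_of_lt hN; linarith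
  linarith

lemma qm_pow (b : ℕ) (hb : P.w1 ≤ YY b) : (P.Wm * ∏ p ∈ P.UU b, p)^4 ≤ 2^(16 * YY b) := by
  have hY1 : 1 ≤ YY b := by have := P.w1_gt; omega
  have h1 : (∏ p ∈ P.w1.primesBelow \ P.S, p) * ∏ p ∈ P.UU b, p ≤ primorial (YY b) := by
    classical
    rw [← prod_union]
    · apply le_of_dvd (primorial_pos _)
      unfold primorial
      apply prod_dvd_prod_of_subset
      intro p hp
      rcases mem_union.1 hp with h | h
      · have := mem_primesBelow.1 (Finset.mem_sdiff.1 h).1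
        exact mem_filter.2 ⟨mem_range.2 (by omega), this.2⟩
      · have := P.UU_spec h
        exact mem_filter.2 ⟨mem_range.2 (by omega), this.1⟩
    · rw [Finset.disjoint_left]
      intro p h1 h2
      have := mem_primesBelow.1 (Finset.mem_sdiff.1 h1).1
      have := P.UU_spec h2
      omega
  have h2 := primorial_le_four_pow (YY b)
  unfold Wm
  rw [mul_assoc]
  calc _ ≤ (2 * 4^(YY b))^4 := pow_le_pow_left (Nat.mul_le_mul_left 2 (h1.trans h2)) 4
    _ = 2^(4 + 8 * YY b) := by
        rw [show (4:ℕ) = 2^2 by norm_num, ← pow_mul, ← pow_succ', ← pow_mul]; congr 1; ring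
    _ ≤ _ := pow_le_pow_right (by norm_num) (by omega)

end Par

theorem exCx : ∃ (c : ℝ) (Ck C0 : ℕ), 0 < c ∧ 1 ≤ Ck ∧ ∀ P : Par, ∃ b0 : ℕ, ∀ b, b0 ≤ b → ∃ (Dr : Finset ℕ) (J k : ℕ),
    P.Cx C0 Ck b Dr J k ∧ c * #(P.G b) * 2^k / ((P.qm b Dr).totient * k) ≤ ∑ h ∈ P.G b, (PC (P.qm b Dr) h (2^k) (2^k) : ℝ) := by
  classical
  obtain ⟨c, Ck, C0, hc, hCk, hT⟩ := ThmP'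
  refine ⟨c, Ck, C0, hc, hCk, fun P => ?_⟩
  obtain ⟨J0, hJ0⟩ := hT P.Wm P.Wm_pos
  obtain ⟨b1, -, hb1⟩ := P.good_coprime
  obtain ⟨b2, hb2⟩ := P.q_big C0
  obtain ⟨b3, hb3⟩ := ev_nat (2^J0)
  refine ⟨b1 + b2 + b3 + P.w1 + 1, fun b hb => ?_⟩
  have hbe := add_one_le_exp (b:ℝ)
  have hYb : exp b ≤ Par.YY b := le_ceil _
  have hYb' : (Par.YY b : ℝ) < exp b + 1 := Nat.ceil_lt_add_one (exp_pos _).le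
  have hbY : b + 1 ≤ Par.YY b := by
    have : (b:ℝ) + 1 ≤ Par.YY b := by linarith
    exact_mod_cast this
  set J := Nat.log 2 (16 * Par.YY b) + 1 with hJ
  have hJ1 : 16 * Par.YY b < 2^J := lt_pow_succ_log_self (by norm_num) _
  have hJ2 : 2^J ≤ 32 * Par.YY b := by
    have := pow_log_le_self 2 (x := 16 * Par.YY b) (by omega)
    rw [hJ, pow_succ]; omega
  have hJr1 : (16:ℝ) * Par.YY b < 2^J := mod_cast hJ1
  have hJr2 : (2:ℝ)^J ≤ 32 * Par.YY b := mod_cast hJ2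
  have hJJ : J0 ≤ J := by
    by_contra hlt
    have h1 : 2^J ≤ 2^J0 := pow_le_pow_right (by norm_num) (by omega)
    have h2 : 2^J0 ≤ b := mod_cast hb3 b (by omega)
    omega
  obtain ⟨Dr, hDr, hDrc, hD⟩ := hJ0 J hJJ (P.UU b) (fun p hp => by
      have h1 := P.UU_spec hp
      refine ⟨h1.1, fun h => ?_⟩
      have := ((P.prime_dvd_Wm h1.1).1 h).1
      omega) ((P.qm_pow b (by omega)).trans (pow_le_pow_right (by norm_num) hJ1.le))
  obtain ⟨k, hk1, hk2, hk⟩ := hD (P.qm b Dr) rfl (P.G b) (fun h hh => hb1 b (by omega) h hh Dr)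
  refine ⟨Dr, J, k, ⟨hDr, hDrc, by linarith, by linarith, hk1, hk2, ?_, fun h hh => hb1 b (by omega) h hh Dr, hb2 b (by omega) Dr hDrc⟩, hk⟩
  have h1 := P.qm_pow b (by omega)
  refine le_trans (pow_le_pow_left ?_ 4) (h1.trans (pow_le_pow_right (by norm_num) (hJ1.le.trans hk1)))
  unfold Par.qm
  apply Nat.mul_le_mul_left
  apply le_of_dvd (prod_pos (fun p hp => (P.UU_spec hp).1.pos))
  exact prod_dvd_prod_of_subset _ _ _ sdiff_subset

/-- upper bound for primes in progressions modulo `q * d`. -/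
theorem PCub : ∃ C : ℝ, 1 ≤ C ∧ ∀ (q d k a : ℕ), 1 ≤ q → 1 ≤ d → q.Coprime d → a.Coprime (q*d) → 16 ≤ k → q^4 ≤ 2^k →
    d ≤ 2^(k/4) → d ≤ 2 * d.totient → (PC (q*d) a (2^k) (2^k) : ℝ) ≤ C * (2^k / (q.totient * k)) / d := by
  obtain ⟨C, hC, h⟩ := BTp
  refine ⟨16 * C, by linarith, ?_⟩
  intro q d k a hq hd hqd ha hk hq4 hdk hdφ
  have hqk : q ≤ 2^(k/4+1) := by
    by_contra hlt
    push Not at hlt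
    have h1 : (2^(k/4+1))^4 < q^4 := Nat.pow_lt_pow_left hlt (by norm_num)
    rw [← pow_mul] at h1
    have h2 : 2^k ≤ 2^((k/4+1)*4) := pow_le_pow_right (by norm_num) (by omega)
    omega
  have h1 := h (q*d) a (2^k) (2^k) (k/4) (Nat.mul_pos hq hd) ha (by omega) (by
    calc q*d*2^(k/4) ≤ 2^(k/4+1) * 2^(k/4) * 2^(k/4) := by gcongr
      _ = 2^(k/4+1+k/4+k/4) := by rw [pow_add _ (k/4+1+k/4), pow_add _ (k/4+1)]
      _ ≤ 2^k := pow_le_pow_right (by norm_num) (by omega))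
  refine h1.trans ?_
  rw [Nat.totient_mul hqd]
  have hdr : (d:ℝ) ≤ 2 * d.totient := mod_cast hdφ
  have hk4 : (k:ℝ) ≤ 8 * (k/4 : ℕ) := mod_cast (by omega)
  push_cast
  have e : 16 * C * (2^k / (q.totient * k)) / d = C * 2^k / (q.totient * (d/2) * (k/8)) := by field_simp; norm_num
  rw [e]
  gcongr
  · linarith
  · linarith

namespace Par
variable (P : Par)

noncomputable def PP (b : ℕ) (Dr : Finset ℕ) (k : ℕ) : Finset ℕ := {n ∈ Ico (2^k) (2^k+2^k) | n.Prime ∧ n % P.qm b Dr ∈ P.Ib b}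

/-- the main size -/
noncomputable def AA (b : ℕ) (Dr : Finset ℕ) (k : ℕ) : ℝ := 2^k / ((P.qm b Dr).totient * k)

variable {P} {C0 Ck b J k : ℕ} {Dr : Finset ℕ}

lemma Cx.k_ge (H : P.Cx C0 Ck b Dr J k) : (b:ℝ) ≤ k := by
  have h1 := add_one_le_exp (b:ℝ)
  have h2 := H.J1
  have h3 : (2:ℝ)^J ≤ k := mod_cast H.k1
  linarith

lemma Cx.Ib_lt (H : P.Cx C0 Ck b Dr J k) {h : ℕ} (hh : h ∈ P.Ib b) : h < P.qm b Dr := by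
  have := (P.mem_Ib.1 hh).2.trans_le H.qbig
  exact_mod_cast this

lemma Cx.q_lt (H : P.Cx C0 Ck b Dr J k) : P.qm b Dr < 2^k := by
  have h1 := H.q4
  have h2 : 2 ≤ P.qm b Dr := le_of_dvd (P.qm_pos b Dr) (P.two_dvd_qm b Dr)
  have h3 : P.qm b Dr < (P.qm b Dr)^4 := by
    calc P.qm b Dr = (P.qm b Dr)^1 := by rw [pow_one]
      _ < _ := Nat.pow_lt_pow_right (by omega) (by norm_num)
  omega

lemma Cx.fib (H : P.Cx C0 Ck b Dr J k) {h : ℕ} (hh : h ∈ P.Ib b) : 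
    {n ∈ P.PP b Dr k | n % P.qm b Dr = h} = {n ∈ Ico (2^k) (2^k+2^k) | n ≡ h [MOD P.qm b Dr] ∧ n.Prime} := by
  have h1 := H.Ib_lt hh
  ext n
  unfold PP
  simp only [mem_filter, ModEq, mod_eq_of_lt h1]
  grind

lemma Cx.sum_fib (H : P.Cx C0 Ck b Dr J k) (T : Finset ℕ) (hT : T ⊆ P.Ib b) (F : ℕ → ℝ) :
    ∑ n ∈ P.PP b Dr k with n % P.qm b Dr ∈ T, F (n % P.qm b Dr) = ∑ h ∈ T, F h * PC (P.qm b Dr) h (2^k) (2^k) := by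
  have hmaps : ∀ n ∈ ({n ∈ P.PP b Dr k | n % P.qm b Dr ∈ T} : Finset ℕ), n % P.qm b Dr ∈ T := fun n hn => (mem_filter.1 hn).2
  rw [← sum_fiberwise_of_maps_to hmaps]
  apply sum_congr rfl
  intro h hh
  have e : ({n ∈ ({n ∈ P.PP b Dr k | n % P.qm b Dr ∈ T} : Finset ℕ) | n % P.qm b Dr = h} : Finset ℕ) = {n ∈ P.PP b Dr k | n % P.qm b Dr = h} := by
    grind
  rw [e]
  calc _ = ∑ n ∈ P.PP b Dr k with n % P.qm b Dr = h, F h := by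
        apply sum_congr rfl
        intro n hn
        rw [(mem_filter.1 hn).2]
    _ = _ := by
        rw [sum_const, H.fib (hT hh), nsmul_eq_mul, mul_comm]
        rfl

lemma Cx.cop_PP (H : P.Cx C0 Ck b Dr J k) {n : ℕ} (hn : n ∈ P.PP b Dr k) : (n % P.qm b Dr).Coprime (P.qm b Dr) := by
  obtain ⟨h1, h2, h3⟩ := mem_filter.1 hn
  have h4 := (mem_Ico.1 h1).1
  rw [Coprime, (mod_modEq n _).gcd_eq]
  refine (h2.coprime_iff_not_dvd).2 ?_
  intro h
  have := le_of_dvd (P.qm_pos b Dr) h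
  have := H.q_lt
  omega

lemma Cx.split (H : P.Cx C0 Ck b Dr J k) {n : ℕ} (hn : n ∈ P.PP b Dr k) : n % P.qm b Dr ∈ P.G b ∨ n % P.qm b Dr ∈ P.Bd b Dr := by
  by_cases h : n % P.qm b Dr ∈ P.G b
  · exact Or.inl h
  · exact Or.inr (mem_filter.2 ⟨(mem_filter.1 hn).2.2, H.cop_PP hn, h⟩)

lemma Cx.AA_pos (_ : P.Cx C0 Ck b Dr J k) (hk : 1 ≤ k) : 0 < P.AA b Dr k := by
  unfold AA
  have : (0:ℝ) < (P.qm b Dr).totient := mod_cast totient_pos.2 (P.qm_pos b Dr)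
  positivity

end Par

/-- count of bad positions -/
theorem cnt1 (C0 Ck : ℕ) : ∃ C : ℝ, 1 ≤ C ∧ ∀ (P : Par), P.Ok C0 → ∃ b0 : ℕ, ∀ b, b0 ≤ b → ∀ Dr J k, P.Cx C0 Ck b Dr J k →
    (#{n ∈ P.PP b Dr k | n % P.qm b Dr ∈ P.Bd b Dr} : ℝ) ≤ C * P.AA b Dr k * (exp (P.a + b) / (P.a + b)) := by
  obtain ⟨C1, hC1, h1⟩ := bad_cnt
  obtain ⟨C2, hC2, h2⟩ := PCub
  refine ⟨C2 * C1, by nlinarith, fun P hok => ?_⟩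
  obtain ⟨b1, hb1⟩ := h1 P C0 hok
  refine ⟨b1 + 16, fun b hb Dr J k H => ?_⟩
  have hk : 16 ≤ k := by
    have := H.k_ge
    have : b ≤ k := mod_cast this
    omega
  have h3 := H.sum_fib (P.Bd b Dr) (filter_subset _ _) (fun _ => 1)
  rw [sum_const, nsmul_eq_mul, mul_one] at h3
  rw [h3]
  have hA := H.AA_pos (by omega)
  calc _ ≤ ∑ h ∈ P.Bd b Dr, C2 * P.AA b Dr k := by
        apply sum_le_sum
        intro h hh
        have h4 := h2 (P.qm b Dr) 1 k h (P.qm_pos b Dr) le_rfl (by simp) (by simpa using (mem_filter.1 hh).2.1) hk H.q4 one_le_two_pow (by simp)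
        rw [mul_one, cast_one, div_one] at h4
        rw [one_mul]; exact h4
    _ = #(P.Bd b Dr) * (C2 * P.AA b Dr k) := by rw [sum_const, nsmul_eq_mul]
    _ ≤ (C1 * exp (P.a + b) / (P.a + b)) * (C2 * P.AA b Dr k) := by
        gcongr
        exact hb1 b (by omega) Dr H.hDr H.hDrc
    _ = _ := by ring

noncomputable def nz (w n : ℕ) : ℝ := ∑ p ∈ (n-1).primeFactors with w < p, 1/(p:ℝ)

lemma sum_union_le (A B : Finset ℕ) : ∑ m ∈ A ∪ B, (1:ℝ)/m ≤ ∑ m ∈ A, (1:ℝ)/m + ∑ m ∈ B, (1:ℝ)/m := by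
  rw [← sum_union_inter]
  have : 0 ≤ ∑ m ∈ A ∩ B, (1:ℝ)/m := sum_nonneg (fun _ _ => by positivity)
  linarith

lemma sum_big (m u : ℕ) (z : ℝ) (hz : 0 < z) (hm : m < 2^u) (s : Finset ℕ) (hs : ∀ p ∈ s, p ∈ m.primeFactors ∧ z ≤ p) :
    ∑ p ∈ s, 1/(p:ℝ) ≤ u / z := by
  have hc : #s ≤ u := by
    rcases eq_or_ne m 0 with rfl | h0
    · have : s = ∅ := eq_empty_of_forall_notMem (fun p hp => by simpa using (hs p hp).1)
      simp [this]
    have h1 : 2^#s ≤ m := by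
      calc 2^#s ≤ ∏ p ∈ s, p := pow_card_le_prod _ _ _ (fun p hp => (prime_of_mem_primeFactors (hs p hp).1).two_le)
        _ ≤ m := le_of_dvd (Nat.pos_of_ne_zero h0) ((prod_dvd_prod_of_subset _ _ _ (fun p hp => (hs p hp).1)).trans
            (Nat.prod_primeFactors_dvd m))
    exact ((Nat.pow_lt_pow_iff_right (by norm_num : 1 < 2)).1 (h1.trans_lt hm)).le
  calc _ ≤ ∑ p ∈ s, 1/z := by
        apply sum_le_sum
        intro p hp
        have := (hs p hp).2
        gcongr
    _ = #s / z := by rw [sum_const, nsmul_eq_mul, mul_one_div]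
    _ ≤ _ := by gcongr

lemma sum_sq_le (w z : ℕ) (hw : 1 ≤ w) : ∑ p ∈ Ioc w z, 1/(p:ℝ)^2 ≤ 1/(w:ℝ) := by
  rcases le_or_gt w z with h | h
  · have h1 := sum_Ioc_inv_sq_le_sub (α := ℝ) (by omega : w ≠ 0) h
    simp only [one_div]
    have : (0:ℝ) ≤ (z:ℝ)⁻¹ := by positivity
    linarith
  · rw [Ioc_eq_empty (by omega), sum_empty]; positivity

/-- count of noisy elements -/
theorem cnt2 (C0 Ck : ℕ) : ∃ C : ℝ, 1 ≤ C ∧ ∀ (P : Par), P.Ok C0 → ∀ ν : ℝ, 0 < ν → ∃ b0 : ℕ, ∀ b, b0 ≤ b → ∀ Dr J k, P.Cx C0 Ck b Dr J k →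
    (#{n ∈ P.PP b Dr k | n % P.qm b Dr ∈ P.G b ∧ ν < nz P.w n} : ℝ) ≤ C * P.AA b Dr k * (P.N * P.Gh b) / (ν * P.w) := by
  classical
  obtain ⟨C1, hC1, h1⟩ := cntG
  obtain ⟨C2, hC2, h2⟩ := PCub
  refine ⟨4 * C2 * C1, by nlinarith, fun P hok ν hν => ?_⟩
  obtain ⟨b1, hb1E, hb1⟩ := h1 P hok.one_le
  obtain ⟨m0, hm0⟩ := exp_beats ((2*P.a + 10)*4/ν)
  refine ⟨b1 + 4*m0 + 16, fun b hb Dr J k H => ?_⟩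
  have hbk : b ≤ k := mod_cast H.k_ge
  have hk : 16 ≤ k := by omega
  have hA := H.AA_pos (by omega)
  have ha0 : (0:ℝ) ≤ P.a := cast_nonneg _
  set q := P.qm b Dr
  have hq1 : 1 ≤ q := P.qm_pos b Dr
  set z1 := 2^(b/4)
  set z2 := 2^(k/4)
  have hw2 := P.hw
  have hGh : 0 ≤ P.N * P.Gh b := by
    have := (cast_nonneg _).trans (hb1 b (by omega) 0 P.hN).1
    have h3 : 0 ≤ P.Gh b := by nlinarith
    positivity
  have hGsub := P.G_sub_Ib (b := b) (by omega)
  -- cardinalities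
  have hGc : (#(P.G b) : ℝ) ≤ C1 * (P.N * P.Gh b) := by
    calc (#(P.G b) : ℝ) ≤ ∑ i ∈ range P.N, (#(P.Gs b i) : ℝ) := mod_cast card_biUnion_le
      _ ≤ ∑ i ∈ range P.N, C1 * P.Gh b := sum_le_sum (fun i hi => (hb1 b (by omega) i (mem_range.1 hi)).1)
      _ = _ := by rw [sum_const, card_range, nsmul_eq_mul]; ring
  have hGp : ∀ p : ℕ, p.Prime → P.w < p → p ≤ z1 → (#{h ∈ P.G b | h ≡ 1 [MOD p]} : ℝ) ≤ C1 * (P.N * P.Gh b) / p := by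
    intro p hp hwp hpz
    have hpe : (p:ℝ) ≤ exp (b/4) := by
      calc (p:ℝ) ≤ (2:ℝ)^(b/4) := mod_cast hpz
        _ ≤ exp ((b/4 : ℕ):ℝ) := two_pow_le_exp _
        _ ≤ _ := exp_le_exp.2 (by simpa using Nat.cast_div_le (α := ℝ) (m := b) (n := 4))
    have e : ({h ∈ P.G b | h ≡ 1 [MOD p]} : Finset ℕ) = (range P.N).biUnion (fun i => {h ∈ P.Gs b i | h ≡ 1 [MOD p]}) := filter_biUnion _ _ _
    rw [e]
    calc _ ≤ ∑ i ∈ range P.N, (#{h ∈ P.Gs b i | h ≡ 1 [MOD p]} : ℝ) := mod_cast card_biUnion_le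
      _ ≤ ∑ i ∈ range P.N, C1 * P.Gh b / p := sum_le_sum (fun i hi => (hb1 b (by omega) i (mem_range.1 hi)).2 p 1 hp hwp hpe)
      _ = _ := by rw [sum_const, card_range, nsmul_eq_mul]; ring
  set sA : ℕ → ℝ := fun h => ∑ p ∈ Ioc P.w z1 with p.Prime ∧ h ≡ 1 [MOD p], 1/(p:ℝ) with hsA
  set sC : ℕ → ℝ := fun n => ∑ p ∈ Ioc P.w z2 with (p.Prime ∧ ¬ p ∣ q) ∧ n ≡ 1 [MOD p], 1/(p:ℝ) with hsC
  set PG : Finset ℕ := {n ∈ P.PP b Dr k | n % q ∈ P.G b} with hPG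
  have hsA0 : ∀ h, 0 ≤ sA h := fun h => sum_nonneg (fun _ _ => by positivity)
  have hsC0 : ∀ h, 0 ≤ sC h := fun h => sum_nonneg (fun _ _ => by positivity)
  -- pointwise bound
  have hpt : ∀ n ∈ PG, nz P.w n ≤ sA (n % q) + sC n + ν/2 := by
    intro n hn
    obtain ⟨hnP, hnG⟩ := mem_filter.1 hn
    obtain ⟨hn1, hnp, -⟩ := mem_filter.1 hnP
    have hn1 := mem_Ico.1 hn1
    have hh := P.mem_Ib.1 (hGsub hnG)
    set h := n % q
    have hh2 : 2 ≤ h := by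
      have h3 := add_one_le_exp ((P.a:ℝ) + b)
      have h4 : (16:ℝ) ≤ b := mod_cast (by omega : 16 ≤ b)
      have : (2:ℝ) ≤ h := by linarith
      exact_mod_cast this
    have hsub : ({p ∈ (n-1).primeFactors | P.w < p} : Finset ℕ) ⊆ ({p ∈ Ioc P.w z1 | p.Prime ∧ h ≡ 1 [MOD p]} ∪ {p ∈ (h-1).primeFactors | z1 < p}) ∪
        ({p ∈ Ioc P.w z2 | (p.Prime ∧ ¬ p ∣ q) ∧ n ≡ 1 [MOD p]} ∪ {p ∈ (n-1).primeFactors | z2 < p}) := by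
      intro p hp
      obtain ⟨hp1, hwp⟩ := mem_filter.1 hp
      obtain ⟨hpp, hpd, -⟩ := mem_primeFactors.1 hp1
      have hmod : n ≡ 1 [MOD p] := ((modEq_iff_dvd' hnp.one_le).2 hpd).symm
      by_cases hpq : p ∣ q
      · apply mem_union_left
        have hh1 : h ≡ 1 [MOD p] := ((mod_modEq n q).of_dvd hpq).trans hmod
        by_cases hpz : p ≤ z1
        · exact mem_union_left _ (mem_filter.2 ⟨mem_Ioc.2 ⟨hwp, hpz⟩, hpp, hh1⟩)
        · refine mem_union_right _ (mem_filter.2 ⟨mem_primeFactors.2 ⟨hpp, ?_, by omega⟩, by omega⟩)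
          exact (modEq_iff_dvd' (by omega)).1 hh1.symm
      · apply mem_union_right
        by_cases hpz : p ≤ z2
        · exact mem_union_left _ (mem_filter.2 ⟨mem_Ioc.2 ⟨hwp, hpz⟩, ⟨hpp, hpq⟩, hmod⟩)
        · exact mem_union_right _ (mem_filter.2 ⟨hp1, by omega⟩)
    have hgen : ∀ (y m u : ℕ), m0 ≤ y/4 → (u:ℝ) ≤ (2*P.a+10)*(((y/4 : ℕ):ℝ)+1)^2 → m < 2^u → 
        ∑ p ∈ m.primeFactors with 2^(y/4) < p, 1/(p:ℝ) ≤ ν/4 := by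
      intro y m u hy hu hmu
      refine (sum_big m u (2^(y/4)) (by positivity) hmu _ (fun p hp => ?_)).trans ?_
      · obtain ⟨h3, h4⟩ := mem_filter.1 hp
        exact ⟨h3, mod_cast h4.le⟩
      · rw [div_le_iff₀ (by positivity)]
        have h5 := hm0 (y/4) hy
        have e : ν/4 * ((2*P.a + 10)*4/ν * (((y/4 : ℕ):ℝ)+1)^2) = (2*P.a+10)*(((y/4 : ℕ):ℝ)+1)^2 := by field_simp
        have h6 : ν/4 * ((2*P.a + 10)*4/ν * (((y/4 : ℕ):ℝ)+1)^2) ≤ ν/4 * 2^(y/4) := by gcongr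
        linarith
    have hB := hgen b (h-1) (2*(P.a+b+1)) (by omega) (by
      have h3 : (b:ℝ) ≤ 4*((b/4 : ℕ):ℝ) + 4 := mod_cast (by omega)
      have h4 : (0:ℝ) ≤ ((b/4 : ℕ):ℝ) := cast_nonneg _
      push_cast
      nlinarith [mul_nonneg ha0 h4, mul_nonneg ha0 (mul_nonneg h4 h4)]) (by
      have h3 := exp_le_two_pow (P.a + b + 1)
      push_cast at h3
      have h4 : (h:ℝ) < 2^(2*(P.a+b+1)) := by linarith [hh.2]
      have h5 : h < 2^(2*(P.a+b+1)) := mod_cast h4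
      omega)
    have hD := hgen k (n-1) (k+1) (by omega) (by
      have h3 : (k:ℝ) ≤ 4*((k/4 : ℕ):ℝ) + 4 := mod_cast (by omega)
      have h4 : (0:ℝ) ≤ ((k/4 : ℕ):ℝ) := cast_nonneg _
      push_cast
      nlinarith [mul_nonneg ha0 h4, mul_nonneg ha0 (mul_nonneg h4 h4)]) (by rw [pow_succ]; omega)
    unfold nz
    refine (sum_le_sum_of_subset_of_nonneg hsub (fun _ _ _ => by positivity)).trans ?_
    refine (sum_union_le _ _).trans ?_
    have h7 := sum_union_le {p ∈ Ioc P.w z1 | p.Prime ∧ h ≡ 1 [MOD p]} {p ∈ (h-1).primeFactors | z1 < p}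
    have h8 := sum_union_le {p ∈ Ioc P.w z2 | (p.Prime ∧ ¬ p ∣ q) ∧ n ≡ 1 [MOD p]} {p ∈ (n-1).primeFactors | z2 < p}
    simp only [hsA, hsC]
    linarith
  -- first moment, part A
  have hmA : ∑ n ∈ PG, sA (n % q) ≤ C2 * P.AA b Dr k * (C1 * (P.N * P.Gh b) * (1/P.w)) := by
    rw [hPG, H.sum_fib (P.G b) hGsub]
    calc _ ≤ ∑ h ∈ P.G b, C2 * P.AA b Dr k * sA h := by
          apply sum_le_sum
          intro h hh
          have h4 := h2 q 1 k h hq1 le_rfl (by simp) (by simpa using H.cop h hh) hk H.q4 one_le_two_pow (by simp)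
          rw [mul_one, cast_one, div_one] at h4
          rw [mul_comm]
          exact mul_le_mul_of_nonneg_right h4 (hsA0 h)
      _ = C2 * P.AA b Dr k * ∑ h ∈ P.G b, sA h := by rw [mul_sum]
      _ ≤ _ := by
          apply mul_le_mul_of_nonneg_left _ (by positivity)
          simp only [hsA, sum_filter]
          rw [sum_comm]
          calc _ ≤ ∑ p ∈ Ioc P.w z1, C1 * (P.N * P.Gh b) * (1/(p:ℝ)^2) := by
                apply sum_le_sum
                intro p hp
                obtain ⟨hp1, hp2⟩ := mem_Ioc.1 hp
                by_cases hpp : p.Prime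
                · simp only [hpp, true_and]
                  rw [← sum_filter, sum_const, nsmul_eq_mul]
                  calc _ ≤ C1 * (P.N * P.Gh b) / p * (1/(p:ℝ)) := by gcongr; exact hGp p hpp hp1 hp2
                    _ = _ := by ring
                · simp only [hpp, false_and, if_false, sum_const_zero]
                  positivity
            _ ≤ _ := by rw [← mul_sum]; gcongr; exact sum_sq_le _ _ (by omega)
  -- first moment, part C
  have hmC : ∑ n ∈ PG, sC n ≤ C2 * P.AA b Dr k * (C1 * (P.N * P.Gh b) * (1/P.w)) := by
    simp only [hsC, sum_filter]
    rw [sum_comm]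
    calc _ ≤ ∑ p ∈ Ioc P.w z2, C2 * P.AA b Dr k * (C1 * (P.N * P.Gh b)) * (1/(p:ℝ)^2) := by
          apply sum_le_sum
          intro p hp
          obtain ⟨hp1, hp2⟩ := mem_Ioc.1 hp
          by_cases hpp : p.Prime ∧ ¬ p ∣ q
          · simp only [hpp, true_and, not_false_eq_true]
            rw [← sum_filter, sum_const, nsmul_eq_mul]
            have hcop : q.Coprime p := ((Nat.Prime.coprime_iff_not_dvd hpp.1).2 hpp.2).symm
            have hp0 : (0:ℝ) < p := mod_cast hpp.1.pos
            have hmaps : ∀ n ∈ ({n ∈ PG | n ≡ 1 [MOD p]} : Finset ℕ), n % q ∈ P.G b := fun n hn => (mem_filter.1 (mem_filter.1 hn).1).2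
            have hcard : (#{n ∈ PG | n ≡ 1 [MOD p]} : ℝ) ≤ C2 * P.AA b Dr k / p * #(P.G b) := by
              rw [card_eq_sum_card_fiberwise hmaps]
              push_cast
              calc _ ≤ ∑ h ∈ P.G b, C2 * P.AA b Dr k / p := by
                    apply sum_le_sum
                    intro h hh
                    obtain ⟨x, hx1, hx2⟩ := chineseRemainder hcop h 1
                    have hxc : x.Coprime (q*p) := by
                      apply Coprime.mul_right
                      · rw [Coprime, hx1.gcd_eq]; exact H.cop h hh
                      · rw [Coprime, hx2.gcd_eq]; exact Nat.gcd_one_left p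
                    have h4 := h2 q p k x hq1 hpp.1.one_le hcop hxc hk H.q4 hp2 (by
                      rw [Nat.totient_prime hpp.1]; have := hpp.1.two_le; omega)
                    refine le_trans ?_ h4
                    unfold PC
                    apply Nat.cast_le.2
                    apply card_le_card
                    intro n hn
                    obtain ⟨hn1, hn2⟩ := mem_filter.1 hn
                    obtain ⟨hn3, hn4⟩ := mem_filter.1 hn1
                    obtain ⟨hn5, hn6, -⟩ := mem_filter.1 (mem_filter.1 hn3).1
                    refine mem_filter.2 ⟨hn5, ?_, hn6⟩
                    rw [← Nat.modEq_and_modEq_iff_modEq_mul hcop]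
                    refine ⟨?_, hn4.trans hx2.symm⟩
                    have : n ≡ h [MOD q] := by rw [← hn2]; exact (mod_modEq n q).symm
                    exact this.trans hx1.symm
                _ = _ := by rw [sum_const, nsmul_eq_mul]; ring
            calc _ ≤ C2 * P.AA b Dr k / p * (C1 * (P.N * P.Gh b)) * (1/(p:ℝ)) := by
                  gcongr
                  refine hcard.trans ?_
                  gcongr
              _ = _ := by ring
          · simp only [hpp, false_and, if_false, sum_const_zero]
            positivity
      _ ≤ _ := by
          rw [← mul_sum, mul_assoc]
          gcongr
          exact sum_sq_le _ _ (by omega)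
  -- Markov
  have hfin : (#{n ∈ P.PP b Dr k | n % q ∈ P.G b ∧ ν < nz P.w n} : ℝ) * (ν/2) ≤ ∑ n ∈ PG, (sA (n%q) + sC n) := by
    have e : ({n ∈ P.PP b Dr k | n % q ∈ P.G b ∧ ν < nz P.w n} : Finset ℕ) = {n ∈ PG | ν < nz P.w n} := by rw [hPG, filter_filter]
    rw [e, ← nsmul_eq_mul, ← sum_const]
    refine le_trans ?_ (sum_le_sum_of_subset_of_nonneg (filter_subset (fun n => ν < nz P.w n) PG) (fun n _ _ => add_nonneg (hsA0 _) (hsC0 _)))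
    apply sum_le_sum
    intro n hn
    obtain ⟨h3, h4⟩ := mem_filter.1 hn
    have := hpt n h3
    linarith
  rw [sum_add_distrib] at hfin
  rw [le_div_iff₀ (by positivity)]
  have h9 : (#{n ∈ P.PP b Dr k | n % q ∈ P.G b ∧ ν < nz P.w n} : ℝ) * (ν/2) ≤ 2 * (C2 * P.AA b Dr k * (C1 * (P.N * P.Gh b) * (1/P.w))) := by linarith
  calc _ = (#{n ∈ P.PP b Dr k | n % q ∈ P.G b ∧ ν < nz P.w n} : ℝ) * (ν/2) * (2 * P.w) := by ring
    _ ≤ 2 * (C2 * P.AA b Dr k * (C1 * (P.N * P.Gh b) * (1/P.w))) * (2 * P.w) := by gcongr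
    _ = _ := by field_simp; ring

lemma prod_inv_lin {T S : Finset ℕ} (hS : ∀ p ∈ S, p.Prime) (hT : T ⊆ S) :
    ∏ p ∈ T, (1 - 1/(p:ℝ))⁻¹ ≤ 1 + (∏ p ∈ S, (1 - 1/(p:ℝ))⁻¹) * ∑ p ∈ T, 1/(p:ℝ) := by
  have h1 : ∏ p ∈ T, (1 - 1/(p:ℝ)) ≥ 1 - ∑ p ∈ T, 1/(p:ℝ) := by
    have : ∀ p ∈ T, p.Prime := fun p hp => hS p (hT hp)
    clear hT
    induction T using Finset.induction_on with
    | empty => simp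
    | insert p s hp ih =>
      rw [prod_insert hp, sum_insert hp]
      have h2 := ih (fun q hq => this q (mem_insert_of_mem hq))
      obtain ⟨h3, h4⟩ := one_sub_inv_mem (this p (mem_insert_self _ _))
      have h5 : 0 ≤ ∑ p ∈ s, 1/(p:ℝ) := sum_nonneg (fun _ _ => by positivity)
      nlinarith
  have h2 : ∏ p ∈ T, (1 - 1/(p:ℝ))⁻¹ ≤ ∏ p ∈ S, (1 - 1/(p:ℝ))⁻¹ := by
    rw [← prod_sdiff hT]
    exact le_mul_of_one_le_left (zero_le_one.trans (one_le_prod_inv T (fun p hp => hS p (hT hp))))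
      (one_le_prod_inv _ (fun p hp => hS p (mem_sdiff.1 hp).1))
  have h3 : 0 ≤ ∑ p ∈ T, 1/(p:ℝ) := sum_nonneg (fun _ _ => by positivity)
  have h4 : 0 < ∏ p ∈ T, (1 - 1/(p:ℝ)) := prod_pos (fun p hp => (one_sub_inv_mem (hS p (hT hp))).1)
  have h5 : (∏ p ∈ T, (1 - 1/(p:ℝ))⁻¹) * ∏ p ∈ T, (1 - 1/(p:ℝ)) = 1 := by
    rw [prod_inv_distrib, inv_mul_cancel₀ h4.ne']
  have h6 := one_le_prod_inv T (fun p hp => hS p (hT hp))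
  nlinarith

lemma Par.sing_le (P : Par) (C0 : ℕ) (hok : P.Ok C0) : ∃ b0 : ℕ, ∀ b, b0 ≤ b → ∀ Dr ⊆ P.UU b, #Dr ≤ C0 → ∀ h ∈ P.Ib b, ∀ h' ∈ P.Ib b,
    h ≠ h' → ∀ z, Sing z (P.qm b Dr) h h' ≤ exp 2 * (1 + P.WS * ∑ p ∈ P.S with h' ≡ h [MOD p], 1/(p:ℝ)) := by
  classical
  obtain ⟨m0, hm0⟩ := exp_beats (4*(P.a + P.E + 1))
  refine ⟨m0 + P.E, fun b hb Dr hDr hDc h hh h' hh' hne z => ?_⟩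
  have hSp : ∀ p ∈ P.S, p.Prime := fun p hp => (P.hS p hp).1
  set A : Finset ℕ := {p ∈ sv z (P.qm b Dr) | h ≡ h' [MOD p]}
  have hAp : ∀ p ∈ A, p.Prime ∧ ¬ p ∣ P.qm b Dr ∧ h ≡ h' [MOD p] := fun p hp => by
    obtain ⟨h1, h2⟩ := mem_filter.1 hp
    exact ⟨(mem_filter.1 h1).2.1, (mem_filter.1 h1).2.2, h2⟩
  unfold Sing
  rw [← prod_inter_mul_prod_sdiff A P.S, mul_comm]
  refine mul_le_mul ?_ ?_ (zero_le_one.trans (one_le_prod_inv _ (fun p hp => (hAp p (mem_inter.1 hp).1).1))) (exp_pos _).le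
  · refine (prod_inv_le_exp _ (fun p hp => (hAp p (mem_sdiff.1 hp).1).1)).trans (exp_le_exp.2 ?_)
    set m := ((h':ℤ) - h).natAbs
    set B : Finset ℕ := {p ∈ m.primeFactors | exp (b - P.E) ≤ p}
    have hsub : A \ P.S ⊆ Dr ∪ B := by
      intro p hp
      obtain ⟨h1, h2⟩ := mem_sdiff.1 hp
      obtain ⟨h3, h4, h5⟩ := hAp p h1
      rw [P.prime_dvd_qm h3] at h4
      push Not at h4
      rw [mem_union, or_iff_not_imp_left]
      intro h6
      have h7 : p ∉ P.UU b := fun h => h6 (h4.2 h)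
      have h8 : P.w1 ≤ p := by
        by_contra h; exact h2 (h4.1 (by omega))
      have hp0 : (0:ℝ) < p := mod_cast h3.pos
      refine mem_filter.2 ⟨mem_primeFactors.2 ⟨h3, Int.natCast_dvd.1 ((Nat.modEq_iff_dvd).1 h5), by omega⟩, ?_⟩
      by_cases h9 : p < YY b
      · have h10 : p ∈ P.Big b := by
          by_contra h; exact h7 (mem_filter.2 ⟨mem_primesBelow.2 ⟨h9, h3⟩, h8, h⟩)
        have h11 := (mem_filter.1 h10).2.1
        rw [← le_log_iff_exp_le hp0]
        have h12 := floor_le (log_nonneg (mod_cast h3.one_le : (1:ℝ) ≤ p))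
        have h13 : (b:ℝ) ≤ (⌊log p⌋₊ : ℝ) + P.E := mod_cast h11
        linarith
      · have h10 : (YY b : ℝ) ≤ p := mod_cast not_lt.1 h9
        have h11 : exp b ≤ YY b := le_ceil _
        have h12 : exp (b - P.E) ≤ exp b := exp_le_exp.2 (by simp)
        linarith
    have h1 : ∑ p ∈ Dr, 1/(p:ℝ) ≤ 1/2 := by
      have hw : (0:ℝ) < P.w1 := mod_cast (by have := P.w1_gt; omega : 0 < P.w1)
      calc ∑ p ∈ Dr, 1/(p:ℝ) ≤ ∑ p ∈ Dr, 1/(P.w1:ℝ) := by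
            apply sum_le_sum
            intro p hp
            have : (P.w1:ℝ) ≤ p := mod_cast (P.UU_spec (hDr hp)).2.2.1
            gcongr
        _ = #Dr / P.w1 := by rw [sum_const, nsmul_eq_mul, mul_one_div]
        _ ≤ _ := by
            rw [div_le_div_iff₀ hw (by norm_num)]
            have := hok.C0le
            exact_mod_cast (by omega : #Dr * 2 ≤ 1 * P.w1)
    have h2 : ∑ p ∈ B, 1/(p:ℝ) ≤ 1/2 := by
      have hlt : ∀ x ∈ P.Ib b, x < 2^(2*(P.a + b + 1)) := fun x hx => by
        have h3 := (P.mem_Ib.1 hx).2.trans_le (le_trans (le_of_eq (by push_cast; rfl)) (exp_le_two_pow (P.a + b + 1)))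
        exact_mod_cast h3
      have h3 := sum_big m (2*(P.a + b + 1)) (exp (b - P.E)) (exp_pos _) (by
        have := hlt h hh
        have := hlt h' hh'
        omega) B (fun p hp => mem_filter.1 hp)
      refine h3.trans ?_
      rw [div_le_div_iff₀ (exp_pos _) (by norm_num)]
      have h4 := hm0 (b - P.E) (by omega)
      have h5 := two_pow_le_exp (b - P.E)
      rw [cast_sub (by omega)] at h4 h5
      have h6 : (P.E:ℝ) ≤ b := mod_cast (by omega : P.E ≤ b)
      have h7 : (0:ℝ) ≤ P.a := cast_nonneg _
      have h8 : (0:ℝ) ≤ P.E := cast_nonneg _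
      push_cast
      have h9 : (0:ℝ) ≤ (b:ℝ) - P.E := by linarith
      nlinarith [mul_nonneg h7 h9, mul_nonneg h8 h9, mul_nonneg h7 (sq_nonneg ((b:ℝ) - P.E)), mul_nonneg h8 (sq_nonneg ((b:ℝ) - P.E))]
    have h3 := (sum_le_sum_of_subset_of_nonneg hsub (f := fun p : ℕ => 1/(p:ℝ)) (fun _ _ _ => by positivity)).trans (sum_union_le Dr B)
    linarith
  · refine (prod_inv_lin hSp inter_subset_right).trans ?_
    unfold WS
    gcongr
    · exact zero_le_one.trans (one_le_prod_inv _ hSp)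
    · intro p hp
      obtain ⟨h1, h2⟩ := mem_inter.1 hp
      exact mem_filter.2 ⟨h2, (hAp p h1).2.2.symm⟩

set_option maxHeartbeats 1000000 in
/-- count of elements having a partner in the same cluster and row -/
theorem cnt3 (C0 Ck : ℕ) : ∃ C : ℝ, 1 ≤ C ∧ ∀ (P : Par), P.Ok C0 → ∃ b0 : ℕ, ∀ b, b0 ≤ b → ∀ Dr J k, P.Cx C0 Ck b Dr J k →
    ∀ T : Finset ℕ, (∀ n ∈ T, n ∈ P.PP b Dr k ∧ ∃ n' ∈ P.PP b Dr k, n' ≠ n ∧ n' / P.qm b Dr = n / P.qm b Dr ∧ ∃ i < P.N,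
      n % P.qm b Dr ∈ P.Gs b i ∧ n' % P.qm b Dr ∈ P.Gs b i) →
    (#T : ℝ) ≤ C * P.AA b Dr k * (P.N * P.Gh b) * ((P.qm b Dr : ℝ) / ((P.qm b Dr).totient * k) * P.Gh b) := by
  classical
  obtain ⟨C1, hC1, h1⟩ := cntG
  obtain ⟨D, h2⟩ := PB
  obtain ⟨m1, hm1⟩ := exp_beats 64
  set d := 4*D with hd
  set B : ℝ := 24 * Ck^2 * (2^d)^2 with hB
  have hB0 : 0 ≤ B := by positivity
  have he : (1:ℝ) ≤ exp 2 := one_le_exp (by norm_num)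
  refine ⟨2 * ((B + 1) * exp 2) * C1^2, by
    have : 1 ≤ (B+1) * exp 2 := by nlinarith
    have : 1 ≤ C1^2 := by nlinarith
    nlinarith, fun P hok => ?_⟩
  obtain ⟨b1, hb1E, hb1⟩ := h1 P hok.one_le
  obtain ⟨b2, hb2⟩ := P.sing_le C0 hok
  refine ⟨b1 + b2 + d + 4*P.w1 + 8*m1 + 16, fun b hb Dr J k H T hT => ?_⟩
  have hbk : b ≤ k := mod_cast H.k_ge
  have hA := H.AA_pos (by omega)
  have hsing := hb2 b (by omega) Dr H.hDr H.hDrc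
  have hGsub := P.G_sub_Ib (b := b) (by omega)
  have hcop := H.cop
  have hq1 := P.qm_pos b Dr
  have hq2 := P.two_dvd_qm b Dr
  have hqX := H.q_lt
  have hq4 := H.q4
  unfold Par.AA at hA ⊢
  set q := P.qm b Dr
  have hq0 : (0:ℝ) < q := mod_cast hq1
  have hφq : (q.totient:ℝ) ≤ q := mod_cast totient_le q
  have hk0 : (0:ℝ) < k := mod_cast (by omega : 0 < k)
  have hGh : 0 ≤ P.Gh b := by
    have := (cast_nonneg _).trans (hb1 b (by omega) 0 P.hN).1
    nlinarith
  have hG : ∀ i < P.N, P.Gs b i ⊆ P.G b := fun i hi => subset_biUnion_of_mem (P.Gs b) (mem_range.2 hi)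
  set t0 := 2^k / q with ht0
  set Hh := t0 + 2 with hHh
  have hdJ : d ≤ J := by
    have h3 := (two_pow_le_exp b).trans H.J1
    have h4 : (2:ℕ)^b ≤ 2^J := mod_cast h3
    have := (Nat.pow_le_pow_iff_right (by norm_num : 1 < 2)).1 h4
    omega
  set J' := J - d
  have hJJ : 2^J' * 2^d = 2^J := by rw [← pow_add]; congr 1; omega
  have hk1 := H.k1
  have hJk : 2^J' ≤ k := le_trans (by rw [← hJJ]; exact Nat.le_mul_of_pos_right _ (by positivity)) hk1
  have hDk : 4 * (2^J' * D) ≤ k := by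
    have : d < 2^d := lt_two_pow_self
    nlinarith [Nat.mul_le_mul_left (2^J') this.le]
  set M : ℝ := (2:ℝ)^k / (q.totient * k) * ((q:ℝ)/(q.totient * k)) with hM
  have hM0 : 0 ≤ M := by positivity
  set TT : ℕ → ℕ → Finset ℕ := fun h h' => {t ∈ Ico t0 (t0+Hh) | Rough (2^2^J') (h + q * t) ∧ Rough (2^2^J') (h' + q * t)}
  have herr : (2:ℝ)^(2^J'*D) ≤ M := by
    have h3 : (2^(2^J'*D) * q * k^2) ≤ 2^k := by
      rw [← Nat.pow_le_pow_iff_left (by norm_num : 4 ≠ 0)]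
      have e1 : (2^(2^J'*D))^4 ≤ 2^k := by
        rw [← pow_mul]; exact pow_le_pow_right (by norm_num) (by omega)
      have e2 : (k^2)^4 ≤ 2^k := by
        have h4 := hm1 (k/8) (by omega)
        have h5 : 64 * (k/8+1)^2 ≤ 2^(k/8) := mod_cast h4
        have h6 : k^2 ≤ 2^(k/8) := by
          have : k ≤ 8*(k/8+1) := by omega
          nlinarith
        calc (k^2)^4 ≤ (2^(k/8))^4 := pow_le_pow_left h6 4
          _ = 2^(k/8*4) := by rw [← pow_mul]
          _ ≤ _ := pow_le_pow_right (by norm_num) (by omega)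
      calc _ = (2^(2^J'*D))^4 * q^4 * (k^2)^4 := by ring
        _ ≤ 2^k * 2^k * 2^k := Nat.mul_le_mul (Nat.mul_le_mul e1 hq4) e2
        _ ≤ 2^k * 2^k * 2^k * 2^k := Nat.le_mul_of_pos_right _ (by positivity)
        _ = _ := by ring
    have h4 : (2:ℝ)^(2^J'*D) * q * k^2 ≤ 2^k := mod_cast h3
    calc (2:ℝ)^(2^J'*D) ≤ 2^k / (q * k^2) := by
          rw [le_div_iff₀ (by positivity), ← mul_assoc]; exact h4
      _ = 2^k * q / (q * q * k^2) := by field_simp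
      _ ≤ 2^k * q / (q.totient * q.totient * k^2) := by gcongr
      _ = M := by rw [hM]; field_simp
  have hmain : 8 * (Hh:ℝ) * ((q:ℝ) / q.totient)^2 / (2^J')^2 ≤ B * M := by
    have h3 : (Hh:ℝ) ≤ 3 * (2^k/q) := by
      have h4 : (t0:ℝ) ≤ 2^k/q := by rw [ht0]; simpa using Nat.cast_div_le (α := ℝ) (m := 2^k) (n := q)
      have h5 : (1:ℝ) ≤ 2^k/q := by
        rw [le_div_iff₀ hq0, one_mul]; exact_mod_cast hqX.le
      rw [hHh]; push_cast; linarith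
    have h4 : (k:ℝ) ≤ Ck * 2^d * 2^J' := by
      have := H.k2
      rw [← hJJ] at this
      have h5 : (k:ℝ) ≤ Ck * (2^J' * 2^d) := mod_cast this
      linarith
    rw [div_le_iff₀ (by positivity)]
    have h5 : (k:ℝ)^2 ≤ (Ck * 2^d * 2^J')^2 := by gcongr
    calc 8 * (Hh:ℝ) * ((q:ℝ) / q.totient)^2 ≤ 8 * (3 * (2^k/q)) * ((q:ℝ) / q.totient)^2 := by gcongr
      _ = 24 * M * k^2 := by rw [hM]; field_simp; ring
      _ ≤ 24 * M * (Ck * 2^d * 2^J')^2 := by gcongr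
      _ = _ := by rw [hB]; ring
  have hpair : ∀ i < P.N, ∀ h ∈ P.Gs b i, ∀ h' ∈ P.Gs b i, h ≠ h' → (#(TT h h') : ℝ) ≤
      (B+1) * exp 2 * M * (1 + P.WS * ∑ p ∈ P.S with h' ≡ h [MOD p], 1/(p:ℝ)) := by
    intro i hi h hh h' hh' hne
    have h3 := h2 q h h' t0 Hh J' hq1 hq2 (hcop h (hG i hi hh)) (hcop h' (hG i hi hh'))
    have h4 := hsing h (hGsub (hG i hi hh)) h' (hGsub (hG i hi hh')) hne (2^2^J')
    have h5 : 0 < Sing (2^2^J') q h h' := Sing_pos _ _ _ _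
    have hX : 1 ≤ exp 2 * (1 + P.WS * ∑ p ∈ P.S with h' ≡ h [MOD p], 1/(p:ℝ)) := by
      refine one_le_mul_of_one_le_of_one_le he (le_add_of_nonneg_right (mul_nonneg ?_ (sum_nonneg (fun _ _ => by positivity))))
      exact zero_le_one.trans (one_le_prod_inv _ (fun p hp => (P.hS p hp).1))
    set X := exp 2 * (1 + P.WS * ∑ p ∈ P.S with h' ≡ h [MOD p], 1/(p:ℝ)) with hXd
    calc (#(TT h h') : ℝ) ≤ _ := h3
      _ ≤ B * M * X + M * X := add_le_add (mul_le_mul hmain h4 h5.le (by positivity)) (herr.trans (le_mul_of_one_le_right hM0 hX))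
      _ = _ := by rw [hXd]; ring
  have hrow : ∀ i < P.N, ∀ h ∈ P.Gs b i, ∑ h' ∈ P.Gs b i with h ≠ h', (#(TT h h') : ℝ) ≤ (B+1) * exp 2 * M * (2 * C1 * P.Gh b) := by
    intro i hi h hh
    have hWS : 0 ≤ P.WS := zero_le_one.trans (one_le_prod_inv _ (fun p hp => (P.hS p hp).1))
    calc _ ≤ ∑ h' ∈ P.Gs b i with h ≠ h', (B+1) * exp 2 * M * (1 + P.WS * ∑ p ∈ P.S with h' ≡ h [MOD p], 1/(p:ℝ)) :=
          sum_le_sum (fun h' hh' => hpair i hi h hh h' (mem_filter.1 hh').1 (mem_filter.1 hh').2)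
      _ ≤ ∑ h' ∈ P.Gs b i, (B+1) * exp 2 * M * (1 + P.WS * ∑ p ∈ P.S with h' ≡ h [MOD p], 1/(p:ℝ)) :=
          sum_le_sum_of_subset_of_nonneg (filter_subset _ _) (fun _ _ _ =>
            mul_nonneg (by positivity) (add_nonneg zero_le_one (mul_nonneg hWS (sum_nonneg fun _ _ => by positivity))))
      _ = (B+1) * exp 2 * M * (#(P.Gs b i) + P.WS * ∑ p ∈ P.S, (#{h' ∈ P.Gs b i | h' ≡ h [MOD p]} : ℝ) * (1/(p:ℝ))) := by
          rw [← mul_sum, sum_add_distrib, ← mul_sum, sum_const, nsmul_eq_mul, mul_one]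
          simp_rw [sum_filter]
          rw [sum_comm]
          simp_rw [← sum_filter, sum_const, nsmul_eq_mul]
      _ ≤ (B+1) * exp 2 * M * (2 * C1 * P.Gh b) := by
          refine mul_le_mul_of_nonneg_left ?_ (by positivity)
          have h3 := (hb1 b (by omega) i hi).1
          have h4 : ∑ p ∈ P.S, (#{h' ∈ P.Gs b i | h' ≡ h [MOD p]} : ℝ) * (1/(p:ℝ)) ≤ ∑ p ∈ P.S, (C1 * P.Gh b) * (2/(p:ℝ)^2) := by
            apply sum_le_sum
            intro p hp
            obtain ⟨g1, -, -, -, g2, g3⟩ := P.hS p hp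
            have hpe : (p:ℝ) ≤ exp (b/4) := by
              have e1 : (4:ℝ) * p ≤ b := mod_cast (by omega : 4 * p ≤ b)
              have := add_one_le_exp ((b:ℝ)/4)
              linarith
            have hp0 : (0:ℝ) < p := mod_cast g1.pos
            calc _ ≤ C1 * P.Gh b / p * (1/(p:ℝ)) := by
                  have := (hb1 b (by omega) i hi).2 p h g1 g2 hpe
                  gcongr
              _ = (C1 * P.Gh b) * (1/(p:ℝ)^2) := by field_simp
              _ ≤ _ := by gcongr; norm_num
          rw [← mul_sum] at h4
          have h5 := mul_le_mul_of_nonneg_left h4 hWS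
          have h6 := mul_le_mul_of_nonneg_left hok.sq (by positivity : 0 ≤ C1 * P.Gh b)
          linarith
  have hsubT : T ⊆ (range P.N).biUnion (fun i => (P.Gs b i).biUnion (fun h => ({h' ∈ P.Gs b i | h ≠ h'} : Finset ℕ).biUnion
      (fun h' => (TT h h').image (fun t => h + q * t)))) := by
    intro n hn
    obtain ⟨g1, n', g2, g3, g4, i, hi, g5, g6⟩ := hT n hn
    have hro : ∀ x ∈ P.PP b Dr k, Rough (2^2^J') (x % q + q * (x / q)) := by
      intro x hx p hp hpx
      obtain ⟨f1, f2, -⟩ := mem_filter.1 hx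
      rw [mod_add_div, Nat.prime_dvd_prime_iff_eq hp f2] at hpx
      rw [hpx]
      exact (pow_le_pow_right (by norm_num) hJk).trans (mem_Ico.1 f1).1
    simp only [mem_biUnion, mem_image]
    refine ⟨i, mem_range.2 hi, n % q, g5, n' % q, mem_filter.2 ⟨g6, fun h => g3 ?_⟩, n / q, mem_filter.2 ⟨?_, hro n g1, ?_⟩, mod_add_div _ _⟩
    · rw [← mod_add_div n' q, ← mod_add_div n q, h, g4]
    · obtain ⟨f1, f2⟩ := mem_Ico.1 (mem_filter.1 g1).1
      refine mem_Ico.2 ⟨div_le_div_right f1, ?_⟩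
      rw [Nat.div_lt_iff_lt_mul (by omega)]
      have f3 : 2^k < q * (t0 + 1) := Nat.lt_mul_div_succ _ (by omega)
      rw [show (t0 + Hh) * q = q * (t0+1) + q * (t0+1) by rw [hHh]; ring]
      exact f2.trans (add_lt_add f3 f3)
    · rw [← g4]; exact hro n' g2
  calc (#T : ℝ) ≤ ∑ i ∈ range P.N, ∑ h ∈ P.Gs b i, ∑ h' ∈ P.Gs b i with h ≠ h', (#(TT h h') : ℝ) := by
        have h3 : #T ≤ ∑ i ∈ range P.N, ∑ h ∈ P.Gs b i, ∑ h' ∈ P.Gs b i with h ≠ h', #(TT h h') :=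
          (card_le_card hsubT).trans (card_biUnion_le.trans (sum_le_sum (fun i _ => card_biUnion_le.trans (sum_le_sum (fun h _ =>
            card_biUnion_le.trans (sum_le_sum (fun h' _ => card_image_le)))))))
        exact_mod_cast h3
    _ ≤ ∑ i ∈ range P.N, (C1 * P.Gh b) * ((B+1) * exp 2 * M * (2 * C1 * P.Gh b)) := by
        apply sum_le_sum
        intro i hi
        have hi := mem_range.1 hi
        refine (sum_le_sum (hrow i hi)).trans ?_
        rw [sum_const, nsmul_eq_mul]
        exact mul_le_mul_of_nonneg_right (hb1 b (by omega) i hi).1 (by positivity)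
    _ = _ := by rw [sum_const, card_range, nsmul_eq_mul, hM]; ring

/-- a long run of consecutive primes avoiding a sparse set of marked ones -/
lemma window (Pp M : Finset ℕ) (row : ℕ → ℕ) (hrow : Monotone row) (r0 H K : ℕ) (hK : 1 ≤ K)
    (hP : ∀ x ∈ Pp, x.Prime ∧ r0 ≤ row x ∧ row x < r0 + H)
    (hconv : ∀ x ∈ Pp, ∀ z ∈ Pp, row x = row z → ∀ y, y.Prime → x ≤ y → y ≤ z → y ∈ Pp)
    (hH : 1 ≤ H) (hc : (K+1) * (#M + H) ≤ #Pp) :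
    ∃ n v, ∀ i < K, Nat.nth Nat.Prime (n+i) ∈ Pp ∧ Nat.nth Nat.Prime (n+i) ∉ M ∧ row (Nat.nth Nat.Prime (n+i)) = v := by
  classical
  set c : ℕ → ℕ := fun x => #{m ∈ M | m < x}
  have hcm : ∀ x y, x ≤ y → c x ≤ c y := fun x y h => card_le_card (fun m hm => by
    rw [mem_filter] at hm ⊢; exact ⟨hm.1, by omega⟩)
  have h1 : #(Ico r0 (r0 + H + #M)) * K ≤ #(Pp \ M) := by
    have h2 := le_card_sdiff M Pp
    have h3 : (K+1) * (#M + H) = (H + #M) * K + (#M + H) := by ring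
    rw [card_Ico, show r0 + H + #M - r0 = H + #M by omega]
    omega
  obtain ⟨v, -, hv⟩ := exists_le_card_fiber_of_mul_le_card_of_maps_to (f := fun x => row x + c x) (fun x hx => by
    have h2 := (hP x (Finset.mem_sdiff.1 hx).1).2
    have h3 : c x ≤ #M := card_filter_le _ _
    rw [mem_Ico]; omega) ⟨r0, mem_Ico.2 (by omega)⟩ h1
  set F : Finset ℕ := {x ∈ Pp \ M | row x + c x = v} with hF
  have hne : F.Nonempty := card_pos.1 (by omega)
  have hFm : ∀ x, x ∈ F ↔ (x ∈ Pp ∧ x ∉ M) ∧ row x + c x = v := fun x => by rw [hF, mem_filter, Finset.mem_sdiff]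
  have hx0 := F.min'_mem hne
  have hx1 := F.max'_mem hne
  set x0 := F.min' hne
  set x1 := F.max' hne
  obtain ⟨⟨a1, a2⟩, a3⟩ := (hFm _).1 hx0
  obtain ⟨⟨b1, b2⟩, b3⟩ := (hFm _).1 hx1
  have hx0p := (hP x0 a1).1
  have hx1p := (hP x1 b1).1
  have hinf := Nat.infinite_setOfPred_prime
  have hmono := Nat.nth_monotone hinf
  set n := Nat.count Nat.Prime x0 with hn
  set n1 := Nat.count Nat.Prime x1 with hn1
  have hcard : #F ≤ n1 + 1 - n := by
    have : F ⊆ (Ico n (n1+1)).image (Nat.nth Nat.Prime) := by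
      intro x hx
      refine mem_image.2 ⟨Nat.count Nat.Prime x, mem_Ico.2 ⟨Nat.count_monotone _ (F.min'_le _ hx),
        Nat.lt_succ_of_le (Nat.count_monotone _ (F.le_max' _ hx))⟩, Nat.nth_count (hP x ((hFm x).1 hx).1.1).1⟩
    refine (card_le_card this).trans (card_image_le.trans (by rw [card_Ico]))
  refine ⟨n, row x0, fun i hi => ?_⟩
  set y := Nat.nth Nat.Prime (n+i)
  have hyp : y.Prime := Nat.nth_mem_of_infinite hinf _
  have hy0 : x0 ≤ y := by
    have := hmono (Nat.le_add_right n i)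
    rwa [hn, Nat.nth_count hx0p] at this
  have hy1 : y ≤ x1 := by
    have := hmono (show n + i ≤ n1 by omega)
    rwa [hn1, Nat.nth_count hx1p] at this
  have e1 := hrow hy0
  have e2 := hrow hy1
  have e3 := hcm _ _ hy0
  have e4 := hcm _ _ hy1
  refine ⟨hconv x0 a1 x1 b1 (by omega) y hyp hy0 hy1, fun hyM => ?_, by omega⟩
  have hlt : y < x1 := lt_of_le_of_ne hy1 (fun h => b2 (h ▸ hyM))
  have : c y < c x1 := card_lt_card (by
    rw [ssubset_iff_of_subset (fun m hm => by
      rw [mem_filter] at hm ⊢; exact ⟨hm.1, by omega⟩)]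
    exact ⟨y, mem_filter.2 ⟨hyM, hlt⟩, fun h => lt_irrefl _ (mem_filter.1 h).2⟩)
  omega

lemma sig_bounds (w q n : ℕ) (ν : ℝ) (hq : q.Prime) (hq2 : q ≠ 2) (hqw : q ≤ w) (hn : n % 4 = 3)
    (hdiv : ∀ p, p.Prime → p ≠ 2 → p ≤ w → (p ∣ n - 1 ↔ p = q)) (hnz : nz w n ≤ ν) :
    3/2 * ((n:ℝ)-1) * (1 + 1/q) ≤ ((∑ d ∈ (n-1).divisors, d : ℕ):ℝ) ∧
      ((∑ d ∈ (n-1).divisors, d : ℕ):ℝ) ≤ 3/2 * ((n:ℝ)-1) * ((1 - 1/(q:ℝ))⁻¹ * exp (2*ν)) := by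
  classical
  obtain ⟨m, hm⟩ : ∃ m, n - 1 = 2 * m := ⟨(n-1)/2, by omega⟩
  have hm0 : 0 < m := by omega
  have hcop : Coprime 2 m := (coprime_primes prime_two prime_two).elim (fun _ _ => by
    rw [Nat.coprime_two_left, Nat.odd_iff]; omega)
  have hnr : (n:ℝ) - 1 = 2 * m := by
    have : n = 2*m+1 := by omega
    rw [this]; push_cast; ring
  have hqm : q ∣ m := by
    have := (hdiv q hq hq2 hqw).2 rfl
    rw [hm] at this
    exact ((coprime_primes hq prime_two).2 hq2).dvd_of_dvd_mul_left this
  rw [hnr, hm, hcop.sum_divisors_mul, show ∑ d ∈ Nat.divisors 2, d = 3 by decide]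
  have e : ((∑ d ∈ m.divisors, d : ℕ):ℝ) = m * ∑ d ∈ m.divisors, 1/(d:ℝ) := by
    push_cast
    rw [← Nat.sum_div_divisors m (fun d => (d:ℝ)), mul_sum]
    apply sum_congr rfl
    intro d hd
    have hd := (Nat.mem_divisors.1 hd).1
    rw [Nat.cast_div hd (by have := Nat.pos_of_dvd_of_pos hd hm0; positivity), mul_one_div]
  rw [Nat.cast_mul, e]
  push_cast
  have hs1 : 1 + 1/(q:ℝ) ≤ ∑ d ∈ m.divisors, 1/(d:ℝ) := by
    calc 1 + 1/(q:ℝ) = ∑ d ∈ ({1, q} : Finset ℕ), 1/(d:ℝ) := by rw [sum_pair hq.one_lt.ne]; simp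
      _ ≤ _ := sum_le_sum_of_subset_of_nonneg (by
        intro d hd
        rcases mem_insert.1 hd with rfl | hd
        · simp; omega
        · rw [mem_singleton.1 hd]; exact Nat.mem_divisors.2 ⟨hqm, by omega⟩) (fun _ _ _ => by positivity)
  have hs2 : ∑ d ∈ m.divisors, 1/(d:ℝ) ≤ (1 - 1/(q:ℝ))⁻¹ * exp (2*ν) := by
    have h1 := fΩ_sum (t := 1) one_pos one_lt_two m.primeFactors (fun p hp => prime_of_mem_primeFactors hp) m.divisors
      (fun d hd => ⟨(Nat.pos_of_mem_divisors hd).ne', primeFactors_mono (Nat.mem_divisors.1 hd).1 (by omega)⟩)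
    simp only [one_pow] at h1
    refine h1.trans ?_
    rw [← mul_prod_erase _ _ (mem_primeFactors.2 ⟨hq, hqm, by omega⟩)]
    refine mul_le_mul_of_nonneg_left ?_ (inv_pos.2 (one_sub_inv_mem hq).1).le
    refine (prod_inv_le_exp _ (fun p hp => prime_of_mem_primeFactors (mem_erase.1 hp).2)).trans (exp_le_exp.2 ?_)
    have h2 : ∑ p ∈ m.primeFactors.erase q, 1/(p:ℝ) ≤ nz w n := by
      refine sum_le_sum_of_subset_of_nonneg (fun p hp => ?_) (fun _ _ _ => by positivity)
      obtain ⟨g1, g2⟩ := mem_erase.1 hp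
      obtain ⟨g3, g4, -⟩ := mem_primeFactors.1 g2
      have g5 : p ∣ n - 1 := hm ▸ Dvd.dvd.mul_left g4 2
      refine mem_filter.2 ⟨mem_primeFactors.2 ⟨g3, g5, by omega⟩, ?_⟩
      by_contra h
      refine g1 ((hdiv p g3 ?_ (by omega)).1 g5)
      rintro rfl
      omega
    linarith
  constructor <;> nlinarith

lemma sig_lt (w q q' n n' : ℕ) (ν : ℝ) (hν : 0 < ν) (hq : q.Prime) (hq' : q'.Prime) (hq2 : q ≠ 2) (hqq : q + 2 ≤ q') (hqw : q' ≤ w)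
    (hνq : 12 * ν * ((q:ℝ)+2)^2 ≤ 1) (hn : n % 4 = 3) (hn' : n' % 4 = 3)
    (hd : ∀ p, p.Prime → p ≠ 2 → p ≤ w → (p ∣ n - 1 ↔ p = q)) (hd' : ∀ p, p.Prime → p ≠ 2 → p ≤ w → (p ∣ n' - 1 ↔ p = q'))
    (hz : nz w n ≤ ν) (hz' : nz w n' ≤ ν) (hnn : (n':ℝ) - 1 ≤ (1+ν) * ((n:ℝ)-1)) :
    ∑ d ∈ (n'-1).divisors, d < ∑ d ∈ (n-1).divisors, d := by
  have h1 := (sig_bounds w q n ν hq hq2 (by omega) hn hd hz).1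
  have h2 := (sig_bounds w q' n' ν hq' (by have := hq.two_le; omega) hqw hn' hd' hz').2
  have hn0 : (0:ℝ) < (n:ℝ) - 1 := by
    have : (3:ℝ) ≤ n := mod_cast (by omega : 3 ≤ n)
    linarith
  have hq0 : (2:ℝ) ≤ q := mod_cast hq.two_le
  have hq0' : (q:ℝ) + 2 ≤ q' := mod_cast hqq
  have h3 : (1 - 1/(q':ℝ))⁻¹ ≤ ((q:ℝ)+2)/(q+1) := by
    rw [inv_le_comm₀ (one_sub_inv_mem hq').1 (by positivity), inv_div, div_le_iff₀ (by positivity)]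
    have : 1/(q':ℝ) ≤ 1/((q:ℝ)+2) := one_div_le_one_div_of_le (by positivity) hq0'
    have e : (1/((q:ℝ)+2)) * (q+2) = 1 := by field_simp
    nlinarith
  have hν1 : 192 * ν ≤ 1 := by
    have : (16:ℝ) ≤ (q+2)^2 := by nlinarith
    have := mul_le_mul_of_nonneg_left this (by positivity : 0 ≤ 12 * ν)
    linarith
  have h4 : exp (2*ν) ≤ 1 + 4*ν := by
    have := (abs_le.1 (Real.abs_exp_sub_one_le (x := 2*ν) (by rw [abs_of_pos (by positivity)]; linarith))).2
    grind
  have h5 : (1+ν) * (((q:ℝ)+2)/(q+1) * (1+4*ν)) < 1 + 1/q := by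
    rw [show (1:ℝ) + 1/q = (q+1)/q by field_simp, div_mul_eq_mul_div, ← mul_div_assoc, div_lt_div_iff₀ (by positivity) (by positivity)]
    have h6 : (1+ν)*(1+4*ν) ≤ 1 + 6*ν := by nlinarith
    have h7 : (1+ν)*(1+4*ν) * ((q+2)*q) ≤ (1+6*ν) * (((q:ℝ)+2)*q) := by gcongr
    nlinarith
  have h6 : ((∑ d ∈ (n'-1).divisors, d : ℕ):ℝ) < ((∑ d ∈ (n-1).divisors, d : ℕ):ℝ) := by
    calc _ ≤ _ := h2
      _ ≤ 3/2 * ((1+ν) * ((n:ℝ)-1)) * (((q:ℝ)+2)/(q+1) * (1+4*ν)) := by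
          have := (one_sub_inv_mem hq').1
          gcongr
      _ = 3/2 * ((n:ℝ)-1) * ((1+ν) * (((q:ℝ)+2)/(q+1) * (1+4*ν))) := by ring
      _ < 3/2 * ((n:ℝ)-1) * (1 + 1/q) := by gcongr
      _ ≤ _ := h1
  exact_mod_cast h6

lemma exr (w q : ℕ) (hw : 2 ≤ w) : ∃ r : ℕ, r.Coprime (2 * primorial w) ∧
    ∀ n, n ≡ r [MOD 2 * primorial w] → n % 4 = 3 ∧ ∀ p, p.Prime → p ≠ 2 → p ≤ w → (p ∣ n - 1 ↔ p = q) := by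
  classical
  obtain ⟨r, hr⟩ := Nat.chineseRemainderOfFinset (fun p => if p = 2 then 3 else if p = q then 1 else 2) (fun p => if p = 2 then 4 else p)
    {p ∈ range (w+1) | p.Prime} (fun p hp => by
      have := (mem_filter.1 hp).2.pos
      split_ifs <;> omega) (fun p hp p' hp' hne => by
      have h1 := (mem_filter.1 hp).2
      have h2 := (mem_filter.1 hp').2
      have h3 := (coprime_primes h1 h2).2 hne
      simp only [Function.onFun]
      split_ifs with g1 g2 g2
      · omega
      · subst g1; exact h3.pow_left 2
      · subst g2; exact h3.pow_right 2
      · exact h3)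
  have hr4 : r % 4 = 3 := by
    have := hr 2 (mem_filter.2 ⟨mem_range.2 (by omega), prime_two⟩)
    simpa [ModEq] using this
  have hrp : ∀ p, p.Prime → p ≠ 2 → p ≤ w → r ≡ (if p = q then 1 else 2) [MOD p] := fun p hp h2 hpw => by
    simpa [h2] using hr p (mem_filter.2 ⟨mem_range.2 (by omega), hp⟩)
  have hdv : ∀ p, p.Prime → p ≤ w → p ∣ primorial w := fun p hp h => hp.dvd_primorial_iff.2 h
  have hodd : Coprime r 2 := by rw [Nat.coprime_two_right, Nat.odd_iff]; omega
  refine ⟨r, Coprime.mul_right hodd (Coprime.prod_right (fun p hp => ?_)), fun n hn => ?_⟩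
  · obtain ⟨h1, h2⟩ := mem_filter.1 hp
    by_cases h3 : p = 2
    · rw [h3]; exact hodd
    rw [Nat.coprime_comm, h2.coprime_iff_not_dvd]
    intro h4
    have h5 := hrp p h2 h3 (by have := mem_range.1 h1; omega)
    have h6 := ((Nat.modEq_zero_iff_dvd.2 h4).symm.trans h5).symm
    rw [Nat.modEq_zero_iff_dvd] at h6
    have := h2.two_le
    split_ifs at h6
    · exact h2.one_lt.ne' (dvd_one.1 h6)
    · have := le_of_dvd two_pos h6; omega
  · have h4 : n % 4 = 3 := by
      have : 4 ∣ 2 * primorial w := by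
        obtain ⟨c, hc⟩ := hdv 2 prime_two hw
        exact ⟨c, by rw [hc]; ring⟩
      rw [hn.of_dvd this, hr4]
    refine ⟨h4, fun p hp h2 hpw => ?_⟩
    have h5 := (hn.of_dvd (Dvd.dvd.mul_left (hdv p hp hpw) 2)).trans (hrp p hp h2 hpw)
    rw [← modEq_iff_dvd' (by omega)]
    have := hp.two_le
    constructor
    · intro h6
      by_contra h7
      rw [if_neg h7] at h5
      have := h6.trans h5
      rw [modEq_iff_dvd' (by norm_num)] at this
      exact hp.one_lt.ne' (dvd_one.1 this)
    · intro h6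
      rw [if_pos h6] at h5
      exact h5.symm

/-- size of the expected number of partners in a cluster -/
lemma rhoGh (C0 Ck : ℕ) : ∃ C : ℝ, 1 ≤ C ∧ ∀ (P : Par), P.Ok C0 → ∃ b0 : ℕ, ∀ b, b0 ≤ b → ∀ Dr J k, P.Cx C0 Ck b Dr J k →
    P.ε * exp P.a / P.Q.totient ≤ C * Ck * ((P.qm b Dr : ℝ) / ((P.qm b Dr).totient * k) * P.Gh b) ∧
      (P.qm b Dr : ℝ) / ((P.qm b Dr).totient * k) * P.Gh b ≤ C * (P.ε * exp P.a / P.Q.totient) := by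
  obtain ⟨Cr, hCr, h1⟩ := rho
  refine ⟨256 * Cr, by linarith, fun P hok => ?_⟩
  obtain ⟨b0, hb0⟩ := h1 P C0 hok
  refine ⟨b0 + P.a + 1, fun b hb Dr J k H => ?_⟩
  obtain ⟨h2, h3⟩ := hb0 b (by omega) Dr H.hDr H.hDrc
  have hk2 : (k:ℝ) ≤ Ck * 2^J := mod_cast H.k2
  have hk1 : (2:ℝ)^J ≤ k := mod_cast H.k1
  have hJ1 := H.J1
  have hJ2 := H.J2
  have hb1 : (1:ℝ) ≤ b := mod_cast (by omega : 1 ≤ b)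
  have hab : (P.a:ℝ) ≤ b := mod_cast (by omega : P.a ≤ b)
  have ha : (0:ℝ) ≤ P.a := cast_nonneg _
  have he := exp_pos (b:ℝ)
  have hk0 : (0:ℝ) < k := by linarith
  have hC : (0:ℝ) ≤ Ck := cast_nonneg _
  have hWg := hok.one_le
  have hWS := hok.Wgle
  have hWS2 := hok.WSle
  have hQ : (0:ℝ) < P.Q.totient := mod_cast totient_pos.2 P.Q_pos
  have hφ : (0:ℝ) < (P.qm b Dr).totient := mod_cast totient_pos.2 (P.qm_pos b Dr)
  set ρ : ℝ := (P.qm b Dr : ℝ) / (P.qm b Dr).totient with hρ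
  have hτ : 0 ≤ P.ε * exp P.a / P.Q.totient := by
    have := P.hε
    positivity
  set τ := P.ε * exp P.a / P.Q.totient with hτd
  have e : (P.qm b Dr : ℝ) / ((P.qm b Dr).totient * k) * P.Gh b = τ * ((ρ * P.Wg / (P.a + b)) * (exp b / k)) := by
    rw [hρ, hτd, Par.Gh, exp_add]
    field_simp
  have hWS0 : 0 < P.WS := by linarith
  have hab0 : (0:ℝ) < P.a + b := by linarith
  have hρ0 : 0 ≤ ρ := by positivity
  have hu : ρ * P.Wg / (P.a + b) ≤ Cr := by
    rw [div_le_iff₀ hab0]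
    rw [le_div_iff₀ hWS0] at h3
    nlinarith [mul_le_mul_of_nonneg_left hWS hρ0, mul_nonneg (zero_le_one.trans hCr) ha]
  have hl : 1 ≤ 4 * Cr * (ρ * P.Wg / (P.a + b)) := by
    rw [← mul_div_assoc, le_div_iff₀ hab0]
    rw [div_le_iff₀ (by positivity)] at h2
    nlinarith [mul_le_mul_of_nonneg_left hWS2 (mul_nonneg hρ0 (zero_le_one.trans hCr))]
  have hu' : exp b / k ≤ 1 := by rw [div_le_one hk0]; linarith
  have hl' : 1 ≤ 64 * Ck * (exp b / k) := by
    rw [← mul_div_assoc, le_div_iff₀ hk0]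
    nlinarith
  have hv0 : 0 ≤ exp b / k := by positivity
  have hr0 : 0 ≤ ρ * P.Wg / (P.a + b) := by positivity
  rw [e]
  set X := ρ * P.Wg / (P.a + b)
  set Y := exp b / k
  constructor
  · have := mul_le_mul hl hl' zero_le_one (by positivity)
    nlinarith
  · have := mul_le_mul hu hu' hv0 (by linarith)
    nlinarith

end SDR

set_option maxHeartbeats 4000000 in
open Finset SDR in
theorem sigma_decreasing_runs (K : ℕ) (hK : 1 ≤ K) :
    {n : ℕ | ∀ i : ℕ, i + 1 < K →
      ∑ d ∈ (Nat.nth Nat.Prime (n + i + 1) - 1).divisors, d <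
        ∑ d ∈ (Nat.nth Nat.Prime (n + i) - 1).divisors, d}.Infinite := by
  classical
  obtain ⟨c, Ck, C0, hc, hCk, hCx⟩ := exCx
  obtain ⟨C1, hC1, hcnt1⟩ := cnt1 C0 Ck
  obtain ⟨C2, hC2, hcnt2⟩ := cnt2 C0 Ck
  obtain ⟨C3, hC3, hcnt3⟩ := cnt3 C0 Ck
  obtain ⟨Cr, hCr, hrho⟩ := rhoGh C0 Ck
  set δ : ℝ := c / (64 * (K+1)) with hδ
  have hδ0 : 0 < δ := by positivity
  set τ : ℝ := δ / (C3 * Cr) with hτ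
  have hτ0 : 0 < τ := by positivity
  obtain ⟨N, hN⟩ := exists_nat_ge (1/τ + 9 * (Cr * Ck) / (δ * τ) + 1)
  have hN0 : 0 < 1/τ := by positivity
  have hN1 : 0 < 9 * (Cr * Ck) / (δ * τ) := by positivity
  have hN2 : 1 ≤ N := mod_cast (by linarith : (1:ℝ) ≤ N)
  have hinf := Nat.infinite_setOfPred_prime
  have hsm : StrictMono (Nat.nth Nat.Prime) := Nat.nth_strictMono hinf
  set Q : ℕ → ℕ := fun i => Nat.nth Nat.Prime (i+1)
  have hQp : ∀ i, (Q i).Prime := fun i => Nat.nth_mem_of_infinite hinf _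
  have hQ2 : ∀ i, Q i ≠ 2 := fun i => by
    have h1 := hsm (Nat.succ_pos i)
    have h2 := (Nat.nth_mem_of_infinite hinf 0).two_le
    exact (h2.trans_lt h1).ne'
  have hQm : ∀ i j, i < j → Q i + 2 ≤ Q j := fun i j h => by
    have h1 : Q i < Q j := hsm (Nat.succ_lt_succ h)
    have h2 := (hQp i).eq_two_or_odd
    have h3 := (hQp j).eq_two_or_odd
    have := hQ2 i
    have := hQ2 j
    omega
  set ν : ℝ := 1 / (12 * ((Q N : ℝ)+2)^2) with hν
  have hν0 : 0 < ν := by positivity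
  obtain ⟨w, hw⟩ := exists_nat_ge (C2 / (δ * ν) + Q N + 2)
  have hw0 : 0 < C2 / (δ * ν) := by positivity
  have hwQ : Q N + 2 ≤ w := mod_cast (by linarith : (Q N : ℝ) + 2 ≤ w)
  choose r hr1 hr2 using fun i => exr w (Q i) (by omega)
  obtain ⟨P, hPN, hPw, hPr, hok, hSne, hP1, hP2, hP3⟩ := exPar N w hN2 (by omega) r hr1 (C1/δ) τ hτ0 (by linarith) C0
  obtain ⟨b1, hb1⟩ := hCx P
  obtain ⟨b2, hb2⟩ := hcnt1 P hok
  obtain ⟨b3, hb3⟩ := hcnt2 P hok ν hν0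
  obtain ⟨b4, hb4⟩ := hcnt3 P hok
  obtain ⟨b5, hb5⟩ := hrho P hok
  obtain ⟨b6, hb6⟩ := exists_nat_ge (1/ν)
  refine Set.infinite_of_forall_exists_gt (fun n0 => ?_)
  obtain ⟨b, hb, hlow⟩ := P.lowG hok.one_le (b1 + b2 + b3 + b4 + b5 + b6 + P.E + 1 + Nat.nth Nat.Prime n0)
  obtain ⟨Dr, J, k, H, hmany⟩ := hb1 b (by omega)
  have g1 := hb2 b (by omega) Dr J k H
  have g2 := hb3 b (by omega) Dr J k H
  have g3 := hb4 b (by omega) Dr J k H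
  obtain ⟨g5, g6⟩ := hb5 b (by omega) Dr J k H
  have hbk : b ≤ k := mod_cast H.k_ge
  have hA := H.AA_pos (by omega)
  have hq1 := P.qm_pos b Dr
  have hqX := H.q_lt
  have hfib := H.sum_fib (P.G b) (P.G_sub_Ib (by omega)) (fun _ => 1)
  have hQq := P.Q_dvd_qm hSne b Dr
  have hq2 : 2 ≤ P.qm b Dr := Nat.le_of_dvd hq1 (P.two_dvd_qm b Dr)
  have hqb : 1 ≤ ν * P.qm b Dr := by
    have h1 := Real.add_one_le_exp ((P.a:ℝ) + b + 1)
    have h2 : (b6:ℝ) ≤ b := mod_cast (by omega : b6 ≤ b)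
    have h3 := H.qbig
    have h4 : (0:ℝ) ≤ P.a := Nat.cast_nonneg _
    have h5 : 1/ν ≤ P.qm b Dr := by linarith
    rwa [div_le_iff₀' hν0] at h5
  have hq4 : (P.qm b Dr : ℝ)^4 ≤ 2^k := mod_cast H.q4
  set q := P.qm b Dr with hq
  have hqr : (2:ℝ) ≤ q := mod_cast hq2
  set M1 : Finset ℕ := {n ∈ P.PP b Dr k | n % q ∈ P.Bd b Dr}
  set M2 : Finset ℕ := {n ∈ P.PP b Dr k | n % q ∈ P.G b ∧ ν < nz P.w n}
  set M3 : Finset ℕ := {n ∈ P.PP b Dr k | ∃ n' ∈ P.PP b Dr k, n' ≠ n ∧ n' / q = n / q ∧ ∃ i < P.N,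
      n % q ∈ P.Gs b i ∧ n' % q ∈ P.Gs b i}
  have g3 := g3 M3 (fun n hn => mem_filter.1 hn)
  have hk0 : (0:ℝ) < k := mod_cast (by omega : 0 < k)
  have hW := hok.one_le
  have hε := P.hε
  have hφQ : (0:ℝ) < P.Q.totient := mod_cast Nat.totient_pos.2 P.Q_pos
  have hab : (0:ℝ) < (P.a:ℝ) + b := by
    have : (1:ℝ) ≤ b := mod_cast (by omega : 1 ≤ b)
    positivity
  have hGh : 0 < P.Gh b := by
    unfold Par.Gh; positivity
  have hNr : (0:ℝ) < N := mod_cast hN2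
  rw [hPN] at g2 g3 hlow
  rw [hPw] at g2
  set A := P.AA b Dr k with hAd
  set L : ℝ := (q:ℝ) / (q.totient * k) * P.Gh b with hL
  have hL0 : 0 ≤ L := by positivity
  set Z := A * (N * P.Gh b) with hZ
  have hZ0 : 0 ≤ Z := by positivity
  have k1 : (#M1 : ℝ) ≤ δ * Z := by
    refine g1.trans ?_
    have h1 : C1 ≤ δ * (N * P.ε * P.Wg / P.Q.totient) := by rwa [div_le_iff₀' hδ0] at hP1
    have h2 : 0 ≤ A * (Real.exp (P.a + b) / (P.a + b)) := by positivity
    calc _ = C1 * (A * (Real.exp (P.a + b) / (P.a + b))) := by ring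
      _ ≤ δ * (N * P.ε * P.Wg / P.Q.totient) * (A * (Real.exp (P.a + b) / (P.a + b))) := mul_le_mul_of_nonneg_right h1 h2
      _ = _ := by rw [hZ, Par.Gh]; field_simp
  have k2 : (#M2 : ℝ) ≤ δ * Z := by
    refine g2.trans ?_
    have hwr : C2 / (δ * ν) ≤ w := by linarith [(Nat.cast_nonneg (Q N) : (0:ℝ) ≤ _)]
    have hw1 : (0:ℝ) < w := hw0.trans_le hwr
    rw [div_le_iff₀ (by positivity)] at hwr ⊢
    calc _ = C2 * Z := by rw [hZ]; ring
      _ ≤ w * (δ * ν) * Z := mul_le_mul_of_nonneg_right hwr hZ0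
      _ = _ := by ring
  have k3 : (#M3 : ℝ) ≤ δ * Z := by
    refine g3.trans ?_
    have h1 : L ≤ Cr * τ := g6.trans (by gcongr)
    calc _ = C3 * L * Z := by rw [hZ]; ring
      _ ≤ C3 * (Cr * τ) * Z := by gcongr
      _ = δ * Z := by rw [hτ]; field_simp
  have k4 : ((2^k/q + 2 : ℕ):ℝ) ≤ δ * Z := by
    have h4 : ((2^k/q : ℕ):ℝ) ≤ 2^k/q := by simpa using Nat.cast_div_le (α := ℝ) (m := 2^k) (n := q)
    have h5 : (1:ℝ) ≤ 2^k/q := by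
      rw [le_div_iff₀ (by positivity), one_mul]; exact_mod_cast hqX.le
    have h6 : τ / 3 ≤ Cr * Ck * L := hP2.trans g5
    have h7 : 3 ≤ δ * (N * L) := by
      have h8 : 9 * (Cr * Ck) / (δ * τ) ≤ N := by linarith
      rw [div_le_iff₀ (by positivity)] at h8
      have h9 : 9 * (Cr * Ck) ≤ 3 * (Cr * Ck) * (δ * (N * L)) := by
        nlinarith [mul_le_mul_of_nonneg_left h6 (by positivity : 0 ≤ N * δ)]
      have : 0 < Cr * Ck := by positivity
      nlinarith
    calc _ ≤ 3 * ((2:ℝ)^k/q) := by push_cast; linarith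
      _ ≤ δ * (N * L) * ((2:ℝ)^k/q) := by gcongr
      _ = δ * Z := by rw [hZ, hL, hAd, Par.AA, ← hq]; field_simp
  have k5 : 64 * (K+1) * (δ * Z) / 16 ≤ #(P.PP b Dr k) := by
    have h1 : (#{n ∈ P.PP b Dr k | n % q ∈ P.G b} : ℝ) = ∑ h ∈ P.G b, (PC q h (2^k) (2^k) : ℝ) := by
      simpa using hfib
    have h2 : (#{n ∈ P.PP b Dr k | n % q ∈ P.G b} : ℝ) ≤ #(P.PP b Dr k) := mod_cast card_filter_le _ _
    have h3 : c * #(P.G b) * 2^k / (q.totient * k) = c * #(P.G b) * A := by rw [hAd, Par.AA]; ring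
    have h4 : c * (N * P.Gh b / 16) * A ≤ c * #(P.G b) * A := by gcongr
    have h5 : 64 * (K+1) * (δ * Z) / 16 = c * (N * P.Gh b / 16) * A := by rw [hδ, hZ]; field_simp
    linarith
  obtain ⟨n, v, hn⟩ := window (P.PP b Dr k) (M1 ∪ M2 ∪ M3) (fun x => x / q) (fun x y h => Nat.div_le_div_right h)
    (2^k/q) (2^k/q+2) K hK (fun x hx => by
      obtain ⟨h1, h2, -⟩ := mem_filter.1 hx
      obtain ⟨h3, h4⟩ := mem_Ico.1 h1
      refine ⟨h2, Nat.div_le_div_right h3, ?_⟩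
      have f3 : 2^k < q * (2^k/q + 1) := Nat.lt_mul_div_succ _ (by omega)
      rw [Nat.div_lt_iff_lt_mul (by omega), show (2^k/q + (2^k/q+2)) * q = q * (2^k/q+1) + q * (2^k/q+1) by ring]
      exact h4.trans (add_lt_add f3 f3)) (fun x hx z hz hxz y hy h1 h2 => by
      obtain ⟨h3, -, h4⟩ := mem_filter.1 hx
      obtain ⟨h5, -, h6⟩ := mem_filter.1 hz
      have h7 : x / q = y / q := le_antisymm (Nat.div_le_div_right h1) (hxz ▸ Nat.div_le_div_right h2)
      have e1 := Nat.div_add_mod x q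
      have e2 := Nat.div_add_mod y q
      have e3 := Nat.div_add_mod z q
      rw [h7] at e1
      rw [← hxz, h7] at e3
      unfold Par.Ib at h4 h6
      unfold Par.PP Par.Ib
      rw [← hq, mem_Ico] at h4 h6
      rw [mem_Ico] at h3 h5
      rw [mem_filter, mem_Ico, mem_Ico, ← hq]
      exact ⟨⟨by omega, by omega⟩, hy, by omega, by omega⟩) (Nat.succ_pos _) (by
      have h1 : #(M1 ∪ M2 ∪ M3) ≤ #M1 + #M2 + #M3 := (card_union_le _ _).trans (Nat.add_le_add_right (card_union_le _ _) _)
      have h2 : (#(M1 ∪ M2 ∪ M3) : ℝ) ≤ #M1 + #M2 + #M3 := mod_cast h1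
      have h3 : ((K:ℝ)+1) * (#(M1 ∪ M2 ∪ M3) + (2^k/q+2 : ℕ)) ≤ (K+1) * (4 * (δ * Z)) := by gcongr; linarith
      exact_mod_cast (show ((K:ℝ)+1) * (#(M1 ∪ M2 ∪ M3) + (2^k/q+2 : ℕ)) ≤ #(P.PP b Dr k) by linarith))
  have hx : ∀ i < K, ∃ j < N, Nat.nth Nat.Prime (n+i) % q ∈ P.Gs b j ∧ nz w (Nat.nth Nat.Prime (n+i)) ≤ ν := by
    intro i hi
    obtain ⟨h1, h2, -⟩ := hn i hi
    simp only [mem_union, not_or] at h2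
    have h3 : Nat.nth Nat.Prime (n+i) % q ∈ P.G b := (H.split h1).resolve_right (fun h => h2.1.1 (mem_filter.2 ⟨h1, h⟩))
    obtain ⟨j, hj, h4⟩ := mem_biUnion.1 h3
    refine ⟨j, hPN ▸ mem_range.1 hj, h4, not_lt.1 (fun h => h2.1.2 (mem_filter.2 ⟨h1, h3, hPw.symm ▸ h⟩))⟩
  refine ⟨n, fun i hi => ?_, hsm.lt_iff_lt.1 ?_⟩
  · obtain ⟨j, hj, h1, h2⟩ := hx i (by omega)
    obtain ⟨j', hj', h1', h2'⟩ := hx (i+1) hi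
    obtain ⟨f1, f2, f3⟩ := hn i (by omega)
    obtain ⟨f1', -, f3'⟩ := hn (i+1) hi
    rw [← add_assoc] at h1' h2' f1' f3'
    have hlt : Nat.nth Nat.Prime (n+i) < Nat.nth Nat.Prime (n+i+1) := hsm (Nat.lt_succ_self _)
    set x := Nat.nth Nat.Prime (n+i)
    set x' := Nat.nth Nat.Prime (n+i+1)
    have hjj : j' ≠ j := by
      rintro rfl
      exact f2 (mem_union_right _ (mem_filter.2 ⟨f1, x', f1', hlt.ne', by rw [f3, f3'], j', hPN.symm ▸ hj, h1, h1'⟩))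
    have e1 := Nat.div_add_mod x q
    have e2 := Nat.div_add_mod x' q
    rw [f3] at e1
    rw [f3'] at e2
    obtain ⟨⟨s1, s2⟩, s3, s4⟩ := P.Gs_spec (by omega) h1
    obtain ⟨⟨s1', s2'⟩, s3', s4'⟩ := P.Gs_spec (by omega) h1'
    have hlog : Real.log (x % q : ℕ) ≤ Real.log (x' % q : ℕ) :=
      Real.log_le_log (mod_cast s4) (mod_cast (by omega : x % q ≤ x' % q))
    have hj2 : j < j' := by
      by_contra h
      have h3 : j' + 1 ≤ j := by omega
      have h4 : ((j':ℝ) + 1) / N ≤ j / N := by gcongr; exact_mod_cast h3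
      have h5 := P.lε_le
      rw [hPN] at s1 s2' h5
      have h6 : 1/(4*(N:ℝ)) < 1/N := one_div_lt_one_div_of_lt hNr (by linarith)
      rw [add_div] at h4
      linarith
    have hmod : ∀ y j, y % q ≡ P.r j [MOD P.Q] → y ≡ r j [MOD 2 * primorial w] := fun y j h => by
      have h3 : y ≡ P.r j [MOD P.Q] := ((Nat.mod_modEq y q).symm.of_dvd hQq).trans h
      rwa [hPr, Par.Q, hPw] at h3
    obtain ⟨u1, u2⟩ := hr2 j x (hmod x j s3)
    obtain ⟨u1', u2'⟩ := hr2 j' x' (hmod x' j' s3')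
    have hQle : ∀ i < N, Q i ≤ Q N := fun i h => by have := hQm i N h; omega
    refine sig_lt w (Q j) (Q j') x x' ν hν0 (hQp j) (hQp j') (hQ2 j) (hQm j j' hj2) (by have := hQle j' hj'; omega) ?_ u1 u1' u2 u2' h2 h2' ?_
    · have h3 : (Q j : ℝ) ≤ Q N := mod_cast hQle j hj
      calc 12 * ν * ((Q j : ℝ)+2)^2 ≤ 12 * ν * ((Q N : ℝ)+2)^2 := by gcongr
        _ = 1 := by rw [hν]; field_simp
        _ ≤ 1 := le_rfl
    · have h3 : x' ≤ x + q := by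
        have := Nat.mod_lt x' (show 0 < q by omega)
        omega
      have h4 : (x':ℝ) ≤ x + q := mod_cast h3
      have h5 : (2:ℝ)^k ≤ x := mod_cast (mem_Ico.1 (mem_filter.1 f1).1).1
      have h6 : (q:ℝ) + 1 ≤ (q:ℝ)^3 := by nlinarith [sq_nonneg ((q:ℝ))]
      have h7 : (q:ℝ) ≤ ν * (x - 1) := by
        calc (q:ℝ) ≤ (q:ℝ)^3 - 1 := by linarith
          _ ≤ (ν * q) * ((q:ℝ)^3 - 1) := le_mul_of_one_le_left (by linarith) hqb
          _ = ν * (q^4 - q) := by ring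
          _ ≤ ν * (x - 1) := mul_le_mul_of_nonneg_left (by linarith) hν0.le
      linarith
  · have h1 := (mem_Ico.1 (mem_filter.1 (hn 0 (by omega)).1).1).1
    have h2 : k < 2^k := Nat.lt_two_pow_self
    rw [add_zero] at h1
    omega
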